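/- Let 1 < p, q ≤ ∞ be exponents and define r by 1/r = 1/p + 1/q, and assume 0 < 1/r < 3/2. Then there exists a constant C = C(p,q,r) such that for every sequence of real numbers (a_n)_{n∈ℤ}, (b_n)_{n∈ℤ} with a_n < b_n ≤ a_{n+1} for all n (i.e. the intervals [a_n,b_n] are pairwise disjoint, with no further assumption), every sequence (f_n)_{n∈ℤ} of Schwartz functions on ℝ with all but finitely many f_n identically zero, and every Schwartz function g on ℝ, ‖ ( Σ_{n∈ℤ} |π_{[a_n,b_n]}(f_n,g)|² )^{1/2} ‖_{L^r(ℝ)} ≤ C ‖ ( Σ_{n∈ℤ} |f_n|² )^{1/2} ‖_{L^p(ℝ)} ‖g‖_{L^q(ℝ)}. -/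

import Mathlib

open MeasureTheory Real Set
open scoped ENNReal

/-- The Fourier transform `f̂(ξ) = ∫ f(t) e^{-2πitξ} dt`. -/
noncomputable def FT (f : ℝ → ℂ) (ξ : ℝ) : ℂ :=
  ∫ t : ℝ, Complex.exp (((-2 * Real.pi * t * ξ : ℝ) : ℂ) * Complex.I) * f t

/-- The bilinear multiplier
`π_A(f,g)(x) = ∫∫ e^{2πix(ξ₁+ξ₂)} f̂(ξ₁) ĝ(ξ₂) 1_A(ξ₂-ξ₁) dξ₁ dξ₂`. -/
noncomputable def biMul (A : Set ℝ) (f g : ℝ → ℂ) (x : ℝ) : ℂ :=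
  ∫ ξ : ℝ × ℝ, Complex.exp (((2 * Real.pi * x * (ξ.1 + ξ.2) : ℝ) : ℂ) * Complex.I) *
    FT f ξ.1 * FT g ξ.2 * A.indicator 1 (ξ.2 - ξ.1)

namespace BHT

/-- The length `2 ^ k` of the dyadic interval with index `I = (k, n)`. -/
noncomputable def len (I : ℤ × ℤ) : ℝ := (2 : ℝ) ^ I.1

/-- The dyadic interval `[n 2^k, (n+1) 2^k)` with index `I = (k, n)`. -/
def dy (I : ℤ × ℤ) : Set ℝ := {x | ⌊x / len I⌋ = I.2}

/-- The left endpoint of a dyadic interval. -/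
noncomputable def lft (I : ℤ × ℤ) : ℝ := I.2 * len I

/-- The normalized distance weight `1 + |x - n 2^k| / 2^k`. -/
noncomputable def wt (I : ℤ × ℤ) (x : ℝ) : ℝ := 1 + |x / len I - I.2|

lemma len_pos (I : ℤ × ℤ) : 0 < len I := by unfold len; positivity

lemma len_ne (I : ℤ × ℤ) : len I ≠ 0 := (len_pos I).ne'

lemma len_le_len {I J : ℤ × ℤ} (h : I.1 ≤ J.1) : len I ≤ len J :=
  zpow_le_zpow_right₀ (by norm_num) h

lemma one_le_wt (I : ℤ × ℤ) (x : ℝ) : 1 ≤ wt I x := by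
  unfold wt; linarith [abs_nonneg (x / len I - I.2)]

lemma wt_pos (I : ℤ × ℤ) (x : ℝ) : 0 < wt I x := by linarith [one_le_wt I x]

lemma mem_dy {I : ℤ × ℤ} {x : ℝ} :
    x ∈ dy I ↔ lft I ≤ x ∧ x < lft I + len I := by
  have h := len_pos I
  unfold dy lft
  rw [mem_ofPred_eq, Int.floor_eq_iff, le_div_iff₀ h, div_lt_iff₀ h]
  constructor <;> rintro ⟨h1, h2⟩ <;> constructor <;> linarith

lemma dy_eq_Ico (I : ℤ × ℤ) : dy I = Ico (lft I) (lft I + len I) := by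
  ext x; rw [mem_dy, mem_Ico]

lemma lft_mem_dy (I : ℤ × ℤ) : lft I ∈ dy I := by
  rw [mem_dy]; constructor <;> linarith [len_pos I]

lemma measurableSet_dy (I : ℤ × ℤ) : MeasurableSet (dy I) := by
  rw [dy_eq_Ico]; exact measurableSet_Ico

lemma volume_dy (I : ℤ × ℤ) : volume (dy I) = ENNReal.ofReal (len I) := by
  rw [dy_eq_Ico, Real.volume_Ico]; congr 1; ring

lemma volume_real_dy (I : ℤ × ℤ) : volume.real (dy I) = len I := by
  rw [Measure.real, volume_dy, ENNReal.toReal_ofReal (len_pos I).le]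

lemma mem_dy_floor (k : ℤ) (x : ℝ) : x ∈ dy (k, ⌊x / (2 : ℝ) ^ k⌋) := by
  simp [dy, len]

lemma floor_div_eq_of_le {k k' : ℤ} (h : k' ≤ k) {x y : ℝ}
    (hxy : ⌊x / (2 : ℝ) ^ k'⌋ = ⌊y / (2 : ℝ) ^ k'⌋) :
    ⌊x / (2 : ℝ) ^ k⌋ = ⌊y / (2 : ℝ) ^ k⌋ := by
  obtain ⟨m, rfl⟩ := Int.exists_add_of_le h
  have key : ∀ z : ℝ, z / (2 : ℝ) ^ (k' + (m : ℤ)) = z / (2 : ℝ) ^ k' / ((2 ^ m : ℕ) : ℝ) := by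
    intro z
    rw [zpow_add₀ (by norm_num), div_mul_eq_div_div]
    push_cast; rw [zpow_natCast]
  rw [key, key, Int.floor_div_natCast, Int.floor_div_natCast, hxy]

lemma dy_subset_of_mem {I J : ℤ × ℤ} (h : I.1 ≤ J.1) {x : ℝ} (hI : x ∈ dy I) (hJ : x ∈ dy J) :
    dy I ⊆ dy J := by
  intro y hy
  have : ⌊y / (2 : ℝ) ^ J.1⌋ = ⌊x / (2 : ℝ) ^ J.1⌋ := by
    apply floor_div_eq_of_le h
    exact (show ⌊y / len I⌋ = _ from hy).trans (show ⌊x / len I⌋ = _ from hI).symm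
  exact this.trans hJ

lemma dy_subset_or_disjoint {I J : ℤ × ℤ} (h : I.1 ≤ J.1) :
    dy I ⊆ dy J ∨ Disjoint (dy I) (dy J) := by
  by_cases hd : Disjoint (dy I) (dy J)
  · exact Or.inr hd
  · obtain ⟨x, hx, hx'⟩ := Set.not_disjoint_iff.1 hd
    exact Or.inl (dy_subset_of_mem h hx hx')

lemma eq_of_mem_dy {I J : ℤ × ℤ} (h : I.1 = J.1) {x : ℝ} (hI : x ∈ dy I) (hJ : x ∈ dy J) :
    I = J := by
  obtain ⟨k, n⟩ := I
  obtain ⟨k', n'⟩ := J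
  simp only at h
  subst h
  simp only [dy, mem_ofPred_eq, len] at hI hJ
  rw [← hI, ← hJ]

lemma scale_le_of_subset {I J : ℤ × ℤ} (h : dy I ⊆ dy J) : I.1 ≤ J.1 := by
  by_contra hlt
  push Not at hlt
  have h1 : volume (dy I) ≤ volume (dy J) := measure_mono h
  rw [volume_dy, volume_dy, ENNReal.ofReal_le_ofReal_iff (len_pos J).le] at h1
  have h2 : len J < len I := zpow_lt_zpow_right₀ (by norm_num) hlt
  linarith

lemma eq_of_dy_subset {I J : ℤ × ℤ} (h : dy I ⊆ dy J) (hk : J.1 ≤ I.1) : I = J :=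
  eq_of_mem_dy (le_antisymm (scale_le_of_subset h) hk) (lft_mem_dy I) (h (lft_mem_dy I))

lemma wt_eq (I : ℤ × ℤ) (x : ℝ) : wt I x = 1 + |x - lft I| / len I := by
  have h := len_pos I
  unfold wt lft
  rw [← abs_of_pos h, ← abs_div, abs_of_pos h]
  congr 2
  field_simp

lemma wt_add_le {I J : ℤ × ℤ} (h : I.1 ≤ J.1) (x y : ℝ) :
    wt J y ≤ wt J x + |x - y| / len I := by
  rw [wt_eq, wt_eq]
  have h1 : |y - lft J| ≤ |x - lft J| + |x - y| := by
    have := abs_sub_le y x (lft J); rw [abs_sub_comm y x] at this; linarith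
  have h2 : |y - lft J| / len J ≤ (|x - lft J| + |x - y|) / len J := by
    gcongr; exact (len_pos J).le
  have h3 : |x - y| / len J ≤ |x - y| / len I := by
    gcongr
    · exact len_pos I
    · exact len_le_len h
  rw [add_div] at h2
  linarith

lemma wt_lft_le_mul {I J : ℤ × ℤ} (h : I.1 ≤ J.1) (x : ℝ) :
    wt J (lft I) ≤ wt J x * wt I x := by
  have h1 := wt_add_le h x (lft I)
  have h2 := wt_eq I x
  nlinarith [one_le_wt J x, one_le_wt I x]

lemma wt_le_two_mul {I J : ℤ × ℤ} (h : I.1 ≤ J.1) {x y : ℝ} (hx : |x - y| ≤ len I) :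
    wt J y ≤ 2 * wt J x := by
  have h1 := wt_add_le h x y
  have h2 : |x - y| / len I ≤ 1 := by rwa [div_le_one (len_pos I)]
  linarith [one_le_wt J x]

lemma abs_sub_le_of_mem_dy {I : ℤ × ℤ} {x y : ℝ} (hx : x ∈ dy I) (hy : y ∈ dy I) :
    |x - y| ≤ len I := by
  rw [mem_dy] at hx hy
  rw [abs_le]; constructor <;> linarith

@[fun_prop]
lemma continuous_wt (I : ℤ × ℤ) : Continuous (wt I) := by
  unfold wt; fun_prop

/-- The sum `∑ (1 + |j|)⁻²` over the integers, up to a factor. -/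
noncomputable def sumConst : ℝ := 4 * ∑' j : ℤ, ((1 + |(j : ℝ)|) ^ 2)⁻¹

lemma summable_one_add_abs : Summable fun j : ℤ => ((1 + |(j : ℝ)|) ^ 2)⁻¹ := by
  have h := Real.summable_abs_int_rpow (b := 2) (by norm_num)
  refine (Summable.of_norm_bounded_eventually h ?_)
  filter_upwards [Set.Finite.compl_mem_cofinite (Set.finite_singleton (0 : ℤ))] with j hj
  have hj' : (0 : ℝ) < |(j : ℝ)| := by
    rw [abs_pos]; exact_mod_cast hj
  rw [Real.norm_of_nonneg (by positivity), Real.rpow_neg hj'.le]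
  norm_cast
  push_cast
  gcongr
  linarith

lemma sum_wt_le (x : ℝ) (s : Finset ℤ) :
    ∑ n ∈ s, ((1 + |x - n|) ^ 2)⁻¹ ≤ sumConst := by
  have h1 : ∀ n : ℤ, ((1 + |x - n|) ^ 2)⁻¹ ≤ 4 * ((1 + |((⌊x⌋ - n : ℤ) : ℝ)|) ^ 2)⁻¹ := by
    intro n
    have h2 : 1 + |((⌊x⌋ - n : ℤ) : ℝ)| ≤ 2 * (1 + |x - n|) := by
      push_cast
      have := abs_sub_le (⌊x⌋ : ℝ) x n
      have h3 : |(⌊x⌋ : ℝ) - x| ≤ 1 := by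
        rw [abs_le]; constructor <;> linarith [Int.floor_le x, Int.lt_floor_add_one x]
      linarith [abs_nonneg (x - n)]
    rw [show (4 : ℝ) * ((1 + |((⌊x⌋ - n : ℤ) : ℝ)|) ^ 2)⁻¹
      = (((1 + |((⌊x⌋ - n : ℤ) : ℝ)|) / 2) ^ 2)⁻¹ by field_simp; norm_num]
    gcongr
    linarith
  calc ∑ n ∈ s, ((1 + |x - n|) ^ 2)⁻¹
      ≤ ∑ n ∈ s, 4 * ((1 + |((⌊x⌋ - n : ℤ) : ℝ)|) ^ 2)⁻¹ := Finset.sum_le_sum fun n _ => h1 n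
    _ = 4 * ∑ n ∈ s, ((1 + |((⌊x⌋ - n : ℤ) : ℝ)|) ^ 2)⁻¹ := by rw [Finset.mul_sum]
    _ ≤ sumConst := by
      unfold sumConst
      gcongr
      have := (Equiv.subLeft ⌊x⌋).summable_iff.2 summable_one_add_abs
      have h := this.sum_le_tsum s (fun _ _ => by simp only [Function.comp]; positivity)
      have h' := (Equiv.subLeft ⌊x⌋).tsum_eq (fun j : ℤ => ((1 + |(j : ℝ)|) ^ 2)⁻¹)
      refine le_trans (le_of_eq (Finset.sum_congr rfl fun n _ => ?_)) (h.trans_eq h')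
      simp

lemma sumConst_pos : 0 < sumConst := by
  have := sum_wt_le 0 {0}
  simp at this
  linarith

/-- Sum of the weights at a given point over intervals of a given scale. -/
lemma sum_wt_scale_le (k : ℤ) (x : ℝ) (s : Finset (ℤ × ℤ)) (hs : ∀ I ∈ s, I.1 = k) :
    ∑ I ∈ s, (wt I x ^ 2)⁻¹ ≤ sumConst := by
  have hinj : Set.InjOn (fun I : ℤ × ℤ => I.2) s := by
    intro I hI J hJ h
    exact Prod.ext ((hs I hI).trans (hs J hJ).symm) h
  have := sum_wt_le (x / 2 ^ k) (s.image fun I => I.2)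
  rw [Finset.sum_image hinj] at this
  refine le_trans (le_of_eq (Finset.sum_congr rfl fun I hI => ?_)) this
  simp [wt, len, hs I hI]

/-- The integral of `(1 + |t|)⁻²`. -/
noncomputable def intConst : ℝ := ∫ t : ℝ, ((1 + |t|) ^ 2)⁻¹

lemma integrable_one_add_abs : Integrable fun t : ℝ => ((1 + |t|) ^ 2)⁻¹ := by
  have := integrable_one_add_norm (E := ℝ) (μ := volume) (r := 2) (by simp)
  refine this.congr (Filter.Eventually.of_forall fun t => ?_)
  simp only [Real.norm_eq_abs]
  rw [Real.rpow_neg (by positivity)]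
  norm_cast

lemma intConst_nonneg : 0 ≤ intConst := integral_nonneg fun t => by positivity

lemma integrable_wt (I : ℤ × ℤ) : Integrable fun x => (wt I x ^ 2)⁻¹ := by
  have := (integrable_one_add_abs.comp_sub_right (I.2 : ℝ)).comp_div (len_ne I)
  exact this

lemma integral_wt (I : ℤ × ℤ) : ∫ x, (wt I x ^ 2)⁻¹ = len I * intConst := by
  have h1 := Measure.integral_comp_div (fun t : ℝ => ((1 + |t - I.2|) ^ 2)⁻¹) (len I)
  have h2 := integral_sub_right_eq_self (μ := volume) (fun t : ℝ => ((1 + |t|) ^ 2)⁻¹) (I.2 : ℝ)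
  rw [h2, abs_of_pos (len_pos I), smul_eq_mul] at h1
  exact h1

lemma wt_pow_inv_le (I : ℤ × ℤ) (x : ℝ) {M N : ℕ} (h : M ≤ N) :
    (wt I x ^ N)⁻¹ ≤ (wt I x ^ M)⁻¹ := by
  have := wt_pos I x
  gcongr
  exact one_le_wt I x

lemma integrable_wt_pow (I : ℤ × ℤ) {N : ℕ} (hN : 2 ≤ N) : Integrable fun x => (wt I x ^ N)⁻¹ := by
  refine (integrable_wt I).mono' ?_ (Filter.Eventually.of_forall fun x => ?_)
  · refine Continuous.aestronglyMeasurable (Continuous.inv₀ (by fun_prop) fun x => ?_)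
    exact (pow_pos (wt_pos I x) N).ne'
  · rw [Real.norm_of_nonneg (by have := wt_pos I x; positivity)]
    exact wt_pow_inv_le I x hN

lemma sum_zpow_le (m : ℤ) (s : Finset ℤ) (hs : ∀ k ∈ s, k ≤ m) :
    ∑ k ∈ s, (2 : ℝ) ^ k ≤ 2 * 2 ^ m := by
  have hinj : Set.InjOn (fun k : ℤ => (m - k).toNat) s := by
    intro a ha b hb h
    have := hs a ha; have := hs b hb
    simp only at h; omega
  have h1 : ∑ k ∈ s, (2 : ℝ) ^ k
      = ∑ j ∈ s.image (fun k : ℤ => (m - k).toNat), (2 : ℝ) ^ m * (1 / 2) ^ j := by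
    rw [Finset.sum_image hinj]
    refine Finset.sum_congr rfl fun k hk => ?_
    have h := hs k hk
    have h2 : k = m - ((m - k).toNat : ℤ) := by omega
    conv_lhs => rw [h2]
    rw [zpow_sub₀ (by norm_num), zpow_natCast]
    simp [div_eq_mul_inv]
  rw [h1, ← Finset.mul_sum, mul_comm]
  gcongr
  have := summable_geometric_two.sum_le_tsum (s.image (fun k : ℤ => (m - k).toNat))
    (fun _ _ => by positivity)
  rwa [tsum_geometric_two] at this

lemma integrable_one_add_abs_div (a : ℝ) {L : ℝ} (hL : 0 < L) :
    Integrable fun x : ℝ => ((1 + |x - a| / L) ^ 2)⁻¹ := by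
  have := (integrable_one_add_abs.comp_div hL.ne').comp_sub_right a
  simpa [abs_div, abs_of_pos hL] using this

lemma integral_one_add_abs_div (a : ℝ) {L : ℝ} (hL : 0 < L) :
    ∫ x : ℝ, ((1 + |x - a| / L) ^ 2)⁻¹ = L * intConst := by
  have h1 := integral_sub_right_eq_self (μ := volume) (fun x : ℝ => ((1 + |x / L|) ^ 2)⁻¹) a
  have h2 := Measure.integral_comp_div (fun t : ℝ => ((1 + |t|) ^ 2)⁻¹) L
  rw [h2, abs_of_pos hL, smul_eq_mul] at h1
  simpa [abs_div, abs_of_pos hL, intConst] using h1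

lemma wt_compl_le {I J : ℤ × ℤ} (h : dy I ⊆ dy J) {x : ℝ} (hx : x ∉ dy J) :
    (wt I x ^ 2)⁻¹ ≤ ((1 + |x - lft J| / len I) ^ 2)⁻¹
      + ((1 + |x - (lft J + len J)| / len I) ^ 2)⁻¹ := by
  have hI := len_pos I
  have h1 : lft J ≤ lft I := (mem_dy.1 (h (lft_mem_dy I))).1
  have h2 : lft I ≤ lft J + len J := (mem_dy.1 (h (lft_mem_dy I))).2.le
  rw [mem_dy, not_and_or] at hx
  rw [wt_eq]
  rcases hx with hx | hx
  · refine le_add_of_le_of_nonneg ?_ (by positivity)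
    gcongr ((1 + ?_ / _) ^ 2)⁻¹
    rw [abs_of_neg (by linarith), abs_of_neg (by linarith)]; linarith
  · refine le_add_of_nonneg_of_le (by positivity) ?_
    gcongr ((1 + ?_ / _) ^ 2)⁻¹
    rw [abs_of_nonneg (by linarith), abs_of_nonneg (by linarith)]; linarith

/-- Tails of the weights of subintervals of `J`, integrated outside of `J`. -/
lemma sum_tail_le (J : ℤ × ℤ) (T : Finset (ℤ × ℤ)) (hT : ∀ I ∈ T, dy I ⊆ dy J) :
    ∑ I ∈ T, ∫ x in (dy J)ᶜ, (wt I x ^ 4)⁻¹ ≤ 4 * sumConst * intConst * len J := by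
  classical
  have hc := sumConst_pos
  have hi := intConst_nonneg
  have key : ∀ k : ℤ, ∑ I ∈ T with I.1 = k, ∫ x in (dy J)ᶜ, (wt I x ^ 4)⁻¹
      ≤ 2 * sumConst * intConst * 2 ^ k := by
    intro k
    have hk : (0 : ℝ) < 2 ^ k := by positivity
    rw [← integral_finsetSum _ fun I _ => (integrable_wt_pow I (by norm_num)).integrableOn]
    have hwint : Integrable fun x => sumConst * (((1 + |x - lft J| / 2 ^ k) ^ 2)⁻¹
        + ((1 + |x - (lft J + len J)| / 2 ^ k) ^ 2)⁻¹) :=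
      ((integrable_one_add_abs_div _ hk).add (integrable_one_add_abs_div _ hk)).const_mul _
    calc ∫ x in (dy J)ᶜ, ∑ I ∈ T with I.1 = k, (wt I x ^ 4)⁻¹
        ≤ ∫ x in (dy J)ᶜ, sumConst * (((1 + |x - lft J| / 2 ^ k) ^ 2)⁻¹
          + ((1 + |x - (lft J + len J)| / 2 ^ k) ^ 2)⁻¹) := by
          refine setIntegral_mono_on ?_ hwint.integrableOn (measurableSet_dy J).compl ?_
          · exact integrable_finsetSum _ fun I _ =>
              (integrable_wt_pow I (by norm_num)).integrableOn
          intro x hx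
          have h1 := sum_wt_scale_le k x (T.filter fun I => I.1 = k)
            (fun I hI => (Finset.mem_filter.1 hI).2)
          refine le_trans ?_ (mul_le_mul_of_nonneg_right h1 (by positivity))
          rw [Finset.sum_mul]
          refine Finset.sum_le_sum fun I hI => ?_
          rw [Finset.mem_filter] at hI
          have h2 := wt_compl_le (hT I hI.1) hx
          have h3 : len I = 2 ^ k := by rw [← hI.2]; rfl
          rw [h3] at h2
          have h4 : (wt I x ^ 4)⁻¹ = (wt I x ^ 2)⁻¹ * (wt I x ^ 2)⁻¹ := by
            rw [← mul_inv, ← pow_add]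
          rw [h4]
          have := wt_pos I x
          gcongr
      _ ≤ ∫ x, sumConst * (((1 + |x - lft J| / 2 ^ k) ^ 2)⁻¹
          + ((1 + |x - (lft J + len J)| / 2 ^ k) ^ 2)⁻¹) :=
          setIntegral_le_integral hwint (Filter.Eventually.of_forall fun x => by positivity)
      _ = 2 * sumConst * intConst * 2 ^ k := by
          rw [integral_const_mul, integral_add (integrable_one_add_abs_div _ hk)
            (integrable_one_add_abs_div _ hk), integral_one_add_abs_div _ hk,
            integral_one_add_abs_div _ hk]
          ring
  rw [← Finset.sum_fiberwise_of_maps_to (g := fun I : ℤ × ℤ => I.1) (t := T.image fun I => I.1)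
    (fun I hI => Finset.mem_image_of_mem _ hI)]
  calc _ ≤ ∑ k ∈ T.image fun I => I.1, 2 * sumConst * intConst * 2 ^ k :=
        Finset.sum_le_sum fun k _ => key k
    _ = 2 * sumConst * intConst * ∑ k ∈ T.image fun I => I.1, 2 ^ k := by rw [Finset.mul_sum]
    _ ≤ 2 * sumConst * intConst * (2 * 2 ^ J.1) := by
        gcongr
        refine sum_zpow_le _ _ fun k hk => ?_
        obtain ⟨I, hI, rfl⟩ := Finset.mem_image.1 hk
        exact scale_le_of_subset (hT I hI)
    _ = _ := by unfold len; ring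

/-- Disjoint small intervals outside of `J`, weighted relative to `I`. -/
lemma sum_disjoint_le (I J : ℤ × ℤ) (A : Finset (ℤ × ℤ)) (hk : ∀ I' ∈ A, I'.1 ≤ I.1)
    (hd : (A : Set (ℤ × ℤ)).PairwiseDisjoint dy) (hJ : ∀ I' ∈ A, Disjoint (dy I') (dy J)) :
    ∑ I' ∈ A, len I' * (wt I (lft I') ^ 4)⁻¹ ≤ 16 * ∫ x in (dy J)ᶜ, (wt I x ^ 4)⁻¹ := by
  have hwint := integrable_wt_pow I (N := 4) (by norm_num)
  calc ∑ I' ∈ A, len I' * (wt I (lft I') ^ 4)⁻¹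
      ≤ ∑ I' ∈ A, 16 * ∫ x in dy I', (wt I x ^ 4)⁻¹ := by
        refine Finset.sum_le_sum fun I' hI' => ?_
        have h1 : ∀ x ∈ dy I', (wt I (lft I') ^ 4)⁻¹ / 16 ≤ (wt I x ^ 4)⁻¹ := by
          intro x hx
          have h2 := wt_le_two_mul (hk I' hI')
            (abs_sub_le_of_mem_dy (lft_mem_dy I') hx)
          have h3 : wt I x ^ 4 ≤ (2 * wt I (lft I')) ^ 4 :=
            pow_le_pow_left₀ (wt_pos I x).le h2 4
          have h5 := pow_pos (wt_pos I x) 4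
          have h6 := inv_anti₀ h5 h3
          refine le_trans (le_of_eq ?_) h6
          rw [mul_pow, mul_inv]; norm_num; ring
        have h4 := setIntegral_ge_of_const_le_real (measurableSet_dy I')
          (by rw [volume_dy]; exact ENNReal.ofReal_ne_top) h1 hwint.integrableOn
        rw [volume_real_dy] at h4
        linarith
    _ = 16 * ∫ x in ⋃ I' ∈ A, dy I', (wt I x ^ 4)⁻¹ := by
        rw [← Finset.mul_sum, integral_biUnion_finset _ (fun I' _ => measurableSet_dy I') hd
          (fun I' _ => hwint.integrableOn)]
    _ ≤ _ := by
        refine mul_le_mul_of_nonneg_left (setIntegral_mono_set hwint.integrableOn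
          (ae_of_all _ fun x => ?_) (LE.le.eventuallyLE
            (Set.iUnion₂_subset fun I' hI' => (hJ I' hI').subset_compl_right))) (by norm_num)
        have := wt_pos I x
        show 0 ≤ (wt I x ^ 4)⁻¹
        positivity

/-- Bessel-type inequality from a bound of the Gram matrix tested on the coefficients. -/
lemma bessel_of_gram {𝓗 ι : Type*} [NormedAddCommGroup 𝓗] [InnerProductSpace ℂ 𝓗]
    (D : Finset ι) (c : ι → ℝ) (hc : ∀ i, 0 ≤ c i) (e : ι → 𝓗) (f : 𝓗) {C : ℝ} (hC : 0 ≤ C)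
    (h : ∑ i ∈ D, ∑ j ∈ D, c i * c j * ‖inner ℂ (e i) f‖ * ‖inner ℂ (e j) f‖ *
        ‖inner ℂ (e i) (e j)‖ ≤ C * ∑ i ∈ D, c i * ‖inner ℂ (e i) f‖ ^ 2) :
    ∑ i ∈ D, c i * ‖inner ℂ (e i) f‖ ^ 2 ≤ C * ‖f‖ ^ 2 := by
  set S := ∑ i ∈ D, c i * ‖inner ℂ (e i) f‖ ^ 2 with hS
  have hS0 : 0 ≤ S := Finset.sum_nonneg fun i _ => mul_nonneg (hc i) (by positivity)
  set G : 𝓗 := ∑ i ∈ D, ((c i : ℂ) * inner ℂ (e i) f) • e i with hG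
  have h1 : inner ℂ G f = (S : ℂ) := by
    rw [hG, sum_inner, hS]
    push_cast
    refine Finset.sum_congr rfl fun i _ => ?_
    rw [inner_smul_left, map_mul, Complex.conj_ofReal, mul_assoc, Complex.conj_mul']
  have h2 : S ≤ ‖G‖ * ‖f‖ := by
    have := norm_inner_le_norm (𝕜 := ℂ) G f
    rwa [h1, Complex.norm_real, Real.norm_of_nonneg hS0] at this
  have h3 : ‖G‖ ^ 2 ≤ C * S := by
    refine le_trans ?_ h
    have h4 : ‖G‖ ^ 2 = ‖(inner ℂ G G : ℂ)‖ := by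
      rw [inner_self_eq_norm_sq_to_K]; simp
    rw [h4]
    conv_lhs => rw [hG, sum_inner]
    refine (norm_sum_le _ _).trans (Finset.sum_le_sum fun i _ => ?_)
    rw [inner_sum]
    refine (norm_sum_le _ _).trans (Finset.sum_le_sum fun j _ => ?_)
    rw [inner_smul_left, inner_smul_right, norm_mul, norm_mul, RCLike.norm_conj, norm_mul, norm_mul,
      Complex.norm_real, Complex.norm_real, Real.norm_of_nonneg (hc i), Real.norm_of_nonneg (hc j)]
    apply le_of_eq; ring
  rcases hS0.eq_or_lt with h0 | h0
  · rw [← h0]; positivity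
  · have h5 : S ^ 2 ≤ C * S * ‖f‖ ^ 2 := by
      calc S ^ 2 ≤ (‖G‖ * ‖f‖) ^ 2 := by gcongr
        _ = ‖G‖ ^ 2 * ‖f‖ ^ 2 := by ring
        _ ≤ _ := by gcongr
    have h6 : S * S ≤ S * (C * ‖f‖ ^ 2) := by nlinarith
    exact le_of_mul_le_mul_left h6 h0

/-- A tile: a dyadic interval in space together with a frequency index. -/
abbrev Tile := (ℤ × ℤ) × ℤ

/-- A tree top: a dyadic interval together with a frequency. -/
abbrev Top := (ℤ × ℤ) × ℝ

/-- The frequency `ξ` lies in a large dilate of the frequency interval of `P`. -/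
def InFreq (ξ : ℝ) (P : Tile) : Prop := |ξ * len P.1 - P.2| ≤ 19

/-- `P` belongs to the maximal tree with top `t`. -/
def InTree (t : Top) (P : Tile) : Prop := dy P.1 ⊆ dy t.1 ∧ InFreq t.2 P

/-- The frequency band of `P` with (relative) endpoints `b`. -/
def band (b : ℝ × ℝ) (P : Tile) : Set ℝ := {z | z * len P.1 - P.2 ∈ Icc b.1 b.2}

/-- `P` belongs to the tree of `t`, and its band lies on the side `σ` of the top frequency. -/
def Lac (b : ℝ × ℝ) (σ : ℝ) (t : Top) (P : Tile) : Prop :=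
  InTree t P ∧ ∀ z ∈ band b P, 1 ≤ σ * ((z - t.2) * len P.1)

/-- Scales and frequencies of the tiles in `D` are well separated. -/
def Sparse (D : Finset Tile) : Prop :=
  ∀ P ∈ D, ∀ P' ∈ D, (P.1.1 < P'.1.1 → P.1.1 + 6 ≤ P'.1.1) ∧
    (P.1.1 = P'.1.1 → P.2 < P'.2 → P.2 + 64 ≤ P'.2)

lemma Sparse.mono {D D' : Finset Tile} (h : Sparse D) (hD : D' ⊆ D) : Sparse D' :=
  fun P hP P' hP' => h P (hD hP) P' (hD hP')

lemma Sparse.len_le {D : Finset Tile} (h : Sparse D) {P P' : Tile} (hP : P ∈ D) (hP' : P' ∈ D)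
    (hk : P'.1.1 < P.1.1) : 64 * len P'.1 ≤ len P.1 := by
  have h1 := (h P' hP' P hP).1 hk
  calc 64 * len P'.1 = 2 ^ (P'.1.1 + 6) := by
        unfold len; rw [zpow_add₀ (by norm_num)]; norm_num; ring
    _ ≤ len P.1 := zpow_le_zpow_right₀ (by norm_num) h1

lemma Sparse.snd_eq {D : Finset Tile} (h : Sparse D) {P P' : Tile} (hP : P ∈ D) (hP' : P' ∈ D)
    (hk : P.1.1 = P'.1.1) (hl : |(P.2 : ℝ) - P'.2| < 64) : P.2 = P'.2 := by
  have h1 := (h P hP P' hP').2 hk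
  have h2 := (h P' hP' P hP).2 hk.symm
  have h3 : |P.2 - P'.2| < 64 := by exact_mod_cast hl
  rw [abs_lt] at h3
  by_contra hne
  rcases lt_or_gt_of_ne hne with h4 | h4
  · have := h1 h4; omega
  · have := h2 h4; omega

lemma Sparse.eq_of_inFreq {D : Finset Tile} (h : Sparse D) {P P' : Tile} (hP : P ∈ D)
    (hP' : P' ∈ D) (hI : P.1 = P'.1) {ξ : ℝ} (h1 : InFreq ξ P) (h2 : InFreq ξ P') : P = P' := by
  refine Prod.ext hI (h.snd_eq hP hP' (by rw [hI]) ?_)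
  unfold InFreq at h1 h2
  rw [hI] at h1
  rw [abs_le] at h1 h2
  rw [abs_lt]; constructor <;> linarith

lemma lac_key {b : ℝ × ℝ} (hb1 : -18 ≤ b.1) (hb2 : b.2 ≤ 18) {σ : ℝ} (hσ : σ = 1 ∨ σ = -1)
    {t t' : Top} {P P' : Tile} (h : Lac b σ t P) (h' : Lac b σ t' P') {z z' : ℝ}
    (hz : z ∈ band b P) (hz' : z' ∈ band b P') (hzz : |z - z'| * len P.1 ≤ 1)
    (hL : 64 * len P'.1 ≤ len P.1) : σ * t'.2 < σ * t.2 ∧ InFreq t.2 P' := by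
  have hp := len_pos P.1
  have hp' := len_pos P'.1
  have hf := h.1.2
  have h1 := h'.2 z' hz'
  unfold InFreq at *
  simp only [band, mem_ofPred_eq, mem_Icc] at hz hz'
  have hzz1 : |(z - z') * len P.1| ≤ 1 := by rwa [abs_mul, abs_of_pos hp]
  rw [abs_le] at hf hzz1
  have e1 : |(z' - t.2) * len P.1| ≤ 38 := by
    rw [abs_le]; constructor <;> nlinarith
  have e1' := e1
  rw [abs_mul, abs_of_pos hp] at e1
  have e2 : |z' - t.2| * len P'.1 ≤ 1 - 1 / 8 := by
    have := mul_le_mul_of_nonneg_left hL (abs_nonneg (z' - t.2))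
    nlinarith
  have e3 : |(z' - t.2) * len P'.1| ≤ 1 - 1 / 8 := by rwa [abs_mul, abs_of_pos hp']
  rw [abs_le] at e3
  constructor
  · have : 0 < (σ * t.2 - σ * t'.2) * len P'.1 := by
      rcases hσ with rfl | rfl <;> nlinarith
    have := pos_of_mul_pos_left this hp'.le
    linarith
  · rw [abs_le]; constructor <;> nlinarith

/-- The constant in the energy inequality. -/
noncomputable def energyConst : ℝ := sumConst + 512 * sumConst * intConst

lemma energyConst_pos : 0 < energyConst := by
  have := sumConst_pos; have := intConst_nonneg; unfold energyConst; positivity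

section energy
variable {𝓗 : Type*} [NormedAddCommGroup 𝓗] [InnerProductSpace ℂ 𝓗]

/-- The tile `P'` is smaller than `P`, and their bands intersect. -/
def Below (b : ℝ × ℝ) (P P' : Tile) : Prop := P'.1.1 < P.1.1 ∧ ¬ Disjoint (band b P) (band b P')

lemma below_disjoint_top {b : ℝ × ℝ} (hb1 : -18 ≤ b.1) (hb2 : b.2 ≤ 18) {σ : ℝ}
    (hσ : σ = 1 ∨ σ = -1) {D : Finset Tile} (hD : Sparse D) {τ : Tile → Top}
    (hlac : ∀ P ∈ D, Lac b σ (τ P) P)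
    (hsel : ∀ P ∈ D, ∀ P' ∈ D, σ * (τ P').2 < σ * (τ P).2 → ¬ InTree (τ P) P')
    {P P' : Tile} (hP : P ∈ D) (hP' : P' ∈ D) (hk : P'.1.1 < P.1.1) {z z' : ℝ}
    (hz : z ∈ band b P) (hz' : z' ∈ band b P') (hzz : |z - z'| * len P.1 ≤ 1) :
    Disjoint (dy P'.1) (dy (τ P).1) := by
  have h := lac_key hb1 hb2 hσ (hlac P hP) (hlac P' hP') hz hz' hzz (hD.len_le hP hP' hk)
  have h1 := hsel P hP P' hP' h.1
  have h2 : P'.1.1 ≤ (τ P).1.1 := hk.le.trans (scale_le_of_subset (hlac P hP).1.1)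
  exact (dy_subset_or_disjoint h2).resolve_left fun hs => h1 ⟨hs, h.2⟩

lemma below_pairwise {b : ℝ × ℝ} (hb1 : -18 ≤ b.1) (hb2 : b.2 ≤ 18) {σ : ℝ}
    (hσ : σ = 1 ∨ σ = -1) {D : Finset Tile} (hD : Sparse D) {τ : Tile → Top}
    (hlac : ∀ P ∈ D, Lac b σ (τ P) P)
    (hsel : ∀ P ∈ D, ∀ P' ∈ D, σ * (τ P').2 < σ * (τ P).2 → ¬ InTree (τ P) P')
    {P P' P'' : Tile} (hP : P ∈ D) (hP' : P' ∈ D) (hP'' : P'' ∈ D)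
    (h' : Below b P P') (h'' : Below b P P'') (hne : P' ≠ P'') :
    Disjoint (dy P'.1) (dy P''.1) := by
  obtain ⟨hk', h'⟩ := h'
  obtain ⟨hk'', h''⟩ := h''
  obtain ⟨z', hz', hzz'⟩ := Set.not_disjoint_iff.1 h'
  obtain ⟨z'', hz'', hzz''⟩ := Set.not_disjoint_iff.1 h''
  have hp := len_pos P.1
  have e1 : |z' - z''| * len P.1 ≤ 36 := by
    simp only [band, mem_ofPred_eq, mem_Icc] at hz' hz''
    rw [← abs_of_pos hp, ← abs_mul, abs_le]
    constructor <;> linarith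
  have e2 : ∀ Q ∈ D, Q.1.1 < P.1.1 → |z' - z''| * len Q.1 ≤ 1 := by
    intro Q hQ hk
    have := mul_le_mul_of_nonneg_left (hD.len_le hP hQ hk) (abs_nonneg (z' - z''))
    linarith
  rcases lt_trichotomy P'.1.1 P''.1.1 with hlt | heq | hlt
  · have := below_disjoint_top hb1 hb2 hσ hD hlac hsel hP'' hP' hlt hzz'' hzz'
      (by rw [abs_sub_comm]; exact e2 P'' hP'' hk'')
    exact this.mono_right (hlac P'' hP'').1.1
  · have hl : P'.2 = P''.2 := by
      refine hD.snd_eq hP' hP'' heq ?_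
      have e3 := e2 P' hP' hk'
      have e4 : len P''.1 = len P'.1 := by unfold len; rw [heq]
      simp only [band, mem_ofPred_eq, mem_Icc] at hzz' hzz''
      rw [e4] at hzz''
      rw [← abs_of_pos (len_pos P'.1), ← abs_mul, abs_le] at e3
      rw [abs_lt]
      constructor <;> linarith
    by_contra hd
    obtain ⟨x, hx, hx'⟩ := Set.not_disjoint_iff.1 hd
    exact hne (Prod.ext (eq_of_mem_dy heq hx hx') hl)
  · have := below_disjoint_top hb1 hb2 hσ hD hlac hsel hP' hP'' hlt hzz' hzz'' (e2 P' hP' hk')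
    exact (this.mono_right (hlac P' hP').1.1).symm

/-- The contribution of the interactions of tiles of different scales. -/
lemma below_sum_le {b : ℝ × ℝ} (hb1 : -18 ≤ b.1) (hb2 : b.2 ≤ 18) {σ : ℝ}
    (hσ : σ = 1 ∨ σ = -1) {D : Finset Tile} (hD : Sparse D) {τ : Tile → Top}
    (hlac : ∀ P ∈ D, Lac b σ (τ P) P)
    (hsel : ∀ P ∈ D, ∀ P' ∈ D, σ * (τ P').2 < σ * (τ P).2 → ¬ InTree (τ P) P') :
    open Classical in
    ∑ P ∈ D, ∑ P' ∈ D with Below b P P', len P'.1 * (wt P.1 (lft P'.1) ^ 4)⁻¹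
      ≤ 64 * sumConst * intConst * ∑ t ∈ D.image τ, len t.1 := by
  classical
  have h1 : ∀ P ∈ D, ∑ P' ∈ D with Below b P P', len P'.1 * (wt P.1 (lft P'.1) ^ 4)⁻¹
      ≤ 16 * ∫ x in (dy (τ P).1)ᶜ, (wt P.1 x ^ 4)⁻¹ := by
    intro P hP
    have hpw : ∀ P' ∈ D.filter (Below b P), ∀ P'' ∈ D.filter (Below b P), P' ≠ P'' →
        Disjoint (dy P'.1) (dy P''.1) := by
      intro P' h' P'' h'' hne
      rw [Finset.mem_filter] at h' h''
      exact below_pairwise hb1 hb2 hσ hD hlac hsel hP h'.1 h''.1 h'.2 h''.2 hne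
    have hinj : Set.InjOn (fun P' : Tile => P'.1) (D.filter (Below b P) : Finset Tile) := by
      intro P' h' P'' h'' he
      by_contra hne
      have := hpw P' h' P'' h'' hne
      simp only at he
      rw [he] at this
      exact Set.not_disjoint_iff.2 ⟨_, lft_mem_dy _, lft_mem_dy _⟩ this
    have := sum_disjoint_le P.1 (τ P).1 ((D.filter (Below b P)).image fun P' => P'.1) ?_ ?_ ?_
    · rwa [Finset.sum_image hinj] at this
    · intro I hI
      obtain ⟨P', hP', rfl⟩ := Finset.mem_image.1 hI
      exact (Finset.mem_filter.1 hP').2.1.le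
    · intro I hI I' hI' hne
      obtain ⟨P', hP', rfl⟩ := Finset.mem_image.1 (Finset.mem_coe.1 hI)
      obtain ⟨P'', hP'', rfl⟩ := Finset.mem_image.1 (Finset.mem_coe.1 hI')
      exact hpw P' hP' P'' hP'' fun h => hne (by rw [h])
    · intro I hI
      obtain ⟨P', hP', rfl⟩ := Finset.mem_image.1 hI
      obtain ⟨hP'D, hk, hm⟩ := Finset.mem_filter.1 hP'
      obtain ⟨z, hz, hz'⟩ := Set.not_disjoint_iff.1 hm
      exact below_disjoint_top hb1 hb2 hσ hD hlac hsel hP hP'D hk hz hz' (by simp)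
  refine (Finset.sum_le_sum h1).trans ?_
  rw [← Finset.mul_sum, ← Finset.sum_fiberwise_of_maps_to (g := τ) (t := D.image τ)
    (fun P hP => Finset.mem_image_of_mem _ hP)]
  have h2 : ∀ t ∈ D.image τ, ∑ P ∈ D with τ P = t, ∫ x in (dy (τ P).1)ᶜ, (wt P.1 x ^ 4)⁻¹
      ≤ 4 * sumConst * intConst * len t.1 := by
    intro t _
    have hinj : Set.InjOn (fun P : Tile => P.1) (D.filter fun P => τ P = t : Finset Tile) := by
      intro P hP P' hP' he
      have hP := Finset.mem_filter.1 (Finset.mem_coe.1 hP)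
      have hP' := Finset.mem_filter.1 (Finset.mem_coe.1 hP')
      have e1 := (hlac P hP.1).1.2
      have e2 := (hlac P' hP'.1).1.2
      rw [hP.2] at e1
      rw [hP'.2] at e2
      exact hD.eq_of_inFreq hP.1 hP'.1 he e1 e2
    have := sum_tail_le t.1 ((D.filter fun P => τ P = t).image fun P => P.1) ?_
    · rw [Finset.sum_image hinj] at this
      refine le_trans (le_of_eq (Finset.sum_congr rfl fun P hP => ?_)) this
      rw [(Finset.mem_filter.1 hP).2]
    · intro I hI
      obtain ⟨P, hP, rfl⟩ := Finset.mem_image.1 hI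
      obtain ⟨hPD, rfl⟩ := Finset.mem_filter.1 hP
      exact (hlac P hPD).1.1
  refine (mul_le_mul_of_nonneg_left (Finset.sum_le_sum h2) (by norm_num)).trans (le_of_eq ?_)
  rw [← Finset.mul_sum]; ring

/-- The contribution of the interactions of tiles of the same scale. -/
lemma same_scale_sum_le {b : ℝ × ℝ} (hb1 : -18 ≤ b.1) (hb2 : b.2 ≤ 18)
    {D : Finset Tile} (hD : Sparse D) (a : Tile → ℝ) :
    open Classical in
    ∑ P ∈ D, ∑ P' ∈ D with P'.1.1 = P.1.1 ∧ ¬ Disjoint (band b P) (band b P'),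
      len P'.1 * a P * a P' * (wt P.1 (lft P'.1) ^ 4)⁻¹ ≤ sumConst * ∑ P ∈ D, len P.1 * a P ^ 2 := by
  classical
  set R : Tile → Tile → Prop := fun P P' => P'.1.1 = P.1.1 ∧ ¬ Disjoint (band b P) (band b P')
    with hR
  have hsymm : ∀ P P', R P P' → R P' P := fun P P' h => ⟨h.1.symm, fun hd => h.2 hd.symm⟩
  have hlen : ∀ P P', R P P' → len P'.1 = len P.1 := fun P P' h => by unfold len; rw [h.1]
  have hwt : ∀ P P', R P P' → wt P.1 (lft P'.1) = wt P'.1 (lft P.1) := by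
    intro P P' h
    rw [wt_eq, wt_eq, hlen P P' h, abs_sub_comm]
  have hl : ∀ P ∈ D, ∀ P' ∈ D, R P P' → P.2 = P'.2 := by
    intro P hP P' hP' h
    refine hD.snd_eq hP hP' h.1.symm ?_
    obtain ⟨z, hz, hz'⟩ := Set.not_disjoint_iff.1 h.2
    simp only [band, mem_ofPred_eq, mem_Icc] at hz hz'
    rw [hlen P P' h] at hz'
    rw [abs_lt]; constructor <;> linarith
  have hrow : ∀ P ∈ D, ∑ P' ∈ D with R P P', (wt P'.1 (lft P.1) ^ 4)⁻¹ ≤ sumConst := by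
    intro P hP
    have hinj : Set.InjOn (fun P' : Tile => P'.1) (D.filter (R P) : Finset Tile) := by
      intro P' h' P'' h'' he
      have h' := Finset.mem_filter.1 (Finset.mem_coe.1 h')
      have h'' := Finset.mem_filter.1 (Finset.mem_coe.1 h'')
      exact Prod.ext he ((hl P hP P' h'.1 h'.2).symm.trans (hl P hP P'' h''.1 h''.2))
    have := sum_wt_scale_le P.1.1 (lft P.1) ((D.filter (R P)).image fun P' => P'.1) ?_
    · rw [Finset.sum_image hinj] at this
      refine le_trans (Finset.sum_le_sum fun P' _ => ?_) this
      exact wt_pow_inv_le _ _ (by norm_num)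
    · intro I hI
      obtain ⟨P', hP', rfl⟩ := Finset.mem_image.1 hI
      exact (Finset.mem_filter.1 hP').2.1
  have hA : ∑ P ∈ D, ∑ P' ∈ D with R P P', len P.1 * a P ^ 2 * (wt P'.1 (lft P.1) ^ 4)⁻¹
      ≤ sumConst * ∑ P ∈ D, len P.1 * a P ^ 2 := by
    rw [Finset.mul_sum]
    refine Finset.sum_le_sum fun P hP => ?_
    rw [← Finset.mul_sum, mul_comm sumConst]
    have := len_pos P.1
    exact mul_le_mul_of_nonneg_left (hrow P hP) (by positivity)
  have hB : ∑ P ∈ D, ∑ P' ∈ D with R P P', len P'.1 * a P' ^ 2 * (wt P.1 (lft P'.1) ^ 4)⁻¹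
      = ∑ P ∈ D, ∑ P' ∈ D with R P P', len P.1 * a P ^ 2 * (wt P'.1 (lft P.1) ^ 4)⁻¹ := by
    simp_rw [Finset.sum_filter]
    rw [Finset.sum_comm]
    refine Finset.sum_congr rfl fun P _ => Finset.sum_congr rfl fun P' _ => ?_
    by_cases h : R P P'
    · rw [if_pos h, if_pos (hsymm _ _ h)]
    · rw [if_neg h, if_neg fun h' => h (hsymm _ _ h')]
  calc ∑ P ∈ D, ∑ P' ∈ D with R P P', len P'.1 * a P * a P' * (wt P.1 (lft P'.1) ^ 4)⁻¹
      ≤ ∑ P ∈ D, ∑ P' ∈ D with R P P', (len P.1 * a P ^ 2 * (wt P'.1 (lft P.1) ^ 4)⁻¹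
        + len P'.1 * a P' ^ 2 * (wt P.1 (lft P'.1) ^ 4)⁻¹) / 2 := by
        refine Finset.sum_le_sum fun P _ => Finset.sum_le_sum fun P' hP' => ?_
        have h := (Finset.mem_filter.1 hP').2
        rw [hwt P P' h, hlen P P' h]
        have h1 : 0 ≤ len P.1 * (wt P'.1 (lft P.1) ^ 4)⁻¹ := by
          have := len_pos P.1; positivity
        nlinarith [mul_nonneg h1 (sq_nonneg (a P - a P'))]
    _ = (∑ P ∈ D, ∑ P' ∈ D with R P P', len P.1 * a P ^ 2 * (wt P'.1 (lft P.1) ^ 4)⁻¹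
        + ∑ P ∈ D, ∑ P' ∈ D with R P P', len P'.1 * a P' ^ 2 * (wt P.1 (lft P'.1) ^ 4)⁻¹) / 2 := by
        simp_rw [← Finset.sum_div, Finset.sum_add_distrib]
    _ ≤ _ := by rw [hB]; linarith

/-- The energy inequality for a strongly disjoint collection of lacunary trees. -/
lemma energy_bessel {b : ℝ × ℝ} (hb1 : -18 ≤ b.1) (hb2 : b.2 ≤ 18) {σ : ℝ}
    (hσ : σ = 1 ∨ σ = -1) {D : Finset Tile} (hD : Sparse D) {τ : Tile → Top}
    (hlac : ∀ P ∈ D, Lac b σ (τ P) P)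
    (hsel : ∀ P ∈ D, ∀ P' ∈ D, σ * (τ P').2 < σ * (τ P).2 → ¬ InTree (τ P) P')
    {e : Tile → 𝓗} (f : 𝓗) {K lam : ℝ} (hK : 0 ≤ K) (hlam : 0 ≤ lam)
    (hG : ∀ P ∈ D, ∀ P' ∈ D, P'.1.1 ≤ P.1.1 →
      ‖inner ℂ (e P) (e P')‖ ≤ K * (len P.1)⁻¹ * (wt P.1 (lft P'.1) ^ 4)⁻¹)
    (hG0 : ∀ P ∈ D, ∀ P' ∈ D, Disjoint (band b P) (band b P') → inner ℂ (e P) (e P') = 0)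
    (ha : ∀ P ∈ D, ‖inner ℂ (e P) f‖ ≤ 2 * lam)
    (hT : open Classical in
      lam ^ 2 * ∑ t ∈ D.image τ, len t.1 ≤ ∑ P ∈ D, len P.1 * ‖inner ℂ (e P) f‖ ^ 2) :
    ∑ P ∈ D, len P.1 * ‖inner ℂ (e P) f‖ ^ 2 ≤ K * energyConst * ‖f‖ ^ 2 := by
  classical
  have hc := sumConst_pos
  have hi := intConst_nonneg
  refine bessel_of_gram D (fun P => len P.1) (fun P => (len_pos P.1).le) e f
    (mul_nonneg hK energyConst_pos.le) ?_
  set a : Tile → ℝ := fun P => ‖inner ℂ (e P) f‖ with ha'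
  have ha0 : ∀ P, 0 ≤ a P := fun P => norm_nonneg _
  set G : Tile → Tile → ℝ := fun P P' => len P.1 * len P'.1 * a P * a P' * ‖inner ℂ (e P) (e P')‖
  set S := ∑ P ∈ D, len P.1 * a P ^ 2
  have hG1 : ∀ P ∈ D, ∀ P' ∈ D, P'.1.1 ≤ P.1.1 →
      G P P' ≤ K * (len P'.1 * a P * a P' * (wt P.1 (lft P'.1) ^ 4)⁻¹) := by
    intro P hP P' hP' hk
    have h1 := hG P hP P' hP' hk
    have := len_pos P.1; have := len_pos P'.1; have := ha0 P; have := ha0 P'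
    calc G P P' ≤ len P.1 * len P'.1 * a P * a P' *
          (K * (len P.1)⁻¹ * (wt P.1 (lft P'.1) ^ 4)⁻¹) := by
          refine mul_le_mul_of_nonneg_left h1 (by positivity)
      _ = _ := by field_simp
  have hlow : ∑ P ∈ D, ∑ P' ∈ D with Below b P P', G P P' ≤ K * (256 * sumConst * intConst) * S := by
    calc ∑ P ∈ D, ∑ P' ∈ D with Below b P P', G P P'
        ≤ ∑ P ∈ D, ∑ P' ∈ D with Below b P P',
          4 * lam ^ 2 * K * (len P'.1 * (wt P.1 (lft P'.1) ^ 4)⁻¹) := by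
          refine Finset.sum_le_sum fun P hP => Finset.sum_le_sum fun P' hP' => ?_
          obtain ⟨hP'D, hk, -⟩ := Finset.mem_filter.1 hP'
          refine (hG1 P hP P' hP'D hk.le).trans ?_
          have h1 : a P * a P' ≤ 2 * lam * (2 * lam) :=
            mul_le_mul (ha P hP) (ha P' hP'D) (ha0 _) (by positivity)
          have h2 : 0 ≤ K * (len P'.1 * (wt P.1 (lft P'.1) ^ 4)⁻¹) := by
            have := len_pos P'.1; have := wt_pos P.1 (lft P'.1); positivity
          nlinarith [mul_le_mul_of_nonneg_left h1 h2]
      _ = 4 * lam ^ 2 * K *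
          ∑ P ∈ D, ∑ P' ∈ D with Below b P P', len P'.1 * (wt P.1 (lft P'.1) ^ 4)⁻¹ := by
          simp_rw [Finset.mul_sum]
      _ ≤ 4 * lam ^ 2 * K * (64 * sumConst * intConst * ∑ t ∈ D.image τ, len t.1) := by
          refine mul_le_mul_of_nonneg_left ?_ (by positivity)
          exact below_sum_le hb1 hb2 hσ hD hlac hsel
      _ = K * (256 * sumConst * intConst) * (lam ^ 2 * ∑ t ∈ D.image τ, len t.1) := by ring
      _ ≤ _ := mul_le_mul_of_nonneg_left hT (by positivity)
  have hsame : ∑ P ∈ D, ∑ P' ∈ D with P'.1.1 = P.1.1 ∧ ¬ Disjoint (band b P) (band b P'), G P P'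
      ≤ K * sumConst * S := by
    calc _ ≤ ∑ P ∈ D, ∑ P' ∈ D with P'.1.1 = P.1.1 ∧ ¬ Disjoint (band b P) (band b P'),
          K * (len P'.1 * a P * a P' * (wt P.1 (lft P'.1) ^ 4)⁻¹) := by
          refine Finset.sum_le_sum fun P hP => Finset.sum_le_sum fun P' hP' => ?_
          obtain ⟨hP'D, hk, -⟩ := Finset.mem_filter.1 hP'
          exact hG1 P hP P' hP'D hk.le
      _ = K * ∑ P ∈ D, ∑ P' ∈ D with P'.1.1 = P.1.1 ∧ ¬ Disjoint (band b P) (band b P'),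
          len P'.1 * a P * a P' * (wt P.1 (lft P'.1) ^ 4)⁻¹ := by
          simp_rw [Finset.mul_sum]
      _ ≤ K * (sumConst * S) :=
          mul_le_mul_of_nonneg_left (same_scale_sum_le hb1 hb2 hD a) hK
      _ = _ := by ring
  have hup : ∑ P ∈ D, ∑ P' ∈ D with Below b P' P, G P P'
      = ∑ P ∈ D, ∑ P' ∈ D with Below b P P', G P P' := by
    simp_rw [Finset.sum_filter]
    rw [Finset.sum_comm]
    refine Finset.sum_congr rfl fun P _ => Finset.sum_congr rfl fun P' _ => ?_
    have : G P' P = G P P' := by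
      simp only [G]; rw [norm_inner_symm]; ring
    rw [this]
  have hsplit : ∀ P ∈ D, ∀ P' ∈ D, G P P' ≤ (if Below b P P' then G P P' else 0)
      + (if P'.1.1 = P.1.1 ∧ ¬ Disjoint (band b P) (band b P') then G P P' else 0)
      + (if Below b P' P then G P P' else 0) := by
    intro P hP P' hP'
    have hG0' : 0 ≤ G P P' := by
      have := len_pos P.1; have := len_pos P'.1; have := ha0 P; have := ha0 P'
      simp only [G]; positivity
    by_cases hd : Disjoint (band b P) (band b P')
    · have : G P P' = 0 := by simp only [G]; rw [hG0 P hP P' hP' hd]; simp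
      rw [this]; simp
    · have hd' : ¬ Disjoint (band b P') (band b P) := fun h => hd h.symm
      unfold Below
      rcases lt_trichotomy P.1.1 P'.1.1 with h | h | h
      · simp [h, hd', h.ne', h.not_gt]
      · simp [h, hd]
      · simp [h, hd, h.ne, h.not_gt]
  calc ∑ P ∈ D, ∑ P' ∈ D, G P P' ≤ _ :=
        Finset.sum_le_sum fun P hP => Finset.sum_le_sum fun P' hP' => hsplit P hP P' hP'
    _ = ∑ P ∈ D, ∑ P' ∈ D with Below b P P', G P P'
        + ∑ P ∈ D, ∑ P' ∈ D with P'.1.1 = P.1.1 ∧ ¬ Disjoint (band b P) (band b P'), G P P'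
        + ∑ P ∈ D, ∑ P' ∈ D with Below b P' P, G P P' := by
        simp_rw [Finset.sum_filter, Finset.sum_add_distrib]
    _ ≤ K * energyConst * S := by
        rw [hup]; unfold energyConst
        linarith

end energy

open Classical in
/-- The square sum of the coefficients over a lacunary tree. -/
noncomputable def lacSum (b : ℝ × ℝ) (a : Tile → ℝ) (D : Finset Tile) (σ : ℝ) (t : Top) : ℝ :=
  ∑ P ∈ D with Lac b σ t P, len P.1 * a P ^ 2

/-- The size of the collection `D` with respect to the tops in `Θ` is at most `S`. -/
def SizeLe (b : ℝ × ℝ) (a : Tile → ℝ) (Θ : Finset Top) (D : Finset Tile) (S : ℝ) : Prop :=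
  ∀ t ∈ Θ, ∀ σ : ℝ, σ = 1 ∨ σ = -1 → lacSum b a D σ t ≤ S ^ 2 * len t.1

/-- Every tile is itself a lacunary tree. -/
def Singles (b : ℝ × ℝ) (Θ : Finset Top) (D : Finset Tile) : Prop :=
  ∀ P ∈ D, ∃ t ∈ Θ, ∃ σ : ℝ, (σ = 1 ∨ σ = -1) ∧ t.1 = P.1 ∧ Lac b σ t P

lemma lacSum_mono (b : ℝ × ℝ) (a : Tile → ℝ) {D D' : Finset Tile} (h : D' ⊆ D) (σ : ℝ) (t : Top) :
    lacSum b a D' σ t ≤ lacSum b a D σ t := by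
  classical
  refine Finset.sum_le_sum_of_subset_of_nonneg (Finset.filter_subset_filter _ h) fun P _ _ => ?_
  have := len_pos P.1; positivity

lemma SizeLe.mono {b : ℝ × ℝ} {a : Tile → ℝ} {Θ : Finset Top} {D D' : Finset Tile} {S : ℝ}
    (h : SizeLe b a Θ D S) (hD : D' ⊆ D) : SizeLe b a Θ D' S :=
  fun t ht σ hσ => (lacSum_mono b a hD σ t).trans (h t ht σ hσ)

lemma SizeLe.le {b : ℝ × ℝ} {a : Tile → ℝ} {Θ : Finset Top} {D : Finset Tile} {S : ℝ}
    (h : SizeLe b a Θ D S) (h1 : Singles b Θ D) (hS : 0 ≤ S) {P : Tile} (hP : P ∈ D) :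
    a P ≤ S := by
  classical
  obtain ⟨t, ht, σ, hσ, hI, hl⟩ := h1 P hP
  have h2 := h t ht σ hσ
  have h3 : len P.1 * a P ^ 2 ≤ lacSum b a D σ t := by
    refine Finset.single_le_sum (f := fun P : Tile => len P.1 * a P ^ 2) (fun Q _ => ?_)
      (Finset.mem_filter.2 ⟨hP, hl⟩)
    have := len_pos Q.1; positivity
  have h4 : a P ^ 2 ≤ S ^ 2 := by
    have h5 : len P.1 * a P ^ 2 ≤ len P.1 * S ^ 2 := by
      rw [mul_comm (len P.1) (S ^ 2), ← hI]; rw [← hI] at h3; exact h3.trans h2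
    exact le_of_mul_le_mul_left h5 (len_pos P.1)
  exact le_of_sq_le_sq h4 hS

/-- Greedy selection of heavy lacunary trees on the side `σ`. -/
lemma greedy_select (b : ℝ × ℝ) (a : Tile → ℝ) (Θ : Finset Top) (σ lam : ℝ) :
    ∀ (n : ℕ) (D : Finset Tile), D.card = n → ∃ (E Q : Finset Tile) (τ : Tile → Top),
      E ⊆ D ∧ Q ⊆ D ∧ (∀ P ∈ E, Lac b σ (τ P) P) ∧
      (∀ P ∈ E, ∀ P' ∈ E, σ * (τ P').2 < σ * (τ P).2 → ¬ InTree (τ P) P') ∧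
      (∀ P ∈ E, τ P ∈ Θ ∧ lam ^ 2 * len (τ P).1 < lacSum b a D σ (τ P)) ∧
      (∀ P ∈ D, P ∉ Q → ∃ P' ∈ E, InTree (τ P') P) ∧
      (∀ t ∈ Θ, lacSum b a Q σ t ≤ lam ^ 2 * len t.1) ∧
      (open Classical in
        lam ^ 2 * ∑ t ∈ E.image τ, len t.1 ≤ ∑ P ∈ E, len P.1 * a P ^ 2) := by
  classical
  intro n
  induction n using Nat.strong_induction_on with
  | _ n ih =>
    intro D hn
    set Hv := Θ.filter fun t => lam ^ 2 * len t.1 < lacSum b a D σ t with hHv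
    rcases Hv.eq_empty_or_nonempty with h0 | hne
    · refine ⟨∅, D, fun _ => ((0, 0), 0), by simp, subset_rfl, by simp, by simp, by simp,
        fun P hP h => absurd hP h, fun t ht => ?_, by simp⟩
      by_contra hlt
      push Not at hlt
      have : t ∈ Hv := Finset.mem_filter.2 ⟨ht, hlt⟩
      rw [h0] at this; simp at this
    · obtain ⟨t, ht, hmax⟩ := Finset.exists_max_image Hv (fun t => σ * t.2) hne
      obtain ⟨htΘ, hth⟩ := Finset.mem_filter.1 ht
      set D' := D.filter fun P => ¬ InTree t P with hD'
      have hsub : D' ⊆ D := Finset.filter_subset _ _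
      have hcard : D'.card < n := by
        rw [← hn]
        refine Finset.card_lt_card ((Finset.ssubset_iff_of_subset hsub).2 ?_)
        have h1 : 0 < lacSum b a D σ t :=
          lt_of_le_of_lt (by have := len_pos t.1; positivity) hth
        obtain ⟨P, hP, -⟩ := Finset.exists_ne_zero_of_sum_ne_zero h1.ne'
        obtain ⟨hPD, hl⟩ := Finset.mem_filter.1 hP
        exact ⟨P, hPD, fun h => (Finset.mem_filter.1 h).2 hl.1⟩
      obtain ⟨E, Q, τ, hE, hQ, hlac, hsel, hhv, hrem, hlight, hsum⟩ := ih _ hcard D' rfl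
      set N := D.filter (Lac b σ t) with hN
      have hEt : ∀ P ∈ E, ¬ InTree t P := fun P hP => (Finset.mem_filter.1 (hE hP)).2
      have hEl : ∀ P ∈ E, ¬ Lac b σ t P := fun P hP h => hEt P hP h.1
      have hNE : Disjoint N E := Finset.disjoint_left.2 fun P hP hP' =>
        hEl P hP' (Finset.mem_filter.1 hP).2
      set τ' : Tile → Top := fun P => if Lac b σ t P then t else τ P with hτ'
      have hτN : ∀ P ∈ N, τ' P = t := fun P hP => if_pos (Finset.mem_filter.1 hP).2
      have hτE : ∀ P ∈ E, τ' P = τ P := fun P hP => if_neg (hEl P hP)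
      have hhv' : ∀ P ∈ E, τ P ∈ Hv := fun P hP => Finset.mem_filter.2
        ⟨(hhv P hP).1, (hhv P hP).2.trans_le (lacSum_mono b a hsub σ _)⟩
      refine ⟨N ∪ E, Q, τ', Finset.union_subset (Finset.filter_subset _ _) (hE.trans hsub),
        hQ.trans hsub, ?_, ?_, ?_, ?_, hlight, ?_⟩
      · intro P hP
        rcases Finset.mem_union.1 hP with hP | hP
        · rw [hτN P hP]; exact (Finset.mem_filter.1 hP).2
        · rw [hτE P hP]; exact hlac P hP
      · intro P hP P' hP' hlt
        rcases Finset.mem_union.1 hP with hP | hP <;> rcases Finset.mem_union.1 hP' with hP' | hP'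
        · rw [hτN P hP, hτN P' hP'] at hlt; exact absurd hlt (lt_irrefl _)
        · rw [hτN P hP]; exact hEt P' hP'
        · rw [hτE P hP, hτN P' hP'] at hlt
          exact absurd hlt (not_lt.2 (hmax _ (hhv' P hP)))
        · rw [hτE P hP, hτE P' hP'] at hlt
          rw [hτE P hP]; exact hsel P hP P' hP' hlt
      · intro P hP
        rcases Finset.mem_union.1 hP with hP | hP
        · rw [hτN P hP]; exact ⟨htΘ, hth⟩
        · rw [hτE P hP]; exact ⟨(hhv P hP).1, (Finset.mem_filter.1 (hhv' P hP)).2⟩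
      · intro P hP hPQ
        by_cases hPt : InTree t P
        · have h1 : 0 < lacSum b a D σ t :=
            lt_of_le_of_lt (by have := len_pos t.1; positivity) hth
          obtain ⟨P', hP', -⟩ := Finset.exists_ne_zero_of_sum_ne_zero h1.ne'
          have hP'N : P' ∈ N := hP'
          exact ⟨P', Finset.mem_union_left _ hP'N, by rw [hτN P' hP'N]; exact hPt⟩
        · obtain ⟨P', hP', h2⟩ := hrem P (Finset.mem_filter.2 ⟨hP, hPt⟩) hPQ
          exact ⟨P', Finset.mem_union_right _ hP', by rw [hτE P' hP']; exact h2⟩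
      · rw [Finset.sum_union hNE, Finset.image_union]
        have h1 : ∑ s ∈ N.image τ' ∪ E.image τ', len s.1 ≤ len t.1 + ∑ s ∈ E.image τ, len s.1 := by
          have h2 : E.image τ' = E.image τ := Finset.image_congr fun P hP => hτE P hP
          have h3 : N.image τ' ⊆ {t} := by
            intro s hs
            obtain ⟨P, hP, rfl⟩ := Finset.mem_image.1 hs
            rw [hτN P hP]; simp
          calc _ ≤ ∑ s ∈ insert t (E.image τ), len s.1 := by
                refine Finset.sum_le_sum_of_subset_of_nonneg ?_ fun s _ _ => (len_pos s.1).le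
                rw [h2, Finset.insert_eq]
                exact Finset.union_subset_union_left h3
            _ ≤ _ := by
                by_cases hm : t ∈ E.image τ
                · rw [Finset.insert_eq_of_mem hm]; linarith [len_pos t.1]
                · rw [Finset.sum_insert hm]
        have h4 : lam ^ 2 * len t.1 ≤ ∑ P ∈ N, len P.1 * a P ^ 2 := hth.le
        nlinarith [mul_le_mul_of_nonneg_left h1 (sq_nonneg lam)]

/-- At every level `λ`, collections of size at most `2λ` can be reduced to collections of size
at most `λ` by removing trees, with the total length of the tops controlled by the energy `En`. -/
def Selects (b : ℝ × ℝ) (a : Tile → ℝ) (Θ : Finset Top) (D : Finset Tile) (En : ℝ) : Prop :=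
  ∀ lam : ℝ, 0 < lam → ∀ D' ⊆ D, SizeLe b a Θ D' (2 * lam) →
    ∃ (T : Finset Top) (Q : Finset Tile), T ⊆ Θ ∧ Q ⊆ D' ∧ lam ^ 2 * ∑ t ∈ T, len t.1 ≤ En ∧
      SizeLe b a Θ Q lam ∧ ∀ P ∈ D', P ∉ Q → ∃ t ∈ T, InTree t P

lemma selects_of_gram {𝓗 : Type*} [NormedAddCommGroup 𝓗] [InnerProductSpace ℂ 𝓗]
    {b : ℝ × ℝ} (hb1 : -18 ≤ b.1) (hb2 : b.2 ≤ 18) {a : Tile → ℝ} {Θ : Finset Top}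
    {D : Finset Tile} (hD : Sparse D) (hΘ : Singles b Θ D) {e : Tile → 𝓗} (f : 𝓗) {K : ℝ}
    (hK : 0 ≤ K)
    (hG : ∀ P ∈ D, ∀ P' ∈ D, P'.1.1 ≤ P.1.1 →
      ‖inner ℂ (e P) (e P')‖ ≤ K * (len P.1)⁻¹ * (wt P.1 (lft P'.1) ^ 4)⁻¹)
    (hG0 : ∀ P ∈ D, ∀ P' ∈ D, Disjoint (band b P) (band b P') → inner ℂ (e P) (e P') = 0)
    (ha : ∀ P ∈ D, ‖inner ℂ (e P) f‖ = a P) :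
    Selects b a Θ D (2 * K * energyConst * ‖f‖ ^ 2) := by
  classical
  intro lam hlam D' hD' hsz
  have step : ∀ σ : ℝ, σ = 1 ∨ σ = -1 → ∀ D₁ ⊆ D', ∃ (T : Finset Top) (Q : Finset Tile), T ⊆ Θ ∧
      Q ⊆ D₁ ∧
      lam ^ 2 * ∑ t ∈ T, len t.1 ≤ K * energyConst * ‖f‖ ^ 2 ∧
      (∀ t ∈ Θ, lacSum b a Q σ t ≤ lam ^ 2 * len t.1) ∧
      ∀ P ∈ D₁, P ∉ Q → ∃ t ∈ T, InTree t P := by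
    intro σ hσ D₁ hD₁
    obtain ⟨E, Q, τ, hE, hQ, hlac, hsel, hhv, hrem, hlight, hsum⟩ :=
      greedy_select b a Θ σ lam _ D₁ rfl
    have hED : E ⊆ D := (hE.trans hD₁).trans hD'
    have hsum' : lam ^ 2 * ∑ t ∈ E.image τ, len t.1
        ≤ ∑ P ∈ E, len P.1 * ‖inner ℂ (e P) f‖ ^ 2 := by
      exact hsum.trans (le_of_eq (Finset.sum_congr rfl fun P hP => by rw [ha P (hED hP)]))
    refine ⟨E.image τ, Q, fun t ht => ?_, hQ, ?_, hlight, ?_⟩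
    · obtain ⟨P, hP, rfl⟩ := Finset.mem_image.1 ht
      exact (hhv P hP).1
    · refine hsum'.trans ?_
      refine energy_bessel hb1 hb2 hσ (hD.mono hED) hlac hsel f hK hlam.le
        (fun P hP P' hP' => hG P (hED hP) P' (hED hP'))
        (fun P hP P' hP' => hG0 P (hED hP) P' (hED hP')) (fun P hP => ?_) hsum'
      rw [ha P (hED hP)]
      exact hsz.le (fun P hP => hΘ P (hD' hP)) (by positivity) (hD₁ (hE hP))
    · intro P hP hPQ
      obtain ⟨P', hP', h⟩ := hrem P hP hPQ
      exact ⟨τ P', Finset.mem_image_of_mem _ hP', h⟩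
  obtain ⟨T₁, Q₁, hΘ₁, hQ₁, hT₁, hl₁, hr₁⟩ := step 1 (Or.inl rfl) D' subset_rfl
  obtain ⟨T₂, Q₂, hΘ₂, hQ₂, hT₂, hl₂, hr₂⟩ := step (-1) (Or.inr rfl) Q₁ hQ₁
  refine ⟨T₁ ∪ T₂, Q₂, Finset.union_subset hΘ₁ hΘ₂, hQ₂.trans hQ₁, ?_, ?_, ?_⟩
  · have h1 : ∑ t ∈ T₁ ∪ T₂, len t.1 ≤ ∑ t ∈ T₁, len t.1 + ∑ t ∈ T₂, len t.1 := by
      have := Finset.sum_union_inter (s₁ := T₁) (s₂ := T₂) (f := fun t : Top => len t.1)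
      have h2 : 0 ≤ ∑ t ∈ T₁ ∩ T₂, len t.1 := Finset.sum_nonneg fun t _ => (len_pos t.1).le
      linarith
    nlinarith [mul_le_mul_of_nonneg_left h1 (sq_nonneg lam)]
  · rintro t ht σ (rfl | rfl)
    · exact (lacSum_mono b a hQ₂ 1 t).trans (hl₁ t ht)
    · exact hl₂ t ht
  · intro P hP hPQ
    by_cases h : P ∈ Q₁
    · obtain ⟨t, ht, h'⟩ := hr₂ P h hPQ
      exact ⟨t, Finset.mem_union_right _ ht, h'⟩
    · obtain ⟨t, ht, h'⟩ := hr₁ P hP h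
      exact ⟨t, Finset.mem_union_left _ ht, h'⟩

/-- The frequency bands of the three families of wave packets. -/
noncomputable def bd : Fin 3 → ℝ × ℝ := ![(-17, -6), (7, 18), (-2, 3)]

lemma bd_fst (j : Fin 3) : -18 ≤ (bd j).1 := by fin_cases j <;> norm_num [bd]

lemma bd_snd (j : Fin 3) : (bd j).2 ≤ 18 := by fin_cases j <;> norm_num [bd]

lemma lac_of_le {b : ℝ × ℝ} {t : Top} {P : Tile} (h : InTree t P)
    (h1 : t.2 * len P.1 - P.2 ≤ b.1 - 1) : Lac b 1 t P := by
  refine ⟨h, fun z hz => ?_⟩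
  simp only [band, mem_ofPred_eq, mem_Icc] at hz
  linarith

lemma lac_of_ge {b : ℝ × ℝ} {t : Top} {P : Tile} (h : InTree t P)
    (h1 : b.2 + 1 ≤ t.2 * len P.1 - P.2) : Lac b (-1) t P := by
  refine ⟨h, fun z hz => ?_⟩
  simp only [band, mem_ofPred_eq, mem_Icc] at hz
  linarith

/-- `P` is lacunary in the tree of `t`, on some side. -/
def LacAny (b : ℝ × ℝ) (t : Top) (P : Tile) : Prop := Lac b 1 t P ∨ Lac b (-1) t P

lemma lacAny_two {t : Top} {P : Tile} (h : InTree t P) :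
    (LacAny (bd 0) t P ∧ LacAny (bd 1) t P) ∨ (LacAny (bd 0) t P ∧ LacAny (bd 2) t P) ∨
      (LacAny (bd 1) t P ∧ LacAny (bd 2) t P) := by
  set y := t.2 * len P.1 - P.2 with hy
  have key : ∀ j, y ≤ (bd j).1 - 1 ∨ (bd j).2 + 1 ≤ y → LacAny (bd j) t P := fun j hj =>
    hj.imp (lac_of_le h) (lac_of_ge h)
  have k0 := key 0
  have k1 := key 1
  have k2 := key 2
  simp only [bd, Matrix.cons_val_zero, Matrix.cons_val_one, Matrix.cons_val] at k0 k1 k2 ⊢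
  rcases le_or_gt y (-9 / 2) with h1 | h1
  · exact Or.inr (Or.inr ⟨k1 (Or.inl (by linarith)), k2 (Or.inl (by linarith))⟩)
  rcases le_or_gt y 5 with h2 | h2
  · exact Or.inl ⟨k0 (Or.inr (by linarith)), k1 (Or.inl (by linarith))⟩
  · exact Or.inr (Or.inl ⟨k0 (Or.inr (by linarith)), k2 (Or.inr (by linarith))⟩)

lemma lacAny_sum_le {b : ℝ × ℝ} {a : Tile → ℝ} {Θ : Finset Top} {D : Finset Tile} {S : ℝ}
    (h : SizeLe b a Θ D S) {t : Top} (ht : t ∈ Θ) :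
    open Classical in
    ∑ P ∈ D with LacAny b t P, len P.1 * a P ^ 2 ≤ 2 * S ^ 2 * len t.1 := by
  classical
  have h1 := h t ht 1 (Or.inl rfl)
  have h2 := h t ht (-1) (Or.inr rfl)
  unfold lacSum at h1 h2
  have h3 : D.filter (LacAny b t) = D.filter (Lac b 1 t) ∪ D.filter (Lac b (-1) t) := by
    ext P; simp [LacAny, and_or_left]
  rw [h3]
  have h4 := Finset.sum_union_inter (s₁ := D.filter (Lac b 1 t)) (s₂ := D.filter (Lac b (-1) t))
    (f := fun P : Tile => len P.1 * a P ^ 2)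
  have h5 : 0 ≤ ∑ P ∈ D.filter (Lac b 1 t) ∩ D.filter (Lac b (-1) t), len P.1 * a P ^ 2 :=
    Finset.sum_nonneg fun P _ => by have := len_pos P.1; positivity
  linarith

lemma tree_pair_le {b b' : ℝ × ℝ} {a a' : Tile → ℝ} {Θ : Finset Top} {D : Finset Tile} {S S' : ℝ}
    (hS : 0 < S) (hS' : 0 < S') (h : SizeLe b a Θ D S) (h' : SizeLe b' a' Θ D S') {t : Top}
    (ht : t ∈ Θ) :
    open Classical in
    ∑ P ∈ D with LacAny b t P ∧ LacAny b' t P, len P.1 * (a P * a' P) ≤ 2 * (S * S') * len t.1 := by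
  classical
  have h1 := lacAny_sum_le h ht
  have h2 := lacAny_sum_le h' ht
  have e1 : ∑ P ∈ D with LacAny b t P ∧ LacAny b' t P, len P.1 * a P ^ 2
      ≤ ∑ P ∈ D with LacAny b t P, len P.1 * a P ^ 2 :=
    Finset.sum_le_sum_of_subset_of_nonneg
      (Finset.monotone_filter_right _ fun P _ hP => hP.1)
      fun P _ _ => by have := len_pos P.1; positivity
  have e2 : ∑ P ∈ D with LacAny b t P ∧ LacAny b' t P, len P.1 * a' P ^ 2
      ≤ ∑ P ∈ D with LacAny b' t P, len P.1 * a' P ^ 2 :=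
    Finset.sum_le_sum_of_subset_of_nonneg
      (Finset.monotone_filter_right _ fun P _ hP => hP.2)
      fun P _ _ => by have := len_pos P.1; positivity
  have hSS : 0 < S * S' := mul_pos hS hS'
  refine le_of_mul_le_mul_left ?_ hSS
  calc S * S' * ∑ P ∈ D with LacAny b t P ∧ LacAny b' t P, len P.1 * (a P * a' P)
      ≤ ∑ P ∈ D with LacAny b t P ∧ LacAny b' t P,
        (S' ^ 2 / 2 * (len P.1 * a P ^ 2) + S ^ 2 / 2 * (len P.1 * a' P ^ 2)) := by
        rw [Finset.mul_sum]
        refine Finset.sum_le_sum fun P _ => ?_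
        nlinarith [mul_nonneg (len_pos P.1).le (sq_nonneg (S' * a P - S * a' P))]
    _ = S' ^ 2 / 2 * ∑ P ∈ D with LacAny b t P ∧ LacAny b' t P, len P.1 * a P ^ 2
        + S ^ 2 / 2 * ∑ P ∈ D with LacAny b t P ∧ LacAny b' t P, len P.1 * a' P ^ 2 := by
        rw [Finset.sum_add_distrib, Finset.mul_sum, Finset.mul_sum]
    _ ≤ S' ^ 2 / 2 * (2 * S ^ 2 * len t.1) + S ^ 2 / 2 * (2 * S' ^ 2 * len t.1) := by
        gcongr
        · exact e1.trans h1
        · exact e2.trans h2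
    _ = _ := by ring

/-- The trilinear form restricted to a tree is controlled by the sizes. -/
lemma tree_estimate {a : Fin 3 → Tile → ℝ} (ha : ∀ j P, 0 ≤ a j P) {Θ : Finset Top}
    {D : Finset Tile} (h1 : ∀ j, Singles (bd j) Θ D) {S : Fin 3 → ℝ} (hS : ∀ j, 0 < S j)
    (h : ∀ j, SizeLe (bd j) (a j) Θ D (S j)) {t : Top} (ht : t ∈ Θ) :
    open Classical in
    ∑ P ∈ D with InTree t P, len P.1 * ∏ j, a j P ≤ 6 * (∏ j, S j) * len t.1 := by
  classical
  have hle : ∀ j, ∀ P ∈ D, a j P ≤ S j := fun j P hP => (h j).le (h1 j) (hS j).le hP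
  set g : Fin 3 → Fin 3 → Tile → ℝ := fun i j P =>
    if LacAny (bd i) t P ∧ LacAny (bd j) t P then len P.1 * (a i P * a j P) else 0 with hg
  have hg0 : ∀ i j P, 0 ≤ g i j P := by
    intro i j P
    have := len_pos P.1; have := ha i P; have := ha j P
    simp only [hg]; split_ifs <;> positivity
  have hgs : ∀ i j, ∑ P ∈ D, g i j P ≤ 2 * (S i * S j) * len t.1 := by
    intro i j
    have := tree_pair_le (hS i) (hS j) (h i) (h j) ht
    rwa [Finset.sum_filter] at this
  have key : ∀ P ∈ D.filter (InTree t), len P.1 * ∏ j, a j P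
      ≤ S 2 * g 0 1 P + S 1 * g 0 2 P + S 0 * g 1 2 P := by
    intro P hP
    obtain ⟨hPD, hPt⟩ := Finset.mem_filter.1 hP
    have h0 := hle 0 P hPD; have h1 := hle 1 P hPD; have h2 := hle 2 P hPD
    have hn := fun i j => mul_nonneg (len_pos P.1).le (mul_nonneg (ha i P) (ha j P))
    have p0 := mul_nonneg (hS 0).le (hg0 1 2 P)
    have p1 := mul_nonneg (hS 1).le (hg0 0 2 P)
    have p2 := mul_nonneg (hS 2).le (hg0 0 1 P)
    rw [Fin.prod_univ_three]
    rcases lacAny_two hPt with hc | hc | hc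
    · have e : g 0 1 P = len P.1 * (a 0 P * a 1 P) := if_pos hc
      have := mul_le_mul_of_nonneg_right h2 (hn 0 1)
      rw [e] at p2 ⊢
      linarith
    · have e : g 0 2 P = len P.1 * (a 0 P * a 2 P) := if_pos hc
      have := mul_le_mul_of_nonneg_right h1 (hn 0 2)
      rw [e] at p1 ⊢
      linarith
    · have e : g 1 2 P = len P.1 * (a 1 P * a 2 P) := if_pos hc
      have := mul_le_mul_of_nonneg_right h0 (hn 1 2)
      rw [e] at p0 ⊢
      linarith
  calc ∑ P ∈ D with InTree t P, len P.1 * ∏ j, a j P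
      ≤ ∑ P ∈ D with InTree t P, (S 2 * g 0 1 P + S 1 * g 0 2 P + S 0 * g 1 2 P) :=
        Finset.sum_le_sum key
    _ ≤ ∑ P ∈ D, (S 2 * g 0 1 P + S 1 * g 0 2 P + S 0 * g 1 2 P) := by
        refine Finset.sum_le_sum_of_subset_of_nonneg (Finset.filter_subset _ _) fun P _ _ => ?_
        have := hg0 0 1 P; have := hg0 0 2 P; have := hg0 1 2 P
        have := hS 0; have := hS 1; have := hS 2
        positivity
    _ = S 2 * ∑ P ∈ D, g 0 1 P + S 1 * ∑ P ∈ D, g 0 2 P + S 0 * ∑ P ∈ D, g 1 2 P := by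
        simp_rw [Finset.sum_add_distrib, Finset.mul_sum]
    _ ≤ S 2 * (2 * (S 0 * S 1) * len t.1) + S 1 * (2 * (S 0 * S 2) * len t.1)
        + S 0 * (2 * (S 1 * S 2) * len t.1) := by
        have := hS 0; have := hS 1; have := hS 2
        gcongr <;> exact hgs _ _
    _ = _ := by rw [Fin.prod_univ_three]; ring

/-- One step of the iterative decomposition into trees. -/
lemma core_step {a : Fin 3 → Tile → ℝ} (ha : ∀ j P, 0 ≤ a j P) {Θ : Finset Top}
    {D : Finset Tile} (h1 : ∀ j, Singles (bd j) Θ D) {S E : Fin 3 → ℝ} (hS : ∀ j, 0 < S j)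
    (hE : ∀ j, 0 < E j) (hsel : ∀ j, Selects (bd j) (a j) Θ D (E j ^ 2)) {u : ℝ} (hu : 0 < u)
    {D' : Finset Tile} (hD' : D' ⊆ D) (h : ∀ j, SizeLe (bd j) (a j) Θ D' (S j))
    (h2 : ∀ j, SizeLe (bd j) (a j) Θ D' (E j * u⁻¹)) :
    ∃ Q ⊆ D', (∀ j, SizeLe (bd j) (a j) Θ Q (E j * (2 * u)⁻¹)) ∧
      ∑ P ∈ D', len P.1 * ∏ j, a j P ≤ ∑ P ∈ Q, len P.1 * ∏ j, a j P
        + 72 * (u ^ 2 * ∏ j, min (S j) (E j * u⁻¹)) := by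
  classical
  have hstep : ∀ j, ∃ (T : Finset Top) (Q : Finset Tile), T ⊆ Θ ∧ Q ⊆ D' ∧
      (E j * (2 * u)⁻¹) ^ 2 * ∑ t ∈ T, len t.1 ≤ E j ^ 2 ∧
      SizeLe (bd j) (a j) Θ Q (E j * (2 * u)⁻¹) ∧ ∀ P ∈ D', P ∉ Q → ∃ t ∈ T, InTree t P := by
    intro j
    have := hE j
    refine hsel j _ (by positivity) D' hD' ?_
    have e : 2 * (E j * (2 * u)⁻¹) = E j * u⁻¹ := by field_simp
    rw [e]; exact h2 j
  choose T Q hT hQ hlen hsz hcov using hstep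
  have hm : ∀ j, SizeLe (bd j) (a j) Θ D' (min (S j) (E j * u⁻¹)) := by
    intro j
    rcases min_choice (S j) (E j * u⁻¹) with hh | hh <;> rw [hh]
    exacts [h j, h2 j]
  have hmpos : ∀ j, 0 < min (S j) (E j * u⁻¹) := fun j =>
    lt_min (hS j) (mul_pos (hE j) (inv_pos.2 hu))
  have hterm : ∀ P : Tile, 0 ≤ len P.1 * ∏ j, a j P := fun P =>
    mul_nonneg (len_pos P.1).le (Finset.prod_nonneg fun j _ => ha j P)
  refine ⟨D'.filter fun P => ∀ j, P ∈ Q j, Finset.filter_subset _ _, fun j => ?_, ?_⟩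
  · exact (hsz j).mono fun P hP => (Finset.mem_filter.1 hP).2 j
  have hlen' : ∀ j, ∑ t ∈ T j, len t.1 ≤ 4 * u ^ 2 := by
    intro j
    have e := hlen j
    have hEj := hE j
    have e2 : (E j * (2 * u)⁻¹) ^ 2 = E j ^ 2 * (4 * u ^ 2)⁻¹ := by
      rw [mul_pow, inv_pow]; ring
    rw [e2, mul_assoc] at e
    have e3 : (4 * u ^ 2)⁻¹ * ∑ t ∈ T j, len t.1 ≤ 1 := by
      have : 0 < E j ^ 2 := by positivity
      nlinarith
    rwa [inv_mul_le_iff₀ (by positivity), mul_one] at e3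
  rw [← Finset.sum_filter_add_sum_filter_not D' (fun P => ∀ j, P ∈ Q j)]
  refine add_le_add le_rfl ?_
  calc ∑ P ∈ D' with ¬ ∀ j, P ∈ Q j, len P.1 * ∏ j, a j P
      ≤ ∑ P ∈ D', ∑ j, ∑ t ∈ T j, if InTree t P then len P.1 * ∏ j, a j P else 0 := by
        rw [Finset.sum_filter]
        refine Finset.sum_le_sum fun P hP => ?_
        have hnn : ∀ j, ∀ t ∈ T j, 0 ≤ if InTree t P then len P.1 * ∏ j, a j P else 0 := by
          intro j t _
          split_ifs
          exacts [hterm P, le_rfl]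
        split_ifs with hc
        · exact Finset.sum_nonneg fun j _ => Finset.sum_nonneg (hnn j)
        · obtain ⟨j, hj⟩ := not_forall.1 hc
          obtain ⟨t, ht, hPt⟩ := hcov j P hP hj
          calc len P.1 * ∏ j, a j P = if InTree t P then len P.1 * ∏ j, a j P else 0 :=
                (if_pos hPt).symm
            _ ≤ ∑ t ∈ T j, if InTree t P then len P.1 * ∏ j, a j P else 0 :=
                Finset.single_le_sum (hnn j) ht
            _ ≤ _ := Finset.single_le_sum
                (f := fun j => ∑ t ∈ T j, if InTree t P then len P.1 * ∏ j, a j P else 0)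
                (fun j _ => Finset.sum_nonneg (hnn j)) (Finset.mem_univ j)
    _ = ∑ j, ∑ t ∈ T j, ∑ P ∈ D' with InTree t P, len P.1 * ∏ j, a j P := by
        rw [Finset.sum_comm]
        refine Finset.sum_congr rfl fun j _ => ?_
        rw [Finset.sum_comm]
        exact Finset.sum_congr rfl fun t _ => (Finset.sum_filter _ _).symm
    _ ≤ ∑ j : Fin 3, ∑ t ∈ T j, 6 * (∏ j, min (S j) (E j * u⁻¹)) * len t.1 :=
        Finset.sum_le_sum fun j _ => Finset.sum_le_sum fun t ht =>
          tree_estimate ha (fun j P hP => h1 j P (hD' hP)) hmpos hm (hT j ht)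
    _ ≤ ∑ j : Fin 3, 6 * (∏ j, min (S j) (E j * u⁻¹)) * (4 * u ^ 2) := by
        refine Finset.sum_le_sum fun j _ => ?_
        rw [← Finset.mul_sum]
        refine mul_le_mul_of_nonneg_left (hlen' j) ?_
        exact mul_nonneg (by norm_num) (Finset.prod_nonneg fun j _ => (hmpos j).le)
    _ = _ := by rw [Finset.sum_const]; simp; ring

lemma min_le_rpow_mul {x y α : ℝ} (hx : 0 < x) (hy : 0 < y) (h0 : 0 ≤ α) (h1 : α ≤ 1) :
    min x y ≤ x ^ α * y ^ (1 - α) := by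
  have hm : 0 < min x y := lt_min hx hy
  calc min x y = min x y ^ α * min x y ^ (1 - α) := by
        rw [← rpow_add hm]; simp
    _ ≤ _ := by
        exact mul_le_mul (rpow_le_rpow hm.le (min_le_left _ _) h0)
          (rpow_le_rpow hm.le (min_le_right _ _) (by linarith)) (by positivity) (by positivity)

/-- A single term of the iteration. -/
lemma core_term {S E θ : Fin 3 → ℝ} (hS : ∀ j, 0 < S j) (hE : ∀ j, 0 < E j)
    (hθ : ∑ j, θ j = 1) {δ : ℝ} (h0 : ∀ j, 0 ≤ θ j + δ) (h1 : ∀ j, θ j + δ ≤ 1) {u : ℝ}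
    (hu : 0 < u) : u ^ 2 * ∏ j, min (S j) (E j * u⁻¹)
      ≤ (∏ j, S j ^ θ j * E j ^ (1 - θ j)) * ((∏ j, S j / E j) * u ^ 3) ^ δ := by
  have hle : ∏ j, min (S j) (E j * u⁻¹)
      ≤ ∏ j, S j ^ (θ j + δ) * (E j * u⁻¹) ^ (1 - (θ j + δ)) := by
    refine Finset.prod_le_prod (fun j _ => ?_) fun j _ => ?_
    · exact (lt_min (hS j) (mul_pos (hE j) (inv_pos.2 hu))).le
    · exact min_le_rpow_mul (hS j) (mul_pos (hE j) (inv_pos.2 hu)) (h0 j) (h1 j)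
  refine (mul_le_mul_of_nonneg_left hle (by positivity)).trans (le_of_eq ?_)
  have hs : ∀ j, S j = exp (log (S j)) := fun j => (exp_log (hS j)).symm
  have he : ∀ j, E j = exp (log (E j)) := fun j => (exp_log (hE j)).symm
  have hv : u = exp (log u) := (exp_log hu).symm
  simp only [Fin.sum_univ_three] at hθ
  simp only [Fin.prod_univ_three]
  rw [hs 0, hs 1, hs 2, he 0, he 1, he 2, hv]
  simp only [← exp_neg, ← exp_add, ← exp_mul, ← exp_sub, ← exp_nat_mul]
  congr 1
  have : θ 2 = 1 - θ 0 - θ 1 := by linarith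
  rw [this]; push_cast; ring

lemma sum_rpow_natAbs_le {ρ : ℝ} (h0 : 0 ≤ ρ) (h1 : ρ < 1) (s : Finset ℤ) :
    ∑ n ∈ s, ρ ^ n.natAbs ≤ 2 * (1 - ρ)⁻¹ := by
  have hs : Summable fun n : ℕ => ρ ^ n := summable_geometric_of_lt_one h0 h1
  have e : ∑ n ∈ s, ρ ^ n.natAbs ≤ ∑ n ∈ s with 0 ≤ n, ρ ^ n.natAbs
      + ∑ n ∈ s with n ≤ 0, ρ ^ n.natAbs := by
    rw [Finset.sum_filter, Finset.sum_filter, ← Finset.sum_add_distrib]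
    refine Finset.sum_le_sum fun n _ => ?_
    have : 0 ≤ ρ ^ n.natAbs := by positivity
    rcases le_total 0 n with h | h
    · rw [if_pos h]; split_ifs <;> linarith
    · rw [if_pos h]; split_ifs <;> linarith
  have key : ∀ s' : Finset ℤ, Set.InjOn Int.natAbs (s' : Set ℤ) →
      ∑ n ∈ s', ρ ^ n.natAbs ≤ (1 - ρ)⁻¹ := by
    intro s' hinj
    rw [← Finset.sum_image (f := fun n : ℕ => ρ ^ n) hinj, ← tsum_geometric_of_lt_one h0 h1]
    exact hs.sum_le_tsum _ fun n _ => by positivity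
  have e1 := key (s.filter fun n => 0 ≤ n) (by
    intro x hx y hy hxy
    have := (Finset.mem_filter.1 (Finset.mem_coe.1 hx)).2
    have := (Finset.mem_filter.1 (Finset.mem_coe.1 hy)).2
    omega)
  have e2 := key (s.filter fun n => n ≤ 0) (by
    intro x hx y hy hxy
    have := (Finset.mem_filter.1 (Finset.mem_coe.1 hx)).2
    have := (Finset.mem_filter.1 (Finset.mem_coe.1 hy)).2
    omega)
  linarith

/-- The constant in the iteration. -/
noncomputable def coreConst (ε : ℝ) : ℝ := 72 * ((8 : ℝ) ^ ε * (2 * (1 - (8 : ℝ) ^ (-ε))⁻¹))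

lemma core_sum {S E θ : Fin 3 → ℝ} (hS : ∀ j, 0 < S j) (hE : ∀ j, 0 < E j)
    (hθ : ∑ j, θ j = 1) {ε : ℝ} (hε : 0 < ε) (h0 : ∀ j, ε ≤ θ j) (h1 : ∀ j, θ j + ε ≤ 1)
    (s : Finset ℤ) :
    ∑ n ∈ s, 72 * (((2 : ℝ) ^ n) ^ 2 * ∏ j, min (S j) (E j * ((2 : ℝ) ^ n)⁻¹))
      ≤ coreConst ε * ∏ j, S j ^ θ j * E j ^ (1 - θ j) := by
  set Y := ∏ j, S j / E j with hY
  set R := ∏ j, S j ^ θ j * E j ^ (1 - θ j) with hR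
  have hYpos : 0 < Y := Finset.prod_pos fun j _ => div_pos (hS j) (hE j)
  have hRpos : 0 ≤ R := Finset.prod_nonneg fun j _ =>
    mul_nonneg (rpow_nonneg (hS j).le _) (rpow_nonneg (hE j).le _)
  obtain ⟨m, hm1, hm2⟩ := exists_mem_Ico_zpow hYpos (by norm_num : (1 : ℝ) < 8)
  have h8 : ∀ n : ℤ, ((2 : ℝ) ^ n) ^ 3 = 8 ^ n := by
    intro n
    rw [← zpow_natCast, ← zpow_mul, mul_comm, zpow_mul]; norm_num
  have hterm : ∀ n : ℤ, ((2 : ℝ) ^ n) ^ 2 * ∏ j, min (S j) (E j * ((2 : ℝ) ^ n)⁻¹)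
      ≤ R * (8 ^ ε * ((8 : ℝ) ^ (-ε)) ^ (n + m).natAbs) := by
    intro n
    have hu : (0 : ℝ) < 2 ^ n := by positivity
    have hlo : (8 : ℝ) ^ (n + m) ≤ Y * 8 ^ n := by
      rw [zpow_add₀ (by norm_num), mul_comm]; gcongr
    have hhi : Y * 8 ^ n ≤ 8 * (8 : ℝ) ^ (n + m) := by
      have : (8 : ℝ) ^ (m + 1) = 8 * 8 ^ m := by rw [zpow_add₀ (by norm_num)]; simp; ring
      rw [this] at hm2
      rw [zpow_add₀ (by norm_num), mul_comm ((8 : ℝ) ^ n), ← mul_assoc]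
      gcongr
    have h8pos : (0 : ℝ) < 8 ^ (n + m) := by positivity
    have hYn : 0 < Y * (8 : ℝ) ^ n := by positivity
    rcases le_total 0 (n + m) with hs | hs
    · have e := core_term hS hE hθ (δ := -ε) (fun j => by linarith [h0 j])
        (fun j => by linarith [h0 j, h1 j]) hu
      rw [h8] at e
      refine e.trans (mul_le_mul_of_nonneg_left ?_ hRpos)
      calc (Y * (8 : ℝ) ^ n) ^ (-ε) ≤ ((8 : ℝ) ^ (n + m)) ^ (-ε) :=
            rpow_le_rpow_of_nonpos h8pos hlo (by linarith)
        _ = ((8 : ℝ) ^ (-ε)) ^ (n + m).natAbs := by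
            have e2 : (n + m) = (((n + m).natAbs : ℕ) : ℤ) := by omega
            conv_lhs => rw [e2, zpow_natCast]
            rw [← rpow_natCast, ← rpow_natCast, ← rpow_mul (by norm_num), ← rpow_mul (by norm_num),
              mul_comm]
        _ ≤ _ := by
            refine le_mul_of_one_le_left (by positivity) ?_
            exact one_le_rpow (by norm_num) hε.le
    · have e := core_term hS hE hθ (δ := ε) (fun j => by linarith [h0 j])
        (fun j => h1 j) hu
      rw [h8] at e
      refine e.trans (mul_le_mul_of_nonneg_left ?_ hRpos)
      calc (Y * (8 : ℝ) ^ n) ^ ε ≤ (8 * (8 : ℝ) ^ (n + m)) ^ ε :=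
            rpow_le_rpow hYn.le hhi hε.le
        _ = _ := by
            rw [mul_rpow (by norm_num) h8pos.le]
            congr 1
            have e2 : (n + m) = -(((n + m).natAbs : ℕ) : ℤ) := by omega
            conv_lhs => rw [e2, zpow_neg, zpow_natCast]
            rw [← rpow_natCast, ← rpow_natCast, ← rpow_neg (by norm_num), ← rpow_mul (by norm_num),
              ← rpow_mul (by norm_num)]
            congr 1; ring
  have hρ : (8 : ℝ) ^ (-ε) < 1 := rpow_lt_one_of_one_lt_of_neg (by norm_num) (by linarith)
  have hsum := sum_rpow_natAbs_le (by positivity) hρ (s.image fun n => n + m)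
  rw [Finset.sum_image fun x _ y _ h => by simpa using h] at hsum
  calc _ ≤ ∑ n ∈ s, 72 * (R * (8 ^ ε * ((8 : ℝ) ^ (-ε)) ^ (n + m).natAbs)) :=
        Finset.sum_le_sum fun n _ => by linarith [hterm n]
    _ = 72 * (R * (8 ^ ε * ∑ n ∈ s, ((8 : ℝ) ^ (-ε)) ^ (n + m).natAbs)) := by
        simp_rw [Finset.mul_sum]
    _ ≤ 72 * (R * (8 ^ ε * (2 * (1 - (8 : ℝ) ^ (-ε))⁻¹))) := by gcongr
    _ = _ := by unfold coreConst; ring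

/-- The trilinear form is bounded by a product of powers of sizes and energies. -/
lemma core_estimate {a : Fin 3 → Tile → ℝ} (ha : ∀ j P, 0 ≤ a j P) {Θ : Finset Top}
    {D : Finset Tile} (h1 : ∀ j, Singles (bd j) Θ D) {S E θ : Fin 3 → ℝ} (hS : ∀ j, 0 < S j)
    (hE : ∀ j, 0 < E j) (hsel : ∀ j, Selects (bd j) (a j) Θ D (E j ^ 2))
    (h : ∀ j, SizeLe (bd j) (a j) Θ D (S j)) (hθ : ∑ j, θ j = 1) {ε : ℝ} (hε : 0 < ε)
    (hθ0 : ∀ j, ε ≤ θ j) (hθ1 : ∀ j, θ j + ε ≤ 1) :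
    ∑ P ∈ D, len P.1 * ∏ j, a j P ≤ coreConst ε * ∏ j, S j ^ θ j * E j ^ (1 - θ j) := by
  classical
  obtain ⟨n₀, hn₀⟩ : ∃ n₀ : ℤ, ∀ j, S j ≤ E j * ((2 : ℝ) ^ n₀)⁻¹ := by
    obtain ⟨N, hN⟩ := pow_unbounded_of_one_lt (∑ j, S j / E j) (by norm_num : (1 : ℝ) < 2)
    refine ⟨-N, fun j => ?_⟩
    rw [zpow_neg, inv_inv, zpow_natCast]
    have e1 : S j / E j ≤ ∑ j, S j / E j := Finset.single_le_sum
      (f := fun j => S j / E j) (fun j _ => (div_pos (hS j) (hE j)).le) (Finset.mem_univ j)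
    have := (e1.trans hN.le)
    rwa [div_le_iff₀' (hE j)] at this
  have iter : ∀ N : ℕ, ∃ Q ⊆ D, (∀ j, SizeLe (bd j) (a j) Θ Q (E j * ((2 : ℝ) ^ (n₀ + N))⁻¹)) ∧
      ∑ P ∈ D, len P.1 * ∏ j, a j P ≤ ∑ P ∈ Q, len P.1 * ∏ j, a j P
        + ∑ n ∈ (Finset.range N).image (fun i : ℕ => n₀ + (i : ℤ)),
          72 * (((2 : ℝ) ^ n) ^ 2 * ∏ j, min (S j) (E j * ((2 : ℝ) ^ n)⁻¹)) := by
    intro N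
    induction N with
    | zero =>
      refine ⟨D, subset_rfl, fun j t ht σ hσ => (h j t ht σ hσ).trans ?_, by simp⟩
      have := len_pos t.1; have := hS j
      have e := hn₀ j
      gcongr
      simpa using e
    | succ N ih =>
      obtain ⟨Q, hQ, hsz, hle⟩ := ih
      obtain ⟨Q', hQ', hsz', hle'⟩ := core_step ha h1 hS hE hsel
        (u := (2 : ℝ) ^ (n₀ + (N : ℤ))) (by positivity) hQ (fun j => (h j).mono hQ) hsz
      refine ⟨Q', hQ'.trans hQ, fun j => ?_, ?_⟩
      · have e : (2 : ℝ) ^ (n₀ + ((N + 1 : ℕ) : ℤ)) = 2 * 2 ^ (n₀ + (N : ℤ)) := by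
          push_cast; rw [← add_assoc, zpow_add₀ (by norm_num) _ 1]; simp; ring
        rw [e]; exact hsz' j
      · rw [Finset.range_add_one, Finset.image_insert, Finset.sum_insert]
        · linarith
        · simp
  have hterm : ∀ P : Tile, 0 ≤ len P.1 * ∏ j, a j P := fun P =>
    mul_nonneg (len_pos P.1).le (Finset.prod_nonneg fun j _ => ha j P)
  have hbound : ∀ N : ℕ, ∑ P ∈ D, len P.1 * ∏ j, a j P
      ≤ (∑ P ∈ D, len P.1) * ∏ j, (E j * ((2 : ℝ) ^ (n₀ + (N : ℤ)))⁻¹)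
        + coreConst ε * ∏ j, S j ^ θ j * E j ^ (1 - θ j) := by
    intro N
    obtain ⟨Q, hQ, hsz, hle⟩ := iter N
    refine hle.trans (add_le_add ?_ (core_sum hS hE hθ hε hθ0 hθ1 _))
    have hpos : ∀ j, 0 ≤ E j * ((2 : ℝ) ^ (n₀ + (N : ℤ)))⁻¹ := fun j => by
      have := hE j; positivity
    calc ∑ P ∈ Q, len P.1 * ∏ j, a j P
        ≤ ∑ P ∈ Q, len P.1 * ∏ j, (E j * ((2 : ℝ) ^ (n₀ + (N : ℤ)))⁻¹) := by
          refine Finset.sum_le_sum fun P hP => ?_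
          refine mul_le_mul_of_nonneg_left ?_ (len_pos P.1).le
          exact Finset.prod_le_prod (fun j _ => ha j P) fun j _ =>
            (hsz j).le (fun P hP => h1 j P (hQ hP)) (hpos j) hP
      _ ≤ _ := by
          rw [← Finset.sum_mul]
          refine mul_le_mul_of_nonneg_right ?_ (Finset.prod_nonneg fun j _ => hpos j)
          exact Finset.sum_le_sum_of_subset_of_nonneg hQ fun P _ _ => (len_pos P.1).le
  have hlim : Filter.Tendsto (fun N : ℕ => (∑ P ∈ D, len P.1) *
      ∏ j, (E j * ((2 : ℝ) ^ (n₀ + (N : ℤ)))⁻¹)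
        + coreConst ε * ∏ j, S j ^ θ j * E j ^ (1 - θ j)) Filter.atTop
      (nhds ((∑ P ∈ D, len P.1) * ∏ j, (E j * 0) +
        coreConst ε * ∏ j, S j ^ θ j * E j ^ (1 - θ j))) := by
    refine Filter.Tendsto.add_const _ (Filter.Tendsto.const_mul _ ?_)
    refine tendsto_finsetProd _ fun j _ => Filter.Tendsto.const_mul _ ?_
    have : Filter.Tendsto (fun N : ℕ => ((2 : ℝ) ^ n₀)⁻¹ * (1 / 2) ^ N) Filter.atTop
        (nhds (((2 : ℝ) ^ n₀)⁻¹ * 0)) :=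
      (tendsto_pow_atTop_nhds_zero_of_lt_one (by norm_num) (by norm_num)).const_mul _
    rw [mul_zero] at this
    refine this.congr fun N => ?_
    rw [zpow_add₀ (by norm_num), mul_inv, zpow_natCast, one_div, inv_pow]
  have := ge_of_tendsto' hlim hbound
  simpa using this

lemma sum_len_scale_le (J : ℤ × ℤ) (T : Finset (ℤ × ℤ)) (hT : ∀ I ∈ T, dy I ⊆ dy J) (k : ℤ)
    (hk : ∀ I ∈ T, I.1 = k) : ∑ I ∈ T, len I ≤ len J := by
  have hd : (T : Set (ℤ × ℤ)).PairwiseDisjoint dy := by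
    intro I hI I' hI' hne
    refine Set.disjoint_left.2 fun x hx hx' => hne ?_
    exact eq_of_mem_dy ((hk I hI).trans (hk I' hI').symm) hx hx'
  have h1 := measureReal_biUnion_finset (μ := volume) hd (fun I _ => measurableSet_dy I)
    (fun I _ => by rw [volume_dy]; exact ENNReal.ofReal_ne_top)
  simp_rw [volume_real_dy] at h1
  rw [← h1, ← volume_real_dy J]
  exact measureReal_mono (Set.iUnion₂_subset hT) (by rw [volume_dy]; exact ENNReal.ofReal_ne_top)

lemma sum_len_disjoint_le {s : Set ℝ} {c : ℝ} (hs : volume s ≤ ENNReal.ofReal c) (hc : 0 ≤ c)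
    (T : Finset (ℤ × ℤ)) (hT : ∀ I ∈ T, dy I ⊆ s)
    (hd : (T : Set (ℤ × ℤ)).PairwiseDisjoint dy) : ∑ I ∈ T, len I ≤ c := by
  have h1 := measureReal_biUnion_finset (μ := volume) hd (fun I _ => measurableSet_dy I)
    (fun I _ => by rw [volume_dy]; exact ENNReal.ofReal_ne_top)
  simp_rw [volume_real_dy] at h1
  rw [← h1]
  refine ENNReal.toReal_le_of_le_ofReal hc ((measure_mono (Set.iUnion₂_subset hT)).trans hs)

/-- Sum over a family of intervals by scales, with geometric decay away from the scale `m`. -/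
lemma sum_by_scale_le (T : Finset (ℤ × ℤ)) (g : ℤ × ℤ → ℝ) {B : ℝ} (hB : 0 ≤ B) (m : ℤ)
    (h : ∀ k : ℤ, ∑ I ∈ T with I.1 = k, g I ≤ B * (1 / 2) ^ (m - k).natAbs) :
    ∑ I ∈ T, g I ≤ 4 * B := by
  classical
  rw [← Finset.sum_fiberwise_of_maps_to (g := fun I : ℤ × ℤ => I.1) (t := T.image fun I => I.1)
    (fun I hI => Finset.mem_image_of_mem _ hI)]
  calc _ ≤ ∑ k ∈ T.image fun I => I.1, B * (1 / 2) ^ (m - k).natAbs :=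
        Finset.sum_le_sum fun k _ => h k
    _ = B * ∑ n ∈ (T.image fun I => I.1).image fun k => m - k, (1 / 2) ^ n.natAbs := by
        rw [Finset.mul_sum]
        generalize T.image (fun I => I.1) = s
        rw [Finset.sum_image fun x _ y _ hxy => by simpa using hxy]
    _ ≤ B * (2 * (1 - 1 / 2)⁻¹) := by
        gcongr
        exact sum_rpow_natAbs_le (by norm_num) (by norm_num) _
    _ = _ := by ring

lemma zpow_sub_eq_half {k m : ℤ} (h : k ≤ m) : (2 : ℝ) ^ k = 2 ^ m * (1 / 2) ^ (m - k).natAbs := by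
  have e : k = m - ((m - k).natAbs : ℤ) := by omega
  conv_lhs => rw [e, zpow_sub₀ (by norm_num), zpow_natCast]
  simp [div_eq_mul_inv]

/-- The triple of a dyadic interval. -/
def near (J : ℤ × ℤ) : Set ℝ := {x | |⌊x / len J⌋ - J.2| ≤ 1}

lemma near_eq (J : ℤ × ℤ) : near J = Ico (lft J - len J) (lft J + 2 * len J) := by
  have h := len_pos J
  ext x
  have e : x ∈ near J ↔ J.2 - 1 ≤ ⌊x / len J⌋ ∧ ⌊x / len J⌋ < J.2 + 2 := by
    simp only [near, mem_ofPred_eq, abs_le]; omega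
  rw [e, Int.le_floor, Int.floor_lt, le_div_iff₀ h, div_lt_iff₀ h, mem_Ico]
  unfold lft
  push_cast
  constructor <;> rintro ⟨h1, h2⟩ <;> constructor <;> linarith

lemma measurableSet_near (J : ℤ × ℤ) : MeasurableSet (near J) := by
  rw [near_eq]; exact measurableSet_Ico

lemma volume_near (J : ℤ × ℤ) : volume (near J) = ENNReal.ofReal (3 * len J) := by
  rw [near_eq, Real.volume_Ico]; congr 1; ring

lemma wt_le_of_mem_near {J : ℤ × ℤ} {x : ℝ} (hx : x ∈ near J) : wt J x ≤ 3 := by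
  rw [near_eq] at hx
  have h := len_pos J
  rw [wt_eq]
  have : |x - lft J| / len J ≤ 2 := by
    rw [div_le_iff₀ h, abs_le]; constructor <;> linarith [hx.1, hx.2]
  linarith

lemma wt_mul_len_le_of_not_mem_near {I J : ℤ × ℤ} (h : dy I ⊆ dy J) {x : ℝ} (hx : x ∉ near J) :
    wt J x * len J ≤ 4 * (wt I x * len I) := by
  have hI := len_pos I
  have hJ := len_pos J
  have h1 := mem_dy.1 (h (lft_mem_dy I))
  rw [wt_eq, wt_eq, add_mul, add_mul, div_mul_cancel₀ _ hI.ne', div_mul_cancel₀ _ hJ.ne']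
  rw [near_eq, mem_Ico, not_and_or] at hx
  rcases hx with hx | hx
  · rw [abs_of_neg (by linarith), abs_of_neg (by linarith)]; linarith
  · rw [abs_of_nonneg (by linarith), abs_of_nonneg (by linarith)]; linarith

section size
variable {H : Type*} [NormedAddCommGroup H] [NormedSpace ℂ H]

/-- Decay of a wave packet adapted to the interval `I`. -/
def Decay (C : ℝ) (N : ℕ) (φ : ℝ → ℂ) (I : ℤ × ℤ) : Prop :=
  ∀ x, ‖φ x‖ ≤ C * (len I)⁻¹ * (wt I x ^ N)⁻¹

/-- Regularity, at the scale of `I`, of a wave packet adapted to the interval `I`. -/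
def Lip (C : ℝ) (N : ℕ) (φ : ℝ → ℂ) (I : ℤ × ℤ) : Prop :=
  ∀ x x', |x - x'| ≤ len I → ‖φ x - φ x'‖ ≤ C * ((len I)⁻¹ * (len I)⁻¹) * |x - x'| * (wt I x' ^ N)⁻¹

lemma Decay.integrable_smul {C : ℝ} {N : ℕ} {φ : ℝ → ℂ} {I : ℤ × ℤ} (h : Decay C N φ I)
    (hC : 0 ≤ C) (hφ : Continuous φ) {f : ℝ → H} (hf : Integrable f) :
    Integrable fun x => φ x • f x := by
  refine hf.bdd_smul (C * (len I)⁻¹) hφ.aestronglyMeasurable (ae_of_all _ fun x => (h x).trans ?_)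
  have := len_pos I
  refine mul_le_of_le_one_right (by positivity) (inv_le_one_of_one_le₀ (one_le_pow₀ (one_le_wt I x)))

lemma integrable_norm_wt {H : Type*} [NormedAddCommGroup H] {f : ℝ → H} (hf : Integrable f)
    (I : ℤ × ℤ) (N : ℕ) : Integrable fun x => ‖f x‖ * (wt I x ^ N)⁻¹ := by
  refine hf.norm.mul_bdd (c := 1) ?_ (ae_of_all _ fun x => ?_)
  · exact (Continuous.inv₀ ((continuous_wt I).pow N)
      fun x => (pow_pos (wt_pos I x) N).ne').aestronglyMeasurable
  · have := one_le_wt I x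
    rw [Real.norm_of_nonneg (by positivity)]
    exact inv_le_one_of_one_le₀ (one_le_pow₀ this)

lemma Decay.norm_integral_le {C : ℝ} {N : ℕ} {φ : ℝ → ℂ} {I : ℤ × ℤ} (h : Decay C N φ I)
    {f : ℝ → H} (hf : Integrable f) {s : Set ℝ} :
    ‖∫ x in s, φ x • f x‖ ≤ C * (len I)⁻¹ * ∫ x in s, ‖f x‖ * (wt I x ^ N)⁻¹ := by
  rw [← integral_const_mul]
  refine norm_integral_le_of_norm_le ((integrable_norm_wt hf I N).integrableOn.const_mul _)
    (ae_of_all _ fun x => ?_)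
  rw [norm_smul]
  calc ‖φ x‖ * ‖f x‖ ≤ C * (len I)⁻¹ * (wt I x ^ N)⁻¹ * ‖f x‖ := by gcongr; exact h x
    _ = _ := by ring

lemma Decay.norm_integral_le_avg {C A : ℝ} {N W : ℕ} (hNW : W ≤ N) (hC : 0 ≤ C)
    {φ : ℝ → ℂ} {I : ℤ × ℤ} (h : Decay C N φ I) {f : ℝ → H} (hf : Integrable f)
    (hA : ∫ x, ‖f x‖ * (wt I x ^ W)⁻¹ ≤ A * len I) (s : Set ℝ) :
    ‖∫ x in s, φ x • f x‖ ≤ C * A := by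
  have hI := len_pos I
  refine (h.norm_integral_le hf).trans ?_
  have h1 : ∫ x in s, ‖f x‖ * (wt I x ^ N)⁻¹ ≤ A * len I := by
    refine le_trans ?_ hA
    refine (setIntegral_le_integral (integrable_norm_wt hf I N) (ae_of_all _ fun x => ?_)).trans
      (integral_mono (integrable_norm_wt hf I N) (integrable_norm_wt hf I W) fun x => ?_)
    · have := wt_pos I x; show 0 ≤ ‖f x‖ * (wt I x ^ N)⁻¹; positivity
    · exact mul_le_mul_of_nonneg_left (wt_pow_inv_le I x hNW) (norm_nonneg _)
  calc _ ≤ C * (len I)⁻¹ * (A * len I) := by gcongr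
    _ = _ := by field_simp

/-- The part of `f` away from the top interval. -/
lemma far_sum_le {C A : ℝ} {N W : ℕ} (hNW : W + 2 ≤ N) (hC : 0 ≤ C) (hA0 : 0 ≤ A) {J : ℤ × ℤ}
    {T : Finset (ℤ × ℤ)} (hT : ∀ I ∈ T, dy I ⊆ dy J) {φ : ℤ × ℤ → ℝ → ℂ}
    (h : ∀ I ∈ T, Decay C N (φ I) I) {f : ℝ → H} (hf : Integrable f)
    (hA : ∫ x, ‖f x‖ * (wt J x ^ W)⁻¹ ≤ A * len J) :
    ∑ I ∈ T, len I * ‖∫ x in (near J)ᶜ, φ I x • f x‖ ^ 2 ≤ 4 * (C * A * 4 ^ (W + 2)) ^ 2 * len J := by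
  have hJ := len_pos J
  have key : ∀ I ∈ T, ‖∫ x in (near J)ᶜ, φ I x • f x‖ ≤ C * A * 4 ^ (W + 2) * (len I / len J) := by
    intro I hI
    have hIp := len_pos I
    refine ((h I hI).norm_integral_le hf).trans ?_
    have h1 : ∫ x in (near J)ᶜ, ‖f x‖ * (wt I x ^ N)⁻¹
        ≤ ∫ x in (near J)ᶜ, 4 ^ (W + 2) * (len I / len J) ^ 2 * (‖f x‖ * (wt J x ^ W)⁻¹) := by
      refine setIntegral_mono_on (integrable_norm_wt hf I N).integrableOn
        ((integrable_norm_wt hf J W).const_mul _).integrableOn (measurableSet_near J).compl ?_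
      intro x hx
      have hw := wt_mul_len_le_of_not_mem_near (hT I hI) hx
      have hwI := wt_pos I x
      have hwJ := wt_pos J x
      have hwJ1 := one_le_wt J x
      have e1 : (wt I x)⁻¹ ≤ 4 * (len I / len J) * (wt J x)⁻¹ := by
        rw [inv_le_iff_one_le_mul₀ hwI]
        rw [show 4 * (len I / len J) * (wt J x)⁻¹ * wt I x
          = 4 * (wt I x * len I) / (wt J x * len J) by field_simp]
        rwa [one_le_div (by positivity)]
      have e2 : len I / len J ≤ 1 := by
        rw [div_le_one hJ]; exact len_le_len (scale_le_of_subset (hT I hI))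
      have hr : 0 ≤ len I / len J := by positivity
      have e3 : (wt I x ^ N)⁻¹ ≤ 4 ^ (W + 2) * (len I / len J) ^ 2 * (wt J x ^ W)⁻¹ := by
        calc (wt I x ^ N)⁻¹ ≤ (wt I x ^ (W + 2))⁻¹ := wt_pow_inv_le I x hNW
          _ = ((wt I x)⁻¹) ^ (W + 2) := by rw [inv_pow]
          _ ≤ (4 * (len I / len J) * (wt J x)⁻¹) ^ (W + 2) := by gcongr
          _ = 4 ^ (W + 2) * ((len I / len J) ^ 2 * (wt J x ^ W)⁻¹)
              * ((len I / len J) ^ W * (wt J x ^ 2)⁻¹) := by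
              rw [mul_pow, mul_pow, inv_pow]; simp only [pow_add, mul_inv]; ring
          _ ≤ 4 ^ (W + 2) * ((len I / len J) ^ 2 * (wt J x ^ W)⁻¹) * (1 * 1) := by
              gcongr
              · exact pow_le_one₀ hr e2
              · exact inv_le_one_of_one_le₀ (one_le_pow₀ hwJ1)
          _ = _ := by ring
      calc _ ≤ ‖f x‖ * (4 ^ (W + 2) * (len I / len J) ^ 2 * (wt J x ^ W)⁻¹) := by gcongr
        _ = _ := by ring
    have h2 : ∫ x in (near J)ᶜ, ‖f x‖ * (wt J x ^ W)⁻¹ ≤ A * len J := by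
      refine (setIntegral_le_integral (integrable_norm_wt hf J W) (ae_of_all _ fun x => ?_)).trans hA
      have := wt_pos J x; show 0 ≤ ‖f x‖ * (wt J x ^ W)⁻¹; positivity
    rw [integral_const_mul] at h1
    calc _ ≤ C * (len I)⁻¹ * (4 ^ (W + 2) * (len I / len J) ^ 2 * (A * len J)) := by
          gcongr
          exact h1.trans (by gcongr)
      _ = _ := by field_simp
  set K := C * A * 4 ^ (W + 2) with hK
  have hK0 : 0 ≤ K := by positivity
  have := sum_by_scale_le T (fun I => len I * ‖∫ x in (near J)ᶜ, φ I x • f x‖ ^ 2)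
    (B := K ^ 2 * len J) (by positivity) J.1 ?_
  · linarith
  intro k
  calc ∑ I ∈ T with I.1 = k, len I * ‖∫ x in (near J)ᶜ, φ I x • f x‖ ^ 2
      ≤ ∑ I ∈ T with I.1 = k, K ^ 2 * (1 / 2) ^ (J.1 - k).natAbs * len I := by
        refine Finset.sum_le_sum fun I hI => ?_
        obtain ⟨hIT, rfl⟩ := Finset.mem_filter.1 hI
        have hIp := len_pos I
        have hk := scale_le_of_subset (hT I hIT)
        have e : len I / len J = (1 / 2) ^ (J.1 - I.1).natAbs := by
          unfold len; rw [zpow_sub_eq_half hk]; field_simp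
        have h1 := key I hIT
        rw [e] at h1
        have h2 : ((1 : ℝ) / 2) ^ (J.1 - I.1).natAbs ≤ 1 := pow_le_one₀ (by norm_num) (by norm_num)
        calc _ ≤ len I * (K * (1 / 2) ^ (J.1 - I.1).natAbs) ^ 2 := by gcongr
          _ = K ^ 2 * ((1 / 2) ^ (J.1 - I.1).natAbs * (1 / 2) ^ (J.1 - I.1).natAbs) * len I := by
              ring
          _ ≤ K ^ 2 * ((1 / 2) ^ (J.1 - I.1).natAbs * 1) * len I := by gcongr
          _ = _ := by ring
    _ = K ^ 2 * (1 / 2) ^ (J.1 - k).natAbs * ∑ I ∈ T with I.1 = k, len I := by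
        rw [Finset.mul_sum]
    _ ≤ K ^ 2 * (1 / 2) ^ (J.1 - k).natAbs * len J := by
        gcongr
        exact sum_len_scale_le J _ (fun I hI => hT I (Finset.mem_filter.1 hI).1) k
          (fun I hI => (Finset.mem_filter.1 hI).2)
    _ = _ := by ring

/-- The interaction of a function of mean zero on `J` with all the wave packets. -/
lemma mean_zero_sum_le {C : ℝ} {N : ℕ} (hN : 3 ≤ N) (hC : 0 ≤ C) {J : ℤ × ℤ}
    {T : Finset (ℤ × ℤ)} {φ : ℤ × ℤ → ℝ → ℂ} (hφ : ∀ I ∈ T, Continuous (φ I))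
    (h : ∀ I ∈ T, Decay C N (φ I) I) (hL : ∀ I ∈ T, Lip C N (φ I) I) {f : ℝ → H}
    (hf : Integrable f) (h0 : ∫ x in dy J, f x = 0)
    (hsep : ∀ I ∈ T, I.1 ≤ J.1 → ∀ x ∈ dy J, len J / len I ≤ wt I x) :
    ∑ I ∈ T, len I * ‖∫ x in dy J, φ I x • f x‖ ≤ 4 * (C * sumConst) * ∫ x in dy J, ‖f x‖ := by
  classical
  have hJ := len_pos J
  have hs := sumConst_pos
  have hI0 : 0 ≤ ∫ x in dy J, ‖f x‖ := integral_nonneg fun x => norm_nonneg _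
  have := sum_by_scale_le T (fun I => len I * ‖∫ x in dy J, φ I x • f x‖)
    (B := C * sumConst * ∫ x in dy J, ‖f x‖) (by positivity) J.1 ?_
  · linarith
  intro k
  rcases le_or_gt k J.1 with hk | hk
  · calc ∑ I ∈ T with I.1 = k, len I * ‖∫ x in dy J, φ I x • f x‖
        ≤ ∑ I ∈ T with I.1 = k, C * ∫ x in dy J, ‖f x‖ * (wt I x ^ N)⁻¹ := by
          refine Finset.sum_le_sum fun I hI => ?_
          obtain ⟨hIT, -⟩ := Finset.mem_filter.1 hI
          have hIp := len_pos I
          calc _ ≤ len I * (C * (len I)⁻¹ * ∫ x in dy J, ‖f x‖ * (wt I x ^ N)⁻¹) := by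
                gcongr; exact (h I hIT).norm_integral_le hf
            _ = _ := by field_simp
      _ = C * ∫ x in dy J, ∑ I ∈ T with I.1 = k, ‖f x‖ * (wt I x ^ N)⁻¹ := by
          rw [integral_finsetSum _ fun I _ => (integrable_norm_wt hf I N).integrableOn,
            Finset.mul_sum]
      _ ≤ C * ∫ x in dy J, ‖f x‖ * (sumConst * (1 / 2) ^ (J.1 - k).natAbs) := by
          refine mul_le_mul_of_nonneg_left ?_ hC
          refine setIntegral_mono_on ?_ (hf.norm.mul_const _).integrableOn (measurableSet_dy J) ?_
          · exact integrable_finsetSum _ fun I _ => (integrable_norm_wt hf I N).integrableOn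
          intro x hx
          rw [← Finset.mul_sum]
          refine mul_le_mul_of_nonneg_left ?_ (norm_nonneg _)
          have h1 := sum_wt_scale_le k x (T.filter fun I => I.1 = k)
            (fun I hI => (Finset.mem_filter.1 hI).2)
          refine le_trans ?_ (mul_le_mul_of_nonneg_right h1 (by positivity))
          rw [Finset.sum_mul]
          refine Finset.sum_le_sum fun I hI => ?_
          obtain ⟨hIT, rfl⟩ := Finset.mem_filter.1 hI
          have hIp := len_pos I
          have hw := hsep I hIT hk x hx
          have hwp := wt_pos I x
          have e : len J / len I = 2 ^ (J.1 - I.1).natAbs := by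
            have e1 : len I = len J * (1 / 2) ^ (J.1 - I.1).natAbs := zpow_sub_eq_half hk
            rw [e1, one_div, inv_pow]; field_simp
          rw [e] at hw
          calc (wt I x ^ N)⁻¹ ≤ (wt I x ^ 3)⁻¹ := wt_pow_inv_le I x hN
            _ = (wt I x ^ 2)⁻¹ * (wt I x)⁻¹ := by rw [← mul_inv, ← pow_succ]
            _ ≤ (wt I x ^ 2)⁻¹ * (2 ^ (J.1 - I.1).natAbs)⁻¹ := by gcongr
            _ = _ := by rw [one_div, inv_pow]
      _ = _ := by rw [integral_mul_const]; ring
  · calc ∑ I ∈ T with I.1 = k, len I * ‖∫ x in dy J, φ I x • f x‖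
        ≤ ∑ I ∈ T with I.1 = k, C * (1 / 2) ^ (J.1 - k).natAbs * (∫ x in dy J, ‖f x‖)
          * (wt I (lft J) ^ 2)⁻¹ := by
          refine Finset.sum_le_sum fun I hI => ?_
          obtain ⟨hIT, rfl⟩ := Finset.mem_filter.1 hI
          have hIp := len_pos I
          have hJI : len J ≤ len I := len_le_len hk.le
          have e0 : ∫ x in dy J, φ I x • f x = ∫ x in dy J, (φ I x - φ I (lft J)) • f x := by
            simp_rw [sub_smul]
            rw [integral_sub, integral_smul, h0, smul_zero, sub_zero]
            · exact ((h I hIT).integrable_smul hC (hφ I hIT) hf).integrableOn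
            · exact (hf.smul _).integrableOn
          have e1 : ‖∫ x in dy J, φ I x • f x‖ ≤ C * ((len I)⁻¹ * (len I)⁻¹) * len J *
              (wt I (lft J) ^ N)⁻¹ * ∫ x in dy J, ‖f x‖ := by
            rw [e0, ← integral_const_mul]
            refine norm_integral_le_of_norm_le (hf.norm.const_mul _).integrableOn ?_
            filter_upwards [ae_restrict_mem (measurableSet_dy J)] with x hx
            rw [norm_smul]
            have hd := abs_sub_le_of_mem_dy hx (lft_mem_dy J)
            have := wt_pos I (lft J)
            refine mul_le_mul_of_nonneg_right ?_ (norm_nonneg _)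
            refine (hL I hIT x (lft J) (hd.trans hJI)).trans ?_
            gcongr
          have e2 : len J = len I * (1 / 2) ^ (J.1 - I.1).natAbs := by
            have : len J = len I * (1 / 2) ^ (I.1 - J.1).natAbs := zpow_sub_eq_half hk.le
            rw [this]; congr 2; omega
          have := wt_pos I (lft J)
          calc _ ≤ len I * (C * ((len I)⁻¹ * (len I)⁻¹) * len J *
              (wt I (lft J) ^ N)⁻¹ * ∫ x in dy J, ‖f x‖) := by gcongr
            _ ≤ len I * (C * ((len I)⁻¹ * (len I)⁻¹) * len J *
              (wt I (lft J) ^ 2)⁻¹ * ∫ x in dy J, ‖f x‖) := by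
              gcongr ?_ * (?_ * ?_ * ?_)
              exact wt_pow_inv_le I _ (by omega)
            _ = _ := by rw [e2]; field_simp
      _ = C * (1 / 2) ^ (J.1 - k).natAbs * (∫ x in dy J, ‖f x‖)
          * ∑ I ∈ T with I.1 = k, (wt I (lft J) ^ 2)⁻¹ := by rw [Finset.mul_sum]
      _ ≤ C * (1 / 2) ^ (J.1 - k).natAbs * (∫ x in dy J, ‖f x‖) * sumConst := by
          gcongr
          exact sum_wt_scale_le k _ _ (fun I hI => (Finset.mem_filter.1 hI).2)
      _ = _ := by ring

end size

lemma floor_div_zpow_succ (x : ℝ) (k : ℤ) : ⌊x / (2 : ℝ) ^ (k + 1)⌋ = ⌊x / (2 : ℝ) ^ k⌋ / 2 := by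
  rw [zpow_add_one₀ (by norm_num), ← div_div]
  exact_mod_cast Int.floor_div_natCast (x / (2 : ℝ) ^ k) 2

/-- At scale `k` the point `x` lies in or next to an ancestor of an interval of `T`. -/
def Touch (T : Finset (ℤ × ℤ)) (k : ℤ) (x : ℝ) : Prop :=
  ∃ I ∈ T, I.1 ≤ k ∧ |⌊lft I / (2 : ℝ) ^ k⌋ - ⌊x / (2 : ℝ) ^ k⌋| ≤ 1

lemma Touch.mono {T : Finset (ℤ × ℤ)} {k k' : ℤ} (h : k ≤ k') {x : ℝ} (ht : Touch T k x) :
    Touch T k' x := by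
  induction k', h using Int.leInduction with
  | base => exact ht
  | succ m hm ih =>
    obtain ⟨I, hI, hk, hd⟩ := ih
    refine ⟨I, hI, by omega, ?_⟩
    rw [floor_div_zpow_succ, floor_div_zpow_succ]
    rw [abs_le] at hd ⊢
    omega

lemma Touch.congr {T : Finset (ℤ × ℤ)} {P : ℤ × ℤ} {k : ℤ} (hk : P.1 ≤ k) {x y : ℝ}
    (hx : x ∈ dy P) (hy : y ∈ dy P) (h : Touch T k x) : Touch T k y := by
  obtain ⟨I, hI, hIk, hd⟩ := h
  refine ⟨I, hI, hIk, ?_⟩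
  rwa [← floor_div_eq_of_le hk (show ⌊x / (2 : ℝ) ^ P.1⌋ = ⌊y / (2 : ℝ) ^ P.1⌋ from hx.trans hy.symm)]

/-- Maximal dyadic intervals near `J` which are separated from the intervals of `T`. -/
def IsWhit (T : Finset (ℤ × ℤ)) (J P : ℤ × ℤ) : Prop :=
  P.1 < J.1 ∧ lft P ∈ near J ∧ ¬ Touch T P.1 (lft P) ∧ Touch T (P.1 + 1) (lft P)

lemma mem_near_iff {P J : ℤ × ℤ} (h : P.1 ≤ J.1) {x : ℝ} (hx : x ∈ dy P) :
    x ∈ near J ↔ lft P ∈ near J := by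
  have := floor_div_eq_of_le h (show ⌊x / (2 : ℝ) ^ P.1⌋ = ⌊lft P / (2 : ℝ) ^ P.1⌋ from
    Eq.trans hx (Eq.symm (lft_mem_dy P)))
  simp only [near, mem_ofPred_eq]
  unfold len at *
  rw [this]

lemma finite_isWhit (T : Finset (ℤ × ℤ)) (J : ℤ × ℤ) : {P | IsWhit T J P}.Finite := by
  obtain ⟨m, hm⟩ : ∃ m : ℤ, ∀ I ∈ T, m ≤ I.1 := by
    obtain ⟨m, hm⟩ := (T.image fun I => I.1).bddBelow
    exact ⟨m, fun I hI => hm (Finset.mem_coe.2 (Finset.mem_image_of_mem _ hI))⟩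
  refine ((Set.finite_Icc (m - 1) J.1).biUnion fun k _ => (Set.finite_Icc
    ⌊(lft J - len J) / 2 ^ k⌋ ⌈(lft J + 2 * len J) / 2 ^ k⌉).image fun n => (k, n)).subset ?_
  rintro P ⟨h1, h2, -, I, hI, h3, -⟩
  have h4 := hm I hI
  rw [near_eq] at h2
  have hp : (0 : ℝ) < 2 ^ P.1 := by positivity
  have h5 : (lft J - len J) / 2 ^ P.1 ≤ P.2 := by
    rw [div_le_iff₀ hp]; exact h2.1
  have h6 : (P.2 : ℝ) ≤ (lft J + 2 * len J) / 2 ^ P.1 := by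
    rw [le_div_iff₀ hp]; exact h2.2.le
  refine mem_iUnion₂.2 ⟨P.1, ⟨by omega, by omega⟩, P.2, ⟨?_, ?_⟩, rfl⟩
  · exact_mod_cast (Int.floor_le _).trans h5
  · exact_mod_cast h6.trans (Int.le_ceil _)

lemma IsWhit.eq {T : Finset (ℤ × ℤ)} {J P P' : ℤ × ℤ} (h : IsWhit T J P) (h' : IsWhit T J P')
    {x : ℝ} (hx : x ∈ dy P) (hx' : x ∈ dy P') : P = P' := by
  have key : ∀ {P P' : ℤ × ℤ}, IsWhit T J P → IsWhit T J P' → x ∈ dy P → x ∈ dy P' →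
      P'.1 ≤ P.1 := by
    intro P P' h h' hx hx'
    by_contra! hlt
    refine h'.2.2.1 (Touch.congr le_rfl hx' (lft_mem_dy P') ?_)
    exact Touch.congr hlt.le (lft_mem_dy P) hx (h.2.2.2.mono (by omega))
  exact eq_of_mem_dy (le_antisymm (key h' h hx' hx) (key h h' hx hx')) hx hx'

lemma exists_isWhit {T : Finset (ℤ × ℤ)} (hT0 : T.Nonempty) {J : ℤ × ℤ}
    (hT : ∀ I ∈ T, dy I ⊆ dy J) {x : ℝ} (hx : x ∈ near J) : ∃ P, IsWhit T J P ∧ x ∈ dy P := by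
  obtain ⟨m, hm⟩ : ∃ m : ℤ, ∀ I ∈ T, m ≤ I.1 := by
    obtain ⟨m, hm⟩ := (T.image fun I => I.1).bddBelow
    exact ⟨m, fun I hI => hm (Finset.mem_coe.2 (Finset.mem_image_of_mem _ hI))⟩
  have hJ : Touch T J.1 x := by
    obtain ⟨I, hI⟩ := hT0
    refine ⟨I, hI, scale_le_of_subset (hT I hI), ?_⟩
    have h1 : ⌊lft I / (2 : ℝ) ^ J.1⌋ = J.2 := hT I hI (lft_mem_dy I)
    rw [h1, abs_sub_comm]
    exact hx
  obtain ⟨k, hk, hmin⟩ := Int.exists_least_of_bdd (P := fun k => Touch T k x)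
    ⟨m, fun k ⟨I, hI, h, _⟩ => (hm I hI).trans h⟩ ⟨J.1, hJ⟩
  have hkJ := hmin _ hJ
  have hx' := mem_dy_floor (k - 1) x
  refine ⟨(k - 1, ⌊x / (2 : ℝ) ^ (k - 1)⌋), ⟨by simp only; omega, ?_, fun h => ?_, ?_⟩, hx'⟩
  · exact (mem_near_iff (by simp only; omega) hx').1 hx
  · have := hmin _ (h.congr le_rfl (lft_mem_dy _) hx')
    simp only at this
    omega
  · simp only [sub_add_cancel]
    exact hk.congr (by simp only; omega) hx' (lft_mem_dy _)

lemma IsWhit.subset_near {T : Finset (ℤ × ℤ)} {J P : ℤ × ℤ} (h : IsWhit T J P) :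
    dy P ⊆ near J := fun _ hx => (mem_near_iff h.1.le hx).2 h.2.1

lemma IsWhit.sep {T : Finset (ℤ × ℤ)} {J P I : ℤ × ℤ} (h : IsWhit T J P) (hI : I ∈ T)
    (hIP : I.1 ≤ P.1) {x : ℝ} (hx : x ∈ dy P) : len P / len I ≤ wt I x := by
  have hp := len_pos P
  have hi := len_pos I
  have h1 : ¬ |⌊lft I / (2 : ℝ) ^ P.1⌋ - ⌊x / (2 : ℝ) ^ P.1⌋| ≤ 1 := fun h2 =>
    h.2.2.1 (Touch.congr le_rfl hx (lft_mem_dy P) ⟨I, hI, hIP, h2⟩)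
  have h2 : len P ≤ |x - lft I| := by
    by_contra! h3
    refine h1 ?_
    have h4 : |lft I / (2 : ℝ) ^ P.1 - x / (2 : ℝ) ^ P.1| < 1 := by
      rw [← sub_div, abs_div, abs_of_pos (show (0 : ℝ) < 2 ^ P.1 from hp),
        div_lt_one (show (0 : ℝ) < 2 ^ P.1 from hp), abs_sub_comm]
      exact h3
    rw [abs_lt] at h4
    have a1 := Int.floor_le (lft I / (2 : ℝ) ^ P.1)
    have a2 := Int.lt_floor_add_one (lft I / (2 : ℝ) ^ P.1)
    have a3 := Int.floor_le (x / (2 : ℝ) ^ P.1)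
    have a4 := Int.lt_floor_add_one (x / (2 : ℝ) ^ P.1)
    have a5 : (⌊lft I / (2 : ℝ) ^ P.1⌋ : ℝ) < ⌊x / (2 : ℝ) ^ P.1⌋ + 2 := by linarith
    have a6 : (⌊x / (2 : ℝ) ^ P.1⌋ : ℝ) < ⌊lft I / (2 : ℝ) ^ P.1⌋ + 2 := by linarith
    norm_cast at a5 a6
    rw [abs_le]
    omega
  rw [wt_eq]
  have : len P / len I ≤ |x - lft I| / len I := by gcongr
  linarith

lemma IsWhit.integral_le {H : Type*} [NormedAddCommGroup H] [NormedSpace ℂ H]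
    {T : Finset (ℤ × ℤ)} {J P : ℤ × ℤ} (h : IsWhit T J P)
    (hT : ∀ I ∈ T, dy I ⊆ dy J) {W : ℕ} {A : ℝ} {f : ℝ → H} (hf : Integrable f)
    (hA : ∀ I ∈ T, ∀ I', dy I ⊆ dy I' → dy I' ⊆ dy J → ∫ x, ‖f x‖ * (wt I' x ^ W)⁻¹ ≤ A * len I') :
    ∫ x in dy P, ‖f x‖ ≤ 2 * 3 ^ W * A * len P := by
  obtain ⟨I, hI, hIk, hd⟩ := h.2.2.2
  have hm := mem_dy_floor (P.1 + 1) (lft I)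
  set I' : ℤ × ℤ := (P.1 + 1, ⌊lft I / (2 : ℝ) ^ (P.1 + 1)⌋) with hI'
  have hlen : len I' = 2 * len P := by
    simp only [hI', len]; rw [zpow_add_one₀ (by norm_num)]; ring
  have h1 := hA I hI I' (dy_subset_of_mem hIk (lft_mem_dy I) hm)
    (dy_subset_of_mem h.1 hm (hT I hI (lft_mem_dy I)))
  have hsub : ∀ x ∈ dy P, x ∈ near I' := by
    intro x hx
    rw [mem_near_iff (by simp [hI']) hx, near, mem_ofPred_eq, abs_sub_comm]
    exact hd
  calc ∫ x in dy P, ‖f x‖ ≤ ∫ x in dy P, 3 ^ W * (‖f x‖ * (wt I' x ^ W)⁻¹) := by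
        refine setIntegral_mono_on hf.norm.integrableOn
          ((integrable_norm_wt hf I' W).const_mul _).integrableOn (measurableSet_dy P) fun x hx => ?_
        have h3 := wt_le_of_mem_near (hsub x hx)
        have h4 := wt_pos I' x
        calc ‖f x‖ = wt I' x ^ W * (‖f x‖ * (wt I' x ^ W)⁻¹) := by field_simp
          _ ≤ _ := by gcongr
    _ ≤ 3 ^ W * ∫ x, ‖f x‖ * (wt I' x ^ W)⁻¹ := by
        rw [integral_const_mul]
        refine mul_le_mul_of_nonneg_left (setIntegral_le_integral (integrable_norm_wt hf I' W)
          (ae_of_all _ fun x => ?_)) (by positivity)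
        have := wt_pos I' x
        show 0 ≤ ‖f x‖ * (wt I' x ^ W)⁻¹
        positivity
    _ ≤ 3 ^ W * (A * len I') := by gcongr
    _ = _ := by rw [hlen]; ring

/-- The constant of `size_estimate`. -/
noncomputable def sizeConst (C : ℝ) (W : ℕ) (B : ℝ) : ℝ :=
  3 * (4 * (C * 4 ^ (W + 2)) ^ 2 + 3 * B * (2 * 3 ^ W) ^ 2
    + (2 * C + C * intConst * (2 * 3 ^ W)) * (24 * C * sumConst * (2 * 3 ^ W)))

lemma sizeConst_nonneg {C B : ℝ} (hC : 0 ≤ C) (hB : 0 ≤ B) (W : ℕ) : 0 ≤ sizeConst C W B := by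
  have := sumConst_pos
  have := intConst_nonneg
  unfold sizeConst
  positivity

lemma norm_add_three_sq_le {H : Type*} [NormedAddCommGroup H] (a b c : H) :
    ‖a + b + c‖ ^ 2 ≤ 3 * (‖a‖ ^ 2 + ‖b‖ ^ 2 + ‖c‖ ^ 2) := by
  have h := norm_add₃_le (a := a) (b := b) (c := c)
  calc ‖a + b + c‖ ^ 2 ≤ (‖a‖ + ‖b‖ + ‖c‖) ^ 2 := by gcongr
    _ ≤ _ := by
      nlinarith [sq_nonneg (‖a‖ - ‖b‖), sq_nonneg (‖a‖ - ‖c‖), sq_nonneg (‖b‖ - ‖c‖)]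

/-- Wave packet coefficients of `f` over a family of intervals satisfying a Bessel inequality are
controlled by local averages of `f`. -/
theorem size_estimate {H : Type*} [NormedAddCommGroup H] [NormedSpace ℂ H]
    [CompleteSpace H] {C A B : ℝ} {N W : ℕ} (hNW : W + 2 ≤ N) (hN : 3 ≤ N) (hC : 0 ≤ C)
    (hA0 : 0 ≤ A) (hB : 0 ≤ B) {J : ℤ × ℤ} {T : Finset (ℤ × ℤ)} (hT : ∀ I ∈ T, dy I ⊆ dy J)
    {φ : ℤ × ℤ → ℝ → ℂ} (hφ : ∀ I ∈ T, Continuous (φ I))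
    (h : ∀ I ∈ T, Decay C N (φ I) I) (hL : ∀ I ∈ T, Lip C N (φ I) I)
    (hBes : ∀ g : ℝ → H, MemLp g 2 →
      ∑ I ∈ T, len I * ‖∫ x, φ I x • g x‖ ^ 2 ≤ B * ∫ x, ‖g x‖ ^ 2)
    {f : ℝ → H} (hf : Integrable f)
    (hA : ∀ I ∈ T, ∀ I', dy I ⊆ dy I' → dy I' ⊆ dy J → ∫ x, ‖f x‖ * (wt I' x ^ W)⁻¹ ≤ A * len I') :
    ∑ I ∈ T, len I * ‖∫ x, φ I x • f x‖ ^ 2 ≤ sizeConst C W B * A ^ 2 * len J := by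
  classical
  rcases T.eq_empty_or_nonempty with rfl | hT0
  · have := sizeConst_nonneg hC hB W
    have := len_pos J
    rw [Finset.sum_empty]; positivity
  have hs := sumConst_pos
  have hi := intConst_nonneg
  have hJ := len_pos J
  have hAI : ∀ I ∈ T, ∫ x, ‖f x‖ * (wt I x ^ W)⁻¹ ≤ A * len I := fun I hI =>
    hA I hI I subset_rfl (hT I hI)
  set 𝓙 := (finite_isWhit T J).toFinset with h𝓙
  have hW : ∀ P ∈ 𝓙, IsWhit T J P := fun P hP => by simpa [h𝓙] using hP
  have hdis : (𝓙 : Set (ℤ × ℤ)).PairwiseDisjoint dy := fun P hP P' hP' hne =>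
    Set.disjoint_left.2 fun x hx hx' => hne ((hW P hP).eq (hW P' hP') hx hx')
  have hcov : near J = ⋃ P ∈ 𝓙, dy P := by
    refine Subset.antisymm (fun x hx => ?_) (iUnion₂_subset fun P hP => (hW P hP).subset_near)
    obtain ⟨P, hP, hx⟩ := exists_isWhit hT0 hT hx
    exact mem_iUnion₂.2 ⟨P, by simpa [h𝓙] using hP, hx⟩
  have hlen : ∑ P ∈ 𝓙, len P ≤ 3 * len J :=
    sum_len_disjoint_le (volume_near J).le (by positivity) 𝓙 (fun P hP => (hW P hP).subset_near) hdis
  set G := 2 * 3 ^ W * A with hG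
  have hG0 : 0 ≤ G := by positivity
  have hwint : ∀ P ∈ 𝓙, ∫ x in dy P, ‖f x‖ ≤ G * len P := fun P hP => (hW P hP).integral_le hT hf hA
  set m : ℤ × ℤ → H := fun P => (len P)⁻¹ • ∫ x in dy P, f x with hm
  have hmG : ∀ P ∈ 𝓙, len P * ‖m P‖ ≤ ∫ x in dy P, ‖f x‖ := by
    intro P hP
    have := len_pos P
    rw [hm, norm_smul, norm_inv, Real.norm_of_nonneg this.le, mul_inv_cancel_left₀ this.ne']
    exact norm_integral_le_integral_norm _
  have hmG' : ∀ P ∈ 𝓙, ‖m P‖ ≤ G := fun P hP =>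
    le_of_mul_le_mul_left (by linarith [hmG P hP, hwint P hP]) (len_pos P)
  have hvol : ∀ P, volume (dy P) ≠ ∞ := fun P => by rw [volume_dy]; exact ENNReal.ofReal_ne_top
  set u : ℤ × ℤ → ℝ → H := fun P => (dy P).indicator fun _ => m P with hu
  have hui : ∀ P, Integrable (u P) := fun P =>
    (integrable_indicator_iff (measurableSet_dy P)).2 (integrableOn_const (hvol P))
  set g : ℝ → H := fun x => ∑ P ∈ 𝓙, u P x with hg
  have hgi : Integrable g := integrable_finsetSum _ fun P _ => hui P
  have hgP : ∀ P ∈ 𝓙, ∀ x ∈ dy P, g x = m P := by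
    intro P hP x hx
    rw [hg]
    simp only
    rw [Finset.sum_eq_single_of_mem P hP]
    · simp [hu, hx]
    · intro P' hP' hne
      have : x ∉ dy P' := fun hx' => hne ((hW P' hP').eq (hW P hP) hx' hx)
      simp [hu, this]
  have hgn : ∀ x ∉ near J, g x = 0 := by
    intro x hx
    refine Finset.sum_eq_zero fun P hP => ?_
    have : x ∉ dy P := fun h' => hx ((hW P hP).subset_near h')
    simp [hu, this]
  have hgb : ∀ x, ‖g x‖ ≤ (near J).indicator (fun _ => G) x := by
    intro x
    by_cases hx : x ∈ near J
    · rw [indicator_of_mem hx]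
      rw [hcov] at hx
      obtain ⟨P, hP, hx⟩ := mem_iUnion₂.1 hx
      rw [hgP P hP x hx]
      exact hmG' P hP
    · rw [hgn x hx, norm_zero, indicator_of_notMem hx]
  have hgG : ∀ x, ‖g x‖ ≤ G := fun x => (hgb x).trans (indicator_le_self' (fun _ _ => hG0) x)
  have hgL : MemLp g 2 := by
    refine MemLp.of_le (g := (near J).indicator fun _ => G) ?_ hgi.aestronglyMeasurable
      (ae_of_all _ fun x => (hgb x).trans (le_abs_self _))
    exact memLp_indicator_const 2 (measurableSet_near J) G
      (Or.inr (by rw [volume_near]; exact ENNReal.ofReal_ne_top))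
  have hg2 : ∫ x, ‖g x‖ ^ 2 ≤ G ^ 2 * (3 * len J) := by
    calc ∫ x, ‖g x‖ ^ 2 ≤ ∫ x, (near J).indicator (fun _ => G ^ 2) x := by
          refine integral_mono_of_nonneg (ae_of_all _ fun x => by positivity)
            ((integrable_indicator_iff (measurableSet_near J)).2
              (integrableOn_const (by rw [volume_near]; exact ENNReal.ofReal_ne_top)))
            (ae_of_all _ fun x => ?_)
          have h1 := hgb x
          by_cases hx : x ∈ near J
          · simp only [indicator_of_mem hx] at h1 ⊢; gcongr
          · simp [indicator_of_notMem hx, hgn x hx]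
      _ = _ := by
          rw [integral_indicator (measurableSet_near J), setIntegral_const, Measure.real,
            volume_near, ENNReal.toReal_ofReal (by positivity), smul_eq_mul]
          ring
  set b : ℤ × ℤ → ℤ × ℤ → H := fun I P => ∫ x in dy P, φ I x • (f x - u P x) with hb
  have hφf : ∀ I ∈ T, Integrable fun x => φ I x • f x := fun I hI =>
    (h I hI).integrable_smul hC (hφ I hI) hf
  have hφg : ∀ I ∈ T, Integrable fun x => φ I x • g x := fun I hI =>
    (h I hI).integrable_smul hC (hφ I hI) hgi
  have hdec : ∀ I ∈ T, ∫ x, φ I x • f x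
      = (∫ x in (near J)ᶜ, φ I x • f x) + (∫ x, φ I x • g x) + ∑ P ∈ 𝓙, b I P := by
    intro I hI
    have e1 := integral_add_compl (measurableSet_near J) (hφf I hI)
    have e2 : ∫ x, φ I x • g x = ∫ x in near J, φ I x • g x := by
      rw [setIntegral_eq_integral_of_forall_compl_eq_zero]
      intro x hx; rw [hgn x hx, smul_zero]
    have e3 : ∫ x in near J, φ I x • f x = (∫ x in near J, φ I x • g x) + ∑ P ∈ 𝓙, b I P := by
      rw [hcov, integral_biUnion_finset _ (fun P _ => measurableSet_dy P) hdis
        (fun P _ => (hφf I hI).integrableOn), integral_biUnion_finset _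
        (fun P _ => measurableSet_dy P) hdis (fun P _ => (hφg I hI).integrableOn),
        ← Finset.sum_add_distrib]
      refine Finset.sum_congr rfl fun P hP => ?_
      have e4 : b I P = ∫ x in dy P, (φ I x • f x - φ I x • g x) := by
        refine setIntegral_congr_fun (measurableSet_dy P) fun x hx => ?_
        simp only [smul_sub, hgP P hP x hx, hu, indicator_of_mem hx]
      rw [e4, integral_sub (hφf I hI).integrableOn (hφg I hI).integrableOn]
      abel
    rw [← e1, e3, e2]
    abel
  have hfar := far_sum_le hNW hC hA0 hT h hf
    (hA _ hT0.choose_spec J (hT _ hT0.choose_spec) subset_rfl)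
  have hgood := hBes g hgL
  set K := 2 * C + C * intConst * (2 * 3 ^ W) with hK
  have hgI : ∀ I ∈ T, ‖∫ x, φ I x • g x‖ ≤ C * intConst * G := by
    intro I hI
    have hIp := len_pos I
    have h1 := (h I hI).norm_integral_le hgi (s := univ)
    simp only [Measure.restrict_univ] at h1
    have h2 : ∫ x, ‖g x‖ * (wt I x ^ N)⁻¹ ≤ ∫ x, G * (wt I x ^ 2)⁻¹ := by
      refine integral_mono (integrable_norm_wt hgi I N) ((integrable_wt I).const_mul _) fun x => ?_
      have := wt_pos I x
      exact mul_le_mul (hgG x) (wt_pow_inv_le I x (by omega)) (by positivity) hG0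
    rw [integral_const_mul, integral_wt] at h2
    calc _ ≤ C * (len I)⁻¹ * (G * (len I * intConst)) := h1.trans (by gcongr)
      _ = _ := by field_simp
  have hbK : ∀ I ∈ T, ‖∑ P ∈ 𝓙, b I P‖ ≤ K * A := by
    intro I hI
    have e : ∑ P ∈ 𝓙, b I P = (∫ x, φ I x • f x) - (∫ x in (near J)ᶜ, φ I x • f x)
        - ∫ x, φ I x • g x := by rw [hdec I hI]; abel
    have h1 := (h I hI).norm_integral_le_avg (W := W) (by omega) hC hf (hAI I hI) univ
    simp only [Measure.restrict_univ] at h1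
    have h2 := (h I hI).norm_integral_le_avg (W := W) (by omega) hC hf (hAI I hI) (near J)ᶜ
    rw [e]
    calc _ ≤ C * A + C * A + C * intConst * G :=
          (norm_sub_le _ _).trans (add_le_add ((norm_sub_le _ _).trans (add_le_add h1 h2)) (hgI I hI))
      _ = _ := by rw [hK, hG]; ring
  have hbP : ∀ P ∈ 𝓙, ∑ I ∈ T, len I * ‖b I P‖ ≤ 4 * (C * sumConst) * (2 * (G * len P)) := by
    intro P hP
    have hPp := len_pos P
    have hFi : Integrable fun x => f x - u P x := hf.sub (hui P)
    have hcongr : ∫ x in dy P, u P x = len P • m P := by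
      rw [setIntegral_congr_fun (g := fun _ => m P) (measurableSet_dy P)
        (fun x hx => by simp [hu, hx]), setIntegral_const, volume_real_dy]
    refine (mean_zero_sum_le hN hC hφ h hL hFi ?_ fun I hI hIP x hx =>
      (hW P hP).sep hI hIP hx).trans ?_
    · rw [integral_sub hf.integrableOn (hui P).integrableOn, hcongr, hm, smul_inv_smul₀ hPp.ne',
        sub_self]
    · refine mul_le_mul_of_nonneg_left ?_ (by positivity)
      calc ∫ x in dy P, ‖f x - u P x‖ ≤ ∫ x in dy P, (‖f x‖ + ‖m P‖) := by
            refine setIntegral_mono_on hFi.norm.integrableOn (hf.norm.integrableOn.add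
              (integrableOn_const (hvol P))) (measurableSet_dy P) fun x hx => ?_
            have : u P x = m P := by simp [hu, hx]
            rw [this]
            exact norm_sub_le _ _
        _ = (∫ x in dy P, ‖f x‖) + len P * ‖m P‖ := by
            rw [integral_add hf.norm.integrableOn (integrableOn_const (hvol P)), setIntegral_const,
              volume_real_dy, smul_eq_mul]
        _ ≤ _ := by linarith [hmG P hP, hwint P hP]
  have hbsum : ∑ I ∈ T, len I * ‖∑ P ∈ 𝓙, b I P‖ ^ 2
      ≤ K * A * (4 * (C * sumConst) * (2 * (G * (3 * len J)))) := by
    calc _ ≤ ∑ I ∈ T, K * A * ∑ P ∈ 𝓙, len I * ‖b I P‖ := by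
          refine Finset.sum_le_sum fun I hI => ?_
          have hIp := len_pos I
          rw [← Finset.mul_sum]
          calc len I * ‖∑ P ∈ 𝓙, b I P‖ ^ 2
              = ‖∑ P ∈ 𝓙, b I P‖ * (len I * ‖∑ P ∈ 𝓙, b I P‖) := by ring
            _ ≤ K * A * (len I * ∑ P ∈ 𝓙, ‖b I P‖) := by
                gcongr
                · exact hbK I hI
                · exact norm_sum_le _ _
      _ = K * A * ∑ P ∈ 𝓙, ∑ I ∈ T, len I * ‖b I P‖ := by
          rw [← Finset.mul_sum, Finset.sum_comm]
      _ ≤ K * A * ∑ P ∈ 𝓙, 4 * (C * sumConst) * (2 * (G * len P)) := by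
          gcongr with P hP
          exact hbP P hP
      _ = K * A * (4 * (C * sumConst) * (2 * (G * ∑ P ∈ 𝓙, len P))) := by
          simp only [Finset.mul_sum]
      _ ≤ _ := by gcongr
  calc ∑ I ∈ T, len I * ‖∫ x, φ I x • f x‖ ^ 2
      ≤ ∑ I ∈ T, 3 * (len I * ‖∫ x in (near J)ᶜ, φ I x • f x‖ ^ 2
          + len I * ‖∫ x, φ I x • g x‖ ^ 2 + len I * ‖∑ P ∈ 𝓙, b I P‖ ^ 2) := by
        refine Finset.sum_le_sum fun I hI => ?_
        have hIp := len_pos I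
        rw [hdec I hI]
        calc _ ≤ len I * (3 * (_ + _ + _)) := by
              gcongr; exact norm_add_three_sq_le _ _ _
          _ = _ := by ring
    _ ≤ 3 * (4 * (C * A * 4 ^ (W + 2)) ^ 2 * len J + B * (G ^ 2 * (3 * len J))
          + K * A * (4 * (C * sumConst) * (2 * (G * (3 * len J))))) := by
        rw [← Finset.mul_sum, Finset.sum_add_distrib, Finset.sum_add_distrib]
        gcongr
        exact hgood.trans (by gcongr)
    _ = _ := by rw [sizeConst, hG, hK]; ring

/-- The character `e^{2πit}`. -/
noncomputable def ph (t : ℝ) : ℂ := Complex.exp (((2 * π * t : ℝ) : ℂ) * Complex.I)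

lemma norm_ph (t : ℝ) : ‖ph t‖ = 1 := Complex.norm_exp_ofReal_mul_I _

lemma ph_add (s t : ℝ) : ph (s + t) = ph s * ph t := by
  rw [ph, ph, ph, ← Complex.exp_add]; congr 1; push_cast; ring

lemma ph_zero : ph 0 = 1 := by simp [ph]

lemma ph_mul_neg (t : ℝ) : ph t * ph (-t) = 1 := by rw [← ph_add, add_neg_cancel, ph_zero]

lemma continuous_ph : Continuous ph := by unfold ph; fun_prop

lemma conj_ph (t : ℝ) : (starRingEnd ℂ) (ph t) = ph (-t) := by
  rw [ph, ph, ← Complex.exp_conj, map_mul, Complex.conj_ofReal, Complex.conj_I]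
  congr 1
  push_cast
  ring

/-- Families of wave packets adapted to tiles: `E P` is concentrated near the interval of `P`, and
its frequencies lie in the image of `band b P` under multiplication by `c`. -/
structure Adapted (C : ℝ) (N : ℕ) (b : ℝ × ℝ) (c : ℝ) (E : Tile → ℝ → ℂ) : Prop where
  cont : ∀ P, Continuous (E P)
  decay : ∀ P, Decay C N (E P) P.1
  lip : ∀ P ξ, InFreq ξ P → Lip C N (fun x => ph (c * ξ * x) * E P x) P.1
  orth : ∀ P P', Disjoint (band b P) (band b P') → ∫ x, E P x * (starRingEnd ℂ) (E P' x) = 0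

section
variable {H : Type*} [NormedAddCommGroup H] [InnerProductSpace ℂ H]

lemma Decay.memLp {C : ℝ} {N : ℕ} {φ : ℝ → ℂ} {I : ℤ × ℤ} (h : Decay C N φ I)
    (hN : 2 ≤ N) (hφ : Continuous φ) : MemLp φ 2 := by
  refine (memLp_two_iff_integrable_sq_norm hφ.aestronglyMeasurable).2 ?_
  have hI := len_pos I
  refine ((integrable_wt_pow I hN).const_mul ((C * (len I)⁻¹) ^ 2)).mono'
    (hφ.norm.pow 2).aestronglyMeasurable (ae_of_all _ fun x => ?_)
  have h1 := one_le_wt I x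
  have h2 : (wt I x ^ N)⁻¹ ≤ 1 := inv_le_one_of_one_le₀ (one_le_pow₀ h1)
  have h3 : 0 ≤ (wt I x ^ N)⁻¹ := by positivity
  rw [Real.norm_of_nonneg (by positivity)]
  calc ‖φ x‖ ^ 2 ≤ (C * (len I)⁻¹ * (wt I x ^ N)⁻¹) ^ 2 := by gcongr; exact h x
    _ = (C * (len I)⁻¹) ^ 2 * ((wt I x ^ N)⁻¹ * (wt I x ^ N)⁻¹) := by ring
    _ ≤ (C * (len I)⁻¹) ^ 2 * ((wt I x ^ N)⁻¹ * 1) := by gcongr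
    _ = _ := by ring

/-- Wave packets at different intervals are almost orthogonal. -/
lemma Decay.norm_integral_mul_le {C : ℝ} {N : ℕ} (hN : 6 ≤ N) (hC : 0 ≤ C) {φ φ' : ℝ → ℂ}
    {I I' : ℤ × ℤ} (h : Decay C N φ I) (h' : Decay C N φ' I') (hk : I'.1 ≤ I.1) :
    ‖∫ x, φ x * (starRingEnd ℂ) (φ' x)‖
      ≤ C ^ 2 * intConst * (len I)⁻¹ * (wt I (lft I') ^ 4)⁻¹ := by
  have hI := len_pos I
  have hI' := len_pos I'
  have hw := wt_pos I (lft I')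
  calc ‖∫ x, φ x * (starRingEnd ℂ) (φ' x)‖
      ≤ ∫ x, C ^ 2 * (len I)⁻¹ * (len I')⁻¹ * (wt I (lft I') ^ 4)⁻¹ * (wt I' x ^ 2)⁻¹ := by
        refine norm_integral_le_of_norm_le ((integrable_wt I').const_mul _) (ae_of_all _ fun x => ?_)
        have h1 := wt_pos I x
        have h2 := wt_pos I' x
        rw [norm_mul, RCLike.norm_conj]
        calc ‖φ x‖ * ‖φ' x‖
            ≤ (C * (len I)⁻¹ * (wt I x ^ N)⁻¹) * (C * (len I')⁻¹ * (wt I' x ^ N)⁻¹) := by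
              gcongr
              · exact h x
              · exact h' x
          _ ≤ (C * (len I)⁻¹ * (wt I x ^ 4)⁻¹) * (C * (len I')⁻¹ * (wt I' x ^ 6)⁻¹) := by
              gcongr ?_ * ?_ * ?_ * (?_ * ?_ * ?_)
              · exact wt_pow_inv_le I x (by omega)
              · exact wt_pow_inv_le I' x hN
          _ = C ^ 2 * (len I)⁻¹ * (len I')⁻¹ * ((wt I x * wt I' x) ^ 4)⁻¹ * (wt I' x ^ 2)⁻¹ := by
              rw [mul_pow, mul_inv, show wt I' x ^ 6 = wt I' x ^ 4 * wt I' x ^ 2 by ring, mul_inv]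
              ring
          _ ≤ _ := by
              gcongr
              exact wt_lft_le_mul hk x
    _ = _ := by
        rw [integral_const_mul, integral_wt]
        field_simp

lemma norm_toLp_sq {f : ℝ → H} (hf : MemLp f 2) : ‖hf.toLp f‖ ^ 2 = ∫ x, ‖f x‖ ^ 2 := by
  rw [← inner_self_eq_norm_sq (𝕜 := ℂ), L2.inner_def]
  have : ∫ x, inner ℂ ((hf.toLp f) x) ((hf.toLp f) x) = ((∫ x, ‖f x‖ ^ 2 : ℝ) : ℂ) := by
    rw [← integral_complex_ofReal]
    refine integral_congr_ae ?_
    filter_upwards [hf.coeFn_toLp] with x hx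
    rw [hx, inner_self_eq_norm_sq_to_K]
    push_cast
    rfl
  rw [this]
  exact Complex.ofReal_re _

variable [CompleteSpace H]

/-- The coefficients of `f` as inner products. -/
lemma Adapted.exists_vectors {C : ℝ} {N : ℕ} {b : ℝ × ℝ} {c : ℝ} {E : Tile → ℝ → ℂ}
    (h : Adapted C N b c E) (hN : 6 ≤ N) (hC : 0 ≤ C) {f : ℝ → H} (hf : MemLp f 2) :
    ∃ e : Tile → Lp H 2 (volume : Measure ℝ),
      (∀ P P', P'.1.1 ≤ P.1.1 →
        ‖inner ℂ (e P) (e P')‖ ≤ C ^ 2 * intConst * (len P.1)⁻¹ * (wt P.1 (lft P'.1) ^ 4)⁻¹) ∧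
      (∀ P P', Disjoint (band b P) (band b P') → inner ℂ (e P) (e P') = 0) ∧
      ∀ P, ‖inner ℂ (e P) (hf.toLp f)‖ = ‖∫ x, E P x • f x‖ := by
  set v : Tile → H := fun P => ∫ x, E P x • f x with hv
  set u : Tile → H := fun P => ((‖v P‖⁻¹ : ℝ) : ℂ) • v P with hu
  have hu1 : ∀ P, ‖u P‖ ≤ 1 := by
    intro P
    rw [hu, norm_smul, Complex.norm_real, norm_inv, norm_norm]
    exact inv_mul_le_one
  have hconj : ∀ P, MemLp (fun x => (starRingEnd ℂ) (E P x)) 2 := by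
    intro P
    refine ((h.decay P).memLp (by omega) (h.cont P)).of_le
      (Complex.continuous_conj.comp (h.cont P)).aestronglyMeasurable (ae_of_all _ fun x => ?_)
    rw [RCLike.norm_conj]
  have hmem : ∀ P, MemLp (fun x => (starRingEnd ℂ) (E P x) • u P) 2 := fun P => by
    have := (memLp_top_const (μ := (volume : Measure ℝ)) (u P)).smul (hconj P) (r := 2)
    exact this
  have hinner : ∀ P P', inner ℂ ((hmem P).toLp _) ((hmem P').toLp _)
      = inner ℂ (u P) (u P') * ∫ x, E P x * (starRingEnd ℂ) (E P' x) := by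
    intro P P'
    rw [L2.inner_def, ← integral_const_mul]
    refine integral_congr_ae ?_
    filter_upwards [(hmem P).coeFn_toLp, (hmem P').coeFn_toLp] with x h1 h2
    rw [h1, h2, inner_smul_left, inner_smul_right]
    simp only [Complex.conj_conj]
    ring
  refine ⟨fun P => (hmem P).toLp _, fun P P' hk => ?_, fun P P' hd => ?_, fun P => ?_⟩
  · rw [hinner, norm_mul]
    refine (mul_le_of_le_one_left (norm_nonneg _) ?_).trans
      ((h.decay P).norm_integral_mul_le hN hC (h.decay P') hk)
    refine (norm_inner_le_norm _ _).trans ?_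
    exact mul_le_one₀ (hu1 P) (norm_nonneg _) (hu1 P')
  · rw [hinner, h.orth P P' hd, mul_zero]
  · have hwint : Integrable fun x => E P x • f x :=
      memLp_one_iff_integrable.1 (hf.smul ((h.decay P).memLp (by omega) (h.cont P)) (r := 1))
    have e1 : inner ℂ ((hmem P).toLp _) (hf.toLp f) = inner ℂ (u P) (v P) := by
      rw [L2.inner_def, hv, ← integral_inner hwint]
      refine integral_congr_ae ?_
      filter_upwards [(hmem P).coeFn_toLp, hf.coeFn_toLp] with x h1 h2
      rw [h1, h2, inner_smul_left, inner_smul_right, Complex.conj_conj]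
    rw [e1, hu, inner_smul_left, inner_self_eq_norm_sq_to_K]
    by_cases h0 : ‖v P‖ = 0
    · simp [hv] at *
      simp [h0]
    · rw [norm_mul, RCLike.norm_conj, Complex.norm_real, norm_inv, norm_norm, norm_pow,
        RCLike.norm_ofReal, abs_norm, sq, inv_mul_cancel_left₀ h0]

/-- The energy of `f`. -/
theorem Adapted.selects {C : ℝ} {N : ℕ} {b : ℝ × ℝ} {c : ℝ} {E : Tile → ℝ → ℂ}
    (h : Adapted C N b c E) (hN : 6 ≤ N) (hC : 0 ≤ C) (hb1 : -18 ≤ b.1) (hb2 : b.2 ≤ 18)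
    {D : Finset Tile} (hD : Sparse D) {Θ : Finset Top} (hΘ : Singles b Θ D)
    {f : ℝ → H} (hf : MemLp f 2) :
    Selects b (fun P => ‖∫ x, E P x • f x‖) Θ D
      (2 * (C ^ 2 * intConst) * energyConst * ∫ x, ‖f x‖ ^ 2) := by
  obtain ⟨e, h1, h2, h3⟩ := h.exists_vectors hN hC hf
  have h4 := selects_of_gram hb1 hb2 hD hΘ (hf.toLp f) (K := C ^ 2 * intConst)
    (mul_nonneg (by positivity) intConst_nonneg) (fun P _ P' _ hk => h1 P P' hk)
    (fun P _ P' _ hd => h2 P P' hd) (fun P _ => h3 P)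
  have h5 := norm_toLp_sq hf
  rwa [h5] at h4

lemma Adapted.bessel {C : ℝ} {N : ℕ} {b : ℝ × ℝ} {c : ℝ} {E : Tile → ℝ → ℂ}
    (h : Adapted C N b c E) (hN : 6 ≤ N) (hC : 0 ≤ C) (hb1 : -18 ≤ b.1) (hb2 : b.2 ≤ 18)
    {D : Finset Tile} (hD : Sparse D) {σ : ℝ} (hσ : σ = 1 ∨ σ = -1) {t : Top}
    (hlac : ∀ P ∈ D, Lac b σ t P) {f : ℝ → H} (hf : MemLp f 2) :
    ∑ P ∈ D, len P.1 * ‖∫ x, E P x • f x‖ ^ 2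
      ≤ C ^ 2 * intConst * sumConst * ∫ x, ‖f x‖ ^ 2 := by
  classical
  obtain ⟨e, h1, h2, h3⟩ := h.exists_vectors hN hC hf
  have hs := sumConst_pos
  have hi := intConst_nonneg
  have h5 := norm_toLp_sq hf
  simp_rw [← h3]
  rw [← h5]
  refine bessel_of_gram D (fun P => len P.1) (fun P => (len_pos _).le) e _ (by positivity) ?_
  have hkey := same_scale_sum_le hb1 hb2 hD fun P => ‖inner ℂ (e P) (hf.toLp f)‖
  calc _ ≤ ∑ P ∈ D, ∑ P' ∈ D with P'.1.1 = P.1.1 ∧ ¬ Disjoint (band b P) (band b P'),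
        C ^ 2 * intConst * (len P'.1 * ‖inner ℂ (e P) (hf.toLp f)‖
          * ‖inner ℂ (e P') (hf.toLp f)‖ * (wt P.1 (lft P'.1) ^ 4)⁻¹) := by
        refine Finset.sum_le_sum fun P hP => ?_
        rw [Finset.sum_filter]
        refine Finset.sum_le_sum fun P' hP' => ?_
        have hp := len_pos P.1
        have hp' := len_pos P'.1
        split_ifs with hc
        · calc _ ≤ len P.1 * len P'.1 * ‖inner ℂ (e P) (hf.toLp f)‖
                * ‖inner ℂ (e P') (hf.toLp f)‖ *
                (C ^ 2 * intConst * (len P.1)⁻¹ * (wt P.1 (lft P'.1) ^ 4)⁻¹) := by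
                gcongr
                exact h1 P P' hc.1.le
            _ = _ := by field_simp
        · have hd : Disjoint (band b P) (band b P') := by
            by_contra hnd
            have hne : P'.1.1 ≠ P.1.1 := fun he => hc ⟨he, hnd⟩
            obtain ⟨z, hz, hz'⟩ := Set.not_disjoint_iff.1 hnd
            rcases lt_or_gt_of_ne hne with hlt | hlt
            · exact lt_irrefl _ (lac_key hb1 hb2 hσ (hlac P hP) (hlac P' hP') hz hz'
                (by simp) (hD.len_le hP hP' hlt)).1
            · exact lt_irrefl _ (lac_key hb1 hb2 hσ (hlac P' hP') (hlac P hP) hz' hz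
                (by simp) (hD.len_le hP' hP hlt)).1
          rw [h2 P P' hd, norm_zero, mul_zero]
    _ = C ^ 2 * intConst * ∑ P ∈ D, ∑ P' ∈ D with P'.1.1 = P.1.1 ∧
          ¬ Disjoint (band b P) (band b P'), len P'.1 * ‖inner ℂ (e P) (hf.toLp f)‖
          * ‖inner ℂ (e P') (hf.toLp f)‖ * (wt P.1 (lft P'.1) ^ 4)⁻¹ := by
        simp only [Finset.mul_sum]
    _ ≤ C ^ 2 * intConst * (sumConst * ∑ P ∈ D, len P.1 * ‖inner ℂ (e P) (hf.toLp f)‖ ^ 2) := by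
        refine mul_le_mul_of_nonneg_left ?_ (by positivity)
        convert hkey
    _ = _ := by ring

/-- The size of a collection of tiles is controlled by local averages of `f`. -/
theorem Adapted.sizeLe {C A : ℝ} {N W : ℕ} {b : ℝ × ℝ} {c : ℝ} {E : Tile → ℝ → ℂ}
    (h : Adapted C N b c E) (hNW : W + 2 ≤ N) (hN : 6 ≤ N) (hC : 0 ≤ C) (hA0 : 0 ≤ A)
    (hb1 : -18 ≤ b.1) (hb2 : b.2 ≤ 18) {D : Finset Tile} (hD : Sparse D) {Q : ℤ × ℤ}
    {Θ : Finset Top} (hΘ : ∀ t ∈ Θ, dy t.1 ⊆ dy Q) {f : ℝ → H} (hf : Integrable f)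
    (hA : ∀ P ∈ D, ∀ I, dy P.1 ⊆ dy I → dy I ⊆ dy Q →
      ∫ x, ‖f x‖ * (wt I x ^ W)⁻¹ ≤ A * len I) :
    SizeLe b (fun P => ‖∫ x, E P x • f x‖) Θ D
      (√(sizeConst C W (C ^ 2 * intConst * sumConst)) * A) := by
  classical
  intro t ht σ hσ
  have hB : 0 ≤ C ^ 2 * intConst * sumConst :=
    mul_nonneg (mul_nonneg (by positivity) intConst_nonneg) sumConst_pos.le
  rw [mul_pow, Real.sq_sqrt (sizeConst_nonneg hC hB W)]
  unfold lacSum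
  set D' := D.filter fun P => Lac b σ t P with hD'
  have hlac : ∀ P ∈ D', Lac b σ t P := fun P hP => (Finset.mem_filter.1 hP).2
  have hDD : D' ⊆ D := Finset.filter_subset _ _
  have hinj : Set.InjOn (fun P : Tile => P.1) D' := fun P hP P' hP' he =>
    hD.eq_of_inFreq (hDD hP) (hDD hP') he (hlac P hP).1.2 (hlac P' hP').1.2
  obtain ⟨ι, hι⟩ : ∃ ι : ℤ × ℤ → Tile, ∀ P ∈ D', ι P.1 = P := by
    refine ⟨fun I => if hI : ∃ P ∈ D', P.1 = I then hI.choose else (I, 0), fun P hP => ?_⟩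
    have hI : ∃ P' ∈ D', P'.1 = P.1 := ⟨P, hP, rfl⟩
    simp only [dif_pos hI]
    exact hinj hI.choose_spec.1 hP hI.choose_spec.2
  set φ : ℤ × ℤ → ℝ → ℂ := fun I x => ph (c * t.2 * x) * E (ι I) x with hφ
  have hφP : ∀ P ∈ D', φ P.1 = fun x => ph (c * t.2 * x) * E P x := fun P hP => by
    simp only [hφ, hι P hP]
  have hcm : Continuous fun x : ℝ => ph (-(c * t.2 * x)) := continuous_ph.comp (by fun_prop)
  have hwint : ∀ P ∈ D', ∀ g : ℝ → H,
      ∫ x, φ P.1 x • (ph (-(c * t.2 * x)) • g x) = ∫ x, E P x • g x := by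
    intro P hP g
    refine integral_congr_ae (ae_of_all _ fun x => ?_)
    simp only [hφP P hP]
    rw [smul_smul, mul_right_comm, ph_mul_neg, one_mul]
  have hwint' : ∀ P ∈ D', ∀ g : ℝ → H,
      ∫ x, φ P.1 x • g x = ∫ x, E P x • (ph (c * t.2 * x) • g x) := by
    intro P hP g
    refine integral_congr_ae (ae_of_all _ fun x => ?_)
    simp only [hφP P hP, smul_smul]
    rw [mul_comm]
  have hf' : Integrable fun x => ph (-(c * t.2 * x)) • f x := by
    refine hf.bdd_smul 1 hcm.aestronglyMeasurable (ae_of_all _ fun x => (norm_ph _).le)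
  have := size_estimate (H := H) hNW (by omega) hC hA0 hB (J := t.1)
    (T := D'.image fun P => P.1) (φ := φ) (f := fun x => ph (-(c * t.2 * x)) • f x) (A := A)
    ?_ ?_ ?_ ?_ ?_ hf' ?_
  · rw [Finset.sum_image hinj] at this
    refine le_trans (le_of_eq ?_) this
    exact Finset.sum_congr rfl fun P hP => by rw [hwint P hP]
  · simp only [Finset.mem_image]
    rintro _ ⟨P, hP, rfl⟩
    exact (hlac P hP).1.1
  · simp only [Finset.mem_image]
    rintro _ ⟨P, hP, rfl⟩
    rw [hφP P hP]
    exact (continuous_ph.comp (by fun_prop)).mul (h.cont P)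
  · simp only [Finset.mem_image]
    rintro _ ⟨P, hP, rfl⟩
    rw [hφP P hP]
    intro x
    rw [norm_mul, norm_ph, one_mul]
    exact h.decay P x
  · simp only [Finset.mem_image]
    rintro _ ⟨P, hP, rfl⟩
    rw [hφP P hP]
    exact h.lip P _ (hlac P hP).1.2
  · intro g hg
    rw [Finset.sum_image hinj]
    have hg' : MemLp (fun x => ph (c * t.2 * x) • g x) 2 := by
      refine hg.of_le ((continuous_ph.comp (by fun_prop)).aestronglyMeasurable.smul
        hg.aestronglyMeasurable) (ae_of_all _ fun x => ?_)
      rw [norm_smul, norm_ph, one_mul]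
    have hb := h.bessel hN hC hb1 hb2 (hD.mono hDD) hσ hlac hg'
    simp only [norm_smul, norm_ph, one_mul] at hb
    refine le_trans (le_of_eq ?_) hb
    exact Finset.sum_congr rfl fun P hP => by rw [hwint' P hP]
  · simp only [Finset.mem_image]
    rintro _ ⟨P, hP, rfl⟩ I hI hI'
    simp only [norm_smul, norm_ph, one_mul]
    exact hA P (hDD hP) I hI (hI'.trans (hΘ t ht))

end

lemma Selects.le {b : ℝ × ℝ} {a : Tile → ℝ} {Θ : Finset Top} {D : Finset Tile} {En En' : ℝ}
    (h : Selects b a Θ D En) (hE : En ≤ En') : Selects b a Θ D En' := by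
  intro lam hlam D' hD' hs
  obtain ⟨T, Q, h1, h2, h3, h4⟩ := h lam hlam D' hD' hs
  exact ⟨T, Q, h1, h2, h3.trans hE, h4⟩

/-- The size of the piece of a function at height `2 ^ κ.1` and distance `2 ^ κ.2`. -/
noncomputable def pieceSize (K s : ℝ) (W : ℕ) (κ : ℕ × ℕ) : ℝ :=
  K * ((2 : ℝ) ^ (1 - s)) ^ κ.1 * (((2 : ℝ) ^ (W - 4))⁻¹) ^ κ.2

/-- The energy of the piece of a function at height `2 ^ κ.1` and distance `2 ^ κ.2`. -/
noncomputable def pieceEnergy (K s L : ℝ) (κ : ℕ × ℕ) : ℝ :=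
  K * ((2 : ℝ) ^ ((2 - s) / 2)) ^ κ.1 * 4 ^ κ.2 * √L

/-- Coefficients which split into pieces with controlled sizes and energies. -/
def Splits (b : ℝ × ℝ) (a : Tile → ℝ) (Θ : Finset Top) (D : Finset Tile) (K s L : ℝ) (W : ℕ) :
    Prop :=
  ∃ (n : ℕ) (a' : ℕ × ℕ → Tile → ℝ), (∀ κ P, 0 ≤ a' κ P) ∧
    (∀ P ∈ D, a P ≤ ∑ κ ∈ Finset.range n ×ˢ Finset.range n, a' κ P) ∧
    (∀ κ, SizeLe b (a' κ) Θ D (pieceSize K s W κ)) ∧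
    ∀ κ, Selects b (a' κ) Θ D (pieceEnergy K s L κ ^ 2)

lemma piece_bound {K s L θ ε δ : ℝ} {W : ℕ} (hK : 0 < K) (hL : 0 < L) (hε : 0 < ε) (hεθ : ε ≤ θ)
    (hs : 2 * (1 + δ) ≤ s * (1 + θ)) (hW : 3 ≤ ε * (W - 4 : ℕ)) (κ : ℕ × ℕ) :
    pieceSize K s W κ ^ θ * pieceEnergy K s L κ ^ (1 - θ)
      ≤ K * √L ^ (1 - θ) * (((2 : ℝ) ^ (-δ)) ^ κ.1 * (1 / 2) ^ κ.2) := by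
  have h2 : (0 : ℝ) < 2 := by norm_num
  have e1 : pieceSize K s W κ = K * 2 ^ ((1 - s) * κ.1 - (W - 4 : ℕ) * κ.2 : ℝ) := by
    rw [pieceSize, mul_assoc, Real.rpow_sub h2 ((1 - s) * κ.1), Real.rpow_mul h2.le,
      Real.rpow_natCast, Real.rpow_mul h2.le _ (κ.2 : ℝ), Real.rpow_natCast, Real.rpow_natCast,
      inv_pow, div_eq_mul_inv]
  have e2 : pieceEnergy K s L κ = K * √L * 2 ^ ((2 - s) / 2 * κ.1 + 2 * κ.2 : ℝ) := by
    rw [pieceEnergy, Real.rpow_add h2, Real.rpow_mul h2.le, Real.rpow_natCast,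
      Real.rpow_mul h2.le, Real.rpow_natCast]
    norm_num
    ring
  have hq : 0 < √L := Real.sqrt_pos.2 hL
  rw [e1, e2, Real.mul_rpow hK.le (by positivity), Real.mul_rpow (by positivity) (by positivity),
    Real.mul_rpow hK.le hq.le, ← Real.rpow_mul h2.le, ← Real.rpow_mul h2.le]
  have e3 : K ^ θ * K ^ (1 - θ) = K := by rw [← Real.rpow_add hK]; simp
  have e4 : ((2 : ℝ) ^ (-δ)) ^ κ.1 * (1 / 2) ^ κ.2 = 2 ^ (-δ * κ.1 - κ.2 : ℝ) := by
    rw [Real.rpow_sub h2, Real.rpow_mul h2.le, Real.rpow_natCast, Real.rpow_natCast, one_div,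
      inv_pow, div_eq_mul_inv]
  rw [e4]
  calc _ = (K ^ θ * K ^ (1 - θ)) * √L ^ (1 - θ) *
        ((2 : ℝ) ^ (((1 - s) * κ.1 - (W - 4 : ℕ) * κ.2) * θ)
          * 2 ^ (((2 - s) / 2 * κ.1 + 2 * κ.2) * (1 - θ))) := by ring
    _ ≤ _ := by
      rw [e3, ← Real.rpow_add h2]
      refine mul_le_mul_of_nonneg_left ?_ (by positivity)
      refine Real.rpow_le_rpow_of_exponent_le (by norm_num) ?_
      have k0 : (0 : ℝ) ≤ κ.1 := Nat.cast_nonneg _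
      have m0 : (0 : ℝ) ≤ κ.2 := Nat.cast_nonneg _
      have w0 : (0 : ℝ) ≤ (W - 4 : ℕ) := Nat.cast_nonneg _
      have h3 : 3 ≤ θ * (W - 4 : ℕ) := hW.trans (by gcongr)
      have h4 : (1 - s * (1 + θ) / 2) * κ.1 ≤ -δ * κ.1 := by gcongr; linarith
      have h5 : (-((W - 4 : ℕ) * θ) + 2 * (1 - θ)) * κ.2 ≤ (-1) * κ.2 := by
        gcongr; nlinarith
      linarith

/-- The constant of `local_estimate`. -/
noncomputable def localConst (K ε δ : ℝ) : ℝ :=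
  coreConst ε * (K * ((1 - (2 : ℝ) ^ (-δ))⁻¹ * 2)) ^ 3

lemma coreConst_nonneg {ε : ℝ} (hε : 0 < ε) : 0 ≤ coreConst ε := by
  have : (8 : ℝ) ^ (-ε) < 1 := Real.rpow_lt_one_of_one_lt_of_neg (by norm_num) (by linarith)
  have : 0 < 1 - (8 : ℝ) ^ (-ε) := by linarith
  unfold coreConst
  positivity

/-- The model form localized to an interval of length `L`. -/
theorem local_estimate {a : Fin 3 → Tile → ℝ} (ha : ∀ j P, 0 ≤ a j P) {Θ : Finset Top}
    {D : Finset Tile} (h1 : ∀ j, Singles (bd j) Θ D) {K L ε δ : ℝ} {s θ : Fin 3 → ℝ} {W : ℕ}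
    (hK : 0 < K) (hL : 0 < L) (hsp : ∀ j, Splits (bd j) (a j) Θ D K (s j) L W)
    (hθ : ∑ j, θ j = 1) (hε : 0 < ε) (hθ0 : ∀ j, ε ≤ θ j) (hθ1 : ∀ j, θ j + ε ≤ 1) (hδ : 0 < δ)
    (hs : ∀ j, 2 * (1 + δ) ≤ s j * (1 + θ j)) (hW : 3 ≤ ε * (W - 4 : ℕ)) :
    ∑ P ∈ D, len P.1 * ∏ j, a j P ≤ localConst K ε δ * L := by
  classical
  choose n a' ha' hle hS hE using hsp
  set 𝒦 : Fin 3 → Finset (ℕ × ℕ) := fun j => Finset.range (n j) ×ˢ Finset.range (n j) with h𝒦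
  have hc := coreConst_nonneg hε
  set ρ := (2 : ℝ) ^ (-δ) with hρ
  have hρ0 : 0 ≤ ρ := by positivity
  have hρ1 : ρ < 1 := Real.rpow_lt_one_of_one_lt_of_neg (by norm_num) (by linarith)
  have hρ2 : 0 < 1 - ρ := by linarith
  have hpS : ∀ j κ, 0 < pieceSize K (s j) W κ := fun j κ => by unfold pieceSize; positivity
  have hpE : ∀ j κ, 0 < pieceEnergy K (s j) L κ := fun j κ => by unfold pieceEnergy; positivity
  have hsum : ∀ j, ∑ κ ∈ 𝒦 j, pieceSize K (s j) W κ ^ θ j * pieceEnergy K (s j) L κ ^ (1 - θ j)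
      ≤ K * √L ^ (1 - θ j) * ((1 - ρ)⁻¹ * 2) := by
    intro j
    calc _ ≤ ∑ κ ∈ 𝒦 j, K * √L ^ (1 - θ j) * (ρ ^ κ.1 * (1 / 2) ^ κ.2) :=
          Finset.sum_le_sum fun κ _ => piece_bound hK hL hε (hθ0 j) (hs j) hW κ
      _ = K * √L ^ (1 - θ j) * ((∑ k ∈ Finset.range (n j), ρ ^ k)
          * ∑ m ∈ Finset.range (n j), (1 / 2 : ℝ) ^ m) := by
          rw [← Finset.mul_sum, Finset.sum_product, Finset.sum_mul_sum]
      _ ≤ _ := by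
          gcongr
          · rw [← tsum_geometric_of_lt_one hρ0 hρ1]
            exact (summable_geometric_of_lt_one hρ0 hρ1).sum_le_tsum _ fun _ _ => by positivity
          · exact sum_geometric_two_le _
  calc ∑ P ∈ D, len P.1 * ∏ j, a j P
      ≤ ∑ P ∈ D, len P.1 * ∏ j, ∑ κ ∈ 𝒦 j, a' j κ P := by
        refine Finset.sum_le_sum fun P hP => ?_
        have := len_pos P.1
        gcongr with j
        · exact fun j _ => ha j P
        · exact hle j P hP
    _ = ∑ κ ∈ Fintype.piFinset 𝒦, ∑ P ∈ D, len P.1 * ∏ j, a' j (κ j) P := by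
        rw [Finset.sum_comm]
        refine Finset.sum_congr rfl fun P _ => ?_
        rw [Finset.prod_univ_sum, Finset.mul_sum]
    _ ≤ ∑ κ ∈ Fintype.piFinset 𝒦, coreConst ε * ∏ j, pieceSize K (s j) W (κ j) ^ θ j
          * pieceEnergy K (s j) L (κ j) ^ (1 - θ j) :=
        Finset.sum_le_sum fun κ _ => core_estimate (fun j P => ha' j (κ j) P) h1
          (fun j => hpS j _) (fun j => hpE j _) (fun j => hE j _) (fun j => hS j _) hθ hε hθ0 hθ1
    _ = coreConst ε * ∏ j, ∑ κ ∈ 𝒦 j, pieceSize K (s j) W κ ^ θ j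
          * pieceEnergy K (s j) L κ ^ (1 - θ j) := by
        rw [← Finset.mul_sum, Finset.prod_univ_sum]
    _ ≤ coreConst ε * ∏ j, K * √L ^ (1 - θ j) * ((1 - ρ)⁻¹ * 2) := by
        gcongr with j
        · exact fun j _ => Finset.sum_nonneg fun κ _ =>
            (mul_pos (Real.rpow_pos_of_pos (hpS j κ) _) (Real.rpow_pos_of_pos (hpE j κ) _)).le
        · exact hsum j
    _ = _ := by
        have hq : 0 < √L := Real.sqrt_pos.2 hL
        have e : ∏ j : Fin 3, √L ^ (1 - θ j) = L := by
          rw [← Real.rpow_sum_of_pos hq, Finset.sum_sub_distrib, hθ]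
          simp only [Finset.sum_const, Finset.card_univ, Fintype.card_fin]
          norm_num
          exact Real.sq_sqrt hL.le
        rw [Finset.prod_mul_distrib, Finset.prod_mul_distrib, e, localConst]
        simp only [Finset.prod_const, Finset.card_univ, Fintype.card_fin]
        ring

lemma le_two_pow_size (x : ℝ) : x < 2 ^ Nat.size ⌊x⌋₊ := by
  have h1 := Nat.lt_size_self ⌊x⌋₊
  have h2 := Nat.lt_of_floor_lt h1
  exact_mod_cast h2

lemma two_pow_size_le {x : ℝ} (hx : 1 ≤ x) : (2 : ℝ) ^ Nat.size ⌊x⌋₊ ≤ 2 * x := by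
  have h0 : 0 < ⌊x⌋₊ := Nat.floor_pos.2 hx
  obtain ⟨k, hk⟩ := Nat.exists_eq_succ_of_ne_zero (Nat.size_pos.2 h0).ne'
  have h1 : k < Nat.size ⌊x⌋₊ := by omega
  have h2 : (2 : ℝ) ^ k ≤ ⌊x⌋₊ := by exact_mod_cast Nat.lt_size.1 h1
  have h3 := Nat.floor_le (zero_le_one.trans hx)
  rw [hk, Nat.succ_eq_add_one, pow_succ]
  linarith

lemma le_two_mul_rpow_size {s x : ℝ} (hs1 : 1 ≤ s) (hs2 : s ≤ 2) (hx : 0 ≤ x) :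
    x ≤ 2 * ((2 : ℝ) ^ (1 - s)) ^ Nat.size ⌊x⌋₊ * (x ^ s + 1) := by
  have hp : 0 ≤ x ^ s := Real.rpow_nonneg hx s
  rcases lt_or_ge x 1 with h | h
  · have : ⌊x⌋₊ = 0 := Nat.floor_eq_zero.2 h
    rw [this, Nat.size_zero, pow_zero]
    linarith
  · have hx0 : 0 < x := by linarith
    have h1 := two_pow_size_le h
    set k := Nat.size ⌊x⌋₊
    have h2 : x ^ (1 - s) ≤ ((2 : ℝ) ^ k / 2) ^ (1 - s) :=
      Real.rpow_le_rpow_of_nonpos (by positivity) (by linarith) (by linarith)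
    have h3 : ((2 : ℝ) ^ k / 2) ^ (1 - s) = ((2 : ℝ) ^ (1 - s)) ^ k * 2 ^ (s - 1) := by
      rw [Real.div_rpow (by positivity) (by norm_num), ← Real.rpow_natCast, ← Real.rpow_natCast,
        ← Real.rpow_mul (by norm_num), ← Real.rpow_mul (by norm_num), mul_comm (k : ℝ),
        div_eq_mul_inv, ← Real.rpow_neg (by norm_num)]
      congr 2; ring
    have h4 : (2 : ℝ) ^ (s - 1) ≤ 2 := by
      calc (2 : ℝ) ^ (s - 1) ≤ 2 ^ (1 : ℝ) :=
            Real.rpow_le_rpow_of_exponent_le (by norm_num) (by linarith)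
        _ = 2 := by simp
    calc x = x ^ s * x ^ (1 - s) := by rw [← Real.rpow_add hx0]; simp
      _ ≤ (x ^ s + 1) * (((2 : ℝ) ^ (1 - s)) ^ k * 2) := by
          gcongr
          · linarith
          · rw [h3] at h2
            exact h2.trans (by gcongr)
      _ = _ := by ring

lemma sq_le_rpow_size {s x : ℝ} (hs1 : 1 ≤ s) (hs2 : s ≤ 2) (hx : 0 ≤ x) :
    x ^ 2 ≤ ((2 : ℝ) ^ (2 - s)) ^ Nat.size ⌊x⌋₊ * x ^ s := by
  rcases hx.eq_or_lt with rfl | hx0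
  · rw [Real.zero_rpow (by linarith)]; simp
  have h1 := le_two_pow_size x
  set k := Nat.size ⌊x⌋₊
  calc x ^ 2 = x ^ (2 - s) * x ^ s := by rw [← Real.rpow_add hx0]; simp
    _ ≤ ((2 : ℝ) ^ k) ^ (2 - s) * x ^ s := by gcongr
    _ = _ := by
        rw [← Real.rpow_natCast, ← Real.rpow_natCast, ← Real.rpow_mul (by norm_num),
          ← Real.rpow_mul (by norm_num), mul_comm (k : ℝ)]

lemma wt_le_two_mul_wt {I Q : ℤ × ℤ} (h : dy I ⊆ dy Q) (x : ℝ) : wt Q x ≤ 2 * wt I x := by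
  have hk := len_le_len (scale_le_of_subset h)
  have hI := len_pos I
  have hQ := len_pos Q
  have h1 := abs_sub_le_of_mem_dy (h (lft_mem_dy I)) (lft_mem_dy Q)
  rw [wt_eq, wt_eq]
  have h2 : |x - lft Q| ≤ |x - lft I| + len Q :=
    (abs_sub_le x (lft I) (lft Q)).trans (by linarith)
  have h3 : |x - lft Q| / len Q ≤ |x - lft I| / len I + 1 :=
    calc |x - lft Q| / len Q ≤ (|x - lft I| + len Q) / len Q := by gcongr
      _ = |x - lft I| / len Q + 1 := by field_simp
      _ ≤ _ := by gcongr
  have : 0 ≤ |x - lft I| / len I := by positivity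
  linarith

lemma wt_inv_le_of_size {I Q : ℤ × ℤ} (h : dy I ⊆ dy Q) {x : ℝ} {m W : ℕ} (hW : 4 ≤ W)
    (hm : m ≤ Nat.size ⌊wt Q x⌋₊) :
    (wt I x ^ W)⁻¹ ≤ 4 ^ W * (((2 : ℝ) ^ (W - 4))⁻¹) ^ m * (wt I x ^ 4)⁻¹ := by
  have h1 := two_pow_size_le (one_le_wt Q x)
  have h2 := wt_le_two_mul_wt h x
  have hw := wt_pos I x
  have h3 : (2 : ℝ) ^ m ≤ 4 * wt I x := by
    calc (2 : ℝ) ^ m ≤ 2 ^ Nat.size ⌊wt Q x⌋₊ := pow_le_pow_right₀ (by norm_num) hm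
      _ ≤ _ := by linarith
  have h4 : ((2 : ℝ) ^ (W - 4)) ^ m ≤ 4 ^ W * wt I x ^ (W - 4) := by
    calc ((2 : ℝ) ^ (W - 4)) ^ m = ((2 : ℝ) ^ m) ^ (W - 4) := by rw [← pow_mul, ← pow_mul, mul_comm]
      _ ≤ (4 * wt I x) ^ (W - 4) := by gcongr
      _ = 4 ^ (W - 4) * wt I x ^ (W - 4) := mul_pow _ _ _
      _ ≤ _ := by gcongr <;> norm_num
  have e : wt I x ^ W = wt I x ^ (W - 4) * wt I x ^ 4 := by rw [← pow_add]; congr 1; omega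
  rw [e, mul_inv, inv_pow]
  refine mul_le_mul_of_nonneg_right ?_ (by positivity)
  rw [← div_eq_mul_inv, le_div_iff₀ (by positivity), inv_mul_le_iff₀ (by positivity)]
  linarith

/-- The constant of `Adapted.splits`. -/
noncomputable def splitConst (C : ℝ) (W : ℕ) : ℝ :=
  √(sizeConst C W (C ^ 2 * intConst * sumConst)) * (2 * 4 ^ W * (1 + intConst))
    + √(2 * (C ^ 2 * intConst) * energyConst) + 1

lemma splitConst_pos (C : ℝ) (W : ℕ) : 0 < splitConst C W := by
  have := intConst_nonneg
  unfold splitConst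
  positivity

variable {H : Type*} [NormedAddCommGroup H]

lemma integrable_rpow_mul_wt {f : ℝ → H} (hfm : StronglyMeasurable f) {B s : ℝ} (hs : 0 ≤ s)
    (hB : ∀ x, ‖f x‖ ≤ B) (I : ℤ × ℤ) : Integrable fun x => ‖f x‖ ^ s * (wt I x ^ 4)⁻¹ := by
  refine ((integrable_wt_pow I (N := 4) (by norm_num)).const_mul (B ^ s)).mono'
    ((hfm.norm.measurable.pow_const s).aestronglyMeasurable.mul
      (integrable_wt_pow I (N := 4) (by norm_num)).aestronglyMeasurable)
    (ae_of_all _ fun x => ?_)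
  have h1 := wt_pos I x
  have h2 := hB x
  have h3 := norm_nonneg (f x)
  rw [Real.norm_of_nonneg (by positivity)]
  gcongr

variable [InnerProductSpace ℂ H] [CompleteSpace H]

/-- Decomposition of the coefficients of a bounded function according to the height of the function
and to the distance to `Q`. -/
theorem Adapted.splits {C : ℝ} {N W : ℕ} {b : ℝ × ℝ} {c : ℝ} {E : Tile → ℝ → ℂ}
    (h : Adapted C N b c E) (hNW : W + 2 ≤ N) (hW : 4 ≤ W) (hC : 0 ≤ C)
    (hb1 : -18 ≤ b.1) (hb2 : b.2 ≤ 18) {D : Finset Tile} (hD : Sparse D) {Q : ℤ × ℤ}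
    {Θ : Finset Top} (hΘ : ∀ t ∈ Θ, dy t.1 ⊆ dy Q) (hS : Singles b Θ D)
    {f : ℝ → H} (hf : Integrable f) (hfm : StronglyMeasurable f) {B s : ℝ} (hs1 : 1 ≤ s)
    (hs2 : s ≤ 2) (hB : ∀ x, ‖f x‖ ≤ B) (hQ : ∃ P ∈ D, dy P.1 ⊆ dy Q)
    (hA : ∀ P ∈ D, ∀ I, dy P.1 ⊆ dy I → dy I ⊆ dy Q →
      ∫ x, ‖f x‖ ^ s * (wt I x ^ 4)⁻¹ ≤ len I) :
    Splits b (fun P => ‖∫ x, E P x • f x‖) Θ D (splitConst C W) s (len Q) W := by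
  classical
  have hN : 6 ≤ N := by omega
  have hi := intConst_nonneg
  have hlQ := len_pos Q
  obtain ⟨P₀, hP₀, hP₀Q⟩ := hQ
  have hf2 : Integrable fun x => ‖f x‖ ^ 2 := by
    refine (hf.norm.mul_const B).mono' (hfm.norm.measurable.pow_const 2).aestronglyMeasurable
      (ae_of_all _ fun x => ?_)
    rw [Real.norm_of_nonneg (by positivity), pow_two]
    exact mul_le_mul_of_nonneg_left (hB x) (norm_nonneg _)
  obtain ⟨n, hn⟩ : ∃ n : ℕ, B < 2 ^ n ∧ ∫ x, ‖f x‖ ^ 2 ≤ 16 ^ n * len Q := by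
    obtain ⟨n, hn⟩ := pow_unbounded_of_one_lt (max B ((∫ x, ‖f x‖ ^ 2) / len Q))
      (by norm_num : (1 : ℝ) < 2)
    have h1 := (max_lt_iff.1 hn).2
    rw [div_lt_iff₀ hlQ] at h1
    refine ⟨n, (max_lt_iff.1 hn).1, h1.le.trans ?_⟩
    gcongr
    norm_num
  set kf : ℝ → ℕ := fun x => Nat.size ⌊‖f x‖⌋₊ with hkf
  set mf : ℝ → ℕ := fun x => min (Nat.size ⌊wt Q x⌋₊) n with hmf
  have hkm : Measurable kf := measurable_from_nat.comp (Nat.measurable_floor.comp hfm.norm.measurable)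
  have hmm : Measurable mf := (measurable_from_nat (f := fun k => min (Nat.size k) n)).comp
    (Nat.measurable_floor.comp (continuous_wt Q).measurable)
  set S : ℕ × ℕ → Set ℝ := fun κ => {x | (kf x, mf x) = κ} with hSdef
  have hSm : ∀ κ, MeasurableSet (S κ) := fun κ => (hkm.prodMk hmm) (measurableSet_singleton κ)
  set g : ℕ × ℕ → ℝ → H := fun κ => (S κ).indicator f with hg
  have hgi : ∀ κ, Integrable (g κ) := fun κ => hf.indicator (hSm κ)
  have hkn : ∀ x, kf x < n + 1 := by
    intro x
    have h1 : ⌊‖f x‖⌋₊ < 2 ^ n := by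
      rw [Nat.floor_lt (norm_nonneg _)]
      exact_mod_cast (hB x).trans_lt hn.1
    exact Nat.lt_succ_of_le (Nat.size_le.2 h1)
  have hmn : ∀ x, mf x < n + 1 := fun x => Nat.lt_succ_of_le (min_le_right _ _)
  have hnorm : ∀ κ x, ‖g κ x‖ = (S κ).indicator (fun x => ‖f x‖) x := fun κ x =>
    norm_indicator_eq_indicator_norm f x
  refine ⟨n + 1, fun κ P => ‖∫ x, E P x • g κ x‖, fun κ P => norm_nonneg _, fun P _ => ?_,
    fun κ => ?_, fun κ => ?_⟩
  · have hsum : ∀ x, E P x • f x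
        = ∑ κ ∈ Finset.range (n + 1) ×ˢ Finset.range (n + 1), E P x • g κ x := by
      intro x
      rw [Finset.sum_eq_single (kf x, mf x)]
      · rw [hg]; simp [S]
      · intro κ _ hκ
        have : x ∉ S κ := fun hx => hκ hx.symm
        rw [hg]; simp [this]
      · intro hx
        exact absurd (by simp only [Finset.mem_product, Finset.mem_range]; exact ⟨hkn x, hmn x⟩) hx
    simp_rw [hsum]
    rw [integral_finsetSum _ fun κ _ => (h.decay P).integrable_smul hC (h.cont P) (hgi κ)]
    exact norm_sum_le _ _
  · have h1 := h.sizeLe hNW hN hC (A := 2 * 4 ^ W * (1 + intConst) * ((2 : ℝ) ^ (1 - s)) ^ κ.1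
      * (((2 : ℝ) ^ (W - 4))⁻¹) ^ κ.2) (by positivity) hb1 hb2 hD hΘ (hgi κ) (fun P hP I hPI hIQ => ?_)
    · intro t ht σ hσ
      refine (h1 t ht σ hσ).trans ?_
      have ht := len_pos t.1
      gcongr
      unfold pieceSize splitConst
      have hq := Real.sqrt_nonneg (2 * (C ^ 2 * intConst) * energyConst)
      have hz : 0 ≤ ((2 : ℝ) ^ (1 - s)) ^ κ.1 * (((2 : ℝ) ^ (W - 4))⁻¹) ^ κ.2 := by positivity
      nlinarith [mul_nonneg hq hz]
    · have hI := len_pos I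
      have hw : ∀ x, 0 < wt I x := wt_pos I
      calc ∫ x, ‖g κ x‖ * (wt I x ^ W)⁻¹
          ≤ ∫ x, 2 * 4 ^ W * ((2 : ℝ) ^ (1 - s)) ^ κ.1 * (((2 : ℝ) ^ (W - 4))⁻¹) ^ κ.2
            * (‖f x‖ ^ s * (wt I x ^ 4)⁻¹ + (wt I x ^ 2)⁻¹) := by
            refine integral_mono (integrable_norm_wt (hgi κ) I W)
              (((integrable_rpow_mul_wt hfm (by linarith) hB I).add (integrable_wt I)).const_mul _)
              fun x => ?_
            have := hw x
            simp only [hnorm]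
            by_cases hx : x ∈ S κ
            · rw [indicator_of_mem hx]
              have e : (kf x, mf x) = κ := hx
              have h2 := le_two_mul_rpow_size hs1 hs2 (norm_nonneg (f x))
              have h3 := wt_inv_le_of_size hIQ (x := x) hW (m := κ.2)
                (by rw [← e]; exact min_le_left _ _)
              rw [show Nat.size ⌊‖f x‖⌋₊ = κ.1 by rw [← e]] at h2
              have h4 := wt_pow_inv_le I x (show 2 ≤ 4 by norm_num)
              calc ‖f x‖ * (wt I x ^ W)⁻¹
                  ≤ (2 * ((2 : ℝ) ^ (1 - s)) ^ κ.1 * (‖f x‖ ^ s + 1))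
                    * (4 ^ W * (((2 : ℝ) ^ (W - 4))⁻¹) ^ κ.2 * (wt I x ^ 4)⁻¹) := by gcongr
                _ = 2 * 4 ^ W * ((2 : ℝ) ^ (1 - s)) ^ κ.1 * (((2 : ℝ) ^ (W - 4))⁻¹) ^ κ.2
                    * (‖f x‖ ^ s * (wt I x ^ 4)⁻¹ + (wt I x ^ 4)⁻¹) := by ring
                _ ≤ _ := by gcongr
            · rw [indicator_of_notMem hx, zero_mul]
              have := norm_nonneg (f x)
              positivity
        _ ≤ 2 * 4 ^ W * ((2 : ℝ) ^ (1 - s)) ^ κ.1 * (((2 : ℝ) ^ (W - 4))⁻¹) ^ κ.2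
            * (len I + len I * intConst) := by
            rw [integral_const_mul, integral_add (integrable_rpow_mul_wt hfm (by linarith) hB I)
              (integrable_wt I), integral_wt]
            have := hA P hP I hPI hIQ
            gcongr
        _ = _ := by ring
  · have hgn : ∀ x, ‖g κ x‖ ≤ ‖f x‖ := fun x => norm_indicator_le_norm_self _ _
    have hg2 : Integrable fun x => ‖g κ x‖ ^ 2 := by
      refine hf2.mono' ((hgi κ).aestronglyMeasurable.norm.pow 2) (ae_of_all _ fun x => ?_)
      rw [Real.norm_of_nonneg (by positivity)]
      gcongr
      exact hgn x
    have hgL : MemLp (g κ) 2 :=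
      (memLp_two_iff_integrable_sq_norm (hgi κ).aestronglyMeasurable).2 hg2
    refine (h.selects hN hC hb1 hb2 hD hS hgL).le ?_
    have hr : (1 : ℝ) ≤ (2 : ℝ) ^ (2 - s) := Real.one_le_rpow (by norm_num) (by linarith)
    have hI2 : ∫ x, ‖g κ x‖ ^ 2 ≤ ((2 : ℝ) ^ (2 - s)) ^ κ.1 * 16 ^ κ.2 * len Q := by
      rcases eq_or_ne κ.2 n with hκ | hκ
      · calc ∫ x, ‖g κ x‖ ^ 2 ≤ ∫ x, ‖f x‖ ^ 2 := integral_mono hg2 hf2 fun x => by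
              simp only; gcongr; exact hgn x
          _ ≤ 1 * 16 ^ κ.2 * len Q := by rw [hκ, one_mul]; exact hn.2
          _ ≤ _ := by gcongr; exact one_le_pow₀ hr
      · have hwint := integrable_rpow_mul_wt hfm (s := s) (by linarith) hB Q
        calc ∫ x, ‖g κ x‖ ^ 2
            ≤ ∫ x, ((2 : ℝ) ^ (2 - s)) ^ κ.1 * 16 ^ κ.2 * (‖f x‖ ^ s * (wt Q x ^ 4)⁻¹) := by
              refine integral_mono hg2 (hwint.const_mul _) fun x => ?_
              have hw := wt_pos Q x
              have hfs := norm_nonneg (f x)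
              simp only [hnorm]
              by_cases hx : x ∈ S κ
              · rw [indicator_of_mem hx]
                have e : (kf x, mf x) = κ := hx
                have h2 := sq_le_rpow_size hs1 hs2 hfs
                rw [show Nat.size ⌊‖f x‖⌋₊ = κ.1 by rw [← e]] at h2
                have h3 : wt Q x < 2 ^ κ.2 := by
                  have h4 := le_two_pow_size (wt Q x)
                  have h5 : κ.2 = min (Nat.size ⌊wt Q x⌋₊) n := by rw [← e]
                  rwa [show Nat.size ⌊wt Q x⌋₊ = κ.2 by omega] at h4
                have h4 : 1 ≤ (16 : ℝ) ^ κ.2 * (wt Q x ^ 4)⁻¹ := by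
                  rw [← div_eq_mul_inv, one_le_div (by positivity)]
                  calc wt Q x ^ 4 ≤ (2 ^ κ.2) ^ 4 := by gcongr
                    _ = 16 ^ κ.2 := by rw [← pow_mul, mul_comm, pow_mul]; norm_num
                calc ‖f x‖ ^ 2 ≤ ((2 : ℝ) ^ (2 - s)) ^ κ.1 * ‖f x‖ ^ s * 1 := by rwa [mul_one]
                  _ ≤ ((2 : ℝ) ^ (2 - s)) ^ κ.1 * ‖f x‖ ^ s * (16 ^ κ.2 * (wt Q x ^ 4)⁻¹) := by
                      gcongr
                  _ = _ := by ring
              · rw [indicator_of_notMem hx, zero_pow two_ne_zero]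
                positivity
          _ ≤ _ := by
              rw [integral_const_mul]
              have := hA P₀ hP₀ Q hP₀Q subset_rfl
              gcongr
    have hce := energyConst_pos
    have hK : 2 * (C ^ 2 * intConst) * energyConst ≤ splitConst C W ^ 2 := by
      have h1 := Real.sq_sqrt (show 0 ≤ 2 * (C ^ 2 * intConst) * energyConst by positivity)
      rw [← h1]
      gcongr
      unfold splitConst
      have : 0 ≤ √(sizeConst C W (C ^ 2 * intConst * sumConst)) * (2 * 4 ^ W * (1 + intConst)) := by
        positivity
      linarith
    have e1 : (((2 : ℝ) ^ ((2 - s) / 2)) ^ κ.1) ^ 2 = ((2 : ℝ) ^ (2 - s)) ^ κ.1 := by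
      rw [← pow_mul, mul_comm, pow_mul, ← Real.rpow_natCast ((2 : ℝ) ^ ((2 - s) / 2)) 2,
        ← Real.rpow_mul (by norm_num)]
      norm_num
    calc 2 * (C ^ 2 * intConst) * energyConst * ∫ x, ‖g κ x‖ ^ 2
        ≤ splitConst C W ^ 2 * (((2 : ℝ) ^ (2 - s)) ^ κ.1 * 16 ^ κ.2 * len Q) := by gcongr
      _ = _ := by
          rw [pieceEnergy, mul_pow, mul_pow, mul_pow, e1, Real.sq_sqrt hlQ.le, ← pow_mul, mul_comm κ.2,
            pow_mul]
          norm_num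
          ring

/-- The constant of `grouping`. -/
noncomputable def groupConst (ρ : ℝ) : ℝ := 2 ^ ρ * (2 * (1 - (2 : ℝ) ^ (-ρ))⁻¹)

lemma sum_zpow_rpow_le {ρ : ℝ} (hρ : 0 < ρ) {m : ℤ} (s : Finset ℤ) (hs : ∀ k ∈ s, k ≤ m) :
    ∑ k ∈ s, ((2 : ℝ) ^ k) ^ ρ ≤ ((2 : ℝ) ^ m) ^ ρ * (2 * (1 - (2 : ℝ) ^ (-ρ))⁻¹) := by
  have h2 : (2 : ℝ) ^ (-ρ) < 1 := Real.rpow_lt_one_of_one_lt_of_neg (by norm_num) (by linarith)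
  have h := sum_rpow_natAbs_le (by positivity) h2 (s.image fun k => m - k)
  rw [Finset.sum_image fun x _ y _ h => by simpa using h] at h
  calc _ = ∑ k ∈ s, ((2 : ℝ) ^ m) ^ ρ * ((2 : ℝ) ^ (-ρ)) ^ (m - k).natAbs := by
        refine Finset.sum_congr rfl fun k hk => ?_
        have h3 : ((m - k).natAbs : ℝ) = m - k := by
          have : ((m - k).natAbs : ℤ) = m - k := Int.natAbs_of_nonneg (by linarith [hs k hk])
          rw [← Int.cast_natCast, this, Int.cast_sub]
        rw [← Real.rpow_natCast, ← Real.rpow_mul (by norm_num), ← Real.rpow_intCast,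
          ← Real.rpow_intCast, ← Real.rpow_mul (by norm_num), ← Real.rpow_mul (by norm_num), h3,
          ← Real.rpow_add (by norm_num)]
        congr 1; ring
    _ ≤ _ := by
        rw [← Finset.mul_sum]
        gcongr

set_option maxHeartbeats 1000000 in
/-- Splitting a collection of tiles according to the levels of several functions. -/
theorem grouping {ι : Type*} [Fintype ι] {ρ : ℝ} (hρ : 0 < ρ) {Φ : Finset Tile → ℝ≥0∞}
    (hΦ0 : Φ ∅ = 0) (hΦ : ∀ D₁ D₂ : Finset Tile, Disjoint D₁ D₂ → Φ (D₁ ∪ D₂) ≤ Φ D₁ + Φ D₂)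
    {u : ι → Tile → ℝ} (hu : ∀ j P, 0 < u j P) {D : Finset Tile} {M : ι → ℝ → ℝ≥0∞}
    (hM : ∀ j, ∀ P ∈ D, ∀ x ∈ dy P.1, ENNReal.ofReal (u j P) ≤ M j x) {C : ℝ≥0∞}
    (h : ∀ D' ⊆ D, D'.Nonempty → ∀ (Q : ℤ × ℤ) (A : ι → ℝ), (∀ j, 0 < A j) →
      (∀ P ∈ D', dy P.1 ⊆ dy Q) → (∀ j, ∀ P ∈ D', u j P ≤ A j) →
      Φ D' ≤ C * ENNReal.ofReal (len Q * ∏ j, A j ^ ρ)) :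
    Φ D ≤ C * (ENNReal.ofReal (groupConst ρ) ^ Fintype.card ι * ∫⁻ x, ∏ j, M j x ^ ρ) := by
  classical
  set κ : Tile → ι → ℤ := fun P j => Int.clog 2 (u j P) with hκ
  have hκ1 : ∀ P j, u j P ≤ (2 : ℝ) ^ κ P j := fun P j => by
    simpa using Int.self_le_zpow_clog (b := 2) (by norm_num) (u j P)
  have hκ2 : ∀ P j, (2 : ℝ) ^ (κ P j - 1) < u j P := fun P j => by
    simpa using Int.zpow_pred_clog_lt_self (b := 2) (by norm_num) (hu j P)
  set G : (ι → ℤ) → Finset Tile := fun k => D.filter fun P => κ P = k with hG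
  set IsM : (ι → ℤ) → ℤ × ℤ → Prop := fun k Q =>
    ∀ P ∈ G k, dy Q ⊆ dy P.1 → P.1 = Q with hIsM
  set 𝒬 : (ι → ℤ) → Finset (ℤ × ℤ) := fun k => ((G k).image Prod.fst).filter (IsM k) with h𝒬
  have hmax : ∀ P ∈ D, ∃ Q ∈ 𝒬 (κ P), dy P.1 ⊆ dy Q := by
    intro P hP
    have hne : ((G (κ P)).filter fun P' => dy P.1 ⊆ dy P'.1).Nonempty :=
      ⟨P, by simp [G, hP]⟩
    obtain ⟨P', hP', hm⟩ := Finset.exists_max_image _ (fun P' => P'.1.1) hne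
    rw [Finset.mem_filter] at hP'
    refine ⟨P'.1, ?_, hP'.2⟩
    rw [h𝒬, Finset.mem_filter]
    refine ⟨Finset.mem_image_of_mem _ hP'.1, fun P'' hP'' hs => ?_⟩
    exact (eq_of_dy_subset hs (hm P'' (Finset.mem_filter.2 ⟨hP'', hP'.2.trans hs⟩))).symm
  have hdisj : ∀ k, ∀ Q ∈ 𝒬 k, ∀ Q' ∈ 𝒬 k, ∀ x ∈ dy Q, x ∈ dy Q' → Q = Q' := by
    have key : ∀ k, ∀ Q ∈ 𝒬 k, ∀ Q' ∈ 𝒬 k, ∀ x ∈ dy Q, x ∈ dy Q' → Q.1 ≤ Q'.1 → Q = Q' := by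
      intro k Q hQ Q' hQ' x hx hx' hle
      rw [h𝒬, Finset.mem_filter] at hQ hQ'
      obtain ⟨P', hP', e⟩ := Finset.mem_image.1 hQ'.1
      have := hQ.2 P' hP' (by rw [e]; exact dy_subset_of_mem hle hx hx')
      rw [← this, e]
    intro k Q hQ Q' hQ' x hx hx'
    rcases le_total Q.1 Q'.1 with hle | hle
    · exact key k Q hQ Q' hQ' x hx hx' hle
    · exact (key k Q' hQ' Q hQ x hx' hx hle).symm
  choose! sel hsel1 hsel2 using hmax
  set g : Tile → (ι → ℤ) × (ℤ × ℤ) := fun P => (κ P, sel P) with hg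
  have hsum : ∀ s : Finset ((ι → ℤ) × (ℤ × ℤ)),
      Φ (D.filter fun P => g P ∈ s) ≤ ∑ τ ∈ s, Φ (D.filter fun P => g P = τ) := by
    intro s
    induction s using Finset.induction_on with
    | empty => simp [hΦ0]
    | insert τ s hτ ih =>
      have e : (D.filter fun P => g P ∈ insert τ s)
          = (D.filter fun P => g P = τ) ∪ D.filter fun P => g P ∈ s := by
        rw [← Finset.filter_or]; simp [Finset.mem_insert]
      rw [e, Finset.sum_insert hτ]
      refine (hΦ _ _ ?_).trans (add_le_add le_rfl ih)
      refine Finset.disjoint_filter.2 fun P _ h1 h2 => hτ (h1 ▸ h2)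
  set T := D.image g with hT
  have hDT : (D.filter fun P => g P ∈ T) = D :=
    Finset.filter_true_of_mem fun P hP => Finset.mem_image_of_mem g hP
  have hone : ∀ τ ∈ T, Φ (D.filter fun P => g P = τ)
      ≤ C * ∫⁻ x, (dy τ.2).indicator (fun _ => ENNReal.ofReal (∏ j, ((2 : ℝ) ^ τ.1 j) ^ ρ)) x := by
    intro τ hτ
    rw [lintegral_indicator_const (measurableSet_dy _), volume_dy, mul_comm (ENNReal.ofReal _),
      ← ENNReal.ofReal_mul (len_pos _).le]
    refine h _ (Finset.filter_subset _ _) ?_ τ.2 (fun j => 2 ^ τ.1 j) (fun j => by positivity) ?_ ?_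
    · obtain ⟨P, hP, e⟩ := Finset.mem_image.1 hτ
      exact ⟨P, Finset.mem_filter.2 ⟨hP, e⟩⟩
    · intro P hP
      rw [Finset.mem_filter] at hP
      rw [← hP.2]
      exact hsel2 P hP.1
    · intro j P hP
      rw [Finset.mem_filter] at hP
      rw [← hP.2]
      exact hκ1 P j
  calc Φ D ≤ ∑ τ ∈ T, Φ (D.filter fun P => g P = τ) := by
        conv_lhs => rw [← hDT]
        exact hsum T
    _ ≤ ∑ τ ∈ T, C * ∫⁻ x, (dy τ.2).indicator
          (fun _ => ENNReal.ofReal (∏ j, ((2 : ℝ) ^ τ.1 j) ^ ρ)) x := Finset.sum_le_sum hone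
    _ = C * ∫⁻ x, ∑ τ ∈ T, (dy τ.2).indicator
          (fun _ => ENNReal.ofReal (∏ j, ((2 : ℝ) ^ τ.1 j) ^ ρ)) x := by
        rw [← Finset.mul_sum, lintegral_finsetSum _ fun τ _ =>
          measurable_const.indicator (measurableSet_dy _)]
    _ ≤ _ := by
        gcongr C * ?_
        rw [← lintegral_const_mul' _ _ (ENNReal.pow_ne_top ENNReal.ofReal_ne_top)]
        refine lintegral_mono fun x => ?_
        set K := (T.filter fun τ => x ∈ dy τ.2).image Prod.fst with hK
        have hKP : ∀ k ∈ K, ∃ P ∈ D, κ P = k ∧ x ∈ dy P.1 := by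
          intro k hk
          obtain ⟨τ, hτ, rfl⟩ := Finset.mem_image.1 hk
          obtain ⟨hτ, hx⟩ := Finset.mem_filter.1 hτ
          obtain ⟨P, hP, rfl⟩ := Finset.mem_image.1 hτ
          have h1 := hsel1 P hP
          rw [h𝒬, Finset.mem_filter] at h1
          obtain ⟨P', hP', e⟩ := Finset.mem_image.1 h1.1
          rw [hG, Finset.mem_filter] at hP'
          exact ⟨P', hP'.1, hP'.2, by rw [e]; exact hx⟩
        have hinj : Set.InjOn Prod.fst ((T.filter fun τ => x ∈ dy τ.2 :
            Finset ((ι → ℤ) × (ℤ × ℤ))) : Set ((ι → ℤ) × (ℤ × ℤ))) := by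
          intro τ hτ τ' hτ' e
          obtain ⟨hτ, hx⟩ := Finset.mem_filter.1 hτ
          obtain ⟨hτ', hx'⟩ := Finset.mem_filter.1 hτ'
          obtain ⟨P, hP, rfl⟩ := Finset.mem_image.1 hτ
          obtain ⟨P', hP', rfl⟩ := Finset.mem_image.1 hτ'
          have e' : κ P = κ P' := e
          refine Prod.ext e ?_
          exact hdisj _ _ (hsel1 P hP) _ (e' ▸ hsel1 P' hP') x hx hx'
        have hfac : ∀ j, ∑ m ∈ K.image (fun k => k j), ENNReal.ofReal (((2 : ℝ) ^ m) ^ ρ)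
            ≤ ENNReal.ofReal (groupConst ρ) * M j x ^ ρ := by
          intro j
          rcases (K.image fun k => k j).eq_empty_or_nonempty with h0 | h0
          · rw [h0]; simp
          obtain ⟨k, hk, e⟩ := Finset.mem_image.1 (Finset.max'_mem _ h0)
          obtain ⟨P, hP, hPk, hxP⟩ := hKP k hk
          have h1 := hκ2 P j
          rw [hPk, e] at h1
          set m := (K.image fun k => k j).max' h0
          rw [← ENNReal.ofReal_sum_of_nonneg fun _ _ => by positivity]
          have h3 := sum_zpow_rpow_le hρ (m := m) _ fun m' hm' => Finset.le_max' (K.image fun k => k j) m' hm'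
          have h2 : (2 : ℝ) ^ (-ρ) < 1 := Real.rpow_lt_one_of_one_lt_of_neg (by norm_num) (by linarith)
          have h2' : 0 < 1 - (2 : ℝ) ^ (-ρ) := by linarith
          have h4 : ((2 : ℝ) ^ m) ^ ρ ≤ 2 ^ ρ * u j P ^ ρ := by
            rw [← Real.mul_rpow (by norm_num) (hu j P).le]
            refine Real.rpow_le_rpow (by positivity) ?_ hρ.le
            rw [zpow_sub_one₀ (by norm_num)] at h1
            linarith
          calc _ ≤ ENNReal.ofReal (groupConst ρ * u j P ^ ρ) := by
                refine ENNReal.ofReal_le_ofReal (h3.trans ?_)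
                calc _ ≤ 2 ^ ρ * u j P ^ ρ * (2 * (1 - (2 : ℝ) ^ (-ρ))⁻¹) := by gcongr
                  _ = _ := by rw [groupConst]; ring
            _ = ENNReal.ofReal (groupConst ρ) * ENNReal.ofReal (u j P) ^ ρ := by
                rw [ENNReal.ofReal_mul (by unfold groupConst; positivity),
                  ENNReal.ofReal_rpow_of_pos (hu j P)]
            _ ≤ _ := by
                gcongr
                exact hM j P hP x hxP
        calc ∑ τ ∈ T, (dy τ.2).indicator
              (fun _ => ENNReal.ofReal (∏ j, ((2 : ℝ) ^ τ.1 j) ^ ρ)) x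
            = ∑ τ ∈ T.filter fun τ => x ∈ dy τ.2, ENNReal.ofReal (∏ j, ((2 : ℝ) ^ τ.1 j) ^ ρ) := by
              rw [Finset.sum_filter]
              rfl
          _ = ∑ k ∈ K, ENNReal.ofReal (∏ j, ((2 : ℝ) ^ k j) ^ ρ) := by
              rw [hK, Finset.sum_image hinj]
          _ = ∑ k ∈ K, ∏ j, ENNReal.ofReal (((2 : ℝ) ^ k j) ^ ρ) :=
              Finset.sum_congr rfl fun k _ =>
                ENNReal.ofReal_prod_of_nonneg fun j _ => by positivity
          _ ≤ ∑ k ∈ Fintype.piFinset fun j => K.image fun k => k j,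
              ∏ j, ENNReal.ofReal (((2 : ℝ) ^ k j) ^ ρ) := by
              refine Finset.sum_le_sum_of_subset fun k hk => ?_
              rw [Fintype.mem_piFinset]
              exact fun j => Finset.mem_image_of_mem _ hk
          _ = ∏ j, ∑ m ∈ K.image (fun k => k j), ENNReal.ofReal (((2 : ℝ) ^ m) ^ ρ) :=
              by rw [Finset.prod_univ_sum]
          _ ≤ ∏ j, ENNReal.ofReal (groupConst ρ) * M j x ^ ρ :=
              Finset.prod_le_prod' fun j _ => hfac j
          _ = _ := by rw [Finset.prod_mul_distrib, Finset.prod_const, Finset.card_univ]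

/-- The dyadic ancestor of `I`, larger by the factor `2 ^ j`. -/
noncomputable def anc (I : ℤ × ℤ) (j : ℕ) : ℤ × ℤ := (I.1 + j, ⌊lft I / (2 : ℝ) ^ (I.1 + j : ℤ)⌋)

lemma len_anc (I : ℤ × ℤ) (j : ℕ) : len (anc I j) = 2 ^ j * len I := by
  unfold len anc
  rw [zpow_add₀ (by norm_num), zpow_natCast, mul_comm]

lemma dy_subset_anc (I : ℤ × ℤ) (j : ℕ) : dy I ⊆ dy (anc I j) :=
  dy_subset_of_mem (by simp [anc]) (lft_mem_dy I) (mem_dy_floor _ _)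

lemma wt_inv_le_tsum (I : ℤ × ℤ) (y : ℝ) :
    ENNReal.ofReal ((wt I y ^ 4)⁻¹) ≤ ∑' j : ℕ, ENNReal.ofReal (4096 * (1 / 16) ^ j)
      * (near (anc I j)).indicator 1 y := by
  classical
  have hI := len_pos I
  have hw := one_le_wt I y
  have key : ∀ j, y ∉ near (anc I j) → (2 : ℝ) ^ j ≤ 4 * wt I y := by
    intro j hj
    have h1 := wt_mul_len_le_of_not_mem_near (dy_subset_anc I j) hj
    rw [len_anc] at h1
    have h2 := one_le_wt (anc I j) y
    have h3 : (2 : ℝ) ^ j * len I ≤ (4 * wt I y) * len I := by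
      have : 0 < 2 ^ j * len I := by positivity
      nlinarith
    exact le_of_mul_le_mul_right h3 hI
  have hex : ∃ j, y ∈ near (anc I j) := by
    by_contra hne
    push Not at hne
    obtain ⟨j, hj⟩ := pow_unbounded_of_one_lt (4 * wt I y) (by norm_num : (1 : ℝ) < 2)
    exact absurd (key j (hne j)) (not_le.2 hj)
  refine le_trans ?_ (ENNReal.le_tsum (Nat.find hex))
  rw [indicator_of_mem (Nat.find_spec hex), Pi.one_apply, mul_one]
  refine ENNReal.ofReal_le_ofReal ?_
  rcases h0 : Nat.find hex with _ | j
  · rw [pow_zero, mul_one]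
    exact (inv_le_one_of_one_le₀ (one_le_pow₀ hw)).trans (by norm_num)
  · have h1 := key j (Nat.find_min hex (by omega))
    rw [inv_le_iff_one_le_mul₀ (by positivity)]
    have h2 : ((2 : ℝ) ^ j) ^ 4 ≤ (4 * wt I y) ^ 4 := by gcongr
    have h3 : ((2 : ℝ) ^ j) ^ 4 = 16 ^ j := by rw [← pow_mul, mul_comm, pow_mul]; norm_num
    have h4 : (1 / 16 : ℝ) ^ j * 16 ^ j = 1 := by rw [← mul_pow]; norm_num
    have h5 : 0 < (1 / 16 : ℝ) ^ j := by positivity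
    rw [h3, mul_pow] at h2
    have h6 := mul_le_mul_of_nonneg_left h2 h5.le
    rw [h4] at h6
    rw [pow_succ (1 / 16 : ℝ)]
    linarith

lemma lintegral_wt_le {F : ℝ → ℝ≥0∞} (hF : Measurable F) {x : ℝ} {c : ℝ≥0∞}
    (h : ∀ I, x ∈ dy I → ∫⁻ y in near I, F y ≤ ENNReal.ofReal (len I) * c) {I : ℤ × ℤ}
    (hx : x ∈ dy I) :
    ∫⁻ y, F y * ENNReal.ofReal ((wt I y ^ 4)⁻¹) ≤ ENNReal.ofReal (len I) * (8192 * c) := by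
  have hI := len_pos I
  calc ∫⁻ y, F y * ENNReal.ofReal ((wt I y ^ 4)⁻¹)
      ≤ ∫⁻ y, ∑' j : ℕ, ENNReal.ofReal (4096 * (1 / 16) ^ j) * (near (anc I j)).indicator F y := by
        refine lintegral_mono fun y => ?_
        refine (mul_le_mul_right (wt_inv_le_tsum I y) (F y)).trans ?_
        rw [← ENNReal.tsum_mul_left]
        refine ENNReal.tsum_le_tsum fun j => ?_
        by_cases hy : y ∈ near (anc I j)
        · simp [hy, mul_comm]
        · simp [hy]
    _ = ∑' j : ℕ, ENNReal.ofReal (4096 * (1 / 16) ^ j) * ∫⁻ y in near (anc I j), F y := by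
        rw [lintegral_tsum fun j => ((hF.indicator (measurableSet_near _)).const_mul _).aemeasurable]
        refine tsum_congr fun j => ?_
        rw [lintegral_const_mul _ (hF.indicator (measurableSet_near _)),
          lintegral_indicator (measurableSet_near _)]
    _ ≤ ∑' j : ℕ, ENNReal.ofReal (4096 * len I * (1 / 2) ^ j) * c := by
        refine ENNReal.tsum_le_tsum fun j => ?_
        refine (mul_le_mul_right (h _ (dy_subset_anc I j hx)) _).trans ?_
        rw [← mul_assoc, ← ENNReal.ofReal_mul (by positivity), len_anc]
        refine mul_le_mul_left (ENNReal.ofReal_le_ofReal ?_) c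
        have h4 : (1 / 16 : ℝ) ^ j * 2 ^ j ≤ (1 / 2) ^ j := by
          rw [← mul_pow]
          gcongr
          norm_num
        calc 4096 * (1 / 16 : ℝ) ^ j * (2 ^ j * len I)
            = 4096 * len I * ((1 / 16 : ℝ) ^ j * 2 ^ j) := by ring
          _ ≤ _ := by gcongr
    _ = _ := by
        rw [ENNReal.tsum_mul_right, ← ENNReal.ofReal_tsum_of_nonneg (fun _ => by positivity)
          (summable_geometric_two.mul_left _), tsum_mul_left, tsum_geometric_two, ← mul_assoc]
        congr 1
        rw [show (4096 : ℝ) * len I * 2 = len I * 8192 by ring, ENNReal.ofReal_mul hI.le]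
        norm_num

/-- The union of the triples of the dyadic intervals on which the average of `G` exceeds `t`. -/
def bigSet (G : ℝ → ℝ≥0∞) (t : ℝ) : Set ℝ :=
  ⋃ K ∈ {K : ℤ × ℤ | ENNReal.ofReal (t * len K) < ∫⁻ y in dy K, G y}, near K

lemma measurableSet_bigSet (G : ℝ → ℝ≥0∞) (t : ℝ) : MeasurableSet (bigSet G t) :=
  MeasurableSet.biUnion (Set.to_countable _) fun _ _ => measurableSet_near _

lemma near_subset_near {K K' : ℤ × ℤ} (h : dy K ⊆ dy K') : near K ⊆ near K' := by
  have hk := len_le_len (scale_le_of_subset h)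
  have hK := len_pos K
  rw [dy_eq_Ico, dy_eq_Ico, Ico_subset_Ico_iff (by linarith)] at h
  rw [near_eq, near_eq]
  exact Ico_subset_Ico (by linarith [h.1]) (by linarith [h.2])

lemma exists_maximal_dy (s : Finset (ℤ × ℤ)) : ∃ t ⊆ s, (∀ K ∈ s, ∃ K' ∈ t, dy K ⊆ dy K') ∧
    (t : Set (ℤ × ℤ)).PairwiseDisjoint dy := by
  classical
  set t := s.filter fun Q => ∀ K ∈ s, dy Q ⊆ dy K → K = Q with ht
  refine ⟨t, Finset.filter_subset _ _, fun K hK => ?_, ?_⟩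
  · have hne : (s.filter fun K' => dy K ⊆ dy K').Nonempty := ⟨K, by simp [hK]⟩
    obtain ⟨K', hK', hm⟩ := Finset.exists_max_image _ (fun K' => K'.1) hne
    rw [Finset.mem_filter] at hK'
    refine ⟨K', Finset.mem_filter.2 ⟨hK'.1, fun K'' hK'' hs => ?_⟩, hK'.2⟩
    exact (eq_of_dy_subset hs (hm K'' (Finset.mem_filter.2 ⟨hK'', hK'.2.trans hs⟩))).symm
  · have key : ∀ Q ∈ t, ∀ Q' ∈ t, Q ≠ Q' → Q.1 ≤ Q'.1 → Disjoint (dy Q) (dy Q') := by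
      intro Q hQ Q' hQ' hne hle
      refine (dy_subset_or_disjoint hle).resolve_left fun hs => hne ?_
      exact ((Finset.mem_filter.1 hQ).2 Q' (Finset.mem_filter.1 hQ').1 hs).symm
    intro Q hQ Q' hQ' hne
    rcases le_total Q.1 Q'.1 with hle | hle
    · exact key Q hQ Q' hQ' hne hle
    · exact (key Q' hQ' Q hQ hne.symm hle).symm

lemma volume_bigSet_le (G : ℝ → ℝ≥0∞) {t : ℝ} (ht : 0 < t) :
    volume (bigSet G t) ≤ ENNReal.ofReal (3 / t) * ∫⁻ y, G y := by
  classical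
  set S := {K : ℤ × ℤ | ENNReal.ofReal (t * len K) < ∫⁻ y in dy K, G y} with hS
  have hfin : ∀ s : Finset S, volume (⋃ K ∈ s, near K.1) ≤ ENNReal.ofReal (3 / t) * ∫⁻ y, G y := by
    intro s
    obtain ⟨m, hms, hm, hd⟩ := exists_maximal_dy (s.image Subtype.val)
    have hsub : (⋃ K ∈ s, near K.1) ⊆ ⋃ K ∈ m, near K := by
      refine iUnion₂_subset fun K hK => ?_
      obtain ⟨K', hK', hKK⟩ := hm K.1 (Finset.mem_image_of_mem _ hK)
      exact (near_subset_near hKK).trans (subset_biUnion_of_mem (u := near) hK')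
    calc volume (⋃ K ∈ s, near K.1) ≤ volume (⋃ K ∈ m, near K) := measure_mono hsub
      _ ≤ ∑ K ∈ m, volume (near K) := measure_biUnion_finset_le _ _
      _ ≤ ∑ K ∈ m, ENNReal.ofReal (3 / t) * ∫⁻ y in dy K, G y := by
          refine Finset.sum_le_sum fun K hK => ?_
          have hKS : K ∈ S := by
            obtain ⟨K', _, rfl⟩ := Finset.mem_image.1 (hms hK)
            exact K'.2
          rw [volume_near, show 3 * len K = 3 / t * (t * len K) by field_simp,
            ENNReal.ofReal_mul (by positivity)]
          gcongr
          exact le_of_lt hKS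
      _ = ENNReal.ofReal (3 / t) * ∫⁻ y in ⋃ K ∈ m, dy K, G y := by
          rw [← Finset.mul_sum, lintegral_biUnion_finset hd fun K _ => measurableSet_dy K]
      _ ≤ _ := by
          exact mul_le_mul_right (setLIntegral_le_lintegral _ _) _
  have e : bigSet G t = ⋃ s : Finset S, ⋃ K ∈ s, near K.1 := by
    ext x
    simp only [bigSet, mem_iUnion]
    constructor
    · rintro ⟨K, hK, hx⟩
      exact ⟨{⟨K, hK⟩}, ⟨K, hK⟩, Finset.mem_singleton_self _, hx⟩
    · rintro ⟨s, K, hK, hx⟩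
      exact ⟨K.1, K.2, hx⟩
  rw [e, Directed.measure_iUnion]
  · exact iSup_le hfin
  · refine directed_of_isDirected_le fun s s' hss => ?_
    exact biUnion_subset_biUnion_left hss

/-- The constant of `maximal`. -/
noncomputable def maxConst (ρ : ℝ) : ℝ :=
  18 * 2 ^ ρ * (6 ^ (ρ - 1) * (2 * (1 - (2 : ℝ) ^ (-(ρ - 1)))⁻¹))

lemma tsum_zpow_indicator_le {ρ : ℝ} (hρ : 0 < ρ) (v : ℝ≥0∞) :
    ∑' k : ℤ, {k : ℤ | ENNReal.ofReal (2 ^ k) < v}.indicator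
      (fun k => ENNReal.ofReal (((2 : ℝ) ^ k) ^ ρ)) k
      ≤ v ^ ρ * ENNReal.ofReal (2 * (1 - (2 : ℝ) ^ (-ρ))⁻¹) := by
  classical
  rw [ENNReal.tsum_eq_iSup_sum]
  refine iSup_le fun s => ?_
  rw [Finset.sum_indicator_eq_sum_filter]
  rcases (s.filter fun k => k ∈ {k : ℤ | ENNReal.ofReal (2 ^ k) < v}).eq_empty_or_nonempty
    with h0 | h0
  · rw [h0]; simp
  have hm := Finset.max'_mem _ h0
  have hle := Finset.le_max' (s.filter fun k => k ∈ {k : ℤ | ENNReal.ofReal (2 ^ k) < v})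
  set m := (s.filter fun k => k ∈ {k : ℤ | ENNReal.ofReal (2 ^ k) < v}).max' h0
  rw [← ENNReal.ofReal_sum_of_nonneg fun _ _ => by positivity]
  have h1 := sum_zpow_rpow_le hρ (m := m) _ hle
  have h2 : ENNReal.ofReal (2 ^ m) < v := (Finset.mem_filter.1 hm).2
  calc _ ≤ ENNReal.ofReal (((2 : ℝ) ^ m) ^ ρ * (2 * (1 - (2 : ℝ) ^ (-ρ))⁻¹)) :=
        ENNReal.ofReal_le_ofReal h1
    _ = ENNReal.ofReal (2 ^ m) ^ ρ * ENNReal.ofReal (2 * (1 - (2 : ℝ) ^ (-ρ))⁻¹) := by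
        rw [ENNReal.ofReal_mul (by positivity), ENNReal.ofReal_rpow_of_pos (by positivity)]
    _ ≤ _ := by gcongr

/-- The maximal theorem. -/
theorem maximal {ρ : ℝ} (hρ : 1 < ρ) {F : ℝ → ℝ≥0∞} (hF : Measurable F) {B : ℝ≥0∞} (hB : B ≠ ∞)
    (hFB : ∀ x, F x ≤ B) : ∃ S : ℝ → ℝ≥0∞, Measurable S ∧
      (∀ I, ∀ x ∈ dy I, ∫⁻ y, F y * ENNReal.ofReal ((wt I y ^ 4)⁻¹) ≤ ENNReal.ofReal (len I) * S x) ∧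
      ∫⁻ x, S x ^ ρ ≤ 8192 ^ ρ * (ENNReal.ofReal (maxConst ρ) * ∫⁻ x, F x ^ ρ) := by
  classical
  have hρ0 : 0 < ρ := by linarith
  set G : ℤ → ℝ → ℝ≥0∞ := fun k => {x | ENNReal.ofReal (2 ^ k) < 6 * F x}.indicator F with hG
  have hGm : ∀ k : ℤ, MeasurableSet {x | ENNReal.ofReal (2 ^ k) < 6 * F x} := fun k =>
    measurableSet_lt measurable_const (hF.const_mul _)
  set U : ℤ → Set ℝ := fun k => bigSet (G k) (2 ^ k / 6) with hU
  set T : ℝ → ℝ≥0∞ := fun x => ∑' k : ℤ, (U k).indicator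
    (fun _ => ENNReal.ofReal (((2 : ℝ) ^ (k + 1)) ^ ρ)) x with hT
  have hbig : ∀ (I : ℤ × ℤ) (x : ℝ) (k : ℤ), x ∈ dy I →
      ENNReal.ofReal (2 ^ k * len I) < ∫⁻ y in near I, F y → x ∈ U k := by
    intro I x k hx hlt
    have hI := len_pos I
    set J : ℤ → ℤ × ℤ := fun i => (I.1, I.2 + i) with hJ
    have hlen : ∀ i, len (J i) = len I := fun i => rfl
    have hsub : near I ⊆ ⋃ i ∈ Finset.Icc (-1 : ℤ) 1, dy (J i) := by
      intro y hy
      have hy' : |⌊y / 2 ^ I.1⌋ - I.2| ≤ 1 := hy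
      rw [abs_le] at hy'
      refine mem_biUnion (x := ⌊y / 2 ^ I.1⌋ - I.2) (Finset.mem_coe.2 (Finset.mem_Icc.2 hy')) ?_
      have h1 := mem_dy_floor I.1 y
      simpa only [hJ, add_sub_cancel] using h1
    obtain ⟨i, hi, hiF⟩ : ∃ i ∈ Finset.Icc (-1 : ℤ) 1,
        ENNReal.ofReal (2 ^ k * len I / 3) < ∫⁻ y in dy (J i), F y := by
      by_contra! hcon
      refine absurd hlt (not_lt.2 ?_)
      calc ∫⁻ y in near I, F y ≤ ∫⁻ y in ⋃ i ∈ Finset.Icc (-1 : ℤ) 1, dy (J i), F y :=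
            lintegral_mono_set hsub
        _ = ∑ i ∈ Finset.Icc (-1 : ℤ) 1, ∫⁻ y in dy (J i), F y := by
            refine lintegral_biUnion_finset ?_ (fun i _ => measurableSet_dy _) _
            intro i _ i' _ hne
            refine disjoint_left.2 fun y hy hy' => hne ?_
            have h1 := eq_of_mem_dy (I := J i) (J := J i') rfl hy hy'
            simpa [hJ] using h1
        _ ≤ ∑ i ∈ Finset.Icc (-1 : ℤ) 1, ENNReal.ofReal (2 ^ k * len I / 3) :=
            Finset.sum_le_sum hcon
        _ = _ := by
            rw [← ENNReal.ofReal_sum_of_nonneg fun _ _ => by positivity, Finset.sum_const]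
            congr 1
            simp
            ring
    refine mem_biUnion (x := J i) ?_ ?_
    · rw [mem_ofPred_eq, hlen]
      by_contra! hcon
      refine absurd hiF (not_lt.2 ?_)
      calc ∫⁻ y in dy (J i), F y ≤ ∫⁻ y in dy (J i), (G k y + ENNReal.ofReal (2 ^ k / 6)) := by
            refine lintegral_mono fun y => ?_
            by_cases hy : ENNReal.ofReal (2 ^ k) < 6 * F y
            · simp only [hG, indicator_of_mem (show y ∈ {x | ENNReal.ofReal (2 ^ k) < 6 * F x} from hy)]
              exact le_self_add
            · refine le_add_left ?_
              rw [ENNReal.ofReal_div_of_pos (by norm_num), ENNReal.le_div_iff_mul_le (by norm_num)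
                (by norm_num), mul_comm]
              simpa using hy
        _ = (∫⁻ y in dy (J i), G k y) + ENNReal.ofReal (2 ^ k / 6) * ENNReal.ofReal (len I) := by
            rw [lintegral_add_right _ measurable_const, setLIntegral_const, volume_dy, hlen]
        _ ≤ ENNReal.ofReal (2 ^ k / 6 * len I) + ENNReal.ofReal (2 ^ k / 6 * len I) := by
            rw [ENNReal.ofReal_mul (by positivity)] at hcon ⊢
            exact add_le_add_left hcon _
        _ = _ := by
            rw [← ENNReal.ofReal_add (by positivity) (by positivity)]
            congr 1
            ring
    · have h1 : ⌊x / 2 ^ I.1⌋ = I.2 := by simpa only [dy, mem_ofPred_eq, len] using hx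
      change |⌊x / 2 ^ I.1⌋ - (I.2 + i)| ≤ 1
      rw [Finset.mem_Icc] at hi
      rw [h1, abs_le]
      omega
  have hfin : ∀ I, ∫⁻ y in near I, F y < ∞ := by
    intro I
    calc ∫⁻ y in near I, F y ≤ ∫⁻ y in near I, B := lintegral_mono hFB
      _ = B * volume (near I) := setLIntegral_const _ _
      _ < ∞ := by
          rw [volume_near]
          exact ENNReal.mul_lt_top hB.lt_top ENNReal.ofReal_lt_top
  have hpt : ∀ x I, x ∈ dy I → ∫⁻ y in near I, F y ≤ ENNReal.ofReal (len I) * T x ^ (1 / ρ) := by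
    intro x I hx
    have hI := len_pos I
    rcases (ENNReal.toReal_nonneg (a := ∫⁻ y in near I, F y)).eq_or_lt with h0 | h0
    · rcases (ENNReal.toReal_eq_zero_iff _).1 h0.symm with h1 | h1
      · rw [h1]; exact bot_le
      · exact absurd h1 (hfin I).ne
    obtain ⟨k, hk1, hk2⟩ := exists_mem_Ioc_zpow (div_pos h0 hI) (one_lt_two (α := ℝ))
    have hxk : x ∈ U k := by
      refine hbig I x k hx ?_
      rw [ENNReal.ofReal_lt_iff_lt_toReal (by positivity) (hfin I).ne]
      exact (lt_div_iff₀ hI).1 hk1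
    have h2 : ENNReal.ofReal (((2 : ℝ) ^ (k + 1)) ^ ρ) ≤ T x := by
      have := ENNReal.le_tsum (f := fun k : ℤ => (U k).indicator
        (fun _ => ENNReal.ofReal (((2 : ℝ) ^ (k + 1)) ^ ρ)) x) k
      rwa [indicator_of_mem hxk] at this
    have h3 : ENNReal.ofReal ((2 : ℝ) ^ (k + 1)) ≤ T x ^ (1 / ρ) := by
      rw [one_div, ENNReal.le_rpow_inv_iff hρ0, ENNReal.ofReal_rpow_of_pos (by positivity)]
      exact h2
    calc ∫⁻ y in near I, F y = ENNReal.ofReal (∫⁻ y in near I, F y).toReal :=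
          (ENNReal.ofReal_toReal (hfin I).ne).symm
      _ ≤ ENNReal.ofReal (len I * 2 ^ (k + 1)) := by
          refine ENNReal.ofReal_le_ofReal ?_
          rw [mul_comm]
          exact (div_le_iff₀ hI).1 hk2
      _ ≤ _ := by
          rw [ENNReal.ofReal_mul hI.le]
          gcongr
  have hTm : Measurable T := Measurable.tsum fun k =>
    measurable_const.indicator (measurableSet_bigSet _ _)
  refine ⟨fun x => 8192 * T x ^ (1 / ρ), (hTm.pow_const _).const_mul _, fun I x hx => lintegral_wt_le hF (fun J hJ => hpt x J hJ) hx,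
    ?_⟩
  have hTi : ∫⁻ x, T x ≤ ENNReal.ofReal (maxConst ρ) * ∫⁻ x, F x ^ ρ := by
    calc ∫⁻ x, T x = ∑' k : ℤ, ENNReal.ofReal (((2 : ℝ) ^ (k + 1)) ^ ρ) * volume (U k) := by
          rw [lintegral_tsum fun k =>
            (measurable_const.indicator (measurableSet_bigSet _ _)).aemeasurable]
          exact tsum_congr fun k => lintegral_indicator_const (measurableSet_bigSet _ _) _
      _ ≤ ∑' k : ℤ, ENNReal.ofReal (18 * 2 ^ ρ * ((2 : ℝ) ^ k) ^ (ρ - 1)) * ∫⁻ x, G k x := by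
          refine ENNReal.tsum_le_tsum fun k => ?_
          refine (mul_le_mul_right (volume_bigSet_le (G k) (by positivity)) _).trans ?_
          rw [← mul_assoc, ← ENNReal.ofReal_mul (by positivity)]
          refine mul_le_mul_left (ENNReal.ofReal_le_ofReal (le_of_eq ?_)) _
          have h2k : (0 : ℝ) < 2 ^ k := by positivity
          rw [zpow_add_one₀ (by norm_num), mul_rpow h2k.le (by norm_num), rpow_sub_one h2k.ne']
          field_simp
          ring
      _ = ∫⁻ x, ∑' k : ℤ, ENNReal.ofReal (18 * 2 ^ ρ * ((2 : ℝ) ^ k) ^ (ρ - 1)) * G k x := by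
          rw [lintegral_tsum (f := fun (k : ℤ) x =>
            ENNReal.ofReal (18 * 2 ^ ρ * ((2 : ℝ) ^ k) ^ (ρ - 1)) * G k x)
            fun k => ((hF.indicator (hGm k)).const_mul _).aemeasurable]
          exact tsum_congr fun k => (lintegral_const_mul _ (hF.indicator (hGm k))).symm
      _ ≤ ∫⁻ x, ENNReal.ofReal (maxConst ρ) * F x ^ ρ := by
          refine lintegral_mono fun x => ?_
          have hv : 6 * F x ≠ ∞ := ENNReal.mul_ne_top (by norm_num) ((hFB x).trans_lt hB.lt_top).ne
          have h1 := tsum_zpow_indicator_le (ρ := ρ - 1) (by linarith) (6 * F x)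
          calc ∑' k : ℤ, ENNReal.ofReal (18 * 2 ^ ρ * ((2 : ℝ) ^ k) ^ (ρ - 1)) * G k x
              = ENNReal.ofReal (18 * 2 ^ ρ) * F x *
                ∑' k : ℤ, {k : ℤ | ENNReal.ofReal (2 ^ k) < 6 * F x}.indicator
                  (fun k => ENNReal.ofReal (((2 : ℝ) ^ k) ^ (ρ - 1))) k := by
                rw [← ENNReal.tsum_mul_left]
                refine tsum_congr fun k => ?_
                by_cases hk : ENNReal.ofReal (2 ^ k) < 6 * F x
                · rw [indicator_of_mem (show k ∈ {k : ℤ | ENNReal.ofReal (2 ^ k) < 6 * F x} from hk)]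
                  simp only [hG]
                  rw [indicator_of_mem
                    (show x ∈ {x | ENNReal.ofReal (2 ^ k) < 6 * F x} from hk),
                    ENNReal.ofReal_mul (by positivity)]
                  ring
                · rw [indicator_of_notMem
                    (show k ∉ {k : ℤ | ENNReal.ofReal (2 ^ k) < 6 * F x} from hk)]
                  simp only [hG]
                  rw [indicator_of_notMem
                    (show x ∉ {x | ENNReal.ofReal (2 ^ k) < 6 * F x} from hk)]
                  simp
            _ ≤ ENNReal.ofReal (18 * 2 ^ ρ) * F x * ((6 * F x) ^ (ρ - 1) *
                  ENNReal.ofReal (2 * (1 - (2 : ℝ) ^ (-(ρ - 1)))⁻¹)) := mul_le_mul_right h1 _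
            _ = _ := by
                have h6 : F x ^ ρ = F x * F x ^ (ρ - 1) := by
                  conv_lhs => rw [show ρ = 1 + (ρ - 1) by ring]
                  rw [ENNReal.rpow_add_of_nonneg _ _ zero_le_one (by linarith), ENNReal.rpow_one]
                have h7 : ENNReal.ofReal ((6 : ℝ) ^ (ρ - 1)) = 6 ^ (ρ - 1) := by
                  rw [← ENNReal.ofReal_rpow_of_pos (by norm_num : (0 : ℝ) < 6)]
                  norm_num
                rw [maxConst, ENNReal.ofReal_mul (p := 18 * 2 ^ ρ) (by positivity),
                  ENNReal.ofReal_mul (p := 6 ^ (ρ - 1)) (by positivity),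
                  ENNReal.mul_rpow_of_nonneg _ _ (by linarith : 0 ≤ ρ - 1), h6, h7]
                ring
      _ = _ := lintegral_const_mul _ (hF.pow_const _)
  simp only
  simp_rw [ENNReal.mul_rpow_of_nonneg _ _ hρ0.le, ← ENNReal.rpow_mul, one_div,
    inv_mul_cancel₀ hρ0.ne', ENNReal.rpow_one]
  rw [lintegral_const_mul' _ _ (by finiteness)]
  gcongr

/-- The exponents of the local estimate. -/
structure Exps (s θ : Fin 3 → ℝ) (ε δ : ℝ) (W : ℕ) : Prop where
  sum_eq : ∑ j, θ j = 1
  eps_pos : 0 < ε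
  le_theta : ∀ j, ε ≤ θ j
  theta_le : ∀ j, θ j + ε ≤ 1
  del_pos : 0 < δ
  le_mul : ∀ j, 2 * (1 + δ) ≤ s j * (1 + θ j)
  le_W : 3 ≤ ε * (W - 4 : ℕ)
  four_le : 4 ≤ W
  one_le : ∀ j, 1 ≤ s j
  le_two : ∀ j, s j ≤ 2

/-- The numbers `a P` are the norms of the coefficients of a function of pointwise norm `F` with
values in some Hilbert space. -/
def Controlled (E : Tile → ℝ → ℂ) (a : Tile → ℝ) (F : ℝ → ℝ) : Prop :=
  ∃ (H : Type) (_ : NormedAddCommGroup H) (_ : InnerProductSpace ℂ H) (_ : CompleteSpace H)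
    (f : ℝ → H), Integrable f ∧ StronglyMeasurable f ∧ (∃ B, ∀ x, ‖f x‖ ≤ B) ∧
    (∀ P, a P = ‖∫ x, E P x • f x‖) ∧ ∀ x, F x = ‖f x‖

lemma Controlled.nonneg {E : Tile → ℝ → ℂ} {a : Tile → ℝ} {F : ℝ → ℝ} (h : Controlled E a F)
    (P : Tile) : 0 ≤ a P := by
  obtain ⟨H, _, _, _, f, -, -, -, h4, -⟩ := h
  rw [h4]; exact norm_nonneg _

lemma Controlled.measurable {E : Tile → ℝ → ℂ} {a : Tile → ℝ} {F : ℝ → ℝ} (h : Controlled E a F) :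
    Measurable F := by
  obtain ⟨H, _, _, _, f, -, h2, -, -, h5⟩ := h
  rw [funext h5]; exact h2.norm.measurable

lemma Controlled.bounded {E : Tile → ℝ → ℂ} {a : Tile → ℝ} {F : ℝ → ℝ} (h : Controlled E a F) :
    ∃ B, ∀ x, F x ≤ B := by
  obtain ⟨H, _, _, _, f, -, -, h3, -, h5⟩ := h
  simpa only [h5] using h3

lemma Controlled.fun_nonneg {E : Tile → ℝ → ℂ} {a : Tile → ℝ} {F : ℝ → ℝ} (h : Controlled E a F)
    (x : ℝ) : 0 ≤ F x := by
  obtain ⟨H, _, _, _, f, -, -, -, -, h5⟩ := h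
  rw [h5]; exact norm_nonneg _

lemma Controlled.eq_zero {E : Tile → ℝ → ℂ} {a : Tile → ℝ} {F : ℝ → ℝ} (h : Controlled E a F)
    (h0 : F =ᵐ[volume] 0) (P : Tile) : a P = 0 := by
  obtain ⟨H, _, _, _, f, -, -, -, h4, h5⟩ := h
  rw [h4, integral_eq_zero_of_ae, norm_zero]
  filter_upwards [h0] with x hx
  rw [h5, Pi.zero_apply, norm_eq_zero] at hx
  simp [hx]

lemma Controlled.smul {E : Tile → ℝ → ℂ} {a : Tile → ℝ} {F : ℝ → ℝ} (h : Controlled E a F) {c : ℝ}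
    (hc : 0 ≤ c) : Controlled E (fun P => c * a P) fun x => c * F x := by
  obtain ⟨H, _, _, _, f, h1, h2, ⟨B, h3⟩, h4, h5⟩ := h
  have hn : ∀ v : H, ‖(c : ℂ) • v‖ = c * ‖v‖ := fun v => by
    rw [norm_smul, Complex.norm_real, Real.norm_of_nonneg hc]
  refine ⟨H, ‹_›, ‹_›, ‹_›, fun x => (c : ℂ) • f x, h1.smul _, h2.const_smul _, ⟨c * B, fun x => ?_⟩,
    fun P => ?_, fun x => ?_⟩
  · rw [hn]; gcongr; exact h3 x
  · simp only [h4]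
    rw [← hn, ← integral_smul]
    congr 2
    ext x
    exact smul_comm _ _ _
  · simp only [h5, hn]

theorem local_model {s θ : Fin 3 → ℝ} {ε δ C : ℝ} {N W : ℕ} (hex : Exps s θ ε δ W)
    (hNW : W + 2 ≤ N) (hC : 0 ≤ C) {E : Fin 3 → Tile → ℝ → ℂ} {c : Fin 3 → ℝ}
    (hE : ∀ j, Adapted C N (bd j) (c j) (E j)) {a : Fin 3 → Tile → ℝ} {F : Fin 3 → ℝ → ℝ}
    (ha : ∀ j, Controlled (E j) (a j) (F j)) {D : Finset Tile} (hD : Sparse D) (hne : D.Nonempty)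
    {Q : ℤ × ℤ} {A : Fin 3 → ℝ} (hA : ∀ j, 0 < A j) (hQ : ∀ P ∈ D, dy P.1 ⊆ dy Q)
    (h : ∀ j, ∀ P ∈ D, ∀ I, dy P.1 ⊆ dy I → dy I ⊆ dy Q →
      ∫ x, F j x ^ s j * (wt I x ^ 4)⁻¹ ≤ A j ^ s j * len I) :
    ∑ P ∈ D, len P.1 * ∏ j, a j P ≤ localConst (splitConst C W) ε δ * (len Q * ∏ j, A j) := by
  classical
  set Θ : Finset Top := D.image (fun P => (P.1, (P.2 : ℝ) / len P.1)) ∪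
    D.image (fun P => (P.1, ((P.2 : ℝ) + 5) / len P.1)) with hΘ
  have hΘQ : ∀ t ∈ Θ, dy t.1 ⊆ dy Q := by
    intro t ht
    rcases Finset.mem_union.1 ht with h1 | h1 <;> obtain ⟨P, hP, rfl⟩ := Finset.mem_image.1 h1
    · exact hQ P hP
    · exact hQ P hP
  have hS : ∀ j, Singles (bd j) Θ D := by
    intro j P hP
    have hl := len_pos P.1
    have e1 : (P.2 : ℝ) / len P.1 * len P.1 = P.2 := by field_simp
    have e2 : ((P.2 : ℝ) + 5) / len P.1 * len P.1 = P.2 + 5 := by field_simp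
    have m1 : (P.1, (P.2 : ℝ) / len P.1) ∈ Θ :=
      Finset.mem_union_left _ (Finset.mem_image.2 ⟨P, hP, rfl⟩)
    have m2 : (P.1, ((P.2 : ℝ) + 5) / len P.1) ∈ Θ :=
      Finset.mem_union_right _ (Finset.mem_image.2 ⟨P, hP, rfl⟩)
    have i1 : InTree (P.1, (P.2 : ℝ) / len P.1) P := by
      refine ⟨subset_rfl, ?_⟩
      unfold InFreq
      simp only [e1]
      norm_num
    have i2 : InTree (P.1, ((P.2 : ℝ) + 5) / len P.1) P := by
      refine ⟨subset_rfl, ?_⟩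
      unfold InFreq
      simp only [e2]
      norm_num
    fin_cases j
    · refine ⟨_, m1, -1, Or.inr rfl, rfl, i1, fun z hz => ?_⟩
      have h1 : z * len P.1 - P.2 ∈ Icc (-17 : ℝ) (-6) := hz
      simp only [sub_mul, e1]
      linarith [h1.2]
    · refine ⟨_, m1, 1, Or.inl rfl, rfl, i1, fun z hz => ?_⟩
      have h1 : z * len P.1 - P.2 ∈ Icc (7 : ℝ) 18 := hz
      simp only [sub_mul, e1]
      linarith [h1.1]
    · refine ⟨_, m2, -1, Or.inr rfl, rfl, i2, fun z hz => ?_⟩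
      have h1 : z * len P.1 - P.2 ∈ Icc (-2 : ℝ) 3 := hz
      simp only [sub_mul, e2]
      linarith [h1.2]
  have hsp : ∀ j, Splits (bd j) (fun P => (A j)⁻¹ * a j P) Θ D (splitConst C W) (s j) (len Q) W := by
    intro j
    have hAj := hA j
    obtain ⟨H, _, _, _, f, h1, h2, ⟨B, h3⟩, h4, h5⟩ := (ha j).smul (inv_nonneg.2 hAj.le)
    have h6 := (hE j).splits hNW hex.four_le hC (bd_fst j) (bd_snd j) hD hΘQ (hS j) h1 h2
      (hex.one_le j) (hex.le_two j) h3 (hne.imp fun P hP => ⟨hP, hQ P hP⟩) (fun P hP I hI hIQ => ?_)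
    · simpa only [← h4] using h6
    · simp only [← h5]
      have e : ∀ x, ((A j)⁻¹ * F j x) ^ s j * (wt I x ^ 4)⁻¹
          = (A j ^ s j)⁻¹ * (F j x ^ s j * (wt I x ^ 4)⁻¹) := fun x => by
        rw [mul_rpow (by positivity) ((ha j).fun_nonneg x), inv_rpow hAj.le]
        ring
      simp only [e]
      rw [integral_const_mul, inv_mul_le_iff₀ (by positivity)]
      exact h j P hP I hI hIQ
  have key := local_estimate (fun j P => mul_nonneg (inv_nonneg.2 (hA j).le) ((ha j).nonneg P)) hS
    (splitConst_pos C W) (len_pos Q) hsp hex.sum_eq hex.eps_pos hex.le_theta hex.theta_le hex.del_pos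
    hex.le_mul hex.le_W
  have hP : 0 < ∏ j, A j := Finset.prod_pos fun j _ => hA j
  have e : ∀ P : Tile, len P.1 * ∏ j, (A j)⁻¹ * a j P
      = (∏ j, A j)⁻¹ * (len P.1 * ∏ j, a j P) := fun P => by
    rw [Finset.prod_mul_distrib, Finset.prod_inv_distrib]
    ring
  simp only [e] at key
  rw [← Finset.mul_sum, inv_mul_le_iff₀ hP] at key
  exact key.trans (le_of_eq (by ring))

/-- The weighted average of `F ^ s` at `I`. -/
noncomputable def wavg (s : ℝ) (F : ℝ → ℝ) (I : ℤ × ℤ) : ℝ :=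
  (∫ x, F x ^ s * (wt I x ^ 4)⁻¹) / len I

/-- The largest of the averages over the dyadic intervals containing `dy P.1`. -/
noncomputable def level (s : ℝ) (F : ℝ → ℝ) (P : Tile) : ℝ :=
  ⨆ I : {I : ℤ × ℤ // dy P.1 ⊆ dy I}, wavg s F I.1 ^ (1 / s)

lemma integrable_rpow_wt {F : ℝ → ℝ} (hF : Measurable F) (h0 : ∀ x, 0 ≤ F x) {B : ℝ}
    (hB : ∀ x, F x ≤ B) {s : ℝ} (hs : 0 < s) (I : ℤ × ℤ) :
    Integrable fun x => F x ^ s * (wt I x ^ 4)⁻¹ := by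
  have := integrable_rpow_mul_wt hF.stronglyMeasurable hs.le (B := B)
    (fun x => by rw [Real.norm_of_nonneg (h0 x)]; exact hB x) I
  simpa only [Real.norm_of_nonneg (h0 _)] using this

lemma wavg_nonneg {F : ℝ → ℝ} (h0 : ∀ x, 0 ≤ F x) (s : ℝ) (I : ℤ × ℤ) : 0 ≤ wavg s F I :=
  div_nonneg (integral_nonneg fun x => mul_nonneg (rpow_nonneg (h0 x) _)
    (by have := wt_pos I x; positivity)) (len_pos I).le

lemma wavg_le {F : ℝ → ℝ} (h0 : ∀ x, 0 ≤ F x) {B : ℝ} (hB : ∀ᵐ x, F x ≤ B)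
    {s : ℝ} (hs : 0 < s) (hB0 : 0 ≤ B) (I : ℤ × ℤ) : wavg s F I ≤ B ^ s * intConst := by
  have hI := len_pos I
  rw [wavg, div_le_iff₀ hI]
  calc ∫ x, F x ^ s * (wt I x ^ 4)⁻¹ ≤ ∫ x, B ^ s * (wt I x ^ 2)⁻¹ := by
        refine integral_mono_of_nonneg (ae_of_all _ fun x => mul_nonneg (rpow_nonneg (h0 x) _)
          (by have := wt_pos I x; positivity)) ((integrable_wt I).const_mul _) ?_
        filter_upwards [hB] with x hx
        have h1 := one_le_wt I x
        have h2 := h0 x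
        have h3 : wt I x ^ 2 ≤ wt I x ^ 4 := pow_le_pow_right₀ h1 (by norm_num)
        gcongr
    _ = _ := by rw [integral_const_mul, integral_wt]; ring

lemma bddAbove_level {F : ℝ → ℝ} (h0 : ∀ x, 0 ≤ F x) {B : ℝ}
    (hB : ∀ x, F x ≤ B) {s : ℝ} (hs : 0 < s) (P : Tile) :
    BddAbove (range fun I : {I : ℤ × ℤ // dy P.1 ⊆ dy I} => wavg s F I.1 ^ (1 / s)) := by
  refine ⟨(B ^ s * intConst) ^ (1 / s), ?_⟩
  rintro _ ⟨I, rfl⟩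
  have h1 := wavg_nonneg h0 s I.1
  exact rpow_le_rpow h1 (wavg_le h0 (ae_of_all _ hB) hs ((h0 0).trans (hB 0)) _) (by positivity)

lemma integral_le_of_level_le {F : ℝ → ℝ} (h0 : ∀ x, 0 ≤ F x) {B : ℝ}
    (hB : ∀ x, F x ≤ B) {s : ℝ} (hs : 0 < s) {P : Tile} {A : ℝ} (hA : level s F P ≤ A) {I : ℤ × ℤ}
    (hI : dy P.1 ⊆ dy I) : ∫ x, F x ^ s * (wt I x ^ 4)⁻¹ ≤ A ^ s * len I := by
  have h1 : wavg s F I ^ (1 / s) ≤ A := (le_ciSup (bddAbove_level h0 hB hs P) ⟨I, hI⟩).trans hA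
  have h2 := wavg_nonneg h0 s I
  rw [← div_le_iff₀ (len_pos I)]
  change wavg s F I ≤ _
  calc wavg s F I = (wavg s F I ^ (1 / s)) ^ s := by
        rw [← rpow_mul h2, one_div, inv_mul_cancel₀ hs.ne', rpow_one]
    _ ≤ _ := by gcongr

lemma level_pos {F : ℝ → ℝ} (hF : Measurable F) (h0 : ∀ x, 0 ≤ F x) {B : ℝ}
    (hB : ∀ x, F x ≤ B) {s : ℝ} (hs : 0 < s) (hne : ¬ F =ᵐ[volume] 0) (P : Tile) :
    0 < level s F P := by
  refine lt_of_lt_of_le ?_ (le_ciSup (bddAbove_level h0 hB hs P) ⟨P.1, subset_rfl⟩)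
  refine rpow_pos_of_pos (div_pos ?_ (len_pos _)) _
  have hn : ∀ x, 0 ≤ F x ^ s * (wt P.1 x ^ 4)⁻¹ := fun x => mul_nonneg (rpow_nonneg (h0 x) _)
    (by have := wt_pos P.1 x; positivity)
  refine lt_of_le_of_ne (integral_nonneg hn) fun he => hne ?_
  have h1 := (integral_eq_zero_iff_of_nonneg hn (integrable_rpow_wt hF h0 hB hs P.1)).1 he.symm
  filter_upwards [h1] with x hx
  have hw := wt_pos P.1 x
  simp only [Pi.zero_apply] at hx ⊢
  rcases mul_eq_zero.1 hx with h2 | h2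
  · exact (rpow_eq_zero (h0 x) hs.ne').1 h2
  · exact absurd h2 (by positivity)

/-- The constant of `exists_level_bound`. -/
noncomputable def levelConst (s x : ℝ) : ℝ≥0∞ :=
  if x = 0 then ENNReal.ofReal (intConst ^ (1 / s)) else
    (8192 ^ (1 / (x * s)) * ENNReal.ofReal (maxConst (1 / (x * s)))) ^ x

lemma levelConst_ne_top {s x : ℝ} (hs : 0 < s) (hx : 0 ≤ x) : levelConst s x ≠ ∞ := by
  unfold levelConst
  split_ifs with h
  · exact ENNReal.ofReal_ne_top
  · exact ENNReal.rpow_ne_top_of_nonneg hx (ENNReal.mul_ne_top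
      (ENNReal.rpow_ne_top_of_nonneg (by positivity) (by norm_num)) ENNReal.ofReal_ne_top)

lemma exists_level_bound {F : ℝ → ℝ} (hF : Measurable F) (h0 : ∀ x, 0 ≤ F x) {B : ℝ}
    (hB : ∀ x, F x ≤ B) {s x : ℝ} (hs : 0 < s) (hx : 0 ≤ x) (hxs : x * s < 1) :
    ∃ M : ℝ → ℝ≥0∞, (∀ P : Tile, ∀ y ∈ dy P.1, ENNReal.ofReal (level s F P) ≤ M y) ∧
      ∀ ρ : ℝ, 0 < ρ → ∃ (K : ℝ≥0∞) (G : ℝ → ℝ≥0∞), Measurable G ∧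
        (∀ y, M y ^ ρ ≤ K * G y ^ (x * ρ)) ∧ K * (∫⁻ y, G y) ^ (x * ρ)
          ≤ (levelConst s x * eLpNorm F (ENNReal.ofReal x)⁻¹ volume) ^ ρ := by
  have hB0 : 0 ≤ B := (h0 0).trans (hB 0)
  have hlev : ∀ (M : ℝ → ℝ≥0∞), (∀ I, ∀ y ∈ dy I, ENNReal.ofReal (wavg s F I ^ (1 / s)) ≤ M y) →
      ∀ P : Tile, ∀ y ∈ dy P.1, ENNReal.ofReal (level s F P) ≤ M y := by
    intro M hM P y hy
    rcases eq_or_ne (M y) ∞ with ht | ht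
    · rw [ht]; exact le_top
    rw [ENNReal.ofReal_le_iff_le_toReal ht]
    have : Nonempty {I : ℤ × ℤ // dy P.1 ⊆ dy I} := ⟨⟨P.1, subset_rfl⟩⟩
    exact ciSup_le fun I => (ENNReal.ofReal_le_iff_le_toReal ht).1 (hM I.1 y (I.2 hy))
  rcases hx.eq_or_lt with rfl | hx
  · have hfin : eLpNorm F ∞ volume ≠ ∞ := by
      rw [eLpNorm_exponent_top]
      refine ((eLpNormEssSup_le_of_ae_bound (C := B) (ae_of_all _ fun x => ?_)).trans_lt
        ENNReal.ofReal_lt_top).ne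
      rw [Real.norm_of_nonneg (h0 x)]; exact hB x
    have hae : ∀ᵐ x, F x ≤ (eLpNorm F ∞ volume).toReal := by
      filter_upwards [ae_le_eLpNormEssSup (f := F) (μ := volume)] with x hx
      rw [eLpNorm_exponent_top] at hfin ⊢
      have := (ENNReal.toReal_le_toReal (by simp) hfin).2 hx
      simpa [Real.norm_of_nonneg (h0 x)] using this
    refine ⟨fun _ => levelConst s 0 * eLpNorm F ∞ volume, hlev _ fun I y hy => ?_, fun ρ hρ =>
      ⟨(levelConst s 0 * eLpNorm F ∞ volume) ^ ρ, 0, measurable_const, fun y => ?_, ?_⟩⟩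
    · have h1 := wavg_le h0 hae hs ENNReal.toReal_nonneg I
      have h2 := wavg_nonneg h0 s I
      have h3 := intConst_nonneg
      rw [levelConst, if_pos rfl, ← ENNReal.ofReal_toReal hfin, ← ENNReal.ofReal_mul (by positivity)]
      refine ENNReal.ofReal_le_ofReal ?_
      calc wavg s F I ^ (1 / s) ≤ ((eLpNorm F ∞ volume).toReal ^ s * intConst) ^ (1 / s) := by gcongr
        _ = _ := by
          rw [mul_rpow (by positivity) h3, ← rpow_mul ENNReal.toReal_nonneg, mul_one_div_cancel hs.ne',
            rpow_one, mul_comm]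
    · simp
    · simp
  · set σ := 1 / (x * s) with hσ
    have hxs0 : 0 < x * s := by positivity
    have hσ1 : 1 < σ := by rw [hσ, lt_div_iff₀ hxs0]; linarith
    obtain ⟨S, hSm, hS1, hS2⟩ := maximal hσ1 (F := fun y => ENNReal.ofReal (F y ^ s))
      (hF.pow_const s).ennreal_ofReal (B := ENNReal.ofReal (B ^ s)) ENNReal.ofReal_ne_top
      fun y => ENNReal.ofReal_le_ofReal (rpow_le_rpow (h0 y) (hB y) hs.le)
    refine ⟨fun y => S y ^ (1 / s), hlev _ fun I y hy => ?_, fun ρ hρ =>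
      ⟨1, fun y => S y ^ σ, hSm.pow_const _, fun y => ?_, ?_⟩⟩
    · have hI := len_pos I
      have h1 := hS1 I y hy
      have h2 := wavg_nonneg h0 s I
      rw [← ENNReal.ofReal_rpow_of_nonneg h2 (by positivity)]
      refine ENNReal.rpow_le_rpow ?_ (by positivity)
      have h3 : ENNReal.ofReal (∫ y, F y ^ s * (wt I y ^ 4)⁻¹) ≤ ENNReal.ofReal (len I) * S y := by
        rw [ofReal_integral_eq_lintegral_ofReal (integrable_rpow_wt hF h0 hB hs I)
          (ae_of_all _ fun x => mul_nonneg (rpow_nonneg (h0 x) _)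
            (by have := wt_pos I x; positivity))]
        refine le_of_eq_of_le ?_ h1
        refine lintegral_congr fun y => ?_
        exact ENNReal.ofReal_mul (rpow_nonneg (h0 y) _)
      rw [wavg, ENNReal.ofReal_div_of_pos hI]
      refine ENNReal.div_le_of_le_mul ?_
      rwa [mul_comm]
    · rw [one_mul, ← ENNReal.rpow_mul, ← ENNReal.rpow_mul]
      refine le_of_eq (congrArg _ ?_)
      rw [hσ]; field_simp
    · have h4 : eLpNorm F (ENNReal.ofReal x)⁻¹ volume
          = (∫⁻ y, ENNReal.ofReal (F y ^ s) ^ σ) ^ x := by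
        rw [← ENNReal.ofReal_inv_of_pos hx, eLpNorm_eq_lintegral_rpow_enorm_toReal
          (by simpa using hx) (by simp), ENNReal.toReal_ofReal (by positivity), one_div, inv_inv]
        congr 1
        refine lintegral_congr fun y => ?_
        rw [← ofReal_norm, Real.norm_of_nonneg (h0 y),
          ENNReal.ofReal_rpow_of_nonneg (h0 y) (by positivity),
          ENNReal.ofReal_rpow_of_nonneg (rpow_nonneg (h0 y) _) (by positivity), ← rpow_mul (h0 y)]
        congr 2
        rw [hσ]; field_simp
      rw [one_mul, h4, levelConst, if_neg hx.ne', ENNReal.rpow_mul,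
        ← ENNReal.mul_rpow_of_nonneg _ _ hx.le]
      refine ENNReal.rpow_le_rpow (ENNReal.rpow_le_rpow ?_ hx.le) hρ.le
      rw [mul_assoc]
      exact hS2

theorem global_sum {ι : Type*} [Fintype ι] {ρ : ℝ} (hρ : 0 < ρ) {Φ : Finset Tile → ℝ≥0∞}
    (hΦ0 : Φ ∅ = 0) (hΦ : ∀ D₁ D₂ : Finset Tile, Disjoint D₁ D₂ → Φ (D₁ ∪ D₂) ≤ Φ D₁ + Φ D₂)
    {F : ι → ℝ → ℝ} (hF : ∀ j, Measurable (F j)) (h0 : ∀ j x, 0 ≤ F j x)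
    (hB : ∀ j, ∃ B, ∀ x, F j x ≤ B) (hne : ∀ j, ¬ F j =ᵐ[volume] 0) {s x : ι → ℝ}
    (hs : ∀ j, 0 < s j) (hx : ∀ j, 0 ≤ x j) (hxs : ∀ j, x j * s j < 1) (hsum : ∑ j, x j * ρ = 1)
    {D : Finset Tile} {C : ℝ≥0∞}
    (h : ∀ D' ⊆ D, D'.Nonempty → ∀ (Q : ℤ × ℤ) (A : ι → ℝ), (∀ j, 0 < A j) →
      (∀ P ∈ D', dy P.1 ⊆ dy Q) →
      (∀ j, ∀ P ∈ D', ∀ I, dy P.1 ⊆ dy I → ∫ x, F j x ^ s j * (wt I x ^ 4)⁻¹ ≤ A j ^ s j * len I) →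
      Φ D' ≤ C * ENNReal.ofReal (len Q * ∏ j, A j ^ ρ)) :
    Φ D ≤ C * (ENNReal.ofReal (groupConst ρ) ^ Fintype.card ι *
      ∏ j, (levelConst (s j) (x j) * eLpNorm (F j) (ENNReal.ofReal (x j))⁻¹ volume) ^ ρ) := by
  choose B hB using hB
  choose M hM1 hM2 using fun j => exists_level_bound (hF j) (h0 j) (hB j) (hs j) (hx j) (hxs j)
  choose K G hG1 hG2 hG3 using fun j => hM2 j ρ hρ
  refine (grouping hρ hΦ0 hΦ (u := fun j => level (s j) (F j))
    (fun j P => level_pos (hF j) (h0 j) (hB j) (hs j) (hne j) P) (M := M)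
    (fun j P _ y hy => hM1 j P y hy) (fun D' hD' hDn Q A hA hQ hu => h D' hD' hDn Q A hA hQ
      fun j P hP I hI => integral_le_of_level_le (h0 j) (hB j) (hs j) (hu j P hP) hI)).trans ?_
  gcongr
  calc ∫⁻ y, ∏ j, M j y ^ ρ ≤ ∫⁻ y, ∏ j, (K j * G j y ^ (x j * ρ)) := by
        refine lintegral_mono fun y => Finset.prod_le_prod' fun j _ => hG2 j y
    _ = (∏ j, K j) * ∫⁻ y, ∏ j, G j y ^ (x j * ρ) := by
        simp only [Finset.prod_mul_distrib]
        exact lintegral_const_mul _ (Finset.measurable_prod _ fun j _ => (hG1 j).pow_const _)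
    _ ≤ (∏ j, K j) * ∏ j, (∫⁻ y, G j y) ^ (x j * ρ) := by
        gcongr
        exact ENNReal.lintegral_prod_norm_pow_le _ (fun j _ => (hG1 j).aemeasurable) hsum
          fun j _ => mul_nonneg (hx j) hρ.le
    _ ≤ _ := by
        rw [← Finset.prod_mul_distrib]
        exact Finset.prod_le_prod' fun j _ => hG3 j

open scoped FourierTransform SchwartzMap

lemma schwartz_decay (χ : 𝓢(ℝ, ℂ)) (N : ℕ) :
    ∃ K, 0 ≤ K ∧ ∀ u, ‖χ u‖ ≤ K * ((1 + |u|) ^ N)⁻¹ := by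
  refine ⟨2 ^ N * ((Finset.Iic (N, 0)).sup fun m => SchwartzMap.seminorm ℝ m.1 m.2) χ,
    by positivity, fun u => ?_⟩
  have := SchwartzMap.one_add_le_sup_seminorm_apply (𝕜 := ℝ) (m := (N, 0)) le_rfl le_rfl χ u
  rw [norm_iteratedFDeriv_zero, Real.norm_eq_abs] at this
  rw [← div_eq_mul_inv, le_div_iff₀ (by positivity), mul_comm]
  exact this

lemma schwartz_lip (χ : 𝓢(ℝ, ℂ)) (N : ℕ) :
    ∃ K, 0 ≤ K ∧ ∀ u u', |u - u'| ≤ 1 → ‖χ u - χ u'‖ ≤ K * |u - u'| * ((1 + |u'|) ^ N)⁻¹ := by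
  obtain ⟨K, hK, h⟩ := schwartz_decay (SchwartzMap.derivCLM ℝ ℂ χ) N
  refine ⟨K * 2 ^ N, by positivity, fun u u' hu => ?_⟩
  have := (convex_uIcc u' u).norm_image_sub_le_of_norm_deriv_le (f := χ)
    (C := K * 2 ^ N * ((1 + |u'|) ^ N)⁻¹) (fun x _ => χ.differentiableAt) (fun x hx => ?_)
    left_mem_uIcc right_mem_uIcc
  · rw [Real.norm_eq_abs] at this
    linarith [this]
  · refine (h x).trans ?_
    have h1 : 1 + |u'| ≤ 2 * (1 + |x|) := by
      have h2 : |u' - x| ≤ |u - u'| := by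
        rw [abs_sub_comm]; exact abs_sub_left_of_mem_uIcc hx
      have := abs_sub_abs_le_abs_sub u' x
      have := abs_nonneg x
      linarith
    rw [mul_assoc]
    gcongr
    rw [← div_eq_mul_inv, le_div_iff₀ (by positivity), ← div_eq_inv_mul,
      div_le_iff₀ (by positivity), ← mul_pow]
    exact pow_le_pow_left₀ (by positivity) h1 _

lemma fourierInv_eq_ph (m : ℝ → ℂ) (u : ℝ) : 𝓕⁻ m u = ∫ v, m v * ph (u * v) := by
  rw [Real.fourierInv_eq']
  refine integral_congr_ae (.of_forall fun v => ?_)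
  simp only [ph, smul_eq_mul, RCLike.inner_apply, conj_trivial]
  rw [mul_comm]

lemma fourier_eq_ph (m : ℝ → ℂ) (u : ℝ) : 𝓕 m u = ∫ v, m v * ph (-(u * v)) := by
  rw [Real.fourier_eq']
  refine integral_congr_ae (.of_forall fun v => ?_)
  simp only [ph, smul_eq_mul, RCLike.inner_apply, conj_trivial]
  rw [mul_comm]
  congr 4
  ring

/-- The wave packet with position `y`, frequency `ζ` and scale `s`, whose profile has Fourier
transform `m`. -/
noncomputable def pk (m : 𝓢(ℝ, ℂ)) (y ζ s x : ℝ) : ℂ :=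
  (s : ℂ)⁻¹ * ph ((y - x) * ζ) * (𝓕⁻ m) ((y - x) / s)

lemma continuous_pk (m : 𝓢(ℝ, ℂ)) (y ζ s : ℝ) : Continuous (pk m y ζ s) := by
  unfold pk
  have := continuous_ph
  have h := (𝓕⁻ m).continuous
  fun_prop

lemma pk_eq (m : 𝓢(ℝ, ℂ)) (y ζ x : ℝ) {s : ℝ} (hs : 0 < s) :
    pk m y ζ s x = ∫ ξ, m (s * (ξ - ζ)) * ph ((y - x) * ξ) := by
  rw [integral_sub_right_eq_self (fun ξ => m (s * (ξ - ζ)) * ph ((y - x) * ξ)) (-ζ) |>.symm]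
  have := Measure.integral_comp_mul_left (fun v => m v * ph ((y - x) / s * v)) s
  rw [pk, SchwartzMap.fourierInv_coe, fourierInv_eq_ph]
  have e : ∀ ξ : ℝ, m (s * (ξ - -ζ - ζ)) * ph ((y - x) * (ξ - -ζ))
      = ph ((y - x) * ζ) * (m (s * ξ) * ph ((y - x) / s * (s * ξ))) := by
    intro ξ
    have h1 : s * (ξ - -ζ - ζ) = s * ξ := by ring
    have h2 : (y - x) * (ξ - -ζ) = (y - x) * ζ + (y - x) / s * (s * ξ) := by field_simp; ring
    rw [h1, h2, ph_add]; ring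
  simp_rw [e]
  rw [integral_const_mul, this, abs_of_pos (by positivity), Complex.real_smul]
  push_cast
  ring

lemma integrable_pk (m : 𝓢(ℝ, ℂ)) (y ζ : ℝ) {s : ℝ} (hs : 0 < s) : Integrable (pk m y ζ s) := by
  have h := (𝓕⁻ m).integrable (μ := volume)
  have h2 := ((h.comp_div hs.ne').comp_sub_left y).const_mul ((s : ℂ)⁻¹)
  refine h2.mono (continuous_pk m y ζ s).aestronglyMeasurable (.of_forall fun x => ?_)
  simp [pk, norm_ph]

lemma integral_ph_mul_pk (m : 𝓢(ℝ, ℂ)) (y ζ ξ : ℝ) {s : ℝ} (hs : 0 < s) :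
    ∫ x, ph (x * ξ) * pk m y ζ s x = ph (y * ξ) * m (s * (ξ - ζ)) := by
  rw [← integral_sub_left_eq_self _ volume y]
  have := Measure.integral_comp_mul_left (fun x => ph ((y - x) * ξ) * pk m y ζ s (y - x)) s
  rw [abs_of_pos (by positivity), Complex.real_smul] at this
  have h2 : 𝓕 (𝓕⁻ m) (s * (ξ - ζ)) = m (s * (ξ - ζ)) := by
    rw [FourierTransform.fourier_fourierInv_eq m]
  rw [SchwartzMap.fourier_coe, fourier_eq_ph] at h2
  have hs' : (s : ℂ) ≠ 0 := by exact_mod_cast hs.ne'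
  have e : ∀ x : ℝ, ph ((y - s * x) * ξ) * pk m y ζ s (y - s * x)
      = (s : ℂ)⁻¹ * ph (y * ξ) * ((𝓕⁻ m) x * ph (-(s * (ξ - ζ) * x))) := by
    intro x
    have h1 : (y - (y - s * x)) / s = x := by field_simp; ring
    have h2 : ph ((y - s * x) * ξ) * ph ((y - (y - s * x)) * ζ)
        = ph (y * ξ) * ph (-(s * (ξ - ζ) * x)) := by
      rw [← ph_add, ← ph_add]; congr 1; ring
    rw [pk, h1]
    linear_combination (s : ℂ)⁻¹ * (𝓕⁻ m) x * h2
  simp_rw [e] at this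
  rw [integral_const_mul, h2] at this
  rw [mul_assoc, Complex.ofReal_inv] at this
  exact (mul_left_cancel₀ (inv_ne_zero hs') this).symm

lemma integrable_profile (m : 𝓢(ℝ, ℂ)) (ζ : ℝ) {s : ℝ} (hs : 0 < s) :
    Integrable fun ξ => m (s * (ξ - ζ)) :=
  ((m.integrable (μ := volume)).comp_mul_left' hs.ne').comp_sub_right ζ

lemma integral_pk_mul_conj_pk (m m' : 𝓢(ℝ, ℂ)) (y ζ y' ζ' : ℝ) {s s' : ℝ} (hs : 0 < s)
    (hs' : 0 < s') (h : ∀ ξ, m (s * (ξ - ζ)) = 0 ∨ m' (s' * (ξ - ζ')) = 0) :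
    ∫ x, pk m y ζ s x * (starRingEnd ℂ) (pk m' y' ζ' s' x) = 0 := by
  have h1 : ∀ x, pk m y ζ s x * (starRingEnd ℂ) (pk m' y' ζ' s' x) = ∫ ξ, pk m y ζ s x *
      ((starRingEnd ℂ) (m' (s' * (ξ - ζ'))) * ph (-((y' - x) * ξ))) := by
    intro x
    rw [pk_eq m' y' ζ' x hs', ← integral_conj, ← integral_const_mul]
    simp only [map_mul, conj_ph]
  simp_rw [h1]
  rw [integral_integral_swap]
  · refine integral_eq_zero_of_ae (.of_forall fun ξ => ?_)
    have e : ∀ x, pk m y ζ s x * ((starRingEnd ℂ) (m' (s' * (ξ - ζ'))) * ph (-((y' - x) * ξ)))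
        = (starRingEnd ℂ) (m' (s' * (ξ - ζ'))) * ph (-(y' * ξ)) * (ph (x * ξ) * pk m y ζ s x) := by
      intro x
      have : -((y' - x) * ξ) = -(y' * ξ) + x * ξ := by ring
      rw [this, ph_add]; ring
    simp_rw [e]
    rw [integral_const_mul, integral_ph_mul_pk m y ζ ξ hs]
    rcases h ξ with h | h <;> simp [h]
  · have hi := (integrable_pk m y ζ hs).mul_prod (integrable_profile m' ζ' hs')
    refine hi.mono ?_ (.of_forall fun x => by simp [norm_ph, Function.uncurry])
    have := continuous_ph
    have := continuous_pk m y ζ s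
    have := m'.continuous
    exact Continuous.aestronglyMeasurable (by unfold Function.uncurry; fun_prop)

lemma wt_le_of_mem_dy {I : ℤ × ℤ} {y s : ℝ} (hy : y ∈ dy I) (hs : 0 < s) (hs2 : s ≤ 2 * len I)
    (x : ℝ) : wt I x ≤ 2 * (1 + |(y - x) / s|) := by
  have hI := len_pos I
  rw [mem_dy] at hy
  have h1 : |y / len I - I.2| ≤ 1 := by
    have e : lft I = len I * I.2 := by simp [lft, mul_comm]
    rw [e] at hy
    rw [abs_le]
    constructor
    · have : (I.2 : ℝ) ≤ y / len I := by rw [le_div_iff₀ hI]; linarith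
      linarith
    · have : y / len I ≤ I.2 + 1 := by rw [div_le_iff₀ hI]; linarith
      linarith
  have h2 : |x / len I - y / len I| ≤ 2 * |(y - x) / s| := by
    rw [← sub_div, abs_div, abs_div, abs_sub_comm, abs_of_pos hI, abs_of_pos hs,
      div_le_iff₀ hI, mul_assoc, div_mul_eq_mul_div, mul_div_assoc', le_div_iff₀ hs]
    nlinarith [abs_nonneg (y - x)]
  have := abs_sub_le (x / len I) (y / len I) I.2
  rw [wt]
  linarith

lemma norm_pk (m : 𝓢(ℝ, ℂ)) (y ζ x : ℝ) {s : ℝ} (hs : 0 < s) :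
    ‖pk m y ζ s x‖ = s⁻¹ * ‖(𝓕⁻ m) ((y - x) / s)‖ := by
  simp [pk, norm_ph, abs_of_pos hs]

lemma pow_wt_inv_le {I : ℤ × ℤ} {y s : ℝ} (hy : y ∈ dy I) (hs : 0 < s) (hs2 : s ≤ 2 * len I)
    (x : ℝ) (N : ℕ) : ((1 + |(y - x) / s|) ^ N)⁻¹ ≤ 2 ^ N * (wt I x ^ N)⁻¹ := by
  have h := wt_le_of_mem_dy hy hs hs2 x
  have := wt_pos I x
  rw [← div_eq_mul_inv, le_div_iff₀ (by positivity), ← div_eq_inv_mul,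
    div_le_iff₀ (by positivity), ← mul_pow]
  exact pow_le_pow_left₀ (by positivity) h _

lemma norm_ph_sub_ph_le (s t : ℝ) : ‖ph s - ph t‖ ≤ 2 * π * |s - t| := by
  have e : ph s - ph t = ph t * (ph (s - t) - 1) := by
    rw [mul_sub, ← ph_add]; congr 2 <;> ring_nf
  rw [e, norm_mul, norm_ph, one_mul, ph, mul_comm _ Complex.I]
  refine (Real.norm_exp_I_mul_ofReal_sub_one_le).trans ?_
  rw [Real.norm_eq_abs, abs_mul, abs_of_pos (by positivity)]

/-- Uniform constant for the packets with profile `m`. -/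
lemma exists_pk_bound (m : 𝓢(ℝ, ℂ)) (N : ℕ) : ∃ C, 0 ≤ C ∧ ∀ (I : ℤ × ℤ) (y ζ s : ℝ),
    y ∈ dy I → len I ≤ s → s ≤ 2 * len I → Decay C N (pk m y ζ s) I ∧
    ∀ ξ, |ξ - ζ| * len I ≤ 40 → Lip C N (fun x => ph (ξ * x) * pk m y ζ s x) I := by
  obtain ⟨K, hK, hd⟩ := schwartz_decay (𝓕⁻ m) N
  obtain ⟨L, hL, hl⟩ := schwartz_lip (𝓕⁻ m) N
  refine ⟨2 ^ N * (2 * π * 40 * K + L + K), by positivity, fun I y ζ s hy hs hs2 => ?_⟩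
  have hI := len_pos I
  have hs0 : 0 < s := hI.trans_le hs
  have hinv : s⁻¹ ≤ (len I)⁻¹ := inv_anti₀ hI hs
  have hdec : ∀ x, ‖(𝓕⁻ m) ((y - x) / s)‖ ≤ K * (2 ^ N * (wt I x ^ N)⁻¹) := fun x =>
    (hd _).trans (by gcongr; exact pow_wt_inv_le hy hs0 hs2 x N)
  have hw : ∀ x, 0 ≤ (wt I x ^ N)⁻¹ := fun x => by have := wt_pos I x; positivity
  refine ⟨fun x => ?_, fun ξ hξ x x' hx => ?_⟩
  · rw [norm_pk m y ζ x hs0]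
    calc s⁻¹ * ‖(𝓕⁻ m) ((y - x) / s)‖ ≤ (len I)⁻¹ * (K * (2 ^ N * (wt I x ^ N)⁻¹)) :=
          mul_le_mul hinv (hdec x) (norm_nonneg _) (by positivity)
      _ ≤ _ := by
          have : 0 ≤ (2 * π * 40 * K + L) * (2 ^ N * (len I)⁻¹ * (wt I x ^ N)⁻¹) := by
            have := hw x; positivity
          linarith
  · have e : ∀ x, ph (ξ * x) * pk m y ζ s x
        = (s : ℂ)⁻¹ * ph (y * ζ) * (ph ((ξ - ζ) * x) * (𝓕⁻ m) ((y - x) / s)) := by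
      intro x
      have : ph (ξ * x) * ph ((y - x) * ζ) = ph (y * ζ) * ph ((ξ - ζ) * x) := by
        rw [← ph_add, ← ph_add]; congr 1; ring
      rw [pk]
      linear_combination (s : ℂ)⁻¹ * (𝓕⁻ m) ((y - x) / s) * this
    have hu : |(y - x) / s - (y - x') / s| = |x - x'| * s⁻¹ := by
      rw [← sub_div, abs_div, abs_of_pos hs0, div_eq_mul_inv, abs_sub_comm]
      congr 2; ring
    have h1 := hl ((y - x) / s) ((y - x') / s) (by
      rw [hu, ← div_eq_mul_inv, div_le_one hs0]; linarith)
    rw [hu] at h1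
    have h2 := norm_ph_sub_ph_le ((ξ - ζ) * x) ((ξ - ζ) * x')
    rw [← mul_sub, abs_mul] at h2
    have h3 : |ξ - ζ| ≤ 40 * (len I)⁻¹ := by
      rw [← div_eq_mul_inv, le_div_iff₀ hI]; exact hξ
    set A := ph ((ξ - ζ) * x)
    set A' := ph ((ξ - ζ) * x')
    set B := (𝓕⁻ m) ((y - x) / s)
    set B' := (𝓕⁻ m) ((y - x') / s)
    have h4 : ‖A * B - A' * B'‖ ≤ ‖B - B'‖ + ‖A - A'‖ * ‖B'‖ := by
      have : A * B - A' * B' = A * (B - B') + (A - A') * B' := by ring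
      rw [this]
      refine (norm_add_le _ _).trans ?_
      rw [norm_mul, norm_mul, norm_ph, one_mul]
    simp only [e]
    rw [← mul_sub, norm_mul, norm_mul, norm_ph, mul_one, norm_inv, Complex.norm_real,
      Real.norm_eq_abs, abs_of_pos hs0]
    have hw' := hw x'
    set w := (wt I x' ^ N)⁻¹
    have h5 : ‖B - B'‖ ≤ L * (|x - x'| * (len I)⁻¹) * (2 ^ N * w) :=
      h1.trans (by gcongr; exact pow_wt_inv_le hy hs0 hs2 x' N)
    have h6 : ‖A - A'‖ * ‖B'‖ ≤ 2 * π * (40 * (len I)⁻¹ * |x - x'|) * (K * (2 ^ N * w)) :=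
      mul_le_mul (h2.trans (by gcongr)) (hdec x') (norm_nonneg _) (by positivity)
    calc s⁻¹ * ‖A * B - A' * B'‖ ≤ (len I)⁻¹ * (L * (|x - x'| * (len I)⁻¹) * (2 ^ N * w)
          + 2 * π * (40 * (len I)⁻¹ * |x - x'|) * (K * (2 ^ N * w))) :=
          mul_le_mul hinv (by linarith) (norm_nonneg _) (by positivity)
      _ ≤ _ := by
          have : 0 ≤ K * (2 ^ N * ((len I)⁻¹ * (len I)⁻¹) * |x - x'| * w) := by positivity
          linarith

/-- The box of phase space attached to a tile, in the coordinates (position, frequency, scale). -/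
def box (P : Tile) : Set (ℝ × ℝ × ℝ) :=
  {z | z.1 ∈ dy P.1 ∧ ⌊z.2.1 * len P.1⌋ = P.2 ∧ len P.1 ≤ z.2.2 ∧ z.2.2 < 2 * len P.1}

/-- Frequency of the `j`-th wave packet attached to a point of phase space. -/
noncomputable def freq (j : Fin 3) (z : ℝ × ℝ × ℝ) : ℝ :=
  ![z.2.1 - 16 / z.2.2, z.2.1 + 16 / z.2.2, 2 * z.2.1] j

def dil : Fin 3 → ℝ := ![1, 1, 2]

/-- The `j`-th wave packet attached to a point of phase space. -/
noncomputable def pack (m : Fin 3 → 𝓢(ℝ, ℂ)) (j : Fin 3) (z : ℝ × ℝ × ℝ) (x : ℝ) : ℂ :=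
  pk (m j) z.1 (freq j z) z.2.2 x

def rad : Fin 3 → ℝ := ![1, 1, 4]

lemma freq_box {j : Fin 3} {P : Tile} {z : ℝ × ℝ × ℝ} (hz : z ∈ box P) {ξ : ℝ}
    (h : |z.2.2 * (dil j * ξ - freq j z)| ≤ rad j) : ξ ∈ band (bd j) P := by
  obtain ⟨-, h2, h3, h4⟩ := hz
  have hI := len_pos P.1
  rw [Int.floor_eq_iff] at h2
  have hs := hI.trans_le h3
  obtain ⟨y, η, s⟩ := z
  simp only at h h2 h3 h4 hs
  have hr : 0 < len P.1 / s := by positivity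
  have hr1 : len P.1 / s ≤ 1 := by rw [div_le_one hs]; exact h3
  have hr2 : 1 / 2 < len P.1 / s := by rw [lt_div_iff₀ hs]; linarith
  rw [abs_le] at h
  have k1 := mul_le_mul_of_nonneg_right h.1 hr.le
  have k2 := mul_le_mul_of_nonneg_right h.2 hr.le
  set ρ := len P.1 / s
  have hρ : ρ * s = len P.1 := by simp only [ρ]; field_simp
  have e1 : 16 / s * len P.1 = 16 * ρ := by simp only [ρ]; field_simp
  have e2 : s * ρ = len P.1 := by linarith
  have e3 : ∀ u, s * u * ρ = u * len P.1 := fun u => by rw [mul_right_comm, e2, mul_comm]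
  rw [e3] at k1 k2
  simp only [band, mem_ofPred_eq, mem_Icc]
  fin_cases j <;> simp [bd, dil, freq, rad] at k1 k2 ⊢ <;> constructor <;> nlinarith

lemma freq_near {j : Fin 3} {P : Tile} {z : ℝ × ℝ × ℝ} (hz : z ∈ box P) {ξ : ℝ}
    (h : InFreq ξ P) : |dil j * ξ - freq j z| * len P.1 ≤ 40 := by
  obtain ⟨-, h2, h3, h4⟩ := hz
  have hI := len_pos P.1
  rw [Int.floor_eq_iff] at h2
  have hs := hI.trans_le h3
  obtain ⟨y, η, s⟩ := z
  simp only at h2 h3 h4 hs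
  have hr : 0 < len P.1 / s := by positivity
  have hr1 : len P.1 / s ≤ 1 := by rw [div_le_one hs]; exact h3
  rw [InFreq, abs_le] at h
  have e1 : 16 / s * len P.1 = 16 * (len P.1 / s) := by field_simp
  rw [show |dil j * ξ - freq j (y, η, s)| * len P.1 = |(dil j * ξ - freq j (y, η, s)) * len P.1|
    by rw [abs_mul, abs_of_pos hI], abs_le]
  fin_cases j <;> simp [dil, freq] <;> constructor <;> nlinarith

/-- Packets sampled at arbitrary points of the boxes are adapted. -/
lemma exists_adapted (m : Fin 3 → 𝓢(ℝ, ℂ)) (hm : ∀ j v, rad j < |v| → m j v = 0) (N : ℕ) :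
    ∃ C, 0 ≤ C ∧ ∀ z : Tile → ℝ × ℝ × ℝ, (∀ P, z P ∈ box P) →
      ∀ j, Adapted C N (bd j) (dil j) (fun P => pack m j (z P)) := by
  choose C hC h using fun j => exists_pk_bound (m j) N
  refine ⟨∑ j, C j, Finset.sum_nonneg fun j _ => hC j, fun z hz j => ?_⟩
  have hle : C j ≤ ∑ j, C j := Finset.single_le_sum (fun j _ => hC j) (Finset.mem_univ j)
  have hh := fun P => h j P.1 (z P).1 (freq j (z P)) (z P).2.2 (hz P).1 (hz P).2.2.1
    (hz P).2.2.2.le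
  have hs : ∀ P, 0 < (z P).2.2 := fun P => (len_pos P.1).trans_le (hz P).2.2.1
  refine ⟨fun P => continuous_pk _ _ _ _, fun P x => ((hh P).1 x).trans ?_,
    fun P ξ hξ x x' hx => (((hh P).2 (dil j * ξ) (freq_near (hz P) hξ)) x x' hx).trans ?_,
    fun P P' hd => ?_⟩
  · have := len_pos P.1
    have := wt_pos P.1 x
    gcongr
  · have := len_pos P.1
    have := wt_pos P.1 x'
    gcongr
  · refine integral_pk_mul_conj_pk _ _ _ _ _ _ (hs P) (hs P') fun ξ => ?_
    by_contra! hcon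
    have hd0 : dil j ≠ 0 := by fin_cases j <;> simp [dil]
    have e : dil j * (ξ / dil j) = ξ := by field_simp
    refine Set.disjoint_left.1 hd (freq_box (ξ := ξ / dil j) (hz P) ?_) (freq_box (hz P') ?_)
    · rw [e]; by_contra! hc; exact hcon.1 (hm j _ hc)
    · rw [e]; by_contra! hc; exact hcon.2 (hm j _ hc)

lemma exists_exps (x : Fin 3 → ℝ) (hx1 : ∀ j, x j < 1)
    (hsum : ∑ j, (2 * max (x j) (1 / 2) - 1) < 1) :
    ∃ s θ : Fin 3 → ℝ, ∃ ε δ : ℝ, ∃ W : ℕ, Exps s θ ε δ W ∧ ∀ j, x j * s j < 1 := by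
  set μ : Fin 3 → ℝ := fun j => max (x j) (1 / 2)
  have hμx : ∀ j, x j ≤ μ j := fun j => le_max_left _ _
  have hμ : ∀ j, 1 / 2 ≤ μ j := fun j => le_max_right _ _
  have hμ1 : ∀ j, μ j < 1 := fun j => max_lt (hx1 j) (by norm_num)
  set d : ℝ := (1 - ∑ j, (2 * μ j - 1)) / 3 with hd
  have hd0 : 0 < d := by rw [hd]; linarith
  have hle : ∀ j, (2 * μ j - 1) + 3 * d ≤ 1 := by
    intro j
    have : 2 * μ j - 1 ≤ ∑ j, (2 * μ j - 1) :=
      Finset.single_le_sum (f := fun j => 2 * μ j - 1) (fun j _ => by have := hμ j; linarith)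
        (Finset.mem_univ j)
    rw [hd]; linarith
  obtain ⟨W, hW⟩ := exists_nat_ge (3 / d)
  have hpos : ∀ j, 0 < μ j + d / 4 := fun j => by have := hμ j; linarith
  refine ⟨fun j => 1 / (μ j + d / 4), fun j => 2 * μ j - 1 + d, d, d / 8, W + 4, ⟨?_, hd0, ?_, ?_,
    by positivity, ?_, ?_, by omega, ?_, ?_⟩, ?_⟩
  · rw [Finset.sum_add_distrib, Finset.sum_const, Finset.card_univ, Fintype.card_fin, hd]
    simp; ring
  · intro j; have := hμ j; linarith
  · intro j; have := hle j; have := hμ j; linarith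
  · intro j
    have := hμ j; have := hμ1 j; have := hle j
    rw [div_mul_eq_mul_div, le_div_iff₀ (hpos j)]
    nlinarith
  · rw [div_le_iff₀ hd0] at hW
    simp; linarith
  · intro j
    have := hle j; have := hμ1 j
    rw [le_div_iff₀ (hpos j)]; linarith
  · intro j
    have := hμ j
    rw [div_le_iff₀ (hpos j)]; linarith
  · intro j
    have := hμx j
    rw [mul_one_div, div_lt_one (hpos j)]; linarith

open scoped FourierTransform SchwartzMap

/-- The class of functions for which the model sums are estimated. -/
structure Nice {H : Type*} [NormedAddCommGroup H] (f : ℝ → H) : Prop where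
  integrable : Integrable f
  meas : StronglyMeasurable f
  bdd : ∃ B, ∀ x, ‖f x‖ ≤ B

section
variable {H : Type*} [NormedAddCommGroup H] [InnerProductSpace ℂ H]

noncomputable def coef (m : Fin 3 → 𝓢(ℝ, ℂ)) (j : Fin 3) (f : ℝ → H) (z : ℝ × ℝ × ℝ) : H :=
  ∫ x, pack m j z x • f x

/-- The contribution of the point `z` of phase space to the bilinear operator. -/
noncomputable def kern (m : Fin 3 → 𝓢(ℝ, ℂ)) (f : ℝ → H) (g : ℝ → ℂ) (z : ℝ × ℝ × ℝ) (x : ℝ) : H :=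
  (coef m 1 g z * (starRingEnd ℂ) (pack m 2 z x)) • coef m 0 f z

/-- The model operator of a finite set of tiles. -/
noncomputable def modelOp (m : Fin 3 → 𝓢(ℝ, ℂ)) (f : ℝ → H) (g : ℝ → ℂ) (D : Finset Tile) (x : ℝ) :
    H := ∑ P ∈ D, ∫ z in box P, kern m f g z x

lemma measurable_pack (m : Fin 3 → 𝓢(ℝ, ℂ)) (j : Fin 3) :
    Measurable fun q : (ℝ × ℝ × ℝ) × ℝ => pack m j q.1 q.2 := by
  have h1 : Measurable fun q : (ℝ × ℝ × ℝ) × ℝ => freq j q.1 := by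
    fin_cases j <;> simp only [freq] <;> dsimp <;> fun_prop
  have h2 := (𝓕⁻ (m j)).continuous.measurable
  have h3 := continuous_ph.measurable
  unfold pack pk
  fun_prop

lemma stronglyMeasurable_coef (m : Fin 3 → 𝓢(ℝ, ℂ)) (j : Fin 3) {f : ℝ → H}
    (hf : StronglyMeasurable f) : StronglyMeasurable (coef m j f) :=
  StronglyMeasurable.integral_prod_right'
    (f := fun q : (ℝ × ℝ × ℝ) × ℝ => pack m j q.1 q.2 • f q.2)
    ((measurable_pack m j).stronglyMeasurable.smul (hf.comp_measurable measurable_snd))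

lemma stronglyMeasurable_kern (m : Fin 3 → 𝓢(ℝ, ℂ)) {f : ℝ → H} {g : ℝ → ℂ}
    (hf : StronglyMeasurable f) (hg : StronglyMeasurable g) :
    StronglyMeasurable fun q : (ℝ × ℝ × ℝ) × ℝ => kern m f g q.1 q.2 := by
  have h1 := (stronglyMeasurable_coef m 0 hf).comp_measurable
    (measurable_fst : Measurable (Prod.fst : (ℝ × ℝ × ℝ) × ℝ → _))
  have h2 := (stronglyMeasurable_coef m 1 hg).comp_measurable
    (measurable_fst : Measurable (Prod.fst : (ℝ × ℝ × ℝ) × ℝ → _))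
  have h3 := (Complex.continuous_conj.measurable.comp (measurable_pack m 2)).stronglyMeasurable
  exact (h2.mul h3).smul h1

lemma stronglyMeasurable_modelOp (m : Fin 3 → 𝓢(ℝ, ℂ)) {f : ℝ → H} {g : ℝ → ℂ}
    (hf : StronglyMeasurable f) (hg : StronglyMeasurable g) (D : Finset Tile) :
    StronglyMeasurable (modelOp m f g D) :=
  Finset.stronglyMeasurable_fun_sum _ fun _ _ =>
    StronglyMeasurable.integral_prod_left' (stronglyMeasurable_kern m hf hg)

lemma box_eq (P : Tile) : box P = dy P.1 ×ˢ (Ico (P.2 / len P.1 : ℝ) ((P.2 + 1) / len P.1) ×ˢ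
    Ico (len P.1) (2 * len P.1)) := by
  have := len_pos P.1
  ext z
  simp only [box, mem_ofPred_eq, mem_prod, mem_Ico, Int.floor_eq_iff, div_le_iff₀ this,
    lt_div_iff₀ this]

lemma measurableSet_box (P : Tile) : MeasurableSet (box P) := by
  rw [box_eq]
  exact (measurableSet_dy _).prod (measurableSet_Ico.prod measurableSet_Ico)

lemma volume_box (P : Tile) : volume (box P) = ENNReal.ofReal (len P.1) := by
  have := len_pos P.1
  rw [box_eq, Measure.volume_eq_prod, Measure.prod_prod, Measure.volume_eq_prod, Measure.prod_prod,
    volume_dy, Real.volume_Ico, Real.volume_Ico, ← ENNReal.ofReal_mul (by rw [← sub_div]; simp; positivity),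
    ← ENNReal.ofReal_mul (by positivity)]
  congr 1
  field_simp
  ring

lemma exists_pack_decay (m : Fin 3 → 𝓢(ℝ, ℂ)) (N : ℕ) :
    ∃ C, 0 ≤ C ∧ ∀ j P, ∀ z ∈ box P, Decay C N (pack m j z) P.1 := by
  choose C hC h using fun j => exists_pk_bound (m j) N
  refine ⟨∑ j, C j, Finset.sum_nonneg fun j _ => hC j, fun j P z hz x => ?_⟩
  have hle : C j ≤ ∑ j, C j := Finset.single_le_sum (fun j _ => hC j) (Finset.mem_univ j)
  refine ((h j P.1 z.1 (freq j z) z.2.2 hz.1 hz.2.2.1 hz.2.2.2.le).1 x).trans ?_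
  have := len_pos P.1
  have := wt_pos P.1 x
  gcongr

lemma norm_coef_le (m : Fin 3 → 𝓢(ℝ, ℂ)) {f : ℝ → H} (hf : Integrable f) (P : Tile) :
    ∃ K, 0 ≤ K ∧ ∀ j, ∀ z ∈ box P, ‖coef m j f z‖ ≤ K := by
  obtain ⟨C, hC, h⟩ := exists_pack_decay m 0
  have := len_pos P.1
  refine ⟨∫ x, C * (len P.1)⁻¹ * ‖f x‖, by positivity, fun j z hz => ?_⟩
  refine norm_integral_le_of_norm_le (hf.norm.const_mul _) (.of_forall fun x => ?_)
  rw [norm_smul]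
  gcongr
  simpa using h j P z hz x

lemma exists_kern_bound (m : Fin 3 → 𝓢(ℝ, ℂ)) {f : ℝ → H} {g : ℝ → ℂ}
    (hf : Integrable f) (hg : Integrable g) (P : Tile) :
    ∃ K, 0 ≤ K ∧ ∀ z ∈ box P, ∀ x, ‖kern m f g z x‖ ≤ K * (wt P.1 x ^ 2)⁻¹ := by
  obtain ⟨C, hC, h⟩ := exists_pack_decay m 2
  obtain ⟨K, hK, hfK⟩ := norm_coef_le m hf P
  obtain ⟨L, hL, hgL⟩ := norm_coef_le m hg P
  have := len_pos P.1
  refine ⟨L * (C * (len P.1)⁻¹) * K, by positivity, fun z hz x => ?_⟩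
  have hw := wt_pos P.1 x
  rw [kern, norm_smul, norm_mul, RCLike.norm_conj]
  calc _ ≤ L * (C * (len P.1)⁻¹ * (wt P.1 x ^ 2)⁻¹) * K := by
        gcongr
        · exact hgL _ z hz
        · exact h 2 P z hz x
        · exact hfK _ z hz
    _ = _ := by ring

lemma one_le_wt_pow_inv (I : ℤ × ℤ) (x : ℝ) (N : ℕ) : (wt I x ^ N)⁻¹ ≤ 1 :=
  inv_le_one_of_one_le₀ (one_le_pow₀ (one_le_wt I x))

lemma nice_modelOp (m : Fin 3 → 𝓢(ℝ, ℂ)) {f : ℝ → H} {g : ℝ → ℂ} (hf : Nice f) (hg : Nice g)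
    (D : Finset Tile) : Nice (modelOp m f g D) := by
  choose K hK h using fun P => exists_kern_bound m hf.integrable hg.integrable P
  have hb : ∀ x, ‖modelOp m f g D x‖ ≤ ∑ P ∈ D, K P * (wt P.1 x ^ 2)⁻¹ * len P.1 := by
    intro x
    refine norm_sum_le_of_le _ fun P _ => ?_
    have := norm_setIntegral_le_of_norm_le_const (μ := volume) (s := box P)
      (f := fun z => kern m f g z x) (by rw [volume_box]; exact ENNReal.ofReal_lt_top)
      (fun z hz => h P z hz x)
    rwa [measureReal_def, volume_box, ENNReal.toReal_ofReal (len_pos _).le] at this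
  have hm := stronglyMeasurable_modelOp m hf.meas hg.meas D
  refine ⟨?_, hm, ∑ P ∈ D, K P * len P.1, fun x => (hb x).trans (Finset.sum_le_sum fun P _ => ?_)⟩
  · refine Integrable.mono' (g := fun x => ∑ P ∈ D, K P * (wt P.1 x ^ 2)⁻¹ * len P.1)
      (integrable_finsetSum _ fun P _ => ?_) hm.aestronglyMeasurable (.of_forall hb)
    exact ((integrable_wt_pow P.1 le_rfl).const_mul _).mul_const _
  · have := one_le_wt_pow_inv P.1 x 2
    have := len_pos P.1
    have := hK P
    calc _ ≤ K P * 1 * len P.1 := by gcongr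
      _ = _ := by ring

end

section
variable {H : Type*} [NormedAddCommGroup H] [InnerProductSpace ℂ H] [CompleteSpace H]

lemma integrable_pack_smul {H : Type*} [NormedAddCommGroup H] [InnerProductSpace ℂ H]
    (m : Fin 3 → 𝓢(ℝ, ℂ)) {h : ℝ → H} (hh : Integrable h) {P : Tile}
    {z : ℝ × ℝ × ℝ} (hz : z ∈ box P) (j : Fin 3) : Integrable fun x => pack m j z x • h x := by
  obtain ⟨C, hC, hd⟩ := exists_pack_decay m 2
  exact (hd j P z hz).integrable_smul hC (continuous_pk _ _ _ _) hh

lemma integral_inner_kern (m : Fin 3 → 𝓢(ℝ, ℂ)) (f : ℝ → H) (g : ℝ → ℂ) {h : ℝ → H}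
    (hh : Integrable h) {P : Tile} {z : ℝ × ℝ × ℝ} (hz : z ∈ box P) :
    ∫ x, inner ℂ (h x) (kern m f g z x) = coef m 1 g z * inner ℂ (coef m 2 h z) (coef m 0 f z) := by
  have e : ∀ x, inner ℂ (h x) (kern m f g z x) = coef m 1 g z *
      (starRingEnd ℂ) (inner ℂ (coef m 0 f z) (pack m 2 z x • h x)) := by
    intro x
    rw [kern, inner_smul_right, inner_conj_symm, inner_smul_left]
    ring
  simp_rw [e]
  rw [integral_const_mul, integral_conj, integral_inner (integrable_pack_smul m hh hz 2),
    inner_conj_symm]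
  rfl

lemma integral_inner_modelOp (m : Fin 3 → 𝓢(ℝ, ℂ)) {f h : ℝ → H} {g : ℝ → ℂ} (hf : Nice f)
    (hg : Nice g) (hh : Nice h) (D : Finset Tile) :
    ∫ x, inner ℂ (h x) (modelOp m f g D x) =
      ∑ P ∈ D, ∫ z in box P, coef m 1 g z * inner ℂ (coef m 2 h z) (coef m 0 f z) := by
  have hsm := stronglyMeasurable_kern m hf.meas hg.meas
  have hwint : ∀ P, Integrable (fun q : ℝ × (ℝ × ℝ × ℝ) => inner ℂ (h q.1) (kern m f g q.2 q.1))
      (volume.prod (volume.restrict (box P))) := by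
    intro P
    obtain ⟨K, hK, hb⟩ := exists_kern_bound m hf.integrable hg.integrable P
    have : IsFiniteMeasure (volume.restrict (box P)) :=
      ⟨by rw [Measure.restrict_apply_univ, volume_box]; exact ENNReal.ofReal_lt_top⟩
    refine Integrable.mono' (hh.integrable.norm.mul_prod (integrable_const K)) ?_ ?_
    · exact ((hh.meas.comp_measurable measurable_fst).inner
        (hsm.comp_measurable measurable_swap)).aestronglyMeasurable
    · have : ∀ᵐ q ∂(volume : Measure ℝ).prod (volume.restrict (box P)), q.2 ∈ box P := by
        have := (Measure.quasiMeasurePreserving_snd (μ := (volume : Measure ℝ))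
          (ν := volume.restrict (box P))).ae (ae_restrict_mem (measurableSet_box P))
        exact this
      filter_upwards [this] with q hq
      refine (norm_inner_le_norm _ _).trans ?_
      gcongr
      refine (hb _ hq _).trans ?_
      have := one_le_wt_pow_inv P.1 q.1 2
      nlinarith
  have hkint : ∀ P x, IntegrableOn (fun z => kern m f g z x) (box P) := by
    intro P x
    obtain ⟨K, hK, hb⟩ := exists_kern_bound m hf.integrable hg.integrable P
    refine IntegrableOn.of_bound (by rw [volume_box]; exact ENNReal.ofReal_lt_top)
      (hsm.comp_measurable (measurable_id.prodMk measurable_const)).aestronglyMeasurable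
      (K * (wt P.1 x ^ 2)⁻¹) ?_
    exact (ae_restrict_mem (measurableSet_box P)).mono fun z hz => hb z hz x
  have e : ∀ x, inner ℂ (h x) (modelOp m f g D x) =
      ∑ P ∈ D, ∫ z in box P, inner ℂ (h x) (kern m f g z x) := by
    intro x
    rw [modelOp, inner_sum]
    exact Finset.sum_congr rfl fun P _ => (integral_inner (hkint P x) _).symm
  simp_rw [e]
  rw [integral_finsetSum _ fun P _ => (hwint P).integral_prod_left]
  refine Finset.sum_congr rfl fun P _ => ?_
  rw [integral_integral_swap (hwint P)]
  exact setIntegral_congr_fun (measurableSet_box P) fun z hz =>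
    integral_inner_kern m f g hh.integrable hz

/-- The form associated with the model operator is bounded by a sum over samples. -/
lemma exists_sample (m : Fin 3 → 𝓢(ℝ, ℂ)) {f h : ℝ → H} {g : ℝ → ℂ} (hf : Nice f)
    (hg : Nice g) (hh : Nice h) : ∃ z : Tile → ℝ × ℝ × ℝ, (∀ P, z P ∈ box P) ∧
      ∀ D : Finset Tile, ‖∫ x, inner ℂ (h x) (modelOp m f g D x)‖ ≤
      ∑ P ∈ D, len P.1 * (‖coef m 0 f (z P)‖ * ‖coef m 1 g (z P)‖ * ‖coef m 2 h (z P)‖) := by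
  have hwint : ∀ P, IntegrableOn (fun z => ‖coef m 0 f z‖ * ‖coef m 1 g z‖ * ‖coef m 2 h z‖)
      (box P) := by
    intro P
    obtain ⟨K, hK, hb⟩ := norm_coef_le m hf.integrable P
    obtain ⟨L, hL, hb'⟩ := norm_coef_le m hg.integrable P
    obtain ⟨M, hM, hb''⟩ := norm_coef_le m hh.integrable P
    refine IntegrableOn.of_bound (by rw [volume_box]; exact ENNReal.ofReal_lt_top)
      (((stronglyMeasurable_coef m 0 hf.meas).norm.mul
        (stronglyMeasurable_coef m 1 hg.meas).norm).mul
        (stronglyMeasurable_coef m 2 hh.meas).norm).aestronglyMeasurable (K * L * M) ?_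
    refine (ae_restrict_mem (measurableSet_box P)).mono fun z hz => ?_
    rw [norm_mul, norm_mul, norm_norm, norm_norm, norm_norm]
    gcongr
    exacts [hb _ z hz, hb' _ z hz, hb'' _ z hz]
  have h0 : ∀ P, volume (box P) ≠ 0 := fun P => by
    rw [volume_box]; simpa using len_pos P.1
  have h1 : ∀ P, volume (box P) ≠ ∞ := fun P => by
    rw [volume_box]; exact ENNReal.ofReal_ne_top
  choose z hz1 hz2 using fun P => exists_setAverage_le (h0 P) (h1 P) (hwint P)
  refine ⟨z, hz1, fun D => ?_⟩
  rw [integral_inner_modelOp m hf hg hh]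
  refine norm_sum_le_of_le _ fun P _ => ?_
  have h2 := hz2 P
  rw [setAverage_eq, measureReal_def, volume_box, ENNReal.toReal_ofReal (len_pos _).le, smul_eq_mul,
    inv_mul_le_iff₀ (len_pos _)] at h2
  refine (norm_integral_le_of_norm_le (hwint P) (.of_forall fun w => ?_)).trans h2
  rw [norm_mul]
  have := norm_inner_le_norm (𝕜 := ℂ) (coef m 2 h w) (coef m 0 f w)
  calc _ ≤ ‖coef m 1 g w‖ * (‖coef m 2 h w‖ * ‖coef m 0 f w‖) := by gcongr
    _ = _ := by ring

end

section
variable {H : Type} [NormedAddCommGroup H] [InnerProductSpace ℂ H]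

/-- The norms of the three functions of a trilinear form. -/
noncomputable def norms (f : ℝ → H) (g : ℝ → ℂ) (h : ℝ → H) : Fin 3 → ℝ → ℝ :=
  ![fun x => ‖f x‖, fun x => ‖g x‖, fun x => ‖h x‖]

/-- The norms of the coefficients of the three functions of a trilinear form. -/
noncomputable def coefs (m : Fin 3 → 𝓢(ℝ, ℂ)) (f : ℝ → H) (g : ℝ → ℂ) (h : ℝ → H)
    (z : Tile → ℝ × ℝ × ℝ) : Fin 3 → Tile → ℝ :=
  ![fun P => ‖coef m 0 f (z P)‖, fun P => ‖coef m 1 g (z P)‖, fun P => ‖coef m 2 h (z P)‖]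

lemma prod_coefs (m : Fin 3 → 𝓢(ℝ, ℂ)) (f : ℝ → H) (g : ℝ → ℂ) (h : ℝ → H)
    (z : Tile → ℝ × ℝ × ℝ) (P : Tile) : ∏ j, coefs m f g h z j P =
      ‖coef m 0 f (z P)‖ * ‖coef m 1 g (z P)‖ * ‖coef m 2 h (z P)‖ := by
  simp [coefs, Fin.prod_univ_three]

variable [CompleteSpace H]

lemma controlled_coefs (m : Fin 3 → 𝓢(ℝ, ℂ)) {f h : ℝ → H} {g : ℝ → ℂ} (hf : Nice f) (hg : Nice g)
    (hh : Nice h) (z : Tile → ℝ × ℝ × ℝ) (j : Fin 3) :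
    Controlled (fun P => pack m j (z P)) (coefs m f g h z j) (norms f g h j) := by
  fin_cases j
  · exact ⟨H, _, _, ‹_›, f, hf.integrable, hf.meas, hf.bdd, fun _ => rfl, fun _ => rfl⟩
  · exact ⟨ℂ, _, _, inferInstance, g, hg.integrable, hg.meas, hg.bdd, fun _ => rfl, fun _ => rfl⟩
  · exact ⟨H, _, _, ‹_›, h, hh.integrable, hh.meas, hh.bdd, fun _ => rfl, fun _ => rfl⟩

end

lemma exists_local_form (m : Fin 3 → 𝓢(ℝ, ℂ)) (hm : ∀ j v, rad j < |v| → m j v = 0)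
    {s θ : Fin 3 → ℝ} {ε δ : ℝ} {W : ℕ} (hex : Exps s θ ε δ W) :
    ∃ K : ℝ, ∀ (H : Type) [NormedAddCommGroup H] [InnerProductSpace ℂ H] [CompleteSpace H]
      (f h : ℝ → H) (g : ℝ → ℂ), Nice f → Nice g → Nice h → ∀ z : Tile → ℝ × ℝ × ℝ,
      (∀ P, z P ∈ box P) → ∀ D : Finset Tile, Sparse D → D.Nonempty → ∀ (Q : ℤ × ℤ) (A : Fin 3 → ℝ),
      (∀ j, 0 < A j) → (∀ P ∈ D, dy P.1 ⊆ dy Q) →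
      (∀ j, ∀ P ∈ D, ∀ I, dy P.1 ⊆ dy I → dy I ⊆ dy Q →
        ∫ x, norms f g h j x ^ s j * (wt I x ^ 4)⁻¹ ≤ A j ^ s j * len I) →
      ∑ P ∈ D, len P.1 * ∏ j, coefs m f g h z j P ≤ K * (len Q * ∏ j, A j) := by
  obtain ⟨C, hC, hE⟩ := exists_adapted m hm (W + 2)
  refine ⟨localConst (splitConst C W) ε δ, fun H _ _ _ f h g hf hg hh z hz D hD hne Q A hA hQ hI => ?_⟩
  exact local_model hex le_rfl hC (hE z hz) (controlled_coefs m hf hg hh z) hD hne hA hQ hI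

lemma exists_form_bound (m : Fin 3 → 𝓢(ℝ, ℂ)) (hm : ∀ j v, rad j < |v| → m j v = 0)
    {x : Fin 3 → ℝ} (hx0 : ∀ j, 0 ≤ x j) (hx1 : ∀ j, x j < 1)
    (hx2 : ∑ j, (2 * max (x j) (1 / 2) - 1) < 1) (hx3 : ∑ j, x j = 1) :
    ∃ K : ℝ≥0∞, K ≠ ∞ ∧ ∀ (H : Type) [NormedAddCommGroup H] [InnerProductSpace ℂ H]
      [CompleteSpace H] (f h : ℝ → H) (g : ℝ → ℂ), Nice f → Nice g → Nice h →
      ∀ D : Finset Tile, Sparse D → ‖∫ y, inner ℂ (h y) (modelOp m f g D y)‖ₑ ≤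
        K * (eLpNorm f (ENNReal.ofReal (x 0))⁻¹ volume * eLpNorm g (ENNReal.ofReal (x 1))⁻¹ volume *
          eLpNorm h (ENNReal.ofReal (x 2))⁻¹ volume) := by
  obtain ⟨s, θ, ε, δ, W, hex, hxs⟩ := exists_exps x hx1 hx2
  obtain ⟨K, hK⟩ := exists_local_form m hm hex
  have hs : ∀ j, 0 < s j := fun j => by linarith [hex.one_le j]
  refine ⟨ENNReal.ofReal K * (ENNReal.ofReal (groupConst 1) ^ 3 *
    ∏ j, levelConst (s j) (x j)), ?_, fun H _ _ _ f h g hf hg hh D hD => ?_⟩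
  · refine ENNReal.mul_ne_top ENNReal.ofReal_ne_top (ENNReal.mul_ne_top (by simp) ?_)
    exact ENNReal.prod_ne_top fun j _ => levelConst_ne_top (hs j) (hx0 j)
  obtain ⟨z, hz, hzD⟩ := exists_sample m hf hg hh
  have hcon := controlled_coefs m hf hg hh z
  set Φ : Finset Tile → ℝ≥0∞ := fun D =>
    ENNReal.ofReal (∑ P ∈ D, len P.1 * ∏ j, coefs m f g h z j P) with hΦ
  have hle : ‖∫ y, inner ℂ (h y) (modelOp m f g D y)‖ₑ ≤ Φ D := by
    rw [← ofReal_norm]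
    refine ENNReal.ofReal_le_ofReal ((hzD D).trans (le_of_eq ?_))
    simp_rw [prod_coefs]
  have hΦ0 : Φ ∅ = 0 := by simp [hΦ]
  refine hle.trans ?_
  by_cases hne : ∀ j, ¬ norms f g h j =ᵐ[volume] 0
  · have := global_sum (Φ := Φ) one_pos hΦ0 ?_ (fun j => (hcon j).measurable)
      (fun j => (hcon j).fun_nonneg) (fun j => (hcon j).bounded) hne hs hx0 hxs (by simpa using hx3)
      (D := D) (C := ENNReal.ofReal K) ?_
    · refine this.trans (le_of_eq ?_)
      simp [norms, Fin.prod_univ_three, eLpNorm_norm]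
      ring
    · intro D₁ D₂ hd
      simp only [hΦ]
      rw [Finset.sum_union hd]
      exact ENNReal.ofReal_add_le
    · intro D' hD' hne' Q A hA hQ hI
      have hp : 0 ≤ len Q * ∏ j, A j :=
        mul_nonneg (len_pos Q).le (Finset.prod_nonneg fun j _ => (hA j).le)
      simp only [rpow_one]
      rw [← ENNReal.ofReal_mul' hp]
      exact ENNReal.ofReal_le_ofReal (hK H f h g hf hg hh z hz D' (hD.mono hD') hne' Q A hA hQ
        fun j P hP I h1 _ => hI j P hP I h1)
  · push Not at hne
    obtain ⟨j, hj⟩ := hne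
    have : Φ D = 0 := by
      simp only [hΦ]
      rw [Finset.sum_eq_zero, ENNReal.ofReal_zero]
      intro P _
      rw [Finset.prod_eq_zero (Finset.mem_univ j) ((hcon j).eq_zero hj P), mul_zero]
    rw [this]; exact bot_le

lemma lintegral_le_of_forall_Icc {F : ℝ → ℝ≥0∞} {C : ℝ≥0∞}
    (h : ∀ n : ℕ, ∫⁻ x in Icc (-n : ℝ) n, F x ≤ C) : ∫⁻ x, F x ≤ C := by
  have hu : (⋃ n : ℕ, Icc (-n : ℝ) n) = univ := by
    refine eq_univ_of_forall fun x => ?_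
    obtain ⟨n, hn⟩ := exists_nat_ge |x|
    exact mem_iUnion.2 ⟨n, abs_le.1 hn⟩
  rw [← setLIntegral_univ, ← hu, setLIntegral_iUnion_of_directed]
  · exact iSup_le h
  · refine (Monotone.directed_le fun a b hab => ?_)
    have : (a : ℝ) ≤ b := by exact_mod_cast hab
    exact Icc_subset_Icc (by linarith) this

section
variable {H : Type*} [NormedAddCommGroup H] [InnerProductSpace ℂ H]

/-- The test functions used for duality. -/
noncomputable def dualFn (T : ℝ → H) (c : ℝ → ℝ) (n : ℕ) : ℝ → H :=
  (Icc (-n : ℝ) n).indicator fun x => (c x : ℂ) • T x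

lemma norm_dualFn {T : ℝ → H} {c : ℝ → ℝ} (hc0 : ∀ x, 0 ≤ c x) (n : ℕ) (x : ℝ) :
    ‖dualFn T c n x‖ = (Icc (-n : ℝ) n).indicator (fun x => c x * ‖T x‖) x := by
  rw [dualFn, norm_indicator_eq_indicator_norm]
  simp [norm_smul, abs_of_nonneg (hc0 _)]

lemma nice_dualFn {T : ℝ → H} (hT : StronglyMeasurable T) {c : ℝ → ℝ} (hc : Measurable c)
    (hc0 : ∀ x, 0 ≤ c x) {n : ℕ} {B : ℝ} (hB : ∀ x ∈ Icc (-n : ℝ) n, c x * ‖T x‖ ≤ B) :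
    Nice (dualFn T c n) := by
  have hm : StronglyMeasurable (fun x => (c x : ℂ) • T x) :=
    (Complex.measurable_ofReal.comp hc).stronglyMeasurable.smul hT
  have hm' : StronglyMeasurable (dualFn T c n) := hm.indicator measurableSet_Icc
  refine ⟨?_, hm', max B 0, fun x => ?_⟩
  · rw [dualFn, integrable_indicator_iff measurableSet_Icc]
    refine IntegrableOn.of_bound measure_Icc_lt_top hm.aestronglyMeasurable B ?_
    refine (ae_restrict_mem measurableSet_Icc).mono fun x hx => ?_
    rw [norm_smul, Complex.norm_real, Real.norm_eq_abs, abs_of_nonneg (hc0 _)]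
    exact hB x hx
  · rw [norm_dualFn hc0]
    by_cases hx : x ∈ Icc (-n : ℝ) n
    · rw [indicator_of_mem hx]; exact (hB x hx).trans (le_max_left _ _)
    · rw [indicator_of_notMem hx]; exact le_max_right _ _

lemma lintegral_dualFn {T : ℝ → H} (hT : Nice T) {c : ℝ → ℝ} (hc : Measurable c)
    (hc0 : ∀ x, 0 ≤ c x) {n : ℕ} {B : ℝ} (hB : ∀ x ∈ Icc (-n : ℝ) n, c x * ‖T x‖ ≤ B) :
    ∫⁻ x in Icc (-n : ℝ) n, ENNReal.ofReal (c x * ‖T x‖ ^ 2) =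
      ‖∫ x, inner ℂ (dualFn T c n x) (T x)‖ₑ := by
  have e : ∀ x, inner ℂ (dualFn T c n x) (T x) =
      (((Icc (-n : ℝ) n).indicator (fun x => c x * ‖T x‖ ^ 2) x : ℝ) : ℂ) := by
    intro x
    by_cases hx : x ∈ Icc (-n : ℝ) n
    · rw [dualFn, indicator_of_mem hx, indicator_of_mem hx, inner_smul_left, Complex.conj_ofReal,
        inner_self_eq_norm_sq_to_K]
      push_cast
      rfl
    · rw [dualFn, indicator_of_notMem hx, indicator_of_notMem hx, inner_zero_left,
        Complex.ofReal_zero]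
  simp_rw [e]
  rw [integral_complex_ofReal, integral_indicator measurableSet_Icc]
  have hnn : ∀ x, 0 ≤ c x * ‖T x‖ ^ 2 := fun x => mul_nonneg (hc0 x) (sq_nonneg _)
  have hi : IntegrableOn (fun x => c x * ‖T x‖ ^ 2) (Icc (-n : ℝ) n) := by
    obtain ⟨B', hB'⟩ := hT.bdd
    refine IntegrableOn.of_bound measure_Icc_lt_top
      (hc.mul (hT.meas.norm.measurable.pow_const 2)).aestronglyMeasurable (B * B') ?_
    refine (ae_restrict_mem measurableSet_Icc).mono fun x hx => ?_
    rw [Real.norm_eq_abs, abs_of_nonneg (hnn x), sq, ← mul_assoc]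
    exact mul_le_mul (hB x hx) (hB' x) (norm_nonneg _)
      ((mul_nonneg (hc0 x) (norm_nonneg _)).trans (hB x hx))
  rw [← ofReal_integral_eq_lintegral_ofReal hi (.of_forall hnn), ← ofReal_norm,
    Complex.norm_real, Real.norm_eq_abs, abs_of_nonneg (integral_nonneg hnn)]

end

lemma le_rpow_of_le_mul_rpow {X K : ℝ≥0∞} {ρ : ℝ} (hρ : 1 ≤ ρ) (hX : X ≠ ∞)
    (h : X ≤ K * X ^ (1 - ρ⁻¹)) : X ≤ K ^ ρ := by
  rcases eq_or_ne X 0 with rfl | h0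
  · exact bot_le
  have hρ0 : ρ ≠ 0 := by positivity
  have h1 : X ^ ρ⁻¹ ≤ K := by
    have h2 : X = X ^ ρ⁻¹ * X ^ (1 - ρ⁻¹) := by
      rw [← ENNReal.rpow_add _ _ h0 hX]; simp
    have h3 : X ^ (1 - ρ⁻¹) ≠ 0 := by simp [ENNReal.rpow_eq_zero_iff, h0, hX]
    have h4 : X ^ (1 - ρ⁻¹) ≠ ∞ := by simp [ENNReal.rpow_eq_top_iff, h0, hX]
    refine (ENNReal.mul_le_mul_iff_left h3 h4).1 ?_
    rw [← h2]; exact h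
  calc X = (X ^ ρ⁻¹) ^ ρ := by rw [← ENNReal.rpow_mul, inv_mul_cancel₀ hρ0, ENNReal.rpow_one]
    _ ≤ K ^ ρ := by gcongr

lemma eLpNorm_dualFn_le {H : Type*} [NormedAddCommGroup H] [InnerProductSpace ℂ H] {T : ℝ → H}
    {ρ : ℝ} (hρ : 1 ≤ ρ) (n : ℕ) :
    eLpNorm (dualFn T (fun x => ‖T x‖ ^ (ρ - 2)) n) (ENNReal.ofReal (1 - ρ⁻¹))⁻¹ volume ≤
      (∫⁻ x in Icc (-n : ℝ) n, ‖T x‖ₑ ^ ρ) ^ (1 - ρ⁻¹) := by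
  have hρ0 : 0 < ρ := by positivity
  have hn : ∀ x, ‖dualFn T (fun x => ‖T x‖ ^ (ρ - 2)) n x‖ₑ ≤
      (Icc (-n : ℝ) n).indicator (fun x => ‖T x‖ₑ ^ (ρ - 1)) x := by
    intro x
    rw [← ofReal_norm, norm_dualFn fun x => by positivity]
    by_cases hx : x ∈ Icc (-n : ℝ) n
    · rw [indicator_of_mem hx, indicator_of_mem hx]
      rcases eq_or_ne (‖T x‖) 0 with h0 | h0
      · simp [h0]
      · have h1 : 0 < ‖T x‖ := lt_of_le_of_ne (norm_nonneg _) h0.symm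
        rw [← ofReal_norm, ENNReal.ofReal_rpow_of_pos h1, ← rpow_add_one h0]
        exact le_of_eq (by ring_nf)
    · simp [indicator_of_notMem hx]
  rcases eq_or_lt_of_le hρ with rfl | hlt
  · simp only [inv_one, sub_self, ENNReal.ofReal_zero, ENNReal.inv_zero, ENNReal.rpow_zero]
    rw [eLpNorm_exponent_top]
    refine essSup_le_of_ae_le _ (.of_forall fun x => (hn x).trans ?_)
    by_cases hx : x ∈ Icc (-n : ℝ) n
    · simp [indicator_of_mem hx]
    · simp [indicator_of_notMem hx]
  · have hx : 0 < 1 - ρ⁻¹ := by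
      have := inv_lt_one_of_one_lt₀ hlt; linarith
    have hx' := ENNReal.ofReal_pos.2 hx
    rw [eLpNorm_eq_lintegral_rpow_enorm_toReal (ENNReal.inv_ne_zero.2 ENNReal.ofReal_ne_top)
      (ENNReal.inv_ne_top.2 hx'.ne'), ENNReal.toReal_inv, ENNReal.toReal_ofReal hx.le,
      one_div, inv_inv, ← lintegral_indicator measurableSet_Icc]
    gcongr with x
    refine (ENNReal.rpow_le_rpow (hn x) (by positivity)).trans ?_
    by_cases hxx : x ∈ Icc (-n : ℝ) n
    · rw [indicator_of_mem hxx, indicator_of_mem hxx, ← ENNReal.rpow_mul]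
      refine le_of_eq ?_
      congr 1
      have : ρ - 1 ≠ 0 := by linarith
      field_simp
    · rw [indicator_of_notMem hxx, indicator_of_notMem hxx, ENNReal.zero_rpow_of_pos (by positivity)]

lemma exists_sparse_bound_one_le (m : Fin 3 → 𝓢(ℝ, ℂ)) (hm : ∀ j v, rad j < |v| → m j v = 0)
    {x y : ℝ} (hx0 : 0 ≤ x) (hx1 : x < 1) (hy0 : 0 ≤ y) (hy1 : y < 1) (hpos : 0 < x + y)
    (hle : x + y ≤ 1) :
    ∃ K : ℝ≥0∞, K ≠ ∞ ∧ ∀ (H : Type) [NormedAddCommGroup H] [InnerProductSpace ℂ H]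
      [CompleteSpace H] (f : ℝ → H) (g : ℝ → ℂ), Nice f → Nice g → ∀ D : Finset Tile, Sparse D →
      ∫⁻ t, ‖modelOp m f g D t‖ₑ ^ (x + y)⁻¹ ≤ K * (eLpNorm f (ENNReal.ofReal x)⁻¹ volume *
        eLpNorm g (ENNReal.ofReal y)⁻¹ volume) ^ (x + y)⁻¹ := by
  set ρ := (x + y)⁻¹ with hρd
  have hρ : 1 ≤ ρ := (one_le_inv₀ hpos).2 hle
  have hρi : ρ⁻¹ = x + y := by rw [hρd, inv_inv]
  have hρ0 : 0 < ρ := by positivity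
  have h0 : ∀ j, 0 ≤ ![x, y, 1 - ρ⁻¹] j := by
    intro j; fin_cases j <;> simp [hρi] <;> linarith
  have h1 : ∀ j, ![x, y, 1 - ρ⁻¹] j < 1 := by
    intro j; fin_cases j <;> simp [hρi] <;> linarith
  have h2 : ∑ j, (2 * max (![x, y, 1 - ρ⁻¹] j) (1 / 2) - 1) < 1 := by
    simp only [Fin.sum_univ_three, hρi, Matrix.cons_val_zero, Matrix.cons_val_one, Matrix.cons_val]
    rcases max_cases x (1 / 2) with h1 | h1 <;> rcases max_cases y (1 / 2) with h2 | h2 <;>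
      rcases max_cases (1 - (x + y)) (1 / 2) with h3 | h3 <;> linarith
  obtain ⟨K, hK, h⟩ := exists_form_bound m hm h0 h1 h2 (by simp [Fin.sum_univ_three, hρi])
  refine ⟨K ^ ρ, ENNReal.rpow_ne_top_of_nonneg hρ0.le hK, fun H _ _ _ f g hf hg D hD => ?_⟩
  set T := modelOp m f g D with hTd
  have hT : Nice T := nice_modelOp m hf hg D
  rw [← ENNReal.mul_rpow_of_nonneg _ _ hρ0.le]
  refine lintegral_le_of_forall_Icc fun n => ?_
  obtain ⟨B, hB⟩ := hT.bdd
  have hc : Measurable fun t => ‖T t‖ ^ (ρ - 2) := hT.meas.norm.measurable.pow_const _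
  have hc0 : ∀ t, 0 ≤ ‖T t‖ ^ (ρ - 2) := fun t => by positivity
  have hcB : ∀ t ∈ Icc (-n : ℝ) n, ‖T t‖ ^ (ρ - 2) * ‖T t‖ ≤ (max B 0) ^ (ρ - 1) := by
    intro t _
    rcases eq_or_ne (‖T t‖) 0 with h0 | h0
    · rw [h0, mul_zero]; positivity
    · rw [← rpow_add_one h0, show ρ - 2 + 1 = ρ - 1 by ring]
      exact rpow_le_rpow (norm_nonneg _) ((hB t).trans (le_max_left _ _)) (by linarith)
  have hnice := nice_dualFn hT.meas hc hc0 hcB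
  have e := lintegral_dualFn hT hc hc0 hcB
  have e2 : ∀ t, ENNReal.ofReal (‖T t‖ ^ (ρ - 2) * ‖T t‖ ^ 2) = ‖T t‖ₑ ^ ρ := by
    intro t
    rw [← ofReal_norm, ENNReal.ofReal_rpow_of_nonneg (norm_nonneg _) hρ0.le]
    congr 1
    rcases eq_or_ne (‖T t‖) 0 with h0 | h0
    · simp [h0, zero_rpow hρ0.ne']
    · rw [← rpow_natCast, ← rpow_add (lt_of_le_of_ne (norm_nonneg _) h0.symm)]
      norm_num
  simp_rw [e2] at e
  refine le_rpow_of_le_mul_rpow hρ ?_ ?_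
  · rw [e]; exact enorm_ne_top
  · conv_lhs => rw [e]
    refine (h H f _ g hf hg hnice D hD).trans ?_
    simp only [Matrix.cons_val_zero, Matrix.cons_val_one, Matrix.cons_val]
    rw [mul_assoc K]
    gcongr
    exact eLpNorm_dualFn_le hρ n

lemma lintegral_rpow_le_of_weight {I : ℤ × ℤ} {u : ℝ → ℝ} (hu : Measurable u) (hu0 : ∀ x, 0 ≤ u x)
    {ρ B : ℝ} (hρ : 2 / 3 ≤ ρ) (hρ1 : ρ ≤ 1) (hB : 0 ≤ B)
    (h : ∫⁻ x, ENNReal.ofReal (wt I x * u x) ≤ ENNReal.ofReal B) :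
    ∫⁻ x, ENNReal.ofReal (u x) ^ ρ ≤ ENNReal.ofReal (B ^ ρ * (len I * intConst) ^ (1 - ρ)) := by
  have hI := len_pos I
  have hρ0 : 0 ≤ ρ := by linarith
  have h1 : ∫⁻ x, ENNReal.ofReal (u x) ^ ρ ≤
      ∫⁻ x, ‖ENNReal.ofReal (wt I x * u x)‖ₑ ^ ρ * ‖ENNReal.ofReal ((wt I x ^ 2)⁻¹)‖ₑ ^ (1 - ρ) := by
    refine lintegral_mono fun x => ?_
    have hw := one_le_wt I x
    have hw0 := wt_pos I x
    rw [enorm_eq_self, enorm_eq_self, ENNReal.ofReal_rpow_of_nonneg (hu0 x) hρ0,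
      ENNReal.ofReal_rpow_of_nonneg (mul_nonneg hw0.le (hu0 x)) hρ0,
      ENNReal.ofReal_rpow_of_nonneg (by positivity) (by linarith), ← ENNReal.ofReal_mul
      (by have := hu0 x; positivity)]
    refine ENNReal.ofReal_le_ofReal ?_
    rw [mul_rpow hw0.le (hu0 x), ← rpow_natCast, ← rpow_neg hw0.le, ← rpow_mul hw0.le,
      mul_right_comm, ← rpow_add hw0]
    exact le_mul_of_one_le_left (rpow_nonneg (hu0 x) _)
      (one_le_rpow hw (by push_cast; linarith))
  refine h1.trans ((ENNReal.lintegral_mul_norm_pow_le ?_ ?_ hρ0 (by linarith) (by ring)).trans ?_)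
  · exact (((continuous_wt I).measurable.mul hu).ennreal_ofReal).aemeasurable
  · exact ((((continuous_wt I).measurable.pow_const 2).inv).ennreal_ofReal).aemeasurable
  · have hw0 := fun x => wt_pos I x
    simp only [enorm_eq_self]
    have e : ∫⁻ x, ENNReal.ofReal ((wt I x ^ 2)⁻¹) = ENNReal.ofReal (len I * intConst) := by
      rw [← ofReal_integral_eq_lintegral_ofReal (integrable_wt_pow I le_rfl)
        (.of_forall fun x => by have := hw0 x; positivity), integral_wt]
    rw [e, ENNReal.ofReal_mul (p := B ^ ρ) (by positivity), ← ENNReal.ofReal_rpow_of_nonneg hB hρ0,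
      ← ENNReal.ofReal_rpow_of_nonneg (by have := intConst_nonneg; positivity) (by linarith)]
    gcongr

section
variable {H : Type} [NormedAddCommGroup H] [InnerProductSpace ℂ H]

lemma coef_eq_zero (m : Fin 3 → 𝓢(ℝ, ℂ)) (j : Fin 3) {f : ℝ → H} (h : (fun x => ‖f x‖) =ᵐ[volume] 0)
    (z : ℝ × ℝ × ℝ) : coef m j f z = 0 := by
  refine integral_eq_zero_of_ae (h.mono fun x hx => ?_)
  have : f x = 0 := by simpa using hx
  simp [this]

lemma modelOp_union (m : Fin 3 → 𝓢(ℝ, ℂ)) (f : ℝ → H) (g : ℝ → ℂ) {D₁ D₂ : Finset Tile}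
    (h : Disjoint D₁ D₂) (x : ℝ) :
    modelOp m f g (D₁ ∪ D₂) x = modelOp m f g D₁ x + modelOp m f g D₂ x :=
  Finset.sum_union h

variable [CompleteSpace H]

lemma lintegral_weight_modelOp_le (m : Fin 3 → 𝓢(ℝ, ℂ)) {s : Fin 3 → ℝ} {K : ℝ}
    (hs1 : 1 ≤ s 2) (hs2 : s 2 ≤ 2) {f : ℝ → H} {g : ℝ → ℂ} (hf : Nice f) (hg : Nice g)
    {D : Finset Tile} {Q : ℤ × ℤ} {A : Fin 2 → ℝ} (hA : ∀ j, 0 < A j)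
    (hK : ∀ h : ℝ → H, Nice h → ∀ z : Tile → ℝ × ℝ × ℝ, (∀ P, z P ∈ box P) →
      ∀ A : Fin 3 → ℝ, (∀ j, 0 < A j) →
      (∀ j, ∀ P ∈ D, ∀ I, dy P.1 ⊆ dy I → dy I ⊆ dy Q →
        ∫ x, norms f g h j x ^ s j * (wt I x ^ 4)⁻¹ ≤ A j ^ s j * len I) →
      ∑ P ∈ D, len P.1 * ∏ j, coefs m f g h z j P ≤ K * (len Q * ∏ j, A j))
    (hI0 : ∀ P ∈ D, ∀ I, dy P.1 ⊆ dy I → ∫ x, ‖f x‖ ^ s 0 * (wt I x ^ 4)⁻¹ ≤ A 0 ^ s 0 * len I)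
    (hI1 : ∀ P ∈ D, ∀ I, dy P.1 ⊆ dy I → ∫ x, ‖g x‖ ^ s 1 * (wt I x ^ 4)⁻¹ ≤ A 1 ^ s 1 * len I) :
    ∫⁻ x, ENNReal.ofReal (wt Q x * ‖modelOp m f g D x‖) ≤
      ENNReal.ofReal (K * (len Q * (A 0 * A 1 * (4 * intConst + 1)))) := by
  set T := modelOp m f g D with hTd
  have hT : Nice T := nice_modelOp m hf hg D
  have hic := intConst_nonneg
  refine lintegral_le_of_forall_Icc fun n => ?_
  have hc : Measurable fun t => wt Q t * ‖T t‖⁻¹ :=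
    (continuous_wt Q).measurable.mul hT.meas.norm.measurable.inv
  have hc0 : ∀ t, 0 ≤ wt Q t * ‖T t‖⁻¹ := fun t => by have := wt_pos Q t; positivity
  have hcw : ∀ t, wt Q t * ‖T t‖⁻¹ * ‖T t‖ ≤ wt Q t := by
    intro t
    have := wt_pos Q t
    rcases eq_or_ne (‖T t‖) 0 with h0 | h0
    · rw [h0, mul_zero]; exact this.le
    · rw [mul_assoc, inv_mul_cancel₀ h0, mul_one]
  obtain ⟨B, hB⟩ := (isCompact_Icc (a := (-n : ℝ)) (b := n)).exists_bound_of_continuousOn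
    (continuous_wt Q).continuousOn
  have hcB : ∀ t ∈ Icc (-n : ℝ) n, wt Q t * ‖T t‖⁻¹ * ‖T t‖ ≤ B := fun t ht =>
    (hcw t).trans ((le_abs_self _).trans (hB t ht))
  have hnice := nice_dualFn hT.meas hc hc0 hcB
  have e := lintegral_dualFn hT hc hc0 hcB
  have e2 : ∀ t, wt Q t * ‖T t‖⁻¹ * ‖T t‖ ^ 2 = wt Q t * ‖T t‖ := by
    intro t
    rcases eq_or_ne (‖T t‖) 0 with h0 | h0
    · simp [h0]
    · field_simp
  simp_rw [e2] at e
  rw [e]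
  set h := dualFn T (fun t => wt Q t * ‖T t‖⁻¹) n with hh
  obtain ⟨z, hz, hzD⟩ := exists_sample m hf hg hnice
  rw [← ofReal_norm]
  refine ENNReal.ofReal_le_ofReal ((hzD D).trans ?_)
  simp_rw [← prod_coefs]
  have hnorm : ∀ t, ‖h t‖ ≤ wt Q t := by
    intro t
    rw [hh, norm_dualFn hc0]
    by_cases ht : t ∈ Icc (-n : ℝ) n
    · rw [indicator_of_mem ht]; exact hcw t
    · rw [indicator_of_notMem ht]; exact (wt_pos Q t).le
  refine (hK h hnice z hz ![A 0, A 1, 4 * intConst + 1] ?_ ?_).trans (le_of_eq ?_)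
  · intro j; fin_cases j
    · exact hA 0
    · exact hA 1
    · simp only [Fin.reduceFinMk, Matrix.cons_val]; positivity
  · intro j P hP I h1 h2
    fin_cases j
    · exact hI0 P hP I h1
    · exact hI1 P hP I h1
    · simp only [norms, Fin.reduceFinMk, Matrix.cons_val]
      have hI := len_pos I
      calc ∫ x, ‖h x‖ ^ s 2 * (wt I x ^ 4)⁻¹ ≤ ∫ x, 4 * (wt I x ^ 2)⁻¹ := by
            refine integral_mono_of_nonneg (.of_forall fun x => ?_)
              ((integrable_wt_pow I le_rfl).const_mul 4) (.of_forall fun x => ?_)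
            · have := wt_pos I x; dsimp only [Pi.zero_apply]; positivity
            · have hw := one_le_wt I x
              have hw2 : ‖h x‖ ≤ 2 * wt I x := (hnorm x).trans (wt_le_two_mul_wt h2 x)
              have h3 : ‖h x‖ ^ s 2 ≤ 4 * wt I x ^ 2 := by
                calc ‖h x‖ ^ s 2 ≤ (2 * wt I x) ^ s 2 :=
                      rpow_le_rpow (norm_nonneg _) hw2 (by linarith)
                  _ ≤ (2 * wt I x) ^ (2 : ℝ) := rpow_le_rpow_of_exponent_le (by linarith) hs2
                  _ = 4 * wt I x ^ 2 := by rw [rpow_two]; ring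
              have hw0 := wt_pos I x
              dsimp only
              rw [← div_eq_mul_inv, ← div_eq_mul_inv, div_le_div_iff₀ (by positivity) (by positivity)]
              calc _ ≤ 4 * wt I x ^ 2 * wt I x ^ 2 := by gcongr
                _ = _ := by ring
        _ = 4 * intConst * len I := by rw [integral_const_mul, integral_wt]; ring
        _ ≤ (4 * intConst + 1) ^ s 2 * len I := by
            gcongr
            calc 4 * intConst ≤ (4 * intConst + 1) ^ (1 : ℝ) := by rw [rpow_one]; linarith
              _ ≤ _ := rpow_le_rpow_of_exponent_le (by linarith) hs1
  · simp [Fin.prod_univ_three]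

end

lemma exists_sparse_bound_one_lt (m : Fin 3 → 𝓢(ℝ, ℂ)) (hm : ∀ j v, rad j < |v| → m j v = 0)
    {x y : ℝ} (hx0 : 0 ≤ x) (hx1 : x < 1) (hy0 : 0 ≤ y) (hy1 : y < 1) (hlt : 1 < x + y)
    (hlt' : x + y < 3 / 2) :
    ∃ K : ℝ≥0∞, K ≠ ∞ ∧ ∀ (H : Type) [NormedAddCommGroup H] [InnerProductSpace ℂ H]
      [CompleteSpace H] (f : ℝ → H) (g : ℝ → ℂ), Nice f → Nice g → ∀ D : Finset Tile, Sparse D →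
      ∫⁻ t, ‖modelOp m f g D t‖ₑ ^ (x + y)⁻¹ ≤ K * (eLpNorm f (ENNReal.ofReal x)⁻¹ volume *
        eLpNorm g (ENNReal.ofReal y)⁻¹ volume) ^ (x + y)⁻¹ := by
  set ρ := (x + y)⁻¹ with hρd
  have hpos : 0 < x + y := by linarith
  have hρ0 : 0 < ρ := by positivity
  have hρ1 : ρ ≤ 1 := inv_le_one_of_one_le₀ hlt.le
  have hρ2 : 2 / 3 ≤ ρ := by
    rw [hρd, le_inv_comm₀ (by norm_num) hpos]; linarith
  have h1 : ∀ j, ![x, y, 1 / 2] j < 1 := by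
    intro j; fin_cases j <;> simp <;> linarith
  have h2 : ∑ j, (2 * max (![x, y, 1 / 2] j) (1 / 2) - 1) < 1 := by
    simp only [Fin.sum_univ_three, Matrix.cons_val_zero, Matrix.cons_val_one, Matrix.cons_val]
    rw [max_self]
    rcases max_cases x (1 / 2) with h1 | h1 <;> rcases max_cases y (1 / 2) with h2 | h2 <;>
      linarith
  obtain ⟨s, θ, ε, δ, W, hex, hxs⟩ := exists_exps _ h1 h2
  obtain ⟨K, hK⟩ := exists_local_form m hm hex
  have hs : ∀ j, 0 < s j := fun j => by linarith [hex.one_le j]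
  have hic := intConst_nonneg
  set L : ℝ := (|K| * (4 * intConst + 1)) ^ ρ * intConst ^ (1 - ρ) with hL
  refine ⟨ENNReal.ofReal L * (ENNReal.ofReal (groupConst ρ) ^ 2 *
    (levelConst (s 0) x * levelConst (s 1) y) ^ ρ), ?_, fun H _ _ _ f g hf hg D hD => ?_⟩
  · refine ENNReal.mul_ne_top ENNReal.ofReal_ne_top (ENNReal.mul_ne_top (by simp) ?_)
    exact ENNReal.rpow_ne_top_of_nonneg hρ0.le (ENNReal.mul_ne_top
      (levelConst_ne_top (hs 0) hx0) (levelConst_ne_top (hs 1) hy0))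
  set Φ : Finset Tile → ℝ≥0∞ := fun D => ∫⁻ t, ‖modelOp m f g D t‖ₑ ^ ρ with hΦ
  change Φ D ≤ _
  by_cases hne : (fun t => ‖f t‖) =ᵐ[volume] 0 ∨ (fun t => ‖g t‖) =ᵐ[volume] 0
  · have : Φ D = 0 := by
      have h0 : ∀ t, modelOp m f g D t = 0 := by
        intro t
        refine Finset.sum_eq_zero fun P _ => integral_eq_zero_of_ae (.of_forall fun z => ?_)
        rcases hne with h | h <;> simp [kern, coef_eq_zero m _ h]
      simp [hΦ, h0, hρ0]
    rw [this]; exact bot_le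
  push Not at hne
  have := global_sum (ι := Fin 2) (Φ := Φ) hρ0 (by simp [hΦ, modelOp, hρ0]) ?_
    (F := ![fun t => ‖f t‖, fun t => ‖g t‖]) (s := ![s 0, s 1]) (x := ![x, y])
    (Fin.forall_fin_two.2 ⟨hf.meas.norm.measurable, hg.meas.norm.measurable⟩)
    (Fin.forall_fin_two.2 ⟨fun t => norm_nonneg _, fun t => norm_nonneg _⟩)
    (Fin.forall_fin_two.2 ⟨hf.bdd, hg.bdd⟩) (Fin.forall_fin_two.2 hne)
    (Fin.forall_fin_two.2 ⟨hs 0, hs 1⟩) (Fin.forall_fin_two.2 ⟨hx0, hy0⟩)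
    (Fin.forall_fin_two.2 ⟨hxs 0, hxs 1⟩) ?_ (D := D) (C := ENNReal.ofReal L) ?_
  · refine this.trans (le_of_eq ?_)
    simp only [Fin.prod_univ_two, Matrix.cons_val_zero, Matrix.cons_val_one, eLpNorm_norm,
      Fintype.card_fin]
    rw [mul_assoc, mul_assoc, ← ENNReal.mul_rpow_of_nonneg _ _ hρ0.le,
      ← ENNReal.mul_rpow_of_nonneg _ _ hρ0.le]
    congr 3
    ring
  · intro D₁ D₂ hd
    simp only [hΦ]
    rw [← lintegral_add_left
      ((stronglyMeasurable_modelOp m hf.meas hg.meas D₁).enorm.pow_const ρ)]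
    refine lintegral_mono fun t => ?_
    dsimp only
    rw [modelOp_union m f g hd]
    exact (ENNReal.rpow_le_rpow (enorm_add_le _ _) hρ0.le).trans
      (ENNReal.rpow_add_le_add_rpow _ _ hρ0.le hρ1)
  · simp only [Fin.sum_univ_two, Matrix.cons_val_zero, Matrix.cons_val_one]
    rw [← add_mul, hρd, mul_inv_cancel₀ hpos.ne']
  · intro D' hD' hne' Q A hA hQ hI
    have hQl := len_pos Q
    have hA0 := hA 0
    have hA1 := hA 1
    have hw := lintegral_weight_modelOp_le m (hex.one_le 2) (hex.le_two 2) hf hg (D := D') (Q := Q)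
      (K := |K|) hA (fun h hh z hz A hA hI => (hK H f h g hf hg hh z hz D' (hD.mono hD') hne' Q A
        hA hQ hI).trans (mul_le_mul_of_nonneg_right (le_abs_self K)
          (mul_nonneg hQl.le (Finset.prod_nonneg fun j _ => (hA j).le)))) (hI 0) (hI 1)
    have := lintegral_rpow_le_of_weight (nice_modelOp m hf hg D').meas.norm.measurable
      (fun t => norm_nonneg _) hρ2 hρ1 (by positivity) hw
    simp only [ofReal_norm] at this
    refine this.trans (le_of_eq ?_)
    rw [← ENNReal.ofReal_mul (by positivity), Fin.prod_univ_two, hL]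
    congr 1
    rw [show |K| * (len Q * (A 0 * A 1 * (4 * intConst + 1))) =
      |K| * (4 * intConst + 1) * len Q * (A 0 * A 1) by ring, mul_rpow (by positivity) (by positivity),
      mul_rpow (by positivity) hQl.le, mul_rpow hQl.le hic, mul_rpow hA0.le hA1.le]
    have : len Q ^ ρ * len Q ^ (1 - ρ) = len Q := by
      rw [← rpow_add hQl]; simp
    linear_combination ((|K| * (4 * intConst + 1)) ^ ρ * (A 0 ^ ρ * A 1 ^ ρ) * intConst ^ (1 - ρ)) *
      this

lemma sum_rpow_le {κ : Type*} [Fintype κ] (a : κ → ℝ≥0∞) {ρ : ℝ} (hρ : 0 < ρ) :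
    (∑ i, a i) ^ ρ ≤ (Fintype.card κ : ℝ≥0∞) ^ ρ * ∑ i, a i ^ ρ := by
  rcases isEmpty_or_nonempty κ with h | h
  · simp [hρ]
  · obtain ⟨j, -, hj⟩ := Finset.exists_max_image Finset.univ a Finset.univ_nonempty
    calc (∑ i, a i) ^ ρ ≤ ((Fintype.card κ : ℝ≥0∞) * a j) ^ ρ := by
          gcongr
          refine (Finset.sum_le_card_nsmul _ _ (a j) fun i hi => hj i hi).trans ?_
          rw [nsmul_eq_mul, Finset.card_univ]
      _ = (Fintype.card κ : ℝ≥0∞) ^ ρ * a j ^ ρ := ENNReal.mul_rpow_of_nonneg _ _ hρ.le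
      _ ≤ _ := by
          gcongr
          exact Finset.single_le_sum (f := fun i => a i ^ ρ) (fun i _ => bot_le) (Finset.mem_univ j)

/-- The sparsity class of a tile. -/
def cls (P : Tile) : ZMod 6 × ZMod 64 := (P.1.1, P.2)

lemma add_le_of_cast_eq {n : ℕ} {a b : ℤ} (h : (a : ZMod n) = b) (hab : a < b) : a + n ≤ b := by
  have h1 := (ZMod.intCast_eq_intCast_iff_dvd_sub a b n).1 h
  have h2 := Int.le_of_dvd (by lia) h1
  lia

lemma sparse_filter_cls (D : Finset Tile) (c : ZMod 6 × ZMod 64) :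
    Sparse (D.filter fun P => cls P = c) := by
  intro P hP P' hP'
  have h := ((Finset.mem_filter.1 hP).2).trans ((Finset.mem_filter.1 hP').2).symm
  simp only [cls, Prod.mk.injEq] at h
  exact ⟨fun hl => add_le_of_cast_eq h.1 hl, fun _ hl => add_le_of_cast_eq h.2 hl⟩

lemma exists_bound (m : Fin 3 → 𝓢(ℝ, ℂ)) (hm : ∀ j v, rad j < |v| → m j v = 0)
    {x y : ℝ} (hx0 : 0 ≤ x) (hx1 : x < 1) (hy0 : 0 ≤ y) (hy1 : y < 1) (hpos : 0 < x + y)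
    (hlt : x + y < 3 / 2) :
    ∃ K : ℝ≥0∞, K ≠ ∞ ∧ ∀ (H : Type) [NormedAddCommGroup H] [InnerProductSpace ℂ H]
      [CompleteSpace H] (f : ℝ → H) (g : ℝ → ℂ), Nice f → Nice g → ∀ D : Finset Tile,
      ∫⁻ t, ‖modelOp m f g D t‖ₑ ^ (x + y)⁻¹ ≤ K * (eLpNorm f (ENNReal.ofReal x)⁻¹ volume *
        eLpNorm g (ENNReal.ofReal y)⁻¹ volume) ^ (x + y)⁻¹ := by
  obtain ⟨K, hK, h⟩ : ∃ K : ℝ≥0∞, K ≠ ∞ ∧ ∀ (H : Type) [NormedAddCommGroup H]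
      [InnerProductSpace ℂ H] [CompleteSpace H] (f : ℝ → H) (g : ℝ → ℂ), Nice f → Nice g →
      ∀ D : Finset Tile, Sparse D →
      ∫⁻ t, ‖modelOp m f g D t‖ₑ ^ (x + y)⁻¹ ≤ K * (eLpNorm f (ENNReal.ofReal x)⁻¹ volume *
        eLpNorm g (ENNReal.ofReal y)⁻¹ volume) ^ (x + y)⁻¹ := by
    rcases le_or_gt (x + y) 1 with h1 | h1
    · exact exists_sparse_bound_one_le m hm hx0 hx1 hy0 hy1 hpos h1
    · exact exists_sparse_bound_one_lt m hm hx0 hx1 hy0 hy1 h1 hlt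
  have hρ : 0 < (x + y)⁻¹ := by positivity
  set N : ℝ≥0∞ := (Fintype.card (ZMod 6 × ZMod 64) : ℝ≥0∞)
  have hN : N ≠ ∞ := ENNReal.natCast_ne_top _
  refine ⟨N ^ (x + y)⁻¹ * (N * K), ENNReal.mul_ne_top (ENNReal.rpow_ne_top_of_nonneg hρ.le hN)
    (ENNReal.mul_ne_top hN hK), fun H _ _ _ f g hf hg D => ?_⟩
  set D' := fun c => D.filter fun P => cls P = c
  have hm' : ∀ c, Measurable fun t => ‖modelOp m f g (D' c) t‖ₑ ^ (x + y)⁻¹ := fun c =>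
    (nice_modelOp m hf hg (D' c)).meas.enorm.pow_const _
  calc ∫⁻ t, ‖modelOp m f g D t‖ₑ ^ (x + y)⁻¹
      ≤ ∫⁻ t, N ^ (x + y)⁻¹ * ∑ c, ‖modelOp m f g (D' c) t‖ₑ ^ (x + y)⁻¹ := by
        refine lintegral_mono fun t => (ENNReal.rpow_le_rpow ?_ hρ.le).trans (sum_rpow_le _ hρ)
        rw [show modelOp m f g D t = ∑ c, modelOp m f g (D' c) t from
          (Finset.sum_fiberwise D cls _).symm]
        exact enorm_sum_le _ _
    _ = N ^ (x + y)⁻¹ * ∑ c, ∫⁻ t, ‖modelOp m f g (D' c) t‖ₑ ^ (x + y)⁻¹ := by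
        rw [lintegral_const_mul _ (Finset.measurable_fun_sum _ fun c _ => hm' c),
          lintegral_finsetSum _ fun c _ => hm' c]
    _ ≤ _ := by
        rw [mul_assoc, mul_assoc]
        gcongr
        refine (Finset.sum_le_card_nsmul _ _ _ fun c _ =>
          h H f g hf hg (D' c) (sparse_filter_cls D c)).trans ?_
        rw [nsmul_eq_mul, Finset.card_univ]

/-- The smooth cutoffs entering the representation of the multiplier by wave packets. -/
structure Bumps (m : Fin 3 → 𝓢(ℝ, ℂ)) (β : ℝ → ℝ) : Prop where
  supp : ∀ j v, rad j < |v| → m j v = 0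
  eq_zero : ∀ v, m 0 v = β v
  eq_one : ∀ v, m 1 v = β v
  eq_two : ∀ v, |v| ≤ 2 → m 2 v = 1
  cont : Continuous β
  nonneg : ∀ v, 0 ≤ β v
  pos : ∀ v, |v| < 1 → 0 < β v

lemma exists_schwartz_bump (b : ContDiffBump (0 : ℝ)) :
    ∃ φ : 𝓢(ℝ, ℂ), ∀ v, φ v = (b v : ℂ) := by
  have h1 : HasCompactSupport fun v => (b v : ℂ) := b.hasCompactSupport.comp_left Complex.ofReal_zero
  have h2 : ContDiff ℝ (⊤ : ℕ∞) fun v => (b v : ℂ) := Complex.ofRealCLM.contDiff.comp b.contDiff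
  exact ⟨h1.toSchwartzMap h2, fun v => rfl⟩

lemma exists_bumps : ∃ m β, Bumps m β := by
  let b : ContDiffBump (0 : ℝ) := ⟨1 / 2, 1, by norm_num, by norm_num⟩
  let b' : ContDiffBump (0 : ℝ) := ⟨2, 4, by norm_num, by norm_num⟩
  obtain ⟨φ, hφ⟩ := exists_schwartz_bump b
  obtain ⟨φ', hφ'⟩ := exists_schwartz_bump b'
  have hb : ∀ v, 1 < |v| → φ v = 0 := fun v hv => by
    rw [hφ, b.zero_of_le_dist (by simpa using hv.le), Complex.ofReal_zero]
  refine ⟨![φ, φ, φ'], b, ⟨fun j v hv => ?_, hφ, hφ, fun v hv => ?_, b.continuous,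
    fun v => b.nonneg, fun v hv => b.pos_of_mem_ball (by simpa using hv)⟩⟩
  · fin_cases j
    · exact hb v hv
    · exact hb v hv
    · change φ' v = 0
      rw [hφ', b'.zero_of_le_dist (by simpa [rad] using hv.le), Complex.ofReal_zero]
  · change φ' v = 1
    rw [hφ', b'.one_of_mem_closedBall (by simpa using hv), Complex.ofReal_one]

/-- The correlation of a cutoff with its translates, centred at `32`. -/
noncomputable def corr (β : ℝ → ℝ) (t : ℝ) : ℝ := ∫ v, β v * β (v + t - 32)

/-- The constant in the representation of the multiplier by wave packets. -/
noncomputable def corrConst (β : ℝ → ℝ) : ℝ := ∫ t in Ioi (0 : ℝ), t⁻¹ * corr β t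

section
variable {m : Fin 3 → 𝓢(ℝ, ℂ)} {β : ℝ → ℝ}

lemma Bumps.abs_le (hβ : Bumps m β) {v : ℝ} (h : β v ≠ 0) :
    |v| ≤ 1 := by
  by_contra! hv
  have := hβ.supp 0 v (by simpa [rad] using hv)
  rw [hβ.eq_zero] at this
  exact h (by simpa using this)

lemma Bumps.hasCompactSupport (hβ : Bumps m β) : HasCompactSupport β :=
  HasCompactSupport.intro (K := Icc (-1) 1) isCompact_Icc fun v hv => by
    by_contra h
    exact hv (_root_.abs_le.1 (hβ.abs_le h))

lemma Bumps.integrable (hβ : Bumps m β) : Integrable β := hβ.cont.integrable_of_hasCompactSupport hβ.hasCompactSupport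

lemma Bumps.exists_bound (hβ : Bumps m β) : ∃ B, ∀ v, β v ≤ B := by
  obtain ⟨B, hB⟩ := hβ.cont.bounded_above_of_compact_support hβ.hasCompactSupport
  exact ⟨B, fun v => (le_abs_self _).trans (hB v)⟩

lemma Bumps.integrable_mul (hβ : Bumps m β) {f : ℝ → ℝ} (hf : Continuous f) :
    Integrable fun v => β v * f v :=
  (hβ.cont.mul hf).integrable_of_hasCompactSupport hβ.hasCompactSupport.mul_right

lemma corr_nonneg (hβ : Bumps m β) (t : ℝ) : 0 ≤ corr β t :=
  integral_nonneg fun v => mul_nonneg (hβ.nonneg v) (hβ.nonneg _)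

lemma corr_eq_zero (hβ : Bumps m β) {t : ℝ} (ht : t ∉ Icc (30 : ℝ) 34) : corr β t = 0 := by
  refine integral_eq_zero_of_ae (.of_forall fun v => ?_)
  by_contra h
  have h1 := abs_le.1 (hβ.abs_le (left_ne_zero_of_mul h))
  have h2 := abs_le.1 (hβ.abs_le (right_ne_zero_of_mul h))
  exact ht ⟨by linarith, by linarith⟩

lemma measurable_corr (hβ : Bumps m β) : Measurable (corr β) := by
  have := hβ.cont
  exact (StronglyMeasurable.integral_prod_right'
    (f := fun q : ℝ × ℝ => β q.2 * β (q.2 + q.1 - 32))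
    (Continuous.stronglyMeasurable (by fun_prop))).measurable

lemma integrableOn_corr (hβ : Bumps m β) : IntegrableOn (fun t => t⁻¹ * corr β t) (Ioi 0) := by
  obtain ⟨B, hB⟩ := hβ.exists_bound
  have hB0 : 0 ≤ B := (hβ.nonneg 0).trans (hB 0)
  have hc : ∀ t, corr β t ≤ ∫ v, β v * B := fun t => by
    have := hβ.cont
    exact integral_mono (hβ.integrable_mul (by fun_prop)) (hβ.integrable.mul_const B)
      fun v => mul_le_mul_of_nonneg_left (hB _) (hβ.nonneg v)
  have hi : Integrable ((Icc (30 : ℝ) 34).indicator fun _ => ∫ v, β v * B) :=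
    (integrable_indicator_iff measurableSet_Icc).2 (by simp)
  refine Integrable.mono' hi.integrableOn (measurable_id.inv.mul (measurable_corr hβ)).aestronglyMeasurable
    (.of_forall fun t => ?_)
  have h0 := corr_nonneg hβ t
  by_cases ht : t ∈ Icc (30 : ℝ) 34
  · have h30 : 30 ≤ t := ht.1
    rw [indicator_of_mem ht, norm_mul, norm_inv, Real.norm_of_nonneg h0, Real.norm_of_nonneg (by linarith)]
    exact (mul_le_of_le_one_left h0 (inv_le_one_of_one_le₀ (by linarith))).trans (hc t)
  · rw [indicator_of_notMem ht, corr_eq_zero hβ ht]; simp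

lemma corr_pos (hβ : Bumps m β) {t : ℝ} (ht : |t - 32| < 1) : 0 < corr β t := by
  have := hβ.cont
  refine Continuous.integral_pos_of_hasCompactSupport_nonneg_nonzero (x := 0) (by fun_prop)
    hβ.hasCompactSupport.mul_right (fun v => mul_nonneg (hβ.nonneg v) (hβ.nonneg _)) ?_
  exact (mul_pos (hβ.pos 0 (by simp)) (hβ.pos _ (by simpa using ht))).ne'

lemma corrConst_pos (hβ : Bumps m β) : 0 < corrConst β := by
  refine (setIntegral_pos_iff_support_of_nonneg_ae ?_ (integrableOn_corr hβ)).2 ?_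
  · refine (ae_restrict_mem measurableSet_Ioi).mono fun t ht => ?_
    exact mul_nonneg (inv_nonneg.2 (le_of_lt ht)) (corr_nonneg hβ t)
  · refine lt_of_lt_of_le (b := volume (Ioo (31 : ℝ) 33)) (by rw [Real.volume_Ioo]; norm_num)
      (measure_mono fun t ht => ?_)
    have h1 : 0 < t := by linarith [ht.1]
    exact ⟨(mul_pos (inv_pos.2 h1) (corr_pos hβ (abs_lt.2 ⟨by linarith [ht.1], by linarith [ht.2]⟩))).ne', h1⟩

lemma integrable_profile_mul (hβ : Bumps m β) (ξ₁ ξ₂ : ℝ) {s : ℝ} (hs : 0 < s) :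
    Integrable fun η => β (s * (ξ₁ - η) + 16) * β (s * (ξ₂ - η) - 16) := by
  have h1 := hβ.cont
  have h := (hβ.integrable_mul (f := fun v => β (v + s * (ξ₂ - ξ₁) - 32)) (by fun_prop))
  convert! ((h.comp_add_right 16).comp_mul_left' hs.ne').comp_sub_left ξ₁ using 4
  ring

lemma integral_profile_mul (β : ℝ → ℝ) (ξ₁ ξ₂ : ℝ) {s : ℝ} (hs : 0 < s) :
    ∫ η, β (s * (ξ₁ - η) + 16) * β (s * (ξ₂ - η) - 16) = s⁻¹ * corr β (s * (ξ₂ - ξ₁)) := by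
  set G := fun v => β v * β (v + s * (ξ₂ - ξ₁) - 32) with hG
  have e : ∀ η, β (s * (ξ₁ - η) + 16) * β (s * (ξ₂ - η) - 16) = G (s * (ξ₁ - η) + 16) := fun η => by
    rw [hG]; dsimp only; congr 2; ring
  simp only [e]
  rw [integral_sub_left_eq_self (fun u => G (s * u + 16)) volume ξ₁,
    Measure.integral_comp_mul_left (fun u => G (u + 16)), integral_add_right_eq_self G 16,
    abs_of_pos (inv_pos.2 hs), smul_eq_mul, corr]

lemma integrableOn_scale (hβ : Bumps m β) (Δ : ℝ) : IntegrableOn (fun s => s⁻¹ * corr β (s * Δ)) (Ioi 0) := by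
  rcases lt_or_ge 0 Δ with h | h
  · have := (integrableOn_Ioi_comp_mul_left_iff (fun t => t⁻¹ * corr β t) 0 h).2
      (by rw [mul_zero]; exact integrableOn_corr hβ)
    refine IntegrableOn.congr_fun (this.const_mul Δ) (fun s hs => ?_) measurableSet_Ioi
    rw [mul_inv, mul_comm Δ s]
    field_simp
  · refine IntegrableOn.congr_fun (integrable_zero ℝ ℝ _) (fun s hs => ?_) measurableSet_Ioi
    change 0 = s⁻¹ * corr β (s * Δ)
    have : s * Δ ≤ 0 := mul_nonpos_of_nonneg_of_nonpos (le_of_lt hs) h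
    rw [corr_eq_zero hβ fun h => by linarith [h.1], mul_zero]

lemma integral_scale (hβ : Bumps m β) (Δ : ℝ) : ∫ s in Ioi (0 : ℝ), s⁻¹ * corr β (s * Δ) =
    corrConst β * (Ioi (0 : ℝ)).indicator 1 Δ := by
  rcases lt_or_ge 0 Δ with h | h
  · rw [indicator_of_mem (mem_Ioi.2 h), Pi.one_apply, mul_one, corrConst]
    have := integral_comp_mul_left_Ioi' (fun t => t⁻¹ * corr β t) 0 h
    rw [mul_zero] at this
    rw [← this, smul_eq_mul, ← integral_const_mul]
    refine setIntegral_congr_fun measurableSet_Ioi fun s hs => ?_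
    rw [mul_inv, mul_comm Δ s]
    field_simp
  · rw [indicator_of_notMem (by simpa using h), mul_zero]
    refine setIntegral_eq_zero_of_forall_eq_zero fun s hs => ?_
    have : s * Δ ≤ 0 := mul_nonpos_of_nonneg_of_nonpos (le_of_lt hs) h
    rw [corr_eq_zero hβ fun h => by linarith [h.1], mul_zero]

end

lemma coef_eq_integral (m : Fin 3 → 𝓢(ℝ, ℂ)) (j : Fin 3) (f : 𝓢(ℝ, ℂ)) {z : ℝ × ℝ × ℝ}
    (hz : 0 < z.2.2) : coef m j f z =
      ∫ ξ, 𝓕 (⇑f) ξ * (m j (z.2.2 * (ξ - freq j z)) * ph (z.1 * ξ)) := by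
  have hi : Integrable (Function.uncurry fun x ξ =>
      m j (z.2.2 * (ξ - freq j z)) * ph ((z.1 - x) * ξ) * f x) (volume.prod volume) := by
    have h := (f.integrable (μ := volume)).mul_prod (integrable_profile (m j) (freq j z) hz)
    refine h.mono ?_ (.of_forall fun q => ?_)
    · have h1 := (m j).continuous
      have h2 := f.continuous
      have h3 := continuous_ph
      exact Continuous.aestronglyMeasurable (by unfold Function.uncurry; fun_prop)
    · simp only [Function.uncurry, norm_mul, norm_ph, mul_one]
      rw [mul_comm]
  calc coef m j f z = ∫ x, ∫ ξ, m j (z.2.2 * (ξ - freq j z)) * ph ((z.1 - x) * ξ) * f x := by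
        refine integral_congr_ae (.of_forall fun x => ?_)
        simp only [smul_eq_mul, pack]
        rw [integral_mul_const, pk_eq _ _ _ _ hz]
    _ = _ := by
        rw [integral_integral_swap hi]
        refine integral_congr_ae (.of_forall fun ξ => ?_)
        simp only
        rw [fourier_eq_ph, ← integral_mul_const]
        refine integral_congr_ae (.of_forall fun x => ?_)
        simp only
        rw [show (z.1 - x) * ξ = z.1 * ξ + -(ξ * x) by ring, ph_add]
        ring

lemma pk_eq_sub (m : 𝓢(ℝ, ℂ)) (y ζ s x : ℝ) : pk m y ζ s x = pk m 0 ζ s (x - y) := by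
  simp [pk]

lemma integrable_pk_left (m : 𝓢(ℝ, ℂ)) (ζ x : ℝ) {s : ℝ} (hs : 0 < s) :
    Integrable fun y => pk m y ζ s x := by
  simp only [pk_eq_sub m _ ζ s x]
  exact (integrable_pk m 0 ζ hs).comp_sub_left x

lemma integral_ph_mul_conj_pk (m : 𝓢(ℝ, ℂ)) (ζ x ω : ℝ) {s : ℝ} (hs : 0 < s) :
    ∫ y, ph (y * ω) * (starRingEnd ℂ) (pk m y ζ s x) =
      ph (x * ω) * (starRingEnd ℂ) (m (s * (ω - ζ))) := by
  have h := integral_ph_mul_pk m 0 ζ ω hs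
  rw [zero_mul, ph_zero, one_mul] at h
  rw [← h, ← integral_conj, ← integral_const_mul,
    ← integral_sub_left_eq_self (fun u => ph (x * ω) * (starRingEnd ℂ) (ph (u * ω) * pk m 0 ζ s u))
      volume x]
  refine integral_congr_ae (.of_forall fun y => ?_)
  simp only [pk_eq_sub m y ζ s x, map_mul, conj_ph]
  rw [← mul_assoc, ← ph_add]
  congr 2
  ring

lemma lintegral_enorm_pk (m : 𝓢(ℝ, ℂ)) (ζ x : ℝ) {s : ℝ} (hs : 0 < s) :
    ∫⁻ y, ‖pk m y ζ s x‖ₑ = ENNReal.ofReal (∫ u, ‖(𝓕⁻ m) u‖) := by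
  rw [← ofReal_integral_norm_eq_lintegral_enorm (integrable_pk_left m ζ x hs)]
  simp only [norm_pk m _ ζ x hs]
  rw [integral_const_mul, integral_sub_right_eq_self (fun u => ‖(𝓕⁻ m : 𝓢(ℝ, ℂ)) (u / s)‖) x,
    Measure.integral_comp_div (fun u => ‖(𝓕⁻ m : 𝓢(ℝ, ℂ)) u‖) s, abs_of_pos hs, smul_eq_mul,
    inv_mul_cancel_left₀ hs.ne']

/-- The measure on the upper half of phase space. -/
noncomputable def halfMeas : Measure (ℝ × ℝ × ℝ) :=
  volume.prod (volume.prod (volume.restrict (Ioi 0)))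

instance : SFinite halfMeas := by unfold halfMeas; infer_instance

/-- The contribution of a point of phase space to the multiplier. -/
noncomputable def wave (m : Fin 3 → 𝓢(ℝ, ℂ)) (β : ℝ → ℝ) (x : ℝ) (ξ : ℝ × ℝ) (z : ℝ × ℝ × ℝ) : ℂ :=
  ((β (z.2.2 * (ξ.1 - z.2.1) + 16) * β (z.2.2 * (ξ.2 - z.2.1) - 16) : ℝ) : ℂ) *
    (ph (z.1 * (ξ.1 + ξ.2)) * (starRingEnd ℂ) (pk (m 2) z.1 (2 * z.2.1) z.2.2 x))

section
variable {m : Fin 3 → 𝓢(ℝ, ℂ)} {β : ℝ → ℝ}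

lemma measurable_wave (hβ : Bumps m β) (x : ℝ) :
    Measurable fun q : (ℝ × ℝ) × (ℝ × ℝ × ℝ) => wave m β x q.1 q.2 := by
  have h1 := hβ.cont.measurable
  have h2 := continuous_ph.measurable
  have h3 := (𝓕⁻ (m 2)).continuous.measurable
  have h4 := RCLike.continuous_conj (K := ℂ) |>.measurable
  unfold wave pk
  fun_prop

lemma lintegral_wave (hβ : Bumps m β) (x : ℝ) (ξ : ℝ × ℝ) :
    ∫⁻ z, ‖wave m β x ξ z‖ₑ ∂halfMeas ≤
      ENNReal.ofReal (corrConst β) * ENNReal.ofReal (∫ u, ‖(𝓕⁻ (m 2)) u‖) := by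
  have hm : Measurable fun z => ‖wave m β x ξ z‖ₑ :=
    ((measurable_wave hβ x).comp measurable_prodMk_left).enorm
  have hm1 : Measurable fun w : ℝ × ℝ => ∫⁻ y, ‖wave m β x ξ (y, w)‖ₑ := hm.lintegral_prod_left'
  rw [halfMeas, lintegral_prod_symm _ hm.aemeasurable, lintegral_prod_symm _ hm1.aemeasurable]
  set N := ENNReal.ofReal (∫ u, ‖(𝓕⁻ (m 2)) u‖)
  have hs : ∀ s ∈ Ioi (0 : ℝ), ∫⁻ η, ∫⁻ y, ‖wave m β x ξ (y, η, s)‖ₑ =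
      ENNReal.ofReal (s⁻¹ * corr β (s * (ξ.2 - ξ.1))) * N := by
    intro s hs
    rw [← integral_profile_mul β ξ.1 ξ.2 hs,
      ofReal_integral_eq_lintegral_ofReal (integrable_profile_mul hβ ξ.1 ξ.2 hs)
      (.of_forall fun η => mul_nonneg (hβ.nonneg _) (hβ.nonneg _)),
      ← lintegral_mul_const' _ _ ENNReal.ofReal_ne_top]
    refine lintegral_congr fun η => ?_
    rw [← lintegral_enorm_pk (m 2) (2 * η) x hs, ← lintegral_const_mul' _ _ ENNReal.ofReal_ne_top]
    refine lintegral_congr fun y => ?_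
    rw [wave, enorm_mul, enorm_mul]
    have e1 : ∀ t, ‖ph t‖ₑ = 1 := fun t => by rw [← ofReal_norm, norm_ph, ENNReal.ofReal_one]
    rw [e1, one_mul, RCLike.enorm_conj, ← ofReal_norm (((_ : ℝ) : ℂ)), Complex.norm_real,
      Real.norm_of_nonneg (mul_nonneg (hβ.nonneg _) (hβ.nonneg _))]
  rw [setLIntegral_congr_fun measurableSet_Ioi hs, lintegral_mul_const' _ _ ENNReal.ofReal_ne_top]
  gcongr
  rw [← ofReal_integral_eq_lintegral_ofReal (integrableOn_scale hβ _), integral_scale hβ]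
  · refine ENNReal.ofReal_le_ofReal (mul_le_of_le_one_right (corrConst_pos hβ).le ?_)
    exact indicator_le' (fun _ _ => le_rfl) (fun _ _ => zero_le_one) _
  · refine (ae_restrict_mem measurableSet_Ioi).mono fun s hs => ?_
    exact mul_nonneg (inv_nonneg.2 (le_of_lt hs)) (corr_nonneg hβ _)

lemma integrable_wave (hβ : Bumps m β) (x : ℝ) (ξ : ℝ × ℝ) : Integrable (wave m β x ξ) halfMeas :=
  ⟨((measurable_wave hβ x).comp measurable_prodMk_left).aestronglyMeasurable,
    (lintegral_wave hβ x ξ).trans_lt (ENNReal.mul_lt_top ENNReal.ofReal_lt_top ENNReal.ofReal_lt_top)⟩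

lemma integral_wave (hβ : Bumps m β) (x : ℝ) (ξ : ℝ × ℝ) : ∫ z, wave m β x ξ z ∂halfMeas =
    corrConst β * (ph (x * (ξ.1 + ξ.2)) * (Ioi (0 : ℝ)).indicator 1 (ξ.2 - ξ.1)) := by
  have hi := integrable_wave hβ x ξ
  rw [halfMeas] at hi ⊢
  rw [integral_prod_symm _ hi, integral_prod_symm _ hi.integral_prod_right]
  have hs : ∀ s ∈ Ioi (0 : ℝ), ∫ η, ∫ y, wave m β x ξ (y, η, s) =
      ((s⁻¹ * corr β (s * (ξ.2 - ξ.1)) : ℝ) : ℂ) * ph (x * (ξ.1 + ξ.2)) := by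
    intro s hs
    rw [← integral_profile_mul β ξ.1 ξ.2 hs, ← integral_complex_ofReal, ← integral_mul_const]
    refine integral_congr_ae (.of_forall fun η => ?_)
    simp only [wave]
    rw [integral_const_mul, integral_ph_mul_conj_pk _ _ _ _ hs]
    by_cases h : β (s * (ξ.1 - η) + 16) * β (s * (ξ.2 - η) - 16) = 0
    · rw [h]; simp
    · have h1 := abs_le.1 (hβ.abs_le (left_ne_zero_of_mul h))
      have h2 := abs_le.1 (hβ.abs_le (right_ne_zero_of_mul h))
      rw [hβ.eq_two _ (abs_le.2 ⟨by linarith, by linarith⟩), map_one, mul_one]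
  rw [setIntegral_congr_fun measurableSet_Ioi hs, integral_mul_const, integral_complex_ofReal,
    integral_scale hβ]
  by_cases h : ξ.2 - ξ.1 ∈ Ioi (0 : ℝ)
  · simp [indicator_of_mem h]
  · simp [indicator_of_notMem h]

end

/-- The bilinear multiplier with symbol `1_{ξ₁ < ξ₂}`. -/
noncomputable def halfMul (f g : ℝ → ℂ) (x : ℝ) : ℂ :=
  ∫ ξ : ℝ × ℝ, 𝓕 f ξ.1 * 𝓕 g ξ.2 *
    (ph (x * (ξ.1 + ξ.2)) * (Ioi (0 : ℝ)).indicator 1 (ξ.2 - ξ.1))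

lemma halfMeas_eq : halfMeas = volume.restrict {z : ℝ × ℝ × ℝ | 0 < z.2.2} := by
  have h : {z : ℝ × ℝ × ℝ | 0 < z.2.2} = univ ×ˢ (univ ×ˢ Ioi 0) := by ext; simp
  rw [h, Measure.volume_eq_prod, Measure.volume_eq_prod, ← Measure.prod_restrict,
    ← Measure.prod_restrict, Measure.restrict_univ, halfMeas]

lemma integral_wave_eq_kern {m : Fin 3 → 𝓢(ℝ, ℂ)} {β : ℝ → ℝ} (hβ : Bumps m β) (f g : 𝓢(ℝ, ℂ))
    (x : ℝ) {z : ℝ × ℝ × ℝ} (hz : 0 < z.2.2) :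
    ∫ ξ : ℝ × ℝ, 𝓕 (⇑f) ξ.1 * 𝓕 (⇑g) ξ.2 * wave m β x ξ z = kern m f g z x := by
  have e0 : ∀ ξ, m 0 (z.2.2 * (ξ - freq 0 z)) = β (z.2.2 * (ξ - z.2.1) + 16) := fun ξ => by
    rw [hβ.eq_zero]; congr 2; change z.2.2 * (ξ - (z.2.1 - 16 / z.2.2)) = _; field_simp; ring
  have e1 : ∀ ξ, m 1 (z.2.2 * (ξ - freq 1 z)) = β (z.2.2 * (ξ - z.2.1) - 16) := fun ξ => by
    rw [hβ.eq_one]; congr 2; change z.2.2 * (ξ - (z.2.1 + 16 / z.2.2)) = _; field_simp; ring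
  rw [kern, coef_eq_integral m 0 f hz, coef_eq_integral m 1 g hz]
  simp only [e0, e1]
  rw [smul_eq_mul, mul_comm _ (∫ _, _), ← mul_assoc, ← integral_prod_mul, ← integral_mul_const]
  refine integral_congr_ae (.of_forall fun ξ => ?_)
  simp only [wave, pack, mul_add, ph_add]
  rw [show freq 2 z = 2 * z.2.1 from rfl]
  push_cast
  ring

lemma integrable_wave_prod {m : Fin 3 → 𝓢(ℝ, ℂ)} {β : ℝ → ℝ} (hβ : Bumps m β) (f g : 𝓢(ℝ, ℂ))
    (x : ℝ) : Integrable (Function.uncurry fun (ξ : ℝ × ℝ) z =>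
      𝓕 (⇑f) ξ.1 * 𝓕 (⇑g) ξ.2 * wave m β x ξ z) (volume.prod halfMeas) := by
  have hf : Continuous (𝓕 (⇑f)) := by rw [← SchwartzMap.fourier_coe]; exact (𝓕 f).continuous
  have hg : Continuous (𝓕 (⇑g)) := by rw [← SchwartzMap.fourier_coe]; exact (𝓕 g).continuous
  have hfi : Integrable (𝓕 (⇑f)) := by rw [← SchwartzMap.fourier_coe]; exact (𝓕 f).integrable
  have hgi : Integrable (𝓕 (⇑g)) := by rw [← SchwartzMap.fourier_coe]; exact (𝓕 g).integrable
  have hm : Measurable (Function.uncurry fun (ξ : ℝ × ℝ) z =>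
      𝓕 (⇑f) ξ.1 * 𝓕 (⇑g) ξ.2 * wave m β x ξ z) := by
    have h1 := hf.measurable
    have h2 := hg.measurable
    exact ((h1.comp (measurable_fst.comp measurable_fst)).mul
      (h2.comp (measurable_snd.comp measurable_fst))).mul (measurable_wave hβ x)
  refine ⟨hm.aestronglyMeasurable, ?_⟩
  set N : ℝ≥0∞ := ENNReal.ofReal (corrConst β) * ENNReal.ofReal (∫ u, ‖(𝓕⁻ (m 2)) u‖) with hN
  have hNt : N ≠ ∞ := ENNReal.mul_ne_top ENNReal.ofReal_ne_top ENNReal.ofReal_ne_top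
  rw [hasFiniteIntegral_iff_enorm, lintegral_prod _ hm.enorm.aemeasurable]
  calc _ ≤ ∫⁻ ξ : ℝ × ℝ, ‖𝓕 (⇑f) ξ.1 * 𝓕 (⇑g) ξ.2‖ₑ * N := by
        refine lintegral_mono fun ξ => ?_
        simp only [Function.uncurry, enorm_mul (_ * _) (wave _ _ _ _ _)]
        rw [lintegral_const_mul' _ _ enorm_ne_top]
        gcongr
        exact lintegral_wave hβ x ξ
    _ = (∫⁻ ξ : ℝ × ℝ, ‖𝓕 (⇑f) ξ.1 * 𝓕 (⇑g) ξ.2‖ₑ) * N := lintegral_mul_const' _ _ hNt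
    _ < ∞ := ENNReal.mul_lt_top (hfi.mul_prod hgi).2 hNt.lt_top

lemma integrableOn_kern {m : Fin 3 → 𝓢(ℝ, ℂ)} {β : ℝ → ℝ} (hβ : Bumps m β) (f g : 𝓢(ℝ, ℂ))
    (x : ℝ) : IntegrableOn (fun z => kern m f g z x) {z : ℝ × ℝ × ℝ | 0 < z.2.2} := by
  have h := (integrable_wave_prod hβ f g x).integral_prod_right
  rw [halfMeas_eq] at h
  refine IntegrableOn.congr_fun h (fun z hz => integral_wave_eq_kern hβ f g x hz) ?_
  exact measurableSet_lt measurable_const (measurable_snd.comp measurable_snd)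

lemma integral_kern {m : Fin 3 → 𝓢(ℝ, ℂ)} {β : ℝ → ℝ} (hβ : Bumps m β) (f g : 𝓢(ℝ, ℂ))
    (x : ℝ) : ∫ z in {z : ℝ × ℝ × ℝ | 0 < z.2.2}, kern m f g z x = corrConst β * halfMul f g x := by
  have hU : MeasurableSet {z : ℝ × ℝ × ℝ | 0 < z.2.2} :=
    measurableSet_lt measurable_const (measurable_snd.comp measurable_snd)
  rw [← setIntegral_congr_fun hU (fun z hz => integral_wave_eq_kern hβ f g x hz), ← halfMeas_eq,
    ← integral_integral_swap (integrable_wave_prod hβ f g x), halfMul, ← integral_const_mul]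
  refine integral_congr_ae (.of_forall fun ξ => ?_)
  simp only
  rw [integral_const_mul, integral_wave hβ]
  ring

lemma iUnion_box : ⋃ P, box P = {z : ℝ × ℝ × ℝ | 0 < z.2.2} := by
  ext z
  simp only [mem_iUnion, mem_ofPred_eq]
  constructor
  · rintro ⟨P, hP⟩
    exact (len_pos P.1).trans_le hP.2.2.1
  · intro hz
    obtain ⟨k, hk⟩ := exists_mem_Ico_zpow hz (one_lt_two : (1 : ℝ) < 2)
    refine ⟨((k, ⌊z.1 / 2 ^ k⌋), ⌊z.2.1 * 2 ^ k⌋), rfl, rfl, hk.1, hk.2.trans_eq ?_⟩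
    rw [zpow_add_one₀ two_ne_zero, mul_comm]; rfl

lemma disjoint_box : Pairwise fun P P' => Disjoint (box P) (box P') := by
  intro P P' hne
  refine Set.disjoint_left.2 fun z hz hz' => hne ?_
  have key : ∀ {Q Q' : Tile}, z ∈ box Q → z ∈ box Q' → Q.1.1 ≤ Q'.1.1 := by
    intro Q Q' h h'
    have h1 : len Q.1 < 2 * len Q'.1 := h.2.2.1.trans_lt h'.2.2.2
    rw [len, len, mul_comm, ← zpow_add_one₀ two_ne_zero, zpow_lt_zpow_iff_right₀ one_lt_two] at h1
    exact Int.lt_add_one_iff.1 h1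
  have hk := le_antisymm (key hz hz') (key hz' hz)
  have hl : len P.1 = len P'.1 := by rw [len, len, hk]
  obtain ⟨a, b, -⟩ := hz
  obtain ⟨a', b', -⟩ := hz'
  have a1 : ⌊z.1 / len P.1⌋ = P.1.2 := a
  have a2 : ⌊z.1 / len P'.1⌋ = P'.1.2 := a'
  rw [hl] at a1 b
  exact Prod.ext (Prod.ext hk (a1.symm.trans a2)) (b.symm.trans b')

lemma tendsto_modelOp {m : Fin 3 → 𝓢(ℝ, ℂ)} {β : ℝ → ℝ} (hβ : Bumps m β) (f g : 𝓢(ℝ, ℂ)) (x : ℝ) :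
    Filter.Tendsto (fun D => modelOp m f g D x) Filter.atTop (nhds (corrConst β * halfMul f g x)) := by
  have h := hasSum_integral_iUnion (f := fun z => kern m f g z x) measurableSet_box disjoint_box
    (by rw [iUnion_box]; exact integrableOn_kern hβ f g x)
  rw [iUnion_box, integral_kern hβ] at h
  exact h

section
variable {H : Type*} [NormedAddCommGroup H] [InnerProductSpace ℂ H]

lemma clm_coef (m : Fin 3 → 𝓢(ℝ, ℂ)) (j : Fin 3) {f : ℝ → H} [CompleteSpace H] (hf : Nice f)
    (L : H →L[ℂ] ℂ) {z : ℝ × ℝ × ℝ} (hz : 0 < z.2.2) :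
    L (coef m j f z) = coef m j (fun x => L (f x)) z := by
  have hi : Integrable fun x => pack m j z x • f x := by
    obtain ⟨B, hB⟩ := hf.bdd
    refine ((integrable_pk (m j) z.1 (freq j z) hz).norm.mul_const B).mono'
      ((continuous_pk _ _ _ _).aestronglyMeasurable.smul hf.meas.aestronglyMeasurable)
      (.of_forall fun x => ?_)
    rw [norm_smul]
    exact mul_le_mul_of_nonneg_left (hB x) (norm_nonneg _)
  rw [coef, ← L.integral_comp_comm hi]
  simp only [map_smul, coef]

lemma clm_modelOp (m : Fin 3 → 𝓢(ℝ, ℂ)) {f : ℝ → H} {g : ℝ → ℂ} [CompleteSpace H] (hf : Nice f)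
    (hg : Nice g) (L : H →L[ℂ] ℂ) (D : Finset Tile) (x : ℝ) :
    L (modelOp m f g D x) = modelOp m (fun x => L (f x)) g D x := by
  rw [modelOp, map_sum]
  refine Finset.sum_congr rfl fun P _ => ?_
  obtain ⟨K, hK, h⟩ := exists_kern_bound m hf.integrable hg.integrable P
  have hi : IntegrableOn (fun z => kern m f g z x) (box P) :=
    Measure.integrableOn_of_bounded (M := K * (wt P.1 x ^ 2)⁻¹) (by simp [volume_box])
      ((stronglyMeasurable_kern m hf.meas hg.meas).comp_measurable
        measurable_prodMk_right).aestronglyMeasurable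
      ((ae_restrict_mem (measurableSet_box P)).mono fun z hz => h z hz x)
  rw [← L.integral_comp_comm hi]
  refine setIntegral_congr_fun (measurableSet_box P) fun z hz => ?_
  simp only [kern, map_smul]
  rw [clm_coef m 0 hf L ((len_pos P.1).trans_le hz.2.2.1)]

end

section
variable {ι : Type} [Fintype ι]

/-- The vector-valued function with given components. -/
noncomputable def vec (F : ι → ℝ → ℂ) (x : ℝ) : EuclideanSpace ℂ ι := WithLp.toLp 2 fun i => F i x

lemma nice_schwartz (f : 𝓢(ℝ, ℂ)) : Nice f := by
  obtain ⟨K, -, h⟩ := schwartz_decay f 0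
  exact ⟨f.integrable, f.continuous.stronglyMeasurable, K, fun x => by simpa using h x⟩

lemma nice_vec (F : ι → 𝓢(ℝ, ℂ)) : Nice (vec fun i => ⇑(F i)) := by
  have hc : Continuous (vec fun i => ⇑(F i)) := by
    refine (PiLp.continuous_toLp 2 _).comp (continuous_pi fun i => (F i).continuous)
  have hb : ∀ x, ‖vec (fun i => ⇑(F i)) x‖ ≤ ∑ i, ‖F i x‖ := fun x => by
    rw [EuclideanSpace.norm_eq]
    refine (Real.sqrt_le_left (Finset.sum_nonneg fun i _ => norm_nonneg _)).2 ?_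
    exact Finset.sum_sq_le_sq_sum_of_nonneg fun i _ => norm_nonneg _
  choose B hB using fun i => (nice_schwartz (F i)).bdd
  refine ⟨?_, hc.stronglyMeasurable, ∑ i, B i, fun x =>
    (hb x).trans (Finset.sum_le_sum fun i _ => hB i x)⟩
  exact (integrable_finsetSum _ fun i _ => (F i).integrable.norm).mono' hc.aestronglyMeasurable
    (.of_forall hb)

lemma tendsto_modelOp_vec {m : Fin 3 → 𝓢(ℝ, ℂ)} {β : ℝ → ℝ} (hβ : Bumps m β) (F : ι → 𝓢(ℝ, ℂ))
    (g : 𝓢(ℝ, ℂ)) (x : ℝ) :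
    Filter.Tendsto (fun D => modelOp m (vec fun i => ⇑(F i)) g D x) Filter.atTop
      (nhds ((corrConst β : ℂ) • vec (fun i => halfMul (F i) g) x)) := by
  have h : Filter.Tendsto (fun D i => modelOp m (F i) g D x) Filter.atTop
      (nhds fun i => corrConst β * halfMul (F i) g x) :=
    tendsto_pi_nhds.2 fun i => tendsto_modelOp hβ (F i) g x
  have h' := ((PiLp.continuous_toLp 2 fun _ : ι => ℂ).tendsto _).comp h
  convert! h' using 1
  ext D i
  exact clm_modelOp m (nice_vec F) (nice_schwartz g) (EuclideanSpace.proj i) D x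

end

lemma exists_halfMul_bound {x y : ℝ} (hx0 : 0 ≤ x) (hx1 : x < 1) (hy0 : 0 ≤ y) (hy1 : y < 1)
    (hpos : 0 < x + y) (hlt : x + y < 3 / 2) :
    ∃ K : ℝ≥0∞, K ≠ ∞ ∧ ∀ (ι : Type) [Fintype ι] (F : ι → 𝓢(ℝ, ℂ)) (g : 𝓢(ℝ, ℂ)),
      ∫⁻ t, ‖vec (fun i => halfMul (F i) g) t‖ₑ ^ (x + y)⁻¹ ≤
        K * (eLpNorm (vec fun i => ⇑(F i)) (ENNReal.ofReal x)⁻¹ volume *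
          eLpNorm g (ENNReal.ofReal y)⁻¹ volume) ^ (x + y)⁻¹ := by
  obtain ⟨m, β, hβ⟩ := exists_bumps
  obtain ⟨K, hK, h⟩ := exists_bound m hβ.supp hx0 hx1 hy0 hy1 hpos hlt
  have hρ : 0 < (x + y)⁻¹ := by positivity
  set ρ := (x + y)⁻¹
  have hc : ‖(corrConst β : ℂ)‖ₑ ^ ρ ≠ 0 := by
    simp [ENNReal.rpow_eq_zero_iff, (corrConst_pos hβ).ne']
  have hct : ‖(corrConst β : ℂ)‖ₑ ^ ρ ≠ ∞ := ENNReal.rpow_ne_top_of_nonneg hρ.le enorm_ne_top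
  refine ⟨(‖(corrConst β : ℂ)‖ₑ ^ ρ)⁻¹ * K, ENNReal.mul_ne_top (ENNReal.inv_ne_top.2 hc) hK,
    fun ι _ F g => ?_⟩
  obtain ⟨D, hD⟩ := Filter.exists_seq_tendsto (Filter.atTop : Filter (Finset Tile))
  have hf := nice_vec F
  have hg := nice_schwartz g
  rw [mul_assoc, ← ENNReal.div_eq_inv_mul, ENNReal.le_div_iff_mul_le (.inl hc) (.inl hct), mul_comm,
    ← lintegral_const_mul' _ _ hct]
  calc _ = ∫⁻ t, Filter.liminf (fun n => ‖modelOp m (vec fun i => ⇑(F i)) g (D n) t‖ₑ ^ ρ)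
        Filter.atTop := by
        refine lintegral_congr fun t => ?_
        have ht := ((ENNReal.continuous_rpow_const (y := ρ)).tendsto _).comp
          ((tendsto_modelOp_vec hβ F g t).comp hD).enorm
        rw [← ENNReal.mul_rpow_of_nonneg _ _ hρ.le, ← enorm_smul]
        exact ht.liminf_eq.symm
    _ ≤ Filter.liminf (fun n => ∫⁻ t, ‖modelOp m (vec fun i => ⇑(F i)) g (D n) t‖ₑ ^ ρ)
        Filter.atTop :=
        lintegral_liminf_le fun n => (nice_modelOp m hf hg (D n)).meas.enorm.pow_const _
    _ ≤ _ := Filter.liminf_le_of_le (by isBoundedDefault) fun b hb => by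
        obtain ⟨n, hn⟩ := hb.exists
        exact hn.trans (h _ _ _ hf hg (D n))

lemma FT_eq_fourier (f : ℝ → ℂ) (ξ : ℝ) : FT f ξ = 𝓕 f ξ := by
  rw [FT, fourier_eq_ph]
  refine integral_congr_ae (.of_forall fun t => ?_)
  simp only [ph]
  rw [mul_comm]
  congr 4
  ring

/-- The modulation `t ↦ e^{2πict} f(t)`. -/
noncomputable def modu (c : ℝ) (f : 𝓢(ℝ, ℂ)) : 𝓢(ℝ, ℂ) :=
  (𝓕⁻ (SchwartzMap.compSubConstCLM ℂ c (𝓕 f)) : 𝓢(ℝ, ℂ))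

lemma fourier_modu (c : ℝ) (f : 𝓢(ℝ, ℂ)) (ξ : ℝ) : 𝓕 (⇑(modu c f)) ξ = 𝓕 (⇑f) (ξ - c) := by
  rw [← SchwartzMap.fourier_coe, modu, FourierTransform.fourier_fourierInv_eq,
    SchwartzMap.compSubConstCLM_apply, SchwartzMap.fourier_coe]

lemma modu_apply (c : ℝ) (f : 𝓢(ℝ, ℂ)) (t : ℝ) : modu c f t = ph (t * c) * f t := by
  have h : f t = (𝓕⁻ (𝓕 f) : 𝓢(ℝ, ℂ)) t := by rw [FourierTransform.fourierInv_fourier_eq]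
  rw [h, modu, SchwartzMap.fourierInv_coe, SchwartzMap.fourierInv_coe, fourierInv_eq_ph,
    fourierInv_eq_ph, ← integral_const_mul]
  refine Eq.trans ?_
    (integral_sub_right_eq_self (fun v => ph (t * c) * ((𝓕 f : 𝓢(ℝ, ℂ)) v * ph (t * v))) c)
  refine integral_congr_ae (.of_forall fun v => ?_)
  simp only [SchwartzMap.compSubConstCLM_apply]
  rw [show t * v = t * c + t * (v - c) by ring, ph_add]
  ring

lemma norm_modu (c : ℝ) (f : 𝓢(ℝ, ℂ)) (t : ℝ) : ‖modu c f t‖ = ‖f t‖ := by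
  rw [modu_apply, norm_mul, norm_ph, one_mul]

/-- The integrand of the bilinear multiplier with symbol `1_{ξ₂ - ξ₁ > c}`. -/
noncomputable def halfInt (f g : ℝ → ℂ) (c x : ℝ) (ξ : ℝ × ℝ) : ℂ :=
  𝓕 f ξ.1 * 𝓕 g ξ.2 * (ph (x * (ξ.1 + ξ.2)) * (Ioi c).indicator 1 (ξ.2 - ξ.1))

lemma measurable_halfInt (f g : 𝓢(ℝ, ℂ)) (c : ℝ) :
    Measurable (Function.uncurry (halfInt f g c)) := by
  have hf : Continuous (𝓕 (⇑f)) := by rw [← SchwartzMap.fourier_coe]; exact (𝓕 f).continuous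
  have hg : Continuous (𝓕 (⇑g)) := by rw [← SchwartzMap.fourier_coe]; exact (𝓕 g).continuous
  have h1 := hf.measurable
  have h2 := hg.measurable
  have h3 := continuous_ph.measurable
  have h4 : Measurable ((Ioi c).indicator (1 : ℝ → ℂ)) := measurable_one.indicator measurableSet_Ioi
  unfold halfInt Function.uncurry
  exact ((h1.comp measurable_snd.fst).mul (h2.comp measurable_snd.snd)).mul
    ((h3.comp (measurable_fst.mul (measurable_snd.fst.add measurable_snd.snd))).mul
      (h4.comp (measurable_snd.snd.sub measurable_snd.fst)))

lemma integrable_halfInt (f g : 𝓢(ℝ, ℂ)) (c x : ℝ) : Integrable (halfInt f g c x) := by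
  have hfi : Integrable (𝓕 (⇑f)) := by rw [← SchwartzMap.fourier_coe]; exact (𝓕 f).integrable
  have hgi : Integrable (𝓕 (⇑g)) := by rw [← SchwartzMap.fourier_coe]; exact (𝓕 g).integrable
  refine (hfi.mul_prod hgi).mono
    ((measurable_halfInt f g c).comp measurable_prodMk_left).aestronglyMeasurable
    (.of_forall fun ξ => ?_)
  rw [halfInt, norm_mul (_ * _) (ph _ * _), norm_mul (ph _), norm_ph, one_mul]
  refine mul_le_of_le_one_right (norm_nonneg _) ?_
  by_cases h : ξ.2 - ξ.1 ∈ Ioi c <;> simp [h]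

lemma measurable_halfMul (f g : 𝓢(ℝ, ℂ)) : Measurable (halfMul f g) :=
  ((measurable_halfInt f g 0).stronglyMeasurable.integral_prod_right).measurable

lemma halfMul_modu (f g : 𝓢(ℝ, ℂ)) (c x : ℝ) :
    halfMul (modu c f) g x = ph (x * c) * ∫ ξ, halfInt f g c x ξ := by
  rw [← integral_const_mul,
    ← integral_sub_right_eq_self (fun ξ : ℝ × ℝ => ph (x * c) * halfInt f g c x ξ) (c, 0), halfMul]
  refine integral_congr_ae (.of_forall fun ξ => ?_)
  have e : (Ioi c).indicator (1 : ℝ → ℂ) (ξ.2 - 0 - (ξ.1 - c))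
      = (Ioi 0).indicator 1 (ξ.2 - ξ.1) := by
    simp only [indicator_apply, mem_Ioi]
    congr 1
    exact propext ⟨fun h => by linarith, fun h => by linarith⟩
  simp only [halfInt, fourier_modu, Prod.fst_sub, Prod.snd_sub, e]
  rw [show x * (ξ.1 + ξ.2) = x * c + x * (ξ.1 - c + (ξ.2 - 0)) by ring, ph_add, sub_zero]
  ring

lemma ae_sub_ne (c : ℝ) : ∀ᵐ ξ : ℝ × ℝ, ξ.2 - ξ.1 ≠ c := by
  have hs : MeasurableSet {ξ : ℝ × ℝ | ξ.2 - ξ.1 ≠ c} :=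
    (measurableSet_singleton c).compl.preimage (measurable_snd.sub measurable_fst)
  rw [Measure.volume_eq_prod, Measure.ae_prod_iff_ae_ae hs]
  refine .of_forall fun u => ?_
  filter_upwards [Measure.ae_ne volume (c + u)] with v hv h
  exact hv (by linarith)

lemma biMul_eq (f g : 𝓢(ℝ, ℂ)) {a b : ℝ} (hab : a < b) (x : ℝ) :
    biMul (Icc a b) f g x =
      ph (-(x * a)) * halfMul (modu a f) g x - ph (-(x * b)) * halfMul (modu b f) g x := by
  have h1 : ∀ c, ph (-(x * c)) * ph (x * c) = 1 := fun c => by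
    rw [← ph_add, neg_add_cancel, ph_zero]
  rw [halfMul_modu, halfMul_modu, ← mul_assoc, ← mul_assoc, h1, h1, one_mul, one_mul,
    ← integral_sub (integrable_halfInt f g a x) (integrable_halfInt f g b x), biMul]
  refine integral_congr_ae ?_
  filter_upwards [ae_sub_ne a] with ξ hξ
  have e : (Icc a b).indicator (1 : ℝ → ℂ) (ξ.2 - ξ.1)
      = (Ioi a).indicator 1 (ξ.2 - ξ.1) - (Ioi b).indicator 1 (ξ.2 - ξ.1) := by
    generalize ξ.2 - ξ.1 = u at hξ
    simp only [indicator_apply, mem_Icc, mem_Ioi, Pi.one_apply]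
    rcases lt_or_gt_of_ne hξ with h | h
    · rw [if_neg (by grind), if_neg (by grind), if_neg (by grind), sub_zero]
    · by_cases h' : u ≤ b
      · rw [if_pos ⟨h.le, h'⟩, if_pos h, if_neg (by grind), sub_zero]
      · rw [if_neg (by grind), if_pos h, if_pos (by grind), sub_self]
  have e2 : Complex.exp (((2 * Real.pi * x * (ξ.1 + ξ.2) : ℝ) : ℂ) * Complex.I)
      = ph (x * (ξ.1 + ξ.2)) := by
    rw [ph]; congr 3; ring
  rw [e, e2, FT_eq_fourier, FT_eq_fourier, halfInt, halfInt]
  ring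

section
variable {ι : Type} [Fintype ι]

lemma norm_vec_mul_ph (θ : ι → ℝ → ℝ) (G : ι → ℝ → ℂ) (x : ℝ) :
    ‖vec (fun i x => ph (θ i x) * G i x) x‖ = ‖vec G x‖ := by
  simp [vec, EuclideanSpace.norm_eq, norm_ph]

lemma norm_vec_biMul_le (F : ι → 𝓢(ℝ, ℂ)) (g : 𝓢(ℝ, ℂ)) {a b : ι → ℝ} (hab : ∀ i, a i < b i)
    (x : ℝ) : ‖vec (fun i => biMul (Icc (a i) (b i)) (F i) g) x‖ ≤
      ‖vec (fun i => halfMul (modu (a i) (F i)) g) x‖ +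
        ‖vec (fun i => halfMul (modu (b i) (F i)) g) x‖ := by
  rw [← norm_vec_mul_ph (fun i x => -(x * a i)) (fun i => halfMul (modu (a i) (F i)) g),
    ← norm_vec_mul_ph (fun i x => -(x * b i)) (fun i => halfMul (modu (b i) (F i)) g)]
  refine le_trans (le_of_eq ?_) (norm_sub_le _ _)
  congr 1
  ext i
  exact biMul_eq (F i) g (hab i) x

lemma measurable_vec_halfMul (F : ι → 𝓢(ℝ, ℂ)) (g : 𝓢(ℝ, ℂ)) :
    Measurable (vec fun i => halfMul (F i) g) :=
  (PiLp.continuous_toLp 2 _).measurable.comp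
    (measurable_pi_lambda _ fun i => measurable_halfMul (F i) g)

lemma eLpNorm_vec_modu (F : ι → 𝓢(ℝ, ℂ)) (c : ι → ℝ) (p : ℝ≥0∞) :
    eLpNorm (vec fun i => ⇑(modu (c i) (F i))) p volume
      = eLpNorm (vec fun i => ⇑(F i)) p volume := by
  refine eLpNorm_congr_norm_ae (.of_forall fun x => ?_)
  simp [vec, EuclideanSpace.norm_eq, norm_modu]

end

lemma exists_biMul_bound {x y : ℝ} (hx0 : 0 ≤ x) (hx1 : x < 1) (hy0 : 0 ≤ y) (hy1 : y < 1)
    (hpos : 0 < x + y) (hlt : x + y < 3 / 2) : ∃ K : ℝ≥0∞, K ≠ ∞ ∧ ∀ (ι : Type) [Fintype ι]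
      (F : ι → 𝓢(ℝ, ℂ)) (g : 𝓢(ℝ, ℂ)) (a b : ι → ℝ), (∀ i, a i < b i) →
      ∫⁻ t, ‖vec (fun i => biMul (Icc (a i) (b i)) (F i) g) t‖ₑ ^ (x + y)⁻¹ ≤
        K * (eLpNorm (vec fun i => ⇑(F i)) (ENNReal.ofReal x)⁻¹ volume *
          eLpNorm g (ENNReal.ofReal y)⁻¹ volume) ^ (x + y)⁻¹ := by
  obtain ⟨K, hK, h⟩ := exists_halfMul_bound hx0 hx1 hy0 hy1 hpos hlt
  have hρ : 0 < (x + y)⁻¹ := inv_pos.2 hpos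
  refine ⟨2 ^ (x + y)⁻¹ * (2 * K), ENNReal.mul_ne_top (ENNReal.rpow_ne_top_of_nonneg hρ.le (by simp))
    (ENNReal.mul_ne_top (by simp) hK), fun ι _ F g a b hab => ?_⟩
  have ha := h ι (fun i => modu (a i) (F i)) g
  have hb := h ι (fun i => modu (b i) (F i)) g
  rw [eLpNorm_vec_modu] at ha hb
  calc _ ≤ ∫⁻ t, 2 ^ (x + y)⁻¹ * (‖vec (fun i => halfMul (modu (a i) (F i)) g) t‖ₑ ^ (x + y)⁻¹ +
        ‖vec (fun i => halfMul (modu (b i) (F i)) g) t‖ₑ ^ (x + y)⁻¹) := by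
        refine lintegral_mono fun t => ?_
        have h1 : ‖vec (fun i => biMul (Icc (a i) (b i)) (F i) g) t‖ₑ ≤
            ‖vec (fun i => halfMul (modu (a i) (F i)) g) t‖ₑ +
              ‖vec (fun i => halfMul (modu (b i) (F i)) g) t‖ₑ := by
          rw [← ofReal_norm, ← ofReal_norm, ← ofReal_norm,
            ← ENNReal.ofReal_add (norm_nonneg _) (norm_nonneg _)]
          exact ENNReal.ofReal_le_ofReal (norm_vec_biMul_le F g hab t)
        have h2 := sum_rpow_le (κ := Fin 2) ![‖vec (fun i => halfMul (modu (a i) (F i)) g) t‖ₑ,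
          ‖vec (fun i => halfMul (modu (b i) (F i)) g) t‖ₑ] hρ
        simp only [Fin.sum_univ_two, Fintype.card_fin, Matrix.cons_val_zero, Matrix.cons_val_one,
          Nat.cast_ofNat] at h2
        exact (ENNReal.rpow_le_rpow h1 hρ.le).trans h2
    _ = 2 ^ (x + y)⁻¹ * ((∫⁻ t, ‖vec (fun i => halfMul (modu (a i) (F i)) g) t‖ₑ ^ (x + y)⁻¹) +
        ∫⁻ t, ‖vec (fun i => halfMul (modu (b i) (F i)) g) t‖ₑ ^ (x + y)⁻¹) := by
        rw [lintegral_const_mul' _ _ (ENNReal.rpow_ne_top_of_nonneg hρ.le (by simp)),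
          lintegral_add_left ((measurable_vec_halfMul (fun i => modu (a i) (F i)) g).enorm.pow_const _)]
    _ ≤ _ := by
        refine (mul_le_mul_right (add_le_add ha hb) _).trans (le_of_eq ?_)
        ring

lemma biMul_zero_left (A : Set ℝ) (g : ℝ → ℂ) (x : ℝ) : biMul A (⇑(0 : 𝓢(ℝ, ℂ))) g x = 0 := by
  simp [biMul, FT]

lemma sqrt_tsum_eq_norm_vec {u : ℤ → ℝ → ℂ} {s : Finset ℤ} (hu : ∀ n ∉ s, ∀ x, u n x = 0) (x : ℝ) :
    Real.sqrt (∑' n, ‖u n x‖ ^ 2) = ‖vec (fun (i : s) => u i) x‖ := by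
  rw [EuclideanSpace.norm_eq, tsum_eq_sum (s := s) fun n hn => by simp [hu n hn x],
    ← Finset.sum_coe_sort s]
  rfl

end BHT

/-- For `1 < p, q ≤ ∞`, `1/r = 1/p + 1/q` with `0 < 1/r < 3/2`,
and any family of pairwise disjoint intervals `[a_n, b_n]`, the square function
`(Σ_n |π_{[a_n,b_n]}(f_n, g)|²)^{1/2}` is controlled by
`‖(Σ_n |f_n|²)^{1/2}‖_p ‖g‖_q`. -/
theorem bilinear_square_function_vector_valued
    (p q r : ℝ≥0∞) (hp : 1 < p) (hq : 1 < q)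
    (hr : 1 / r = 1 / p + 1 / q) (hr0 : 0 < 1 / r) (hr1 : 1 / r < 3 / 2) :
    ∃ C : ℝ, 0 < C ∧ ∀ a b : ℤ → ℝ,
      (∀ n : ℤ, a n < b n) → (∀ n : ℤ, b n ≤ a (n + 1)) →
      ∀ F : ℤ → SchwartzMap ℝ ℂ, (Function.support F).Finite →
      ∀ g : SchwartzMap ℝ ℂ,
        eLpNorm (fun x : ℝ =>
            Real.sqrt (∑' n : ℤ, ‖biMul (Set.Icc (a n) (b n)) (⇑(F n)) (⇑g) x‖ ^ 2))
            r volume ≤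
          ENNReal.ofReal C *
            eLpNorm (fun x : ℝ => Real.sqrt (∑' n : ℤ, ‖F n x‖ ^ 2)) p volume *
            eLpNorm (⇑g) q volume := by
  have hinv : ∀ {s : ℝ≥0∞}, 1 < s → s⁻¹ ≠ ∞ ∧ s⁻¹.toReal < 1 := fun {s} hs => by
    have h : s⁻¹ < 1 := ENNReal.inv_lt_one.2 hs
    exact ⟨(h.trans ENNReal.one_lt_top).ne, by
      simpa using (ENNReal.toReal_lt_toReal (h.trans ENNReal.one_lt_top).ne ENNReal.one_ne_top).2 h⟩
  simp only [one_div] at hr hr0 hr1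
  have hxy : p⁻¹.toReal + q⁻¹.toReal = r⁻¹.toReal := by
    rw [hr, ENNReal.toReal_add (hinv hp).1 (hinv hq).1]
  have hrt : r⁻¹ ≠ ∞ := hr ▸ ENNReal.add_ne_top.2 ⟨(hinv hp).1, (hinv hq).1⟩
  have hr_top : r ≠ ∞ := by rintro rfl; simp at hr0
  have hr_zero : r ≠ 0 := by rintro rfl; simp at hrt
  have hρ : (p⁻¹.toReal + q⁻¹.toReal)⁻¹ = r.toReal := by rw [hxy, ENNReal.toReal_inv, inv_inv]
  have hρ0 : 0 < r.toReal := ENNReal.toReal_pos hr_zero hr_top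
  obtain ⟨K, hK, h⟩ := BHT.exists_biMul_bound (x := p⁻¹.toReal) (y := q⁻¹.toReal)
    ENNReal.toReal_nonneg (hinv hp).2 ENNReal.toReal_nonneg (hinv hq).2
    (by rw [hxy]; exact ENNReal.toReal_pos hr0.ne' hrt)
    (by
      rw [hxy]
      have := (ENNReal.toReal_lt_toReal hrt
        (ENNReal.div_ne_top (by simp) (by simp))).2 hr1
      simpa using this)
  rw [hρ, ENNReal.ofReal_toReal (hinv hp).1, ENNReal.ofReal_toReal (hinv hq).1, inv_inv, inv_inv] at h
  have hKt : K ^ (1 / r.toReal) ≠ ∞ := ENNReal.rpow_ne_top_of_nonneg (by positivity) hK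
  refine ⟨(K ^ (1 / r.toReal)).toReal + 1, by positivity, fun a b hab _ F hF g => ?_⟩
  have hz : ∀ n ∉ hF.toFinset, F n = 0 := fun n hn => by simpa using hn
  have e1 : eLpNorm (fun x : ℝ =>
      Real.sqrt (∑' n : ℤ, ‖biMul (Set.Icc (a n) (b n)) (⇑(F n)) (⇑g) x‖ ^ 2)) r volume =
      eLpNorm (BHT.vec fun i : hF.toFinset => biMul (Set.Icc (a i) (b i)) (⇑(F i)) (⇑g)) r volume := by
    refine eLpNorm_congr_norm_ae (.of_forall fun x => ?_)
    rw [BHT.sqrt_tsum_eq_norm_vec (u := fun n => biMul (Set.Icc (a n) (b n)) (⇑(F n)) (⇑g))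
      (fun n hn x => by rw [hz n hn, BHT.biMul_zero_left]), norm_norm]
  have e2 : eLpNorm (fun x : ℝ => Real.sqrt (∑' n : ℤ, ‖F n x‖ ^ 2)) p volume =
      eLpNorm (BHT.vec fun i : hF.toFinset => ⇑(F i)) p volume := by
    refine eLpNorm_congr_norm_ae (.of_forall fun x => ?_)
    rw [BHT.sqrt_tsum_eq_norm_vec (u := fun n => ⇑(F n)) (fun n hn x => by rw [hz n hn]; rfl), norm_norm]
  rw [e1, e2, eLpNorm_eq_lintegral_rpow_enorm_toReal hr_zero hr_top]
  refine (ENNReal.rpow_le_rpow (h hF.toFinset (fun i => F i) g (fun i => a i) (fun i => b i)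
    fun i => hab i) (by positivity)).trans ?_
  rw [ENNReal.mul_rpow_of_nonneg _ _ (by positivity), ← ENNReal.rpow_mul,
    mul_one_div_cancel hρ0.ne', ENNReal.rpow_one, mul_assoc]
  gcongr
  rw [ENNReal.le_ofReal_iff_toReal_le hKt (by positivity)]
  linarith
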